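/- Let c_n^{(10)} denote the n-th Fourier coefficient of the hauptmodul j₁₀(τ) = η(2τ)η(5τ)⁵/(η(τ)η(10τ)⁵) - 1 of Γ₀(10). Then for every integer n ≥ -1, one has 2n·c_n^{(10)} = Σ_{r∈ℤ} t₂^{(10*)}(4n - r²) + 4σ₁^{(10)}(n) + 12σ₁^{(5)}(n/2), where the sum over r is finite. -/

import Mathlib

open Complex Matrix

noncomputable section

/-- `SL(2, ℝ)`. -/
abbrev SL2R := Matrix.SpecialLinearGroup (Fin 2) ℝ

/-- `q = e^{2πiz}` (also used as `ζ = e^{2πiz}`). -/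
def qc (z : ℂ) : ℂ := Complex.exp (2 * Real.pi * Complex.I * z)

/-- The Dedekind eta function `η(z) = q^{1/24} ∏_{n ≥ 1} (1 - q^n)` (intended for `Im z > 0`). -/
def dedekindEta (z : ℂ) : ℂ :=
  Complex.exp (Real.pi * Complex.I * z / 12) *
    ∏' n : ℕ, (1 - Complex.exp (2 * Real.pi * Complex.I * ((n : ℂ) + 1) * z))

/-- The hauptmodul `j_N` of `Γ₀(N)` for `N ∈ {2, 3, 5, 7, 13, 6, 10}`. -/
def jn (N : ℕ) (z : ℂ) : ℂ :=
  if N = 6 then (dedekindEta (2 * z) * dedekindEta (3 * z) ^ 3 / (dedekindEta z * dedekindEta (6 * z) ^ 3)) ^ 3 - 3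
  else if N = 10 then dedekindEta (2 * z) * dedekindEta (5 * z) ^ 5 / (dedekindEta z * dedekindEta (10 * z) ^ 5) - 1
  else (dedekindEta z / dedekindEta ((N : ℂ) * z)) ^ (24 / (N - 1)) + 24 / ((N : ℂ) - 1)

/-- The hauptmodul `j_N^*` of the Fricke group `Γ₀^*(N)` for `N ∈ {2, 3, 5, 7, 13, 6, 10}`. -/
def jnStar (N : ℕ) (z : ℂ) : ℂ :=
  if N = 6 then
    (dedekindEta z * dedekindEta (3 * z) / (dedekindEta (2 * z) * dedekindEta (6 * z))) ^ 6 + 6 +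
      2 ^ 6 * (dedekindEta (2 * z) * dedekindEta (6 * z) / (dedekindEta z * dedekindEta (3 * z))) ^ 6
  else if N = 10 then
    (dedekindEta z * dedekindEta (5 * z) / (dedekindEta (2 * z) * dedekindEta (10 * z))) ^ 4 + 4 +
      2 ^ 4 * (dedekindEta (2 * z) * dedekindEta (10 * z) / (dedekindEta z * dedekindEta (5 * z))) ^ 4
  else
    (dedekindEta z / dedekindEta ((N : ℂ) * z)) ^ (24 / (N - 1)) + 24 / ((N : ℂ) - 1) +
      (N : ℂ) ^ (12 / (N - 1)) * (dedekindEta ((N : ℂ) * z) / dedekindEta z) ^ (24 / (N - 1))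

/-- `f` has the `q`-expansion `f(τ) = Σ_{n ≥ n₀} (a n) q^n` on the upper half-plane. -/
def HasQExp (f : ℂ → ℂ) (a : ℤ → ℂ) (n₀ : ℤ) : Prop :=
  (∀ n < n₀, a n = 0) ∧
    ∀ τ : ℂ, 0 < τ.im →
      HasSum (fun m : ℕ => a (n₀ + m) * qc τ ^ (n₀ + (m : ℤ))) (f τ)

/-- `Γ₀(N)` viewed as a subgroup of `SL(2, ℝ)`. -/
def Gamma0SL2R (N : ℕ) : Subgroup SL2R :=
  (CongruenceSubgroup.Gamma0 N).map
    (Matrix.SpecialLinearGroup.map (Int.castRingHom ℝ))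

/-- The set of Atkin–Lehner matrices `W_e` of level `N`:
`W_e = e^{-1/2} [[xe, y], [zN, we]]`, `x, y, z, w ∈ ℤ` (determinant `1` being automatic). -/
def atkinLehnerSet (N e : ℕ) : Set SL2R :=
  { g | ∃ x y z w : ℤ,
      g.1 = (Real.sqrt e)⁻¹ • !![(x : ℝ) * e, (y : ℝ); (z : ℝ) * N, (w : ℝ) * e] }

/-- The Fricke group `Γ₀^*(N)`, generated by `Γ₀(N)` and all Atkin–Lehner involutions `W_e`
for `e ∣ N` with `gcd(e, N/e) = 1`. -/
def FrickeGroup (N : ℕ) : Subgroup SL2R :=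
  Subgroup.closure
    ((Gamma0SL2R N : Set SL2R) ∪
      ⋃ e ∈ {e : ℕ | e ∣ N ∧ Nat.Coprime e (N / e)}, atkinLehnerSet N e)

/-- The Gram matrix of the integral binary quadratic form `[a, b, c]`. -/
def formMat (a b c : ℤ) : Matrix (Fin 2) (Fin 2) ℝ :=
  !![(a : ℝ), (b : ℝ) / 2; (b : ℝ) / 2, (c : ℝ)]

/-- `𝒬_{d,N}`: positive definite integral binary quadratic forms `[a, b, c]` of
discriminant `-d` with `N ∣ a`. -/
def QdN (d : ℤ) (N : ℕ) : Set (Matrix (Fin 2) (Fin 2) ℝ) :=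
  { M | ∃ a b c : ℤ, M = formMat a b c ∧ 0 < a ∧ b ^ 2 - 4 * a * c = -d ∧ (N : ℤ) ∣ a }

/-- `𝒬_{d,N,h}`: members of `𝒬_{d,N}` with `b ≡ h (mod 2N)`. -/
def QdNh (d : ℤ) (N : ℕ) (h : ℤ) : Set (Matrix (Fin 2) (Fin 2) ℝ) :=
  { M | ∃ a b c : ℤ, M = formMat a b c ∧ 0 < a ∧ b ^ 2 - 4 * a * c = -d ∧ (N : ℤ) ∣ a ∧
      (b : ZMod (2 * N)) = (h : ZMod (2 * N)) }

/-- Orbit relation of the (right) action `Q ↦ Q ∘ g`, i.e. `M ↦ gᵀ M g`, of `Γ ≤ SL(2, ℝ)`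
on a set `S` of Gram matrices of quadratic forms. -/
def formRel (Γ : Subgroup SL2R) (S : Set (Matrix (Fin 2) (Fin 2) ℝ)) (Q Q' : S) : Prop :=
  ∃ g ∈ Γ, Q'.1 = (g.1)ᵀ * Q.1 * g.1

/-- The CM point `α_Q` of a positive definite form (as a point of `ℂ`; it lies in the upper
half-plane): `α_Q = (-b + i √d) / (2a) = (-(b/2) + i √(det M)) / a`. -/
def cmPointC (M : Matrix (Fin 2) (Fin 2) ℝ) : ℂ :=
  ((-(M 0 1) : ℝ) + Complex.I * Real.sqrt M.det) / ((M 0 0 : ℝ) : ℂ)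

/-- The order of the stabilizer of the form `M` in `Γ/{±1}` (the stabilizer in `Γ` contains
`±1` and has twice the cardinality). -/
def stabOrder (Γ : Subgroup SL2R) (M : Matrix (Fin 2) (Fin 2) ℝ) : ℕ :=
  Nat.card { g : SL2R // g ∈ Γ ∧ (g.1)ᵀ * M * g.1 = M } / 2

/-- The modular trace `Σ_{Q ∈ S/Γ} f(α_Q) / |Γ̄_Q|`. -/
def classTrace (Γ : Subgroup SL2R) (f : ℂ → ℂ)
    (S : Set (Matrix (Fin 2) (Fin 2) ℝ)) : ℂ :=
  ∑ᶠ O : Quot (formRel Γ S),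
    f (cmPointC (Quot.out O).1) / (stabOrder Γ (Quot.out O).1 : ℂ)

/-- `t₂^{(N*)}(d)`, where `P` is the polynomial with `φ₂(j_N^*) = P(j_N^*)`;
includes the paper's conventions at nonpositive indices. -/
def t2Star (N : ℕ) (P : Polynomial ℂ) (d : ℤ) : ℂ :=
  if 0 < d then
    classTrace (FrickeGroup N) (fun z => Polynomial.eval (jnStar N z) P) (QdN d N)
  else if d = 0 then (if N = 2 then 5 else if N = 6 ∨ N = 10 then 5 / 2 else 3)
  else if d = -1 then -1
  else if d = -4 then -2
  else 0

/-- `σ₁^{(N)}(x) = Σ_{d ∣ x, N ∤ d} d` for `x ∈ ℤ_{>0}`, `(N-1)/24` at `x = 0`, and `0`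
off `ℤ_{≥0}`. -/
def sigmaN (N : ℕ) (x : ℚ) : ℂ :=
  if x = 0 then ((N : ℂ) - 1) / 24
  else if 0 < x ∧ x.den = 1 then
    ∑ d ∈ (Nat.divisors x.num.toNat).filter (fun d => ¬ N ∣ d), (d : ℂ)
  else 0

/-- `σ₁(x) = Σ_{d ∣ x} d` for `x ∈ ℤ_{>0}` and `0` otherwise. -/
def sigmaQ (x : ℚ) : ℂ :=
  if 0 < x ∧ x.den = 1 then ∑ d ∈ Nat.divisors x.num.toNat, (d : ℂ) else 0

/-- A weakly holomorphic Jacobi form of weight `k` and index `m`. -/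
structure WeakJacobiForm (k : ℤ) (m : ℕ) where
  toFun : ℂ → ℂ → ℂ
  holo : DifferentiableOn ℂ (fun p : ℂ × ℂ => toFun p.1 p.2)
      ({τ : ℂ | 0 < τ.im} ×ˢ (Set.univ : Set ℂ))
  slash_inv : ∀ a b c d : ℤ, a * d - b * c = 1 → ∀ τ z : ℂ, 0 < τ.im →
    ((c : ℂ) * τ + d) ^ (-k) *
        Complex.exp (-(2 * Real.pi * Complex.I * m * c * z ^ 2) / ((c : ℂ) * τ + d)) *
        toFun (((a : ℂ) * τ + b) / ((c : ℂ) * τ + d)) (z / ((c : ℂ) * τ + d)) =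
      toFun τ z
  elliptic : ∀ lm mu : ℤ, ∀ τ z : ℂ, 0 < τ.im →
    Complex.exp (2 * Real.pi * Complex.I * m * ((lm : ℂ) ^ 2 * τ + 2 * lm * z)) *
        toFun τ (z + lm * τ + mu) = toFun τ z
  coeff : ℤ → ℤ → ℂ
  coeff_neg_finite : {n : ℤ | n < 0 ∧ ∃ r : ℤ, coeff n r ≠ 0}.Finite
  expansion : ∀ τ z : ℂ, 0 < τ.im →
    HasSum (fun p : ℤ × ℤ => coeff p.1 p.2 * qc τ ^ p.1 * qc z ^ p.2) (toFun τ z)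

/-- Meromorphy of weight `k` at all cusps: at each cusp `γ∞`, the function `F|_k γ` has a
Fourier expansion in fractional powers of `q` with only finitely many negative terms. -/
def MeromAtCusps (k : ℤ) (F : ℂ → ℂ) : Prop :=
  ∀ a b c d : ℤ, a * d - b * c = 1 →
    ∃ (M : ℕ) (cs : ℤ → ℂ) (n₀ : ℤ), 0 < M ∧
      ∀ τ : ℂ, 0 < τ.im →
        HasSum
          (fun j : ℕ => cs (n₀ + j) *
            Complex.exp (2 * Real.pi * Complex.I * τ / M) ^ (n₀ + (j : ℤ)))
          (((c : ℂ) * τ + d) ^ (-k) * F (((a : ℂ) * τ + b) / ((c : ℂ) * τ + d)))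

/-- The Möbius action of an element of `SL(2, ℝ)` on `ℂ`. -/
def moebius (g : SL2R) (z : ℂ) : ℂ :=
  ((g.1 0 0 : ℝ) * z + ((g.1 0 1 : ℝ) : ℂ)) / ((g.1 1 0 : ℝ) * z + ((g.1 1 1 : ℝ) : ℂ))

/-- A weakly holomorphic modular function on `Γ`: holomorphic on the upper half-plane,
`Γ`-invariant, with poles only at the cusps. -/
def IsWeaklyHolModularFn (Γ : Subgroup SL2R) (f : ℂ → ℂ) : Prop :=
  DifferentiableOn ℂ f {z : ℂ | 0 < z.im} ∧
    (∀ g ∈ Γ, ∀ z : ℂ, 0 < z.im → f (moebius g z) = f z) ∧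
    MeromAtCusps 0 f

/-- The set `L_{h, d/4N}` of vectors
`X = [[b + h/2N, c/N], [-a, -(b + h/2N)]]`, `a, b, c ∈ ℤ`, of norm `q(X) = d/4N`. -/
def LhSet (N : ℕ) (h d : ℤ) : Set (Matrix (Fin 2) (Fin 2) ℝ) :=
  { X | ∃ a b c : ℤ,
      X = !![(b : ℝ) + (h : ℝ) / (2 * N), (c : ℝ) / N;
             -(a : ℝ), -((b : ℝ) + (h : ℝ) / (2 * N))] ∧
      (2 * b * N + h) ^ 2 - 4 * a * c * N = -d }

/-- The map `X ↦ N ⬝ [[0,-1],[1,0]] ⬝ X` from vectors to Gram matrices of quadratic forms. -/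
def vecToForm (N : ℕ) (X : Matrix (Fin 2) (Fin 2) ℝ) : Matrix (Fin 2) (Fin 2) ℝ :=
  (N : ℝ) • (!![(0 : ℝ), -1; 1, 0] * X)

/-- Orbit relation of `Γ` acting by conjugation `g.X = g X g⁻¹` on a set `S` of vectors. -/
def vecRel (Γ : Subgroup SL2R) (S : Set (Matrix (Fin 2) (Fin 2) ℝ)) (X X' : S) : Prop :=
  ∃ g ∈ Γ, X'.1 = g.1 * X.1 * (g⁻¹).1

/-- The Heegner point `D_X ∈ ℍ` of a vector `X` of positive norm. -/
def heegnerC (X : Matrix (Fin 2) (Fin 2) ℝ) : ℂ :=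
  ((X 0 0 / X 1 0 : ℝ) : ℂ) + Complex.I * Real.sqrt (X.det / (X 1 0) ^ 2)

/-- The order of the stabilizer of the vector `X` in `Γ/{±1}`. -/
def vecStabOrder (Γ : Subgroup SL2R) (X : Matrix (Fin 2) (Fin 2) ℝ) : ℕ :=
  Nat.card { g : SL2R // g ∈ Γ ∧ g.1 * X * (g⁻¹).1 = X } / 2

/-- The modular trace `t_f(h, m) = Σ_{X ∈ Γ\L_{h,m}} f(D_X) / |Γ̄_X|`. -/
def vecTrace (Γ : Subgroup SL2R) (f : ℂ → ℂ) (S : Set (Matrix (Fin 2) (Fin 2) ℝ)) : ℂ :=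
  ∑ᶠ O : Quot (vecRel Γ S), f (heegnerC (Quot.out O).1) / (vecStabOrder Γ (Quot.out O).1 : ℂ)

/-- The weight-2 Eisenstein series `E₂(z) = 1 - 24 Σ_{n ≥ 1} σ₁(n) qⁿ`. -/
def E2 (z : ℂ) : ℂ :=
  1 - 24 * ∑' n : ℕ, (∑ d ∈ Nat.divisors (n + 1), (d : ℂ)) * qc z ^ (n + 1)

/-- `E₂^{(N)}(z) = N E₂(Nz) - E₂(z)`. -/
def E2N (N : ℕ) (z : ℂ) : ℂ := (N : ℂ) * E2 ((N : ℂ) * z) - E2 z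

end

noncomputable section

open UpperHalfPlane hiding I
open scoped MatrixGroups Topology Manifold ModularForm
open Filter

/-! ### Integral matrices of level ten acting on the upper half-plane -/

/-- A real matrix of positive determinant, as an element of `GL(2, ℝ)`. -/
def gl (A B C D : ℝ) (h : 0 < A * D - B * C) : GL (Fin 2) ℝ :=
  Matrix.GeneralLinearGroup.mkOfDetNeZero !![A, B; C, D] (by
    rw [Matrix.det_fin_two_of]; exact h.ne')

lemma gl_coe (A B C D : ℝ) (h : 0 < A * D - B * C) :
    (gl A B C D h : Matrix (Fin 2) (Fin 2) ℝ) = !![A, B; C, D] := rfl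

/-- Integral matrices of determinant `n` whose lower left entry is divisible by `10`. -/
def heckeSet (n : ℤ) : Set (GL (Fin 2) ℝ) :=
  {M | ∃ A B C D : ℤ, M.1 = !![(A : ℝ), (B : ℝ); 10 * (C : ℝ), (D : ℝ)] ∧
    A * D - 10 * B * C = n}

/-- Integral Atkin–Lehner matrices of determinant `e` and level ten. -/
def alSet (e : ℤ) : Set (GL (Fin 2) ℝ) :=
  {M | ∃ x y z w : ℤ, M.1 = !![(e : ℝ) * x, (y : ℝ); 10 * (z : ℝ), (e : ℝ) * w] ∧
    e * x * (e * w) - 10 * y * z = e}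

lemma gl_ext {M N : GL (Fin 2) ℝ} (h : M.1 = N.1) : M = N := Units.ext h

lemma det_of_coe {M : GL (Fin 2) ℝ} {A B C D : ℝ} (h : M.1 = !![A, B; C, D]) :
    M.det.val = A * D - B * C := by
  rw [Matrix.GeneralLinearGroup.val_det_apply, h, Matrix.det_fin_two_of]

lemma smul_of_coe {M : GL (Fin 2) ℝ} {A B C D : ℝ} (h : M.1 = !![A, B; C, D])
    (hd : 0 < A * D - B * C) (τ : ℍ) :
    ((M • τ : ℍ) : ℂ) = (A * (τ : ℂ) + B) / (C * (τ : ℂ) + D) := by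
  rw [coe_smul_of_det_pos (by rwa [det_of_coe h])]
  simp [num, denom, h]

lemma gl_smul {A B C D : ℝ} (hd : 0 < A * D - B * C) (τ : ℍ) :
    ((gl A B C D hd • τ : ℍ) : ℂ) = (A * (τ : ℂ) + B) / (C * (τ : ℂ) + D) :=
  smul_of_coe (gl_coe ..) hd τ

lemma heckeSet_det {n : ℤ} {M : GL (Fin 2) ℝ} (h : M ∈ heckeSet n) : M.det.val = n := by
  obtain ⟨A, B, C, D, h, h'⟩ := h
  rw [det_of_coe h, ← h']; push_cast; ring

lemma alSet_det {e : ℤ} {M : GL (Fin 2) ℝ} (h : M ∈ alSet e) : M.det.val = e := by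
  obtain ⟨A, B, C, D, h, h'⟩ := h
  rw [det_of_coe h]
  have : ((e * A * (e * D) - 10 * B * C : ℤ) : ℝ) = e := by rw [h']
  push_cast at this
  linear_combination this

lemma heckeSet_mul {m n : ℤ} {M N : GL (Fin 2) ℝ} (hM : M ∈ heckeSet m) (hN : N ∈ heckeSet n) :
    M * N ∈ heckeSet (m * n) := by
  obtain ⟨A, B, C, D, h, h'⟩ := hM
  obtain ⟨A', B', C', D', k, k'⟩ := hN
  refine ⟨A * A' + 10 * B * C', A * B' + B * D', C * A' + D * C', 10 * C * B' + D * D', ?_, ?_⟩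
  · rw [Units.val_mul, h, k]
    ext i j; fin_cases i <;> fin_cases j <;> simp <;> ring
  · rw [← h', ← k']; ring

lemma one_mem_heckeSet : (1 : GL (Fin 2) ℝ) ∈ heckeSet 1 :=
  ⟨1, 0, 0, 1, by ext i j; fin_cases i <;> fin_cases j <;> simp, by ring⟩

lemma eq_of_mul_coe {M N K : GL (Fin 2) ℝ} (h : M.1 * N.1 = K.1) : N = M⁻¹ * K := by
  rw [eq_inv_mul_iff_mul_eq]; exact gl_ext h

lemma eq_of_coe_mul {M N K : GL (Fin 2) ℝ} (h : N.1 * M.1 = K.1) : N = K * M⁻¹ := by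
  rw [eq_mul_inv_iff_mul_eq]; exact gl_ext h

/-- If `W ∈ alSet e` and `M ∈ alSet e` then `W⁻¹ M ∈ Γ₀(10)`. -/
lemma alSet_inv_mul {e : ℤ} (he : 0 < e) (he' : e ∣ 10) {W M : GL (Fin 2) ℝ}
    (hW : W ∈ alSet e) (hM : M ∈ alSet e) : W⁻¹ * M ∈ heckeSet 1 := by
  obtain ⟨f, hf⟩ := he'
  have hfR : (10 : ℝ) = e * f := by exact_mod_cast hf
  obtain ⟨x, y, z, w, h, h'⟩ := hW
  obtain ⟨x', y', z', w', k, k'⟩ := hM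
  have heR : (e : ℝ) ≠ 0 := by exact_mod_cast he.ne'
  have e1 : e * x * w - f * y * z = 1 := by
    have : e * (e * x * w - f * y * z) = e * 1 := by
      rw [hf] at h'; linear_combination h'
    exact mul_left_cancel₀ he.ne' this
  have e2 : e * x' * w' - f * y' * z' = 1 := by
    have : e * (e * x' * w' - f * y' * z') = e * 1 := by
      rw [hf] at k'; linear_combination k'
    exact mul_left_cancel₀ he.ne' this
  have e1R : (e : ℝ) * x * w - f * y * z = 1 := by exact_mod_cast e1
  refine ⟨e * w * x' - f * y * z', w * y' - y * w', - z * x' + x * z', e * x * w' - f * z * y', ?_, ?_⟩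
  · have hd : 0 < ((e * w * x' - f * y * z' : ℤ) : ℝ) * ((e * x * w' - f * z * y' : ℤ) : ℝ) -
        ((w * y' - y * w' : ℤ) : ℝ) * (10 * ((- z * x' + x * z' : ℤ) : ℝ)) := by
      have : ((e * w * x' - f * y * z') * (e * x * w' - f * z * y') -
        (w * y' - y * w') * (10 * (- z * x' + x * z')) : ℤ) = 1 := by
        rw [hf]; linear_combination (e * x' * w' - f * y' * z') * e1 + e2
      have h2 : (((e * w * x' - f * y * z') * (e * x * w' - f * z * y') -
        (w * y' - y * w') * (10 * (- z * x' + x * z')) : ℤ) : ℝ) = 1 := by exact_mod_cast this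
      push_cast at h2 ⊢; rw [h2]; norm_num
    have := eq_of_mul_coe (M := W) (N := gl _ _ _ _ hd) (K := M) (by
      rw [h, k, gl_coe]
      push_cast
      ext i j; fin_cases i <;> fin_cases j <;> simp <;> (try rw [hfR])
      · linear_combination e * x' * e1R
      · linear_combination y' * e1R
      · linear_combination e * f * z' * e1R
      · linear_combination e * w' * e1R)
    rw [← this, gl_coe]
  · rw [hf]; linear_combination (e * x' * w' - f * y' * z') * e1 + e2

/-- If `W ∈ alSet e` and `M ∈ alSet e` then `M W⁻¹ ∈ Γ₀(10)`. -/
lemma alSet_mul_inv {e : ℤ} (he : 0 < e) (he' : e ∣ 10) {W M : GL (Fin 2) ℝ}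
    (hW : W ∈ alSet e) (hM : M ∈ alSet e) : M * W⁻¹ ∈ heckeSet 1 := by
  obtain ⟨f, hf⟩ := he'
  have hfR : (10 : ℝ) = e * f := by exact_mod_cast hf
  obtain ⟨x, y, z, w, h, h'⟩ := hW
  obtain ⟨x', y', z', w', k, k'⟩ := hM
  have heR : (e : ℝ) ≠ 0 := by exact_mod_cast he.ne'
  have e1 : e * x * w - f * y * z = 1 := by
    have : e * (e * x * w - f * y * z) = e * 1 := by
      rw [hf] at h'; linear_combination h'
    exact mul_left_cancel₀ he.ne' this
  have e2 : e * x' * w' - f * y' * z' = 1 := by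
    have : e * (e * x' * w' - f * y' * z') = e * 1 := by
      rw [hf] at k'; linear_combination k'
    exact mul_left_cancel₀ he.ne' this
  have e1R : (e : ℝ) * x * w - f * y * z = 1 := by exact_mod_cast e1
  refine ⟨e * x' * w - f * y' * z, x * y' - y * x', w * z' - z * w', e * w' * x - f * z' * y, ?_, ?_⟩
  · have hd : 0 < ((e * x' * w - f * y' * z : ℤ) : ℝ) * ((e * w' * x - f * z' * y : ℤ) : ℝ) -
        ((x * y' - y * x' : ℤ) : ℝ) * (10 * ((w * z' - z * w' : ℤ) : ℝ)) := by
      have : ((e * x' * w - f * y' * z) * (e * w' * x - f * z' * y) -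
        (x * y' - y * x') * (10 * (w * z' - z * w')) : ℤ) = 1 := by
        rw [hf]; linear_combination (e * x' * w' - f * y' * z') * e1 + e2
      have h2 : (((e * x' * w - f * y' * z) * (e * w' * x - f * z' * y) -
        (x * y' - y * x') * (10 * (w * z' - z * w')) : ℤ) : ℝ) = 1 := by exact_mod_cast this
      push_cast at h2 ⊢; rw [h2]; norm_num
    have := eq_of_coe_mul (M := W) (N := gl _ _ _ _ hd) (K := M) (by
      rw [h, k, gl_coe]
      push_cast
      ext i j; fin_cases i <;> fin_cases j <;> simp <;> (try rw [hfR])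
      · linear_combination e * x' * e1R
      · linear_combination y' * e1R
      · linear_combination e * f * z' * e1R
      · linear_combination e * w' * e1R)
    rw [← this, gl_coe]
  · rw [hf]; linear_combination (e * x' * w' - f * y' * z') * e1 + e2

lemma heckeSet_one_eq : heckeSet 1 = alSet 1 := by
  ext M
  constructor
  · rintro ⟨A, B, C, D, h, h'⟩
    exact ⟨A, B, C, D, by simpa using h, by linarith⟩
  · rintro ⟨A, B, C, D, h, h'⟩
    exact ⟨A, B, C, D, by simpa using h, by linarith⟩

lemma heckeSet_one_inv {M : GL (Fin 2) ℝ} (h : M ∈ heckeSet 1) : M⁻¹ ∈ heckeSet 1 := by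
  rw [← mul_one M⁻¹]
  have h1 := one_mem_heckeSet
  rw [heckeSet_one_eq] at h h1
  exact alSet_inv_mul one_pos (one_dvd _) h h1

/-- Conjugation by an Atkin–Lehner matrix preserves the Hecke sets. -/
lemma alSet_conj {e n : ℤ} (hn : 0 < n) (he : 0 < e) (he' : e ∣ 10) {W M : GL (Fin 2) ℝ}
    (hW : W ∈ alSet e) (hM : M ∈ heckeSet n) : W⁻¹ * (M * W) ∈ heckeSet n := by
  obtain ⟨f, hf⟩ := he'
  have hfR : (10 : ℝ) = e * f := by exact_mod_cast hf
  obtain ⟨x, y, z, w, h, h'⟩ := hW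
  obtain ⟨A, B, C, D, k, k'⟩ := hM
  have e1 : e * x * w - f * y * z = 1 := by
    have : e * (e * x * w - f * y * z) = e * 1 := by
      rw [hf] at h'; linear_combination h'
    exact mul_left_cancel₀ he.ne' this
  have e1R : (e : ℝ) * x * w - f * y * z = 1 := by exact_mod_cast e1
  have e2 : A * D - e * f * B * C = n := by rw [← k', hf]
  have key : (w * (A * e * x + 10 * B * z) - f * y * (C * e * x + D * z)) *
      (- f * z * (A * y + e * B * w) + x * (10 * C * y + e * D * w)) -
      10 * (w * (A * y + e * B * w) - y * (f * C * y + D * w)) *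
      (- z * (A * x + f * B * z) + x * (C * e * x + D * z)) = n := by
    rw [hf]
    linear_combination ((e * x * w - f * y * z) * (A * D - e * f * B * C) + (A * D - e * f * B * C)) * e1 + e2
  have keyR : (((w * (A * e * x + 10 * B * z) - f * y * (C * e * x + D * z)) *
      (- f * z * (A * y + e * B * w) + x * (10 * C * y + e * D * w)) -
      10 * (w * (A * y + e * B * w) - y * (f * C * y + D * w)) *
      (- z * (A * x + f * B * z) + x * (C * e * x + D * z)) : ℤ) : ℝ) = n := by
    rw [key]
  refine ⟨w * (A * e * x + 10 * B * z) - f * y * (C * e * x + D * z),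
    w * (A * y + e * B * w) - y * (f * C * y + D * w),
    - z * (A * x + f * B * z) + x * (C * e * x + D * z),
    - f * z * (A * y + e * B * w) + x * (10 * C * y + e * D * w), ?_, key⟩
  have hd : 0 < ((w * (A * e * x + 10 * B * z) - f * y * (C * e * x + D * z) : ℤ) : ℝ) *
      ((- f * z * (A * y + e * B * w) + x * (10 * C * y + e * D * w) : ℤ) : ℝ) -
      ((w * (A * y + e * B * w) - y * (f * C * y + D * w) : ℤ) : ℝ) *
      (10 * ((- z * (A * x + f * B * z) + x * (C * e * x + D * z) : ℤ) : ℝ)) := by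
    have : (0 : ℝ) < n := by exact_mod_cast hn
    push_cast at keyR ⊢
    nlinarith [keyR]
  have := eq_of_mul_coe (M := W) (N := gl _ _ _ _ hd) (K := M * W) (by
      rw [Units.val_mul, h, k, gl_coe]
      push_cast
      ext i j; fin_cases i <;> fin_cases j <;> simp <;> (try rw [hfR])
      · linear_combination (A * e * x + e * f * B * z) * e1R
      · linear_combination (A * y + e * B * w) * e1R
      · linear_combination (e * f * C * e * x + e * f * D * z) * e1R
      · linear_combination (e * f * C * y + e * D * w) * e1R)
  rw [← this, gl_coe]

lemma alSet_mul_gamma {e : ℤ} (he' : e ∣ 10) {W M : GL (Fin 2) ℝ}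
    (hW : W ∈ alSet e) (hM : M ∈ heckeSet 1) : M * W ∈ alSet e := by
  obtain ⟨f, hf⟩ := he'
  have hfR : (10 : ℝ) = e * f := by exact_mod_cast hf
  obtain ⟨x, y, z, w, h, h'⟩ := hW
  obtain ⟨A, B, C, D, k, k'⟩ := hM
  refine ⟨A * x + f * B * z, A * y + e * B * w, C * e * x + D * z, f * C * y + D * w, ?_, ?_⟩
  · rw [Units.val_mul, h, k]
    push_cast
    ext i j; fin_cases i <;> fin_cases j <;> simp <;> (try rw [hfR]) <;> ring
  · rw [hf] at h' k' ⊢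
    linear_combination e * k' + h' * (A * D - e * f * B * C)

/-- The four exact divisors of ten. -/
def ed : Finset ℤ := {1, 2, 5, 10}

lemma ed_pos {e : ℤ} (h : e ∈ ed) : 0 < e := by
  simp only [ed, Finset.mem_insert, Finset.mem_singleton] at h; omega

lemma ed_dvd {e : ℤ} (h : e ∈ ed) : e ∣ 10 := by
  simp only [ed, Finset.mem_insert, Finset.mem_singleton] at h
  rcases h with rfl | rfl | rfl | rfl <;> norm_num

/-- Fixed representatives of the Atkin–Lehner involutions. -/
def alW (e : ℤ) : GL (Fin 2) ℝ :=
  if e = 2 then gl 2 1 10 6 (by norm_num) else if e = 5 then gl 5 2 10 5 (by norm_num)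
  else if e = 10 then gl 0 (-1) 10 0 (by norm_num) else 1

lemma alW_mem {e : ℤ} (h : e ∈ ed) : alW e ∈ alSet e := by
  simp only [ed, Finset.mem_insert, Finset.mem_singleton] at h
  rcases h with rfl | rfl | rfl | rfl
  · simpa [alW, ← heckeSet_one_eq] using one_mem_heckeSet
  · exact ⟨1, 1, 1, 3, by simp [alW, gl_coe]; norm_num, by norm_num⟩
  · exact ⟨1, 2, 1, 1, by simp [alW, gl_coe], by norm_num⟩
  · exact ⟨0, -1, 1, 0, by simp [alW, gl_coe], by norm_num⟩

lemma alW_one : alW 1 = 1 := by simp [alW]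

/-- A bounded modular function of level ten is constant. -/
theorem eq_const_of_bounded (f : ℍ → ℂ) (hol : MDiff f)
    (inv : ∀ γ ∈ heckeSet 1, ∀ τ, f (γ • τ) = f τ)
    (bdd : ∀ e ∈ ed, IsBoundedAtImInfty fun τ ↦ f (alW e • τ)) : ∃ c, ∀ τ, f τ = c := by
  have hΓ : ∀ γ ∈ CongruenceSubgroup.Gamma0 10,
      (Matrix.SpecialLinearGroup.mapGL ℝ γ) ∈ heckeSet 1 := by
    intro γ hγ
    rw [CongruenceSubgroup.Gamma0_mem, ZMod.intCast_zmod_eq_zero_iff_dvd] at hγ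
    obtain ⟨c, hc⟩ := hγ
    refine ⟨γ 0 0, γ 0 1, c, γ 1 1, ?_, ?_⟩
    · ext i j; fin_cases i <;> fin_cases j <;> simp [hc]
    · have := γ.det_coe
      rw [Matrix.det_fin_two, hc] at this
      push_cast at this
      linarith
  let F : ModularForm (CongruenceSubgroup.Gamma0 10 : Subgroup (GL (Fin 2) ℝ)) 0 :=
    { toFun := f
      slash_action_eq' := by
        rintro _ ⟨γ, hγ, rfl⟩
        ext τ
        have h1 := inv _ (hΓ γ hγ) τ
        have h2 := ModularForm.SL_slash_apply (k := 0) (f := f) γ τ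
        rw [ModularForm.SL_slash] at h2
        refine h2.trans ?_
        rw [neg_zero, zpow_zero, mul_one]
        exact h1
      holo' := hol
      bdd_at_cusps' := by
        intro c hc
        rw [Subgroup.IsArithmetic.isCusp_iff_isCusp_SL2Z] at hc
        obtain ⟨A, rfl⟩ := isCusp_SL2Z_iff'.mp hc
        set a := A 0 0 with ha
        set c := A 1 0 with hc'
        have hdet : a * A 1 1 - A 0 1 * c = 1 := by
          have := A.det_coe
          rwa [Matrix.det_fin_two] at this
        obtain ⟨e, he, g, hg, k, hk, hcop⟩ : ∃ e ∈ ed, ∃ g : ℤ, e * g = 10 ∧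
            ∃ k : ℤ, c = g * k ∧ IsCoprime e c := by
          have h2 : (2 : ℤ) ∣ c ∨ IsCoprime 2 c := by
            rcases Int.even_or_odd' c with ⟨m, hm | hm⟩
            · exact Or.inl ⟨m, hm⟩
            · exact Or.inr ⟨-m, 1, by rw [hm]; ring⟩
          have h5 : (5 : ℤ) ∣ c ∨ IsCoprime 5 c := by
            rcases em ((5 : ℤ) ∣ c) with h | h
            · exact Or.inl h
            · exact Or.inr ((Int.prime_iff_natAbs_prime.mpr (by norm_num)).coprime_iff_not_dvd.mpr h)
          rcases h2 with h2 | h2 <;> rcases h5 with h5 | h5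
          · obtain ⟨k, hk⟩ : (10 : ℤ) ∣ c := by omega
            exact ⟨1, by simp [ed], 10, by norm_num, k, hk, isCoprime_one_left⟩
          · obtain ⟨k, hk⟩ := h2
            exact ⟨5, by simp [ed], 2, by norm_num, k, hk, h5⟩
          · obtain ⟨k, hk⟩ := h5
            exact ⟨2, by simp [ed], 5, by norm_num, k, hk, h2⟩
          · exact ⟨10, by simp [ed], 1, by norm_num, c, by ring,
              by simpa using h2.mul_left h5⟩
        have hac : IsCoprime a c := ⟨A 1 1, - A 0 1, by linear_combination hdet⟩
        obtain ⟨w, y, hwy⟩ := hcop.mul_left hac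
        have hepos := ed_pos he
        have hcR : (c : ℝ) * e = 10 * k := by
          have : c * e = 10 * k := by rw [hk, ← hg]; ring
          exact_mod_cast this
        have hdet' : e * a * (e * w) - 10 * -y * k = e := by
          rw [← hg]; linear_combination e * hwy + e * y * (-hk)
        have hdR : ((e : ℝ) * a) * (e * w) - ((-y : ℤ) : ℝ) * (10 * (k : ℝ)) = e := by
          have : (((e * a * (e * w) - 10 * -y * k : ℤ)) : ℝ) = e := by rw [hdet']
          push_cast at this ⊢; linarith
        have heR : (0 : ℝ) < e := by exact_mod_cast hepos
        have hpos : 0 < ((e : ℝ) * a) * (e * w) - ((-y : ℤ) : ℝ) * (10 * (k : ℝ)) := by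
          rw [hdR]; exact heR
        set W := gl _ _ _ _ hpos with hW
        have hWm : W ∈ alSet e := ⟨a, -y, k, w, gl_coe .., hdet'⟩
        have hfix : W • (OnePoint.infty : OnePoint ℝ) =
            (Matrix.SpecialLinearGroup.mapGL ℝ A) • OnePoint.infty := by
          have : W⁻¹ * Matrix.SpecialLinearGroup.mapGL ℝ A =
              gl (1 / e) (w * A 0 1 + (y * A 1 1) / e) 0 1 (by simpa using heR) := by
            symm
            apply eq_of_mul_coe
            have hwyR : (w : ℝ) * (e * a) + y * c = 1 := by exact_mod_cast hwy
            have hdetR : (a : ℝ) * A 1 1 - A 0 1 * c = 1 := by exact_mod_cast hdet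
            rw [hW, gl_coe, gl_coe]
            ext i j; fin_cases i <;> fin_cases j <;>
              simp [← ha, ← hc'] <;> field_simp
            · linear_combination (A 0 1 : ℝ) * hwyR + y * hdetR
            · linarith
            · linear_combination e * A 1 1 * hwyR - (A 0 1 * w * e + y * A 1 1) * hcR - e * e * w * hdetR
          have h4 : (W⁻¹ * Matrix.SpecialLinearGroup.mapGL ℝ A) • (OnePoint.infty : OnePoint ℝ) =
              OnePoint.infty := by
            rw [this, OnePoint.smul_infty_eq_self_iff]; rfl
          rw [mul_smul, inv_smul_eq_iff] at h4
          exact h4.symm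
        rw [OnePoint.isBoundedAt_iff hfix]
        have h5 : (f ∣[(0 : ℤ)] W) = fun τ ↦ f (alW e • τ) * (e : ℂ)⁻¹ := by
          ext τ
          have : W • τ = (W * (alW e)⁻¹) • (alW e • τ) := by
            rw [← mul_smul]; simp
          have h6 := alSet_mul_inv hepos (ed_dvd he) (alW_mem he) hWm
          rw [ModularForm.slash_def]
          have hdW : W.det.val = e := alSet_det hWm
          simp only [σ, hdW, heR, if_true]
          rw [this, inv _ h6]
          simp [abs_of_pos heR]
        change IsBoundedAtImInfty (f ∣[(0 : ℤ)] W)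
        rw [h5]
        have h7 := bdd e he
        unfold IsBoundedAtImInfty at h7 ⊢
        exact h7.mul (Filter.const_boundedAtFilter _ _) }
  obtain ⟨c, hc⟩ := ModularForm.eq_const_of_weight_zero F
  exact ⟨c, fun τ ↦ congrFun hc τ⟩

/-! ### Eta quotients of level ten -/

/-- The Euler product `∏ (1 - q ^ n)`. -/
def eulerProd (q : ℂ) : ℂ := ∏' n : ℕ, (1 - q ^ (n + 1))

lemma norm_qc (z : ℂ) : ‖qc z‖ = Real.exp (-(2 * Real.pi * z.im)) := by
  rw [qc, Complex.norm_exp]; simp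

lemma qc_ne_zero (z : ℂ) : qc z ≠ 0 := Complex.exp_ne_zero _

lemma norm_qc_lt_one {z : ℂ} (hz : 0 < z.im) : ‖qc z‖ < 1 := by
  rw [norm_qc]
  have := Real.pi_pos
  rw [Real.exp_lt_one_iff]
  have : 0 < 2 * Real.pi * z.im := by positivity
  linarith

lemma qc_eq_qParam (z : ℂ) : qc z = Function.Periodic.qParam 1 z := by
  simp [qc, Function.Periodic.qParam]

lemma qc_nat_mul (n : ℕ) (z : ℂ) : qc (n * z) = qc z ^ n := by
  rw [qc, qc, ← Complex.exp_nat_mul]; ring_nf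

lemma qc_add (z w : ℂ) : qc (z + w) = qc z * qc w := by
  rw [qc, qc, qc, ← Complex.exp_add]; ring_nf

lemma qc_intCast (k : ℤ) : qc k = 1 := by
  rw [qc, mul_comm, Complex.exp_int_mul_two_pi_mul_I]

lemma dedekindEta_eq (z : ℂ) :
    dedekindEta z = Complex.exp (Real.pi * Complex.I * z / 12) * eulerProd (qc z) := by
  rw [dedekindEta, eulerProd]
  congr 1
  refine tprod_congr fun n ↦ ?_
  rw [qc, ← Complex.exp_nat_mul]; push_cast; ring_nf

lemma dedekindEta_eq_eta (z : ℂ) : dedekindEta z = ModularForm.eta z := by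
  rw [dedekindEta, ModularForm.eta]
  congr 1
  · rw [Function.Periodic.qParam]; congr 1; push_cast; ring
  · exact tprod_congr fun n ↦ by rw [ModularForm.eta_q_eq_cexp]

lemma dedekindEta_ne_zero {z : ℂ} (hz : 0 < z.im) : dedekindEta z ≠ 0 := by
  rw [dedekindEta_eq_eta]; exact ModularForm.eta_ne_zero hz

lemma differentiableAt_dedekindEta {z : ℂ} (hz : 0 < z.im) :
    DifferentiableAt ℂ dedekindEta z := by
  rw [show dedekindEta = ModularForm.eta from funext dedekindEta_eq_eta]
  exact ModularForm.differentiableAt_eta_of_mem_upperHalfPlaneSet hz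

lemma eulerProd_ne_zero {q : ℂ} (hq : ‖q‖ < 1) : eulerProd q ≠ 0 := by
  refine tprod_one_add_ne_zero_of_summable (f := fun n ↦ -q ^ (n + 1)) ?_ ?_
  · intro i h
    have : q ^ (i + 1) = 1 := by linear_combination -h
    have h2 : ‖q‖ ^ (i + 1) = 1 := by rw [← norm_pow, this, norm_one]
    exact (pow_lt_one₀ (norm_nonneg _) hq (by omega)).ne h2
  · simpa using (summable_nat_add_iff 1).mpr (summable_geometric_of_lt_one (norm_nonneg _) hq)

lemma eulerProd_near_zero {q : ℂ} (hq : ‖q‖ ≤ 1 / 2) :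
    ∃ R : ℂ, eulerProd q = (1 - q) * (1 - q ^ 2) * R ∧ ‖R - 1‖ ≤ 4 * ‖q‖ ^ 3 := by
  have hq1 : ‖q‖ < 1 := by linarith
  have hm := ModularForm.multipliable_one_sub_pow hq1
  have hs : Summable fun n : ℕ ↦ ‖q‖ ^ (n + 3) :=
    (summable_nat_add_iff 3).mpr (summable_geometric_of_lt_one (norm_nonneg _) hq1)
  have hm' : Multipliable fun n : ℕ ↦ 1 + -q ^ (n + 3) := by
    apply multipliable_one_add_of_summable
    simpa using hs
  refine ⟨∏' n : ℕ, (1 + -q ^ (n + 3)), ?_, ?_⟩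
  · have h1 : HasProd (fun n : ℕ ↦ 1 - q ^ (n + 1))
        ((∏ i ∈ Finset.range 2, (1 - q ^ (i + 1))) * ∏' n : ℕ, (1 + -q ^ (n + 3))) := by
      have h3 := hm'.hasProd.tendsto_prod_nat
      have h2 := hm.hasProd.tendsto_prod_nat
      have h4 : Tendsto (fun n ↦ ∏ i ∈ Finset.range (n + 2), (1 - q ^ (i + 1))) atTop
          (𝓝 ((∏ i ∈ Finset.range 2, (1 - q ^ (i + 1))) * ∏' n : ℕ, (1 + -q ^ (n + 3)))) := by
        refine (h3.const_mul (∏ i ∈ Finset.range 2, (1 - q ^ (i + 1)))).congr fun n ↦ ?_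
        rw [add_comm n 2, Finset.prod_range_add]
        congr 1
        refine Finset.prod_congr rfl fun i _ ↦ ?_
        rw [sub_eq_add_neg]; congr 3; ring
      have := tendsto_nhds_unique ((tendsto_add_atTop_iff_nat 2).mpr h2) h4
      rw [← this]; exact hm.hasProd
    rw [eulerProd, h1.tprod_eq]
    simp [Finset.prod_range_succ]
  · have hsum : ∑' n : ℕ, ‖q‖ ^ (n + 3) ≤ 2 * ‖q‖ ^ 3 := by
      simp_rw [pow_add]
      rw [tsum_mul_right, tsum_geometric_of_lt_one (norm_nonneg _) hq1]
      refine mul_le_mul_of_nonneg_right ?_ (by positivity)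
      rw [inv_le_comm₀ (by linarith) (by norm_num)]; linarith
    have h3 := hm'.hasProd.tendsto_prod_nat
    have h4 : Tendsto (fun n ↦ ‖∏ i ∈ Finset.range n, (1 + -q ^ (i + 3)) - 1‖) atTop
        (𝓝 ‖∏' n : ℕ, (1 + -q ^ (n + 3)) - 1‖) := (h3.sub_const 1).norm
    refine le_of_tendsto h4 (Eventually.of_forall fun n ↦ ?_)
    refine (Finset.norm_prod_one_add_sub_one_le _ _).trans ?_
    have h5 : ∑ i ∈ Finset.range n, ‖-q ^ (i + 3)‖ ≤ 2 * ‖q‖ ^ 3 := by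
      refine le_trans ?_ hsum
      simp_rw [norm_neg, norm_pow]
      exact hs.sum_le_tsum _ fun i _ ↦ by positivity
    set s := ∑ i ∈ Finset.range n, ‖-q ^ (i + 3)‖
    have hs0 : 0 ≤ s := Finset.sum_nonneg fun i _ ↦ norm_nonneg _
    have hq3 : ‖q‖ ^ 3 ≤ 1 / 8 := by
      calc ‖q‖ ^ 3 ≤ (1 / 2) ^ 3 := pow_le_pow_left₀ (norm_nonneg _) hq 3
        _ = 1 / 8 := by norm_num
    have hs1 : |s| ≤ 1 := by rw [abs_of_nonneg hs0]; linarith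
    have := Real.abs_exp_sub_one_le hs1
    rw [abs_of_nonneg hs0] at this
    linarith [le_abs_self (Real.exp s - 1)]

/-- Transformation of `η ^ 24` under the modular group. -/
lemma dedekindEta_pow_moebius {a b c d : ℤ} (h : a * d - b * c = 1) {z : ℂ} (hz : 0 < z.im) :
    dedekindEta ((a * z + b) / (c * z + d)) ^ 24 = (c * z + d) ^ 12 * dedekindEta z ^ 24 := by
  let γ : SL(2, ℤ) := ⟨!![a, b; c, d], by rw [Matrix.det_fin_two_of]; exact h⟩
  have h1 := SlashInvariantForm.slash_action_eqn' CuspForm.discriminant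
    (γ := Matrix.SpecialLinearGroup.mapGL ℝ γ) (MonoidHom.mem_range.mpr ⟨γ, rfl⟩) ⟨z, hz⟩
  have hg : ((Matrix.SpecialLinearGroup.mapGL ℝ γ : GL (Fin 2) ℝ)).1 =
      !![(a : ℝ), (b : ℝ); (c : ℝ), (d : ℝ)] := by
    ext i j
    rw [Matrix.SpecialLinearGroup.mapGL_coe_matrix]
    fin_cases i <;> fin_cases j <;> rfl
  have h2 := smul_of_coe hg (by
    have : ((a * d - b * c : ℤ) : ℝ) = 1 := by rw [h]; norm_num
    push_cast at this; rw [this]; norm_num) ⟨z, hz⟩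
  change ModularForm.eta _ ^ 24 = _ * ModularForm.eta _ ^ 24 at h1
  rw [h2] at h1
  simp only [dedekindEta_eq_eta]
  rw [hg] at h1
  simpa using h1

/-- The eta quotient `η(2τ)η(5τ)⁵ / (η(τ)η(10τ)⁵)`. -/
def hauptU (τ : ℍ) : ℂ :=
  dedekindEta (2 * τ) * dedekindEta (5 * τ) ^ 5 / (dedekindEta τ * dedekindEta (10 * τ) ^ 5)

/-- The eta quotient `η(10τ)η(τ)⁵ / (η(5τ)η(2τ)⁵)`. -/
def hauptV (τ : ℍ) : ℂ :=
  dedekindEta (10 * τ) * dedekindEta τ ^ 5 / (dedekindEta (5 * τ) * dedekindEta (2 * τ) ^ 5)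

lemma im_mul_pos (τ : ℍ) {r : ℝ} (hr : 0 < r) : 0 < ((r : ℂ) * (τ : ℂ)).im := by
  simpa using mul_pos hr τ.im_pos

lemma eta_scaled_ne_zero (τ : ℍ) :
    dedekindEta τ ≠ 0 ∧ dedekindEta (2 * τ) ≠ 0 ∧ dedekindEta (5 * τ) ≠ 0 ∧
      dedekindEta (10 * τ) ≠ 0 := by
  refine ⟨dedekindEta_ne_zero τ.im_pos, ?_, ?_, ?_⟩
  · exact dedekindEta_ne_zero (by simpa using im_mul_pos τ (r := 2) (by norm_num))
  · exact dedekindEta_ne_zero (by simpa using im_mul_pos τ (r := 5) (by norm_num))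
  · exact dedekindEta_ne_zero (by simpa using im_mul_pos τ (r := 10) (by norm_num))

lemma hauptU_ne_zero (τ : ℍ) : hauptU τ ≠ 0 := by
  obtain ⟨h1, h2, h5, h10⟩ := eta_scaled_ne_zero τ
  rw [hauptU]; positivity

lemma hauptV_ne_zero (τ : ℍ) : hauptV τ ≠ 0 := by
  obtain ⟨h1, h2, h5, h10⟩ := eta_scaled_ne_zero τ
  rw [hauptV]; positivity

lemma mdiff_dedekindEta {r : ℝ} (hr : 0 < r) : MDiff fun τ : ℍ ↦ dedekindEta (r * τ) := by
  rw [UpperHalfPlane.mdifferentiable_iff]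
  have : DifferentiableOn ℂ (fun z : ℂ ↦ dedekindEta (r * z)) {z | 0 < z.im} := by
    intro z hz
    refine DifferentiableAt.differentiableWithinAt ?_
    have h1 : DifferentiableAt ℂ dedekindEta (r * z) :=
      differentiableAt_dedekindEta (by simpa using mul_pos hr hz)
    exact h1.comp z (by fun_prop)
  refine this.congr fun z hz ↦ ?_
  simp [ofComplex_apply_of_im_pos hz]

lemma mdiff_div {f g : ℍ → ℂ} (hf : MDiff f) (hg : MDiff g) (h : ∀ τ, g τ ≠ 0) :
    MDiff fun τ ↦ f τ / g τ := by
  rw [UpperHalfPlane.mdifferentiable_iff] at hf hg ⊢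
  exact hf.div hg fun z _ ↦ h _

lemma mdiff_mul {f g : ℍ → ℂ} (hf : MDiff f) (hg : MDiff g) : MDiff fun τ ↦ f τ * g τ := by
  rw [UpperHalfPlane.mdifferentiable_iff] at hf hg ⊢
  exact hf.mul hg

lemma mdiff_add {f g : ℍ → ℂ} (hf : MDiff f) (hg : MDiff g) : MDiff fun τ ↦ f τ + g τ := by
  rw [UpperHalfPlane.mdifferentiable_iff] at hf hg ⊢
  exact hf.add hg

lemma mdiff_sub {f g : ℍ → ℂ} (hf : MDiff f) (hg : MDiff g) : MDiff fun τ ↦ f τ - g τ := by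
  rw [UpperHalfPlane.mdifferentiable_iff] at hf hg ⊢
  exact hf.sub hg

lemma mdiff_pow {f : ℍ → ℂ} (hf : MDiff f) (n : ℕ) : MDiff fun τ ↦ f τ ^ n := by
  rw [UpperHalfPlane.mdifferentiable_iff] at hf ⊢
  exact hf.pow n

lemma mdiff_const (c : ℂ) : MDiff fun _ : ℍ ↦ c := by
  rw [UpperHalfPlane.mdifferentiable_iff]
  exact differentiableOn_const c

lemma mdiff_smul {f : ℍ → ℂ} (hf : MDiff f) {M : GL (Fin 2) ℝ} (hM : 0 < M.det.val) :
    MDiff fun τ ↦ f (M • τ) :=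
  hf.comp (UpperHalfPlane.mdifferentiable_smul hM)

lemma mdiff_hauptU : MDiff hauptU := by
  have h1 := mdiff_dedekindEta (r := 1) (by norm_num)
  have h2 := mdiff_dedekindEta (r := 2) (by norm_num)
  have h5 := mdiff_dedekindEta (r := 5) (by norm_num)
  have h10 := mdiff_dedekindEta (r := 10) (by norm_num)
  simp only [ofReal_ofNat, ofReal_one, one_mul] at h1 h2 h5 h10
  refine mdiff_div (mdiff_mul h2 (mdiff_pow h5 5)) (mdiff_mul h1 (mdiff_pow h10 5)) fun τ ↦ ?_
  obtain ⟨h1, h2, h5, h10⟩ := eta_scaled_ne_zero τ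
  positivity

lemma mdiff_hauptV : MDiff hauptV := by
  have h1 := mdiff_dedekindEta (r := 1) (by norm_num)
  have h2 := mdiff_dedekindEta (r := 2) (by norm_num)
  have h5 := mdiff_dedekindEta (r := 5) (by norm_num)
  have h10 := mdiff_dedekindEta (r := 10) (by norm_num)
  simp only [ofReal_ofNat, ofReal_one, one_mul] at h1 h2 h5 h10
  refine mdiff_div (mdiff_mul h10 (mdiff_pow h1 5)) (mdiff_mul h5 (mdiff_pow h2 5)) fun τ ↦ ?_
  obtain ⟨h1, h2, h5, h10⟩ := eta_scaled_ne_zero τ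
  positivity

/-- Two continuous nonvanishing functions with proportional `24`th powers are proportional. -/
lemma exists_const_of_pow_eq {f g : ℍ → ℂ} (hf : Continuous f) (hg : Continuous g)
    (hg0 : ∀ τ, g τ ≠ 0) {c : ℂ} (h : ∀ τ, f τ ^ 24 = c * g τ ^ 24) :
    ∃ ζ : ℂ, ζ ^ 24 = c ∧ ∀ τ, f τ = ζ * g τ := by
  have hT : Set.Finite {z : ℂ | z ^ 24 = c} := by
    have := (Polynomial.nthRoots 24 c).toFinset.finite_toSet
    refine this.subset fun z hz ↦ ?_
    simpa [Polynomial.mem_nthRoots] using hz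
  have : DiscreteTopology {z : ℂ | z ^ 24 = c} := hT.instDiscreteTopology
  have hr : ∀ τ, (f τ / g τ) ^ 24 = c := fun τ ↦ by
    rw [div_pow, h τ, mul_div_assoc, div_self (pow_ne_zero _ (hg0 τ)), mul_one]
  refine ⟨f UpperHalfPlane.I / g UpperHalfPlane.I, hr _, fun τ ↦ ?_⟩
  have := isPreconnected_univ.constant_of_mapsTo (isDiscrete_iff_discreteTopology.mpr this)
    (hf.div hg hg0).continuousOn (fun τ _ ↦ hr τ) (Set.mem_univ τ) (Set.mem_univ UpperHalfPlane.I)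
  simp only [Pi.div_apply] at this
  rw [← this, div_mul_cancel₀ _ (hg0 τ)]

lemma det_pos_of_hecke {n : ℤ} (hn : 0 < n) {M : GL (Fin 2) ℝ} (h : M ∈ heckeSet n) :
    0 < M.det.val := by
  rw [heckeSet_det h]; exact_mod_cast hn

lemma continuous_smul_gl (M : GL (Fin 2) ℝ) : Continuous fun τ : ℍ ↦ M • τ :=
  continuous_const_smul M

lemma hauptU_pow_gamma {A B C D : ℤ} (h : A * D - 10 * B * C = 1) {M : GL (Fin 2) ℝ}
    (hM : M.1 = !![(A : ℝ), (B : ℝ); 10 * (C : ℝ), (D : ℝ)]) (τ : ℍ) :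
    hauptU (M • τ) ^ 24 = hauptU τ ^ 24 := by
  have hz := smul_of_coe hM (by
    have : ((A * D - 10 * B * C : ℤ) : ℝ) = 1 := by rw [h]; norm_num
    push_cast at this; nlinarith) τ
  have hne : (10 * (C : ℂ) * τ + D) ≠ 0 := by
    intro h0
    have h1 := UpperHalfPlane.denom_ne_zero M τ
    rw [denom, hM] at h1
    exact h1 (by simpa using h0)
  have key : ∀ k l : ℤ, k * l = 10 → 0 < k → dedekindEta (k * ((M • τ : ℍ) : ℂ)) ^ 24 =
      (10 * (C : ℂ) * τ + D) ^ 12 * dedekindEta (k * τ) ^ 24 := by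
    intro k l hkl hk
    have hkl' : (k : ℂ) * l = 10 := by exact_mod_cast hkl
    have hk0 : (k : ℂ) ≠ 0 := by exact_mod_cast hk.ne'
    have := dedekindEta_pow_moebius (a := A) (b := B * k) (c := C * l) (d := D)
      (by linear_combination h - B * C * hkl) (z := k * τ) (by
        simpa using mul_pos (by exact_mod_cast hk : (0 : ℝ) < k) τ.im_pos)
    rw [show (((C * l : ℤ) : ℂ) * (k * τ) + D) = 10 * (C : ℂ) * τ + D by
      push_cast; linear_combination C * (τ : ℂ) * hkl'] at this
    rw [← this, hz]
    congr 2
    push_cast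
    field_simp
  have k1 := key 1 10 (by norm_num) (by norm_num)
  have k2 := key 2 5 (by norm_num) (by norm_num)
  have k5 := key 5 2 (by norm_num) (by norm_num)
  have k10 := key 10 1 (by norm_num) (by norm_num)
  push_cast at k1 k2 k5 k10
  rw [one_mul, one_mul] at k1
  obtain ⟨h1, h2, h5, h10⟩ := eta_scaled_ne_zero τ
  rw [hauptU, hauptU, div_pow, div_pow, mul_pow, mul_pow, mul_pow, mul_pow, ← pow_mul, ← pow_mul,
    mul_comm 5 24, pow_mul, pow_mul, k1, k2, k5, k10]
  field_simp

lemma smul_alW_five (τ : ℍ) : ((alW 5 • τ : ℍ) : ℂ) = (5 * τ + 2) / (10 * τ + 5) := by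
  rw [show alW 5 = gl 5 2 10 5 (by norm_num) by simp [alW], gl_smul]; simp

lemma smul_alW_ten (τ : ℍ) : ((alW 10 • τ : ℍ) : ℂ) = -1 / (10 * τ) := by
  rw [show alW 10 = gl 0 (-1) 10 0 (by norm_num) by simp [alW], gl_smul]; simp

lemma lin_ne_zero (τ : ℍ) {c : ℝ} (hc : 0 < c) (d : ℝ) : (c : ℂ) * τ + d ≠ 0 := by
  intro h
  have := congrArg Complex.im h
  have h2 := mul_pos hc τ.im_pos
  simp at this
  rcases this with h | h
  · exact hc.ne' h
  · exact τ.im_pos.ne' h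

lemma hauptU_pow_alW_five (τ : ℍ) : hauptU (alW 5 • τ) ^ 24 = 1 * hauptV τ ^ 24 := by
  have e1 : (10 : ℂ) * τ + 5 ≠ 0 := by
    simpa using lin_ne_zero τ (c := 10) (by norm_num) 5
  have e2 : (2 : ℂ) * τ + 1 ≠ 0 := by
    simpa using lin_ne_zero τ (c := 2) (by norm_num) 1
  have hi := fun r hr ↦ im_mul_pos τ (r := r) hr
  have k1 := dedekindEta_pow_moebius (a := 1) (b := 2) (c := 2) (d := 5) (by norm_num)
    (z := 5 * τ) (by simpa using hi 5 (by norm_num))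
  have k5 := dedekindEta_pow_moebius (a := 5) (b := 2) (c := 2) (d := 1) (by norm_num)
    (z := τ) τ.im_pos
  have k2 := dedekindEta_pow_moebius (a := 1) (b := 4) (c := 1) (d := 5) (by norm_num)
    (z := 10 * τ) (by simpa using hi 10 (by norm_num))
  have k10 := dedekindEta_pow_moebius (a := 5) (b := 4) (c := 1) (d := 1) (by norm_num)
    (z := 2 * τ) (by simpa using hi 2 (by norm_num))
  push_cast at k1 k2 k5 k10
  simp only [one_mul] at k1 k2 k5 k10
  have e3 : (2 : ℂ) * (5 * τ) + 5 = 10 * τ + 5 := by ring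
  rw [e3] at k1
  have f1 : ((5 : ℂ) * τ + 2) / (10 * τ + 5) = ((alW 5 • τ : ℍ) : ℂ) := (smul_alW_five τ).symm
  have f2 : ((10 : ℂ) * τ + 4) / (10 * τ + 5) = 2 * ((alW 5 • τ : ℍ) : ℂ) := by
    rw [← f1]; field_simp; ring
  have f5 : ((5 : ℂ) * τ + 2) / (2 * τ + 1) = 5 * ((alW 5 • τ : ℍ) : ℂ) := by
    rw [← f1, div_eq_iff e2, mul_div_assoc', div_mul_eq_mul_div, eq_div_iff e1]; ring
  have f10 : ((5 : ℂ) * (2 * τ) + 4) / (2 * τ + 1) = 10 * ((alW 5 • τ : ℍ) : ℂ) := by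
    rw [← f1, div_eq_iff e2, mul_div_assoc', div_mul_eq_mul_div, eq_div_iff e1]; ring
  rw [f1] at k1
  rw [f2] at k2
  rw [f5] at k5
  rw [f10] at k10
  obtain ⟨h1, h2, h5, h10⟩ := eta_scaled_ne_zero τ
  rw [hauptU, hauptV, div_pow, div_pow, mul_pow, mul_pow, mul_pow, mul_pow, ← pow_mul, ← pow_mul,
    ← pow_mul, ← pow_mul, mul_comm 5 24, pow_mul, pow_mul (dedekindEta (10 * _)), k1, k2, k5, k10]
  generalize dedekindEta (10 * (τ : ℂ)) = x10 at *
  generalize dedekindEta (5 * (τ : ℂ)) = x5 at *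
  generalize dedekindEta (2 * (τ : ℂ)) = x2 at *
  generalize dedekindEta (τ : ℂ) = x1 at *
  generalize (10 : ℂ) * τ + 5 = y at *
  generalize (2 : ℂ) * τ + 1 = z at *
  field_simp
  norm_num
  ring

lemma hauptU_pow_alW_ten (τ : ℍ) : hauptU (alW 10 • τ) ^ 24 = 4 ^ 24 * (hauptV τ)⁻¹ ^ 24 := by
  have h0 : (τ : ℂ) ≠ 0 := ne_zero τ
  have hi := fun r hr ↦ im_mul_pos τ (r := r) hr
  have k1 := dedekindEta_pow_moebius (a := 0) (b := -1) (c := 1) (d := 0) (by norm_num)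
    (z := 10 * τ) (by simpa using hi 10 (by norm_num))
  have k2 := dedekindEta_pow_moebius (a := 0) (b := -1) (c := 1) (d := 0) (by norm_num)
    (z := 5 * τ) (by simpa using hi 5 (by norm_num))
  have k5 := dedekindEta_pow_moebius (a := 0) (b := -1) (c := 1) (d := 0) (by norm_num)
    (z := 2 * τ) (by simpa using hi 2 (by norm_num))
  have k10 := dedekindEta_pow_moebius (a := 0) (b := -1) (c := 1) (d := 0) (by norm_num)
    (z := τ) τ.im_pos
  push_cast at k1 k2 k5 k10
  simp only [one_mul, add_zero, zero_mul, zero_add] at k1 k2 k5 k10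
  have f1 : (-1 : ℂ) / (10 * τ) = ((alW 10 • τ : ℍ) : ℂ) := (smul_alW_ten τ).symm
  have f2 : (-1 : ℂ) / (5 * τ) = 2 * ((alW 10 • τ : ℍ) : ℂ) := by
    rw [← f1]; field_simp; norm_num
  have f5 : (-1 : ℂ) / (2 * τ) = 5 * ((alW 10 • τ : ℍ) : ℂ) := by
    rw [← f1]; field_simp; norm_num
  have f10 : (-1 : ℂ) / τ = 10 * ((alW 10 • τ : ℍ) : ℂ) := by
    rw [← f1]; field_simp
  rw [f1] at k1
  rw [f2] at k2
  rw [f5] at k5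
  rw [f10] at k10
  obtain ⟨h1, h2, h5, h10⟩ := eta_scaled_ne_zero τ
  rw [hauptU, hauptV, inv_div, div_pow, div_pow, mul_pow, mul_pow, mul_pow, mul_pow, ← pow_mul,
    ← pow_mul, ← pow_mul, ← pow_mul, mul_comm 5 24, pow_mul, pow_mul (dedekindEta (10 * _)),
    k1, k2, k5, k10]
  generalize dedekindEta (10 * (τ : ℂ)) = x10 at *
  generalize dedekindEta (5 * (τ : ℂ)) = x5 at *
  generalize dedekindEta (2 * (τ : ℂ)) = x2 at *
  generalize dedekindEta (τ : ℂ) = x1 at *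
  field_simp
  norm_num
  ring

/-! Expansions -/

/-- The power series of `q * hauptU`. -/
def phiU (q : ℂ) : ℂ :=
  eulerProd (q ^ 2) * eulerProd (q ^ 5) ^ 5 / (eulerProd q * eulerProd (q ^ 10) ^ 5)

/-- The power series of `hauptV`. -/
def phiV (q : ℂ) : ℂ :=
  eulerProd (q ^ 10) * eulerProd q ^ 5 / (eulerProd (q ^ 5) * eulerProd (q ^ 2) ^ 5)

lemma hauptU_eq (τ : ℍ) : hauptU τ = phiU (qc τ) / qc τ := by
  have hq := qc_ne_zero τ
  have e2 := qc_nat_mul 2 τ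
  have e5 := qc_nat_mul 5 τ
  have e10 := qc_nat_mul 10 τ
  push_cast at e2 e5 e10
  have h1 := Complex.exp_ne_zero (Real.pi * Complex.I * τ / 12)
  rw [hauptU, phiU]
  simp only [dedekindEta_eq, e2, e5, e10]
  rw [div_div, mul_pow, mul_pow]
  have hx : ∀ k : ℕ, Complex.exp (Real.pi * Complex.I * (k * τ) / 12) =
      Complex.exp (Real.pi * Complex.I * τ / 12) ^ k := fun k ↦ by
    rw [← Complex.exp_nat_mul]; congr 1; ring
  have x2 := hx 2
  have x5 := hx 5
  have x10 := hx 10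
  have x24 : qc τ = Complex.exp (Real.pi * Complex.I * τ / 12) ^ 24 := by
    rw [← Complex.exp_nat_mul, qc]; congr 1; push_cast; ring
  push_cast at x2 x5 x10
  have hn : ∀ k : ℕ, k ≠ 0 → eulerProd (qc τ ^ k) ≠ 0 := fun k hk ↦ eulerProd_ne_zero (by
    rw [norm_pow]; exact pow_lt_one₀ (norm_nonneg _) (norm_qc_lt_one τ.im_pos) hk)
  have n1 := hn 1 (by norm_num)
  have n10 := hn 10 (by norm_num)
  rw [pow_one] at n1
  rw [x2, x5, x10]
  set E1 := eulerProd (qc τ)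
  set E2 := eulerProd (qc τ ^ 2)
  set E5 := eulerProd (qc τ ^ 5)
  set E10 := eulerProd (qc τ ^ 10)
  rw [x24]
  field_simp

lemma hauptV_eq (τ : ℍ) : hauptV τ = phiV (qc τ) := by
  have hq := qc_ne_zero τ
  have e2 := qc_nat_mul 2 τ
  have e5 := qc_nat_mul 5 τ
  have e10 := qc_nat_mul 10 τ
  push_cast at e2 e5 e10
  have h1 := Complex.exp_ne_zero (Real.pi * Complex.I * τ / 12)
  rw [hauptV, phiV]
  simp only [dedekindEta_eq, e2, e5, e10]
  rw [mul_pow, mul_pow]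
  have hx : ∀ k : ℕ, Complex.exp (Real.pi * Complex.I * (k * τ) / 12) =
      Complex.exp (Real.pi * Complex.I * τ / 12) ^ k := fun k ↦ by
    rw [← Complex.exp_nat_mul]; congr 1; ring
  have x2 := hx 2
  have x5 := hx 5
  have x10 := hx 10
  push_cast at x2 x5 x10
  have hn : ∀ k : ℕ, k ≠ 0 → eulerProd (qc τ ^ k) ≠ 0 := fun k hk ↦ eulerProd_ne_zero (by
    rw [norm_pow]; exact pow_lt_one₀ (norm_nonneg _) (norm_qc_lt_one τ.im_pos) hk)
  have n5 := hn 5 (by norm_num)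
  have n2 := hn 2 (by norm_num)
  rw [x2, x5, x10]
  set E1 := eulerProd (qc τ)
  set E2 := eulerProd (qc τ ^ 2)
  set E5 := eulerProd (qc τ ^ 5)
  set E10 := eulerProd (qc τ ^ 10)
  field_simp

lemma eulerProd_ofReal_pos {r : ℝ} (hr : |r| < 1) : ∃ s : ℝ, 0 < s ∧ eulerProd r = s := by
  have hm : Multipliable fun n : ℕ ↦ 1 - r ^ (n + 1) := by
    have : Multipliable fun n : ℕ ↦ 1 + -r ^ (n + 1) := by
      apply multipliable_one_add_of_summable
      simpa using (summable_nat_add_iff 1).mpr (summable_geometric_of_lt_one (abs_nonneg _) hr)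
    simpa [sub_eq_add_neg] using this
  have h1 : eulerProd r = ((∏' n : ℕ, (1 - r ^ (n + 1)) : ℝ) : ℂ) := by
    have := (hm.hasProd.map Complex.ofRealHom Complex.continuous_ofReal).tprod_eq
    simp only [Function.comp_def, ofRealHom_eq_coe, ofReal_sub, ofReal_one, ofReal_pow] at this
    exact this
  refine ⟨_, ?_, h1⟩
  have h2 : eulerProd r ≠ 0 := eulerProd_ne_zero (by simpa using hr)
  rw [h1] at h2
  have h3 : ∏' n : ℕ, (1 - r ^ (n + 1)) ≠ 0 := by exact_mod_cast h2
  refine lt_of_le_of_ne ?_ h3.symm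
  refine ge_of_tendsto hm.hasProd.tendsto_prod_nat (Eventually.of_forall fun n ↦ ?_)
  refine Finset.prod_nonneg fun i _ ↦ ?_
  have h4 : |r ^ (i + 1)| ≤ 1 := by rw [abs_pow]; exact pow_le_one₀ (abs_nonneg _) hr.le
  linarith [le_abs_self (r ^ (i + 1))]

lemma phi_ofReal_pos {r : ℝ} (hr : |r| < 1) :
    (∃ s : ℝ, 0 < s ∧ phiU r = s) ∧ ∃ s : ℝ, 0 < s ∧ phiV r = s := by
  have hk : ∀ k : ℕ, k ≠ 0 → ∃ s : ℝ, 0 < s ∧ eulerProd ((r : ℂ) ^ k) = s := fun k hk ↦ by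
    have := eulerProd_ofReal_pos (r := r ^ k)
      (by rw [abs_pow]; exact pow_lt_one₀ (abs_nonneg _) hr hk)
    simpa using this
  obtain ⟨s1, p1, h1⟩ := eulerProd_ofReal_pos hr
  obtain ⟨s2, p2, h2⟩ := hk 2 (by norm_num)
  obtain ⟨s5, p5, h5⟩ := hk 5 (by norm_num)
  obtain ⟨s10, p10, h10⟩ := hk 10 (by norm_num)
  refine ⟨⟨s2 * s5 ^ 5 / (s1 * s10 ^ 5), by positivity, ?_⟩,
    ⟨s10 * s1 ^ 5 / (s5 * s2 ^ 5), by positivity, ?_⟩⟩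
  · rw [phiU, h1, h2, h5, h10]; push_cast; rfl
  · rw [phiV, h1, h2, h5, h10]; push_cast; rfl

lemma real_root_of_unity {s : ℝ} (h : (s : ℂ) ^ 24 = 1) : s = 1 ∨ s = -1 := by
  have h2 : s ^ 24 = 1 := by exact_mod_cast h
  have := (pow_eq_one_iff_of_nonneg (abs_nonneg s) (by norm_num : 24 ≠ 0)).mp (by
    rw [Even.pow_abs (by decide)]; exact h2)
  exact abs_eq (by norm_num) |>.mp this

/-- Translation by an integer. -/
def glT (k : ℤ) : GL (Fin 2) ℝ := gl 1 k 0 1 (by norm_num)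

lemma glT_smul (k : ℤ) (τ : ℍ) : ((glT k • τ : ℍ) : ℂ) = τ + k := by
  rw [glT, gl_smul]; simp

lemma qc_glT (k : ℤ) (τ : ℍ) : qc (glT k • τ : ℍ) = qc τ := by
  rw [glT_smul, qc_add, qc_intCast, mul_one]

lemma hauptU_glT (k : ℤ) (τ : ℍ) : hauptU (glT k • τ) = hauptU τ := by
  rw [hauptU_eq, hauptU_eq, qc_glT]

lemma hauptV_glT (k : ℤ) (τ : ℍ) : hauptV (glT k • τ) = hauptV τ := by
  rw [hauptV_eq, hauptV_eq, qc_glT]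

lemma continuous_hauptU : Continuous hauptU := mdiff_hauptU.continuous

lemma continuous_hauptV : Continuous hauptV := mdiff_hauptV.continuous

lemma exists_hauptU_alW_five : ∃ ζ : ℂ, ζ ^ 24 = 1 ∧ ∀ τ, hauptU (alW 5 • τ) = ζ * hauptV τ :=
  exists_const_of_pow_eq (continuous_hauptU.comp (continuous_smul_gl _)) continuous_hauptV
    hauptV_ne_zero hauptU_pow_alW_five

lemma exists_hauptU_alW_ten :
    ∃ ζ : ℂ, ζ ^ 24 = 4 ^ 24 ∧ ∀ τ, hauptU (alW 10 • τ) = ζ * (hauptV τ)⁻¹ :=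
  exists_const_of_pow_eq (continuous_hauptU.comp (continuous_smul_gl _))
    (continuous_hauptV.inv₀ hauptV_ne_zero) (fun τ ↦ inv_ne_zero (hauptV_ne_zero τ))
    hauptU_pow_alW_ten

/-- An element of `GL(2, ℝ)` is determined up to sign on the upper half-plane. -/
lemma smul_congr_of_neg {M N : GL (Fin 2) ℝ} (h : M.1 = -N.1) (τ : ℍ) : M • τ = N • τ := by
  have : M = -N := gl_ext (by rw [h]; rfl)
  rw [this, UpperHalfPlane.neg_smul]

lemma hauptU_inv_of_conj {W M : GL (Fin 2) ℝ} {k : ℤ} (h : ∀ τ, hauptU (W • glT k • τ) = hauptU (W • τ))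
    (hM : M * W = W * glT k) (τ : ℍ) : hauptU (M • τ) = hauptU τ := by
  have h1 := h (W⁻¹ • τ)
  rw [smul_inv_smul, ← mul_smul, ← hM, mul_smul, smul_inv_smul] at h1
  exact h1

lemma hauptU_inv_of_fixed {A B C D : ℤ} (h : A * D - 10 * B * C = 1) {M : GL (Fin 2) ℝ}
    (hM : M.1 = !![(A : ℝ), (B : ℝ); 10 * (C : ℝ), (D : ℝ)]) {τ₀ : ℍ} (hf : M • τ₀ = τ₀) (τ : ℍ) :
    hauptU (M • τ) = hauptU τ := by
  obtain ⟨ζ, -, hζ⟩ := exists_const_of_pow_eq (f := fun τ ↦ hauptU (M • τ)) (c := 1)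
    (continuous_hauptU.comp (continuous_smul_gl M)) continuous_hauptU hauptU_ne_zero
    (fun τ ↦ by rw [hauptU_pow_gamma h hM, one_mul])
  have h1 := hζ τ₀
  rw [hf] at h1
  have : ζ = 1 := by
    have h2 := hauptU_ne_zero τ₀
    exact (mul_right_cancel₀ h2 (by rw [← h1, one_mul]))
  rw [hζ, this, one_mul]

/-- The elliptic point `(3 + i) / 10`. -/
def ell3 : ℍ := ⟨(3 + Complex.I) / 10, by simp⟩

/-- The elliptic point `(-3 + i) / 10`. -/
def ell3' : ℍ := ⟨(-3 + Complex.I) / 10, by simp⟩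

lemma ell3_fixed : gl 3 (-1) 10 (-3) (by norm_num) • ell3 = ell3 := by
  apply UpperHalfPlane.ext
  rw [gl_smul, ell3]
  have : (3 + Complex.I) - 3 ≠ 0 := by simp
  push_cast
  rw [div_eq_iff (by convert this using 1; ring)]
  linear_combination (- 1 / 10 : ℂ) * Complex.I_sq

lemma ell3'_fixed : gl (-3) (-1) 10 3 (by norm_num) • ell3' = ell3' := by
  apply UpperHalfPlane.ext
  rw [gl_smul, ell3']
  have : (-3 + Complex.I) + 3 ≠ 0 := by simp
  push_cast
  rw [div_eq_iff (by convert this using 1; ring)]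
  linear_combination (- 1 / 10 : ℂ) * Complex.I_sq

/-- Reduction of the lower row of a matrix of level ten by a right multiplication. -/
lemma hauptU_gamma_aux (N : ℕ) : ∀ A B C D : ℤ, A * D - 10 * B * C = 1 → C.natAbs ≤ N →
    ∀ M : GL (Fin 2) ℝ, M.1 = !![(A : ℝ), (B : ℝ); 10 * (C : ℝ), (D : ℝ)] →
      ∀ τ, hauptU (M • τ) = hauptU τ := by
  induction N using Nat.strong_induction_on with
  | _ N ih =>
  intro A B C D hdet hN M hM τ
  by_cases hC0 : C = 0
  · subst hC0
    have hAD : A * D = 1 := by linarith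
    rcases Int.mul_eq_one_iff_eq_one_or_neg_one.mp hAD with ⟨rfl, rfl⟩ | ⟨rfl, rfl⟩
    · have : M = glT B := gl_ext (by rw [hM, glT, gl_coe]; simp)
      rw [this, hauptU_glT]
    · have : M.1 = -(glT (-B)).1 := by rw [hM, glT, gl_coe]; simp
      rw [smul_congr_of_neg this, hauptU_glT]
  have reduce : ∀ a b c d : ℤ, a * d - 10 * b * c = 1 →
      (∀ K : GL (Fin 2) ℝ, K.1 = !![(a : ℝ), (b : ℝ); 10 * (c : ℝ), (d : ℝ)] →
        ∀ τ, hauptU (K • τ) = hauptU τ) →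
      (C * a + D * c).natAbs < C.natAbs → hauptU (M • τ) = hauptU τ := by
    intro a b c d h hK hlt
    have hR : (a : ℝ) * d - b * (10 * c) = 1 := by
      have : ((a * d - 10 * b * c : ℤ) : ℝ) = 1 := by rw [h]; norm_num
      push_cast at this; linarith
    set K := gl a b (10 * c) d (by rw [hR]; norm_num)
    have h1 := ih _ (hlt.trans_le hN) (A * a + 10 * B * c) (A * b + B * d) (C * a + D * c)
      (10 * C * b + D * d) (by linear_combination (a * d - 10 * b * c) * hdet + h) le_rfl (M * K) (by
        rw [Units.val_mul, hM, gl_coe]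
        ext i j; fin_cases i <;> fin_cases j <;> simp <;> ring) (K⁻¹ • τ)
    rw [mul_smul, smul_inv_smul] at h1
    rw [h1]
    have h2 := hK K (gl_coe ..) (K⁻¹ • τ)
    rw [smul_inv_smul] at h2
    exact h2.symm
  obtain ⟨k, D', hD', hlo, hhi⟩ : ∃ k D' : ℤ, D' = D + 10 * k * C ∧
      (0 < C → -6 * C ≤ D' ∧ D' < 4 * C) ∧ (C < 0 → -6 * C ≥ D' ∧ D' > 4 * C) := by
    rcases lt_or_gt_of_ne hC0 with h | h
    · have h1 := Int.emod_add_mul_ediv (-D - 6 * C) (-10 * C)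
      have h2 := Int.emod_nonneg (-D - 6 * C) (b := -10 * C) (by omega)
      have h3 := Int.emod_lt_of_pos (-D - 6 * C) (b := -10 * C) (by omega)
      refine ⟨-((-D - 6 * C) / (-10 * C)), _, rfl, fun h' ↦ by omega, fun _ ↦ ?_⟩
      constructor <;> nlinarith
    · have h1 := Int.emod_add_mul_ediv (D + 6 * C) (10 * C)
      have h2 := Int.emod_nonneg (D + 6 * C) (b := 10 * C) (by omega)
      have h3 := Int.emod_lt_of_pos (D + 6 * C) (b := 10 * C) (by omega)
      refine ⟨-((D + 6 * C) / (10 * C)), _, rfl, fun _ ↦ ?_, fun h' ↦ by omega⟩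
      constructor <;> nlinarith
  have hne : ∀ j : ℤ, (2 ∣ j ∨ 5 ∣ j) → D' ≠ j * C := by
    intro j hj h
    have h1 : C * (A * (j - 10 * k) - 10 * B) = 1 := by
      have h2 : D = j * C - 10 * k * C := by linarith
      rw [← hdet, h2]; ring
    have h3 : C ∣ 1 := ⟨_, h1.symm⟩
    rcases hj with ⟨l, rfl⟩ | ⟨l, rfl⟩
    · have : (2 : ℤ) ∣ 1 := ⟨C * (A * (l - 5 * k) - 5 * B), by rw [← h1]; ring⟩
      omega
    · have : (5 : ℤ) ∣ 1 := ⟨C * (A * (l - 2 * k) - 2 * B), by rw [← h1]; ring⟩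
      omega
  have reduce_add : ∀ a b c d : ℤ, a * d - 10 * b * c = 1 →
      (∀ K : GL (Fin 2) ℝ, K.1 = !![(a : ℝ), (b : ℝ); 10 * (c : ℝ), (d : ℝ)] →
        ∀ τ, hauptU (K • τ) = hauptU τ) →
      (C * a + D' * c).natAbs < C.natAbs → hauptU (M • τ) = hauptU τ := by
    intro a b c d h hK hlt
    refine reduce (a + 10 * k * c) (b + k * d) c d (by rw [← h]; ring) (fun K hK' τ ↦ ?_) ?_
    · have hR : (a : ℝ) * d - b * (10 * c) = 1 := by
        have : ((a * d - 10 * b * c : ℤ) : ℝ) = 1 := by rw [h]; norm_num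
        push_cast at this; linarith
      have h2 : K = glT k * gl a b (10 * c) d (by rw [hR]; norm_num) := by
        apply gl_ext
        rw [hK', Units.val_mul, glT, gl_coe, gl_coe]
        ext i j; fin_cases i <;> fin_cases j <;> simp
        ring
      rw [h2, mul_smul, hauptU_glT]
      exact hK _ (gl_coe ..) τ
    · convert hlt using 2
      rw [hD']; ring
  obtain ⟨ζ, -, hζ⟩ := exists_hauptU_alW_ten
  obtain ⟨ξ, -, hξ⟩ := exists_hauptU_alW_five
  have gA : ∀ s : ℤ, ∀ K : GL (Fin 2) ℝ, K.1 = !![((1 : ℤ) : ℝ), ((0 : ℤ) : ℝ); 10 * (s : ℝ), ((1 : ℤ) : ℝ)] →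
        ∀ τ, hauptU (K • τ) = hauptU τ := by
    intro s K hK
    refine hauptU_inv_of_conj (W := alW 10) (k := -s) (fun τ ↦ by rw [hζ, hζ, hauptV_glT]) ?_
    apply gl_ext
    rw [Units.val_mul, Units.val_mul, hK, glT, gl_coe, show alW 10 = gl 0 (-1) 10 0 (by norm_num) by
      simp [alW], gl_coe]
    ext i j; fin_cases i <;> fin_cases j <;> simp
  have gB : ∀ K : GL (Fin 2) ℝ, K.1 = !![((9 : ℤ) : ℝ), ((-5 : ℤ) : ℝ); 10 * ((2 : ℤ) : ℝ), ((-11 : ℤ) : ℝ)] →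
        ∀ τ, hauptU (K • τ) = hauptU τ := by
    intro K hK τ
    rw [smul_congr_of_neg (N := -K) (by simp)]
    refine hauptU_inv_of_conj (W := alW 5) (k := 1) (fun τ ↦ by rw [hξ, hξ, hauptV_glT]) ?_ τ
    apply gl_ext
    rw [Units.val_mul, Units.val_mul, Units.val_neg, hK, glT, gl_coe,
      show alW 5 = gl 5 2 10 5 (by norm_num) by simp [alW], gl_coe]
    ext i j; fin_cases i <;> fin_cases j <;> simp <;> norm_num
  have gB' : ∀ K : GL (Fin 2) ℝ, K.1 = !![((-11 : ℤ) : ℝ), ((5 : ℤ) : ℝ); 10 * ((-2 : ℤ) : ℝ), ((9 : ℤ) : ℝ)] →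
        ∀ τ, hauptU (K • τ) = hauptU τ := by
    intro K hK τ
    rw [smul_congr_of_neg (N := -K) (by simp)]
    refine hauptU_inv_of_conj (W := alW 5) (k := -1) (fun τ ↦ by rw [hξ, hξ, hauptV_glT]) ?_ τ
    apply gl_ext
    rw [Units.val_mul, Units.val_mul, Units.val_neg, hK, glT, gl_coe,
      show alW 5 = gl 5 2 10 5 (by norm_num) by simp [alW], gl_coe]
    ext i j; fin_cases i <;> fin_cases j <;> simp <;> norm_num
  have gE : ∀ K : GL (Fin 2) ℝ, K.1 = !![((3 : ℤ) : ℝ), ((-1 : ℤ) : ℝ); 10 * ((1 : ℤ) : ℝ), ((-3 : ℤ) : ℝ)] →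
        ∀ τ, hauptU (K • τ) = hauptU τ := by
    intro K hK
    refine hauptU_inv_of_fixed (by norm_num) hK (τ₀ := ell3) ?_
    rw [show K = gl 3 (-1) 10 (-3) (by norm_num) from gl_ext (by rw [hK, gl_coe]; simp), ell3_fixed]
  have gE' : ∀ K : GL (Fin 2) ℝ, K.1 = !![((-3 : ℤ) : ℝ), ((-1 : ℤ) : ℝ); 10 * ((1 : ℤ) : ℝ), ((3 : ℤ) : ℝ)] →
        ∀ τ, hauptU (K • τ) = hauptU τ := by
    intro K hK
    refine hauptU_inv_of_fixed (by norm_num) hK (τ₀ := ell3') ?_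
    rw [show K = gl (-3) (-1) 10 3 (by norm_num) from gl_ext (by rw [hK, gl_coe]; simp), ell3'_fixed]
  have n1 := hne (-6) (by norm_num)
  have n2 := hne (-5) (by norm_num)
  have n3 := hne (-4) (by norm_num)
  have n4 := hne (-2) (by norm_num)
  have n5 := hne 0 (by norm_num)
  have n6 := hne 2 (by norm_num)
  by_cases r1 : (C * 9 + D' * 2).natAbs < C.natAbs
  · exact reduce_add 9 (-5) 2 (-11) (by norm_num) gB r1
  by_cases r2 : (C * (-11) + D' * (-2)).natAbs < C.natAbs
  · exact reduce_add (-11) 5 (-2) 9 (by norm_num) gB' r2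
  by_cases r3 : (C * 3 + D' * 1).natAbs < C.natAbs
  · exact reduce_add 3 (-1) 1 (-3) (by norm_num) gE r3
  by_cases r4 : (C * (-3) + D' * 1).natAbs < C.natAbs
  · exact reduce_add (-3) (-1) 1 3 (by norm_num) gE' r4
  by_cases r5 : (C * 1 + D' * 1).natAbs < C.natAbs
  · exact reduce_add 1 0 1 1 (by norm_num) (gA 1) r5
  by_cases r6 : (C * 1 + D' * (-1)).natAbs < C.natAbs
  · exact reduce_add 1 0 (-1) 1 (by norm_num) (gA (-1)) r6
  clear * - hlo hhi n1 n2 n3 n4 n5 n6 r1 r2 r3 r4 r5 r6 hC0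
  omega

theorem hauptU_gamma {M : GL (Fin 2) ℝ} (hM : M ∈ heckeSet 1) (τ : ℍ) :
    hauptU (M • τ) = hauptU τ := by
  obtain ⟨A, B, C, D, h, h'⟩ := hM
  exact hauptU_gamma_aux _ A B C D h' le_rfl M h τ

/-- The fixed point of an Atkin–Lehner involution of type five. -/
def ell5 : ℍ := ⟨1 / 2 + Complex.I * (Real.sqrt 5 / 10 : ℝ), by
  have := Real.sqrt_pos.mpr (show (0 : ℝ) < 5 by norm_num)
  simp⟩

theorem hauptU_alW_five (τ : ℍ) : hauptU (alW 5 • τ) = - hauptV τ := by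
  obtain ⟨ζ, h24, hζ⟩ := exists_hauptU_alW_five
  set W := gl 5 (-3) 10 (-5) (by norm_num)
  have hW : W ∈ alSet 5 := ⟨1, -3, 1, -1, by rw [gl_coe]; simp, by norm_num⟩
  have hfix : W • ell5 = ell5 := by
    apply UpperHalfPlane.ext
    have h5 : ((Real.sqrt 5 : ℝ) : ℂ) ^ 2 = 5 := by
      rw [← ofReal_pow, Real.sq_sqrt (by norm_num)]; norm_num
    have hne : ((Real.sqrt 5 : ℝ) : ℂ) ≠ 0 := by intro h; rw [h] at h5; norm_num at h5
    rw [gl_smul, ell5]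
    push_cast
    rw [div_eq_iff]
    · linear_combination (-(1 / 10 : ℂ)) * (((Real.sqrt 5 : ℝ) : ℂ) ^ 2) * Complex.I_sq + (1 / 10) * h5
    · have : (10 : ℂ) * (1 / 2 + Complex.I * (((Real.sqrt 5 : ℝ) : ℂ) / 10)) + -5 =
        Complex.I * ((Real.sqrt 5 : ℝ) : ℂ) := by ring
      rw [this]; exact mul_ne_zero Complex.I_ne_zero hne
  have h1 : hauptU ell5 = ζ * hauptV ell5 := by
    rw [← hζ]
    conv_lhs => rw [← hfix]
    have h2 := alSet_mul_inv (by norm_num) (by norm_num) (alW_mem (e := 5) (by simp [ed])) hW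
    have h3 := hauptU_gamma h2 (alW 5 • ell5)
    rw [← mul_smul, inv_mul_cancel_right] at h3
    exact h3
  obtain ⟨r, hr, hr'⟩ : ∃ r : ℝ, 0 < r ∧ qc ell5 = ((-r : ℝ) : ℂ) := by
    refine ⟨Real.exp (-(2 * Real.pi * (Real.sqrt 5 / 10))), Real.exp_pos _, ?_⟩
    rw [qc, ell5]
    push_cast
    rw [show 2 * (Real.pi : ℂ) * Complex.I * (1 / 2 + Complex.I * (((Real.sqrt 5 : ℝ) : ℂ) / 10)) =
      Real.pi * Complex.I + -(2 * Real.pi * (((Real.sqrt 5 : ℝ) : ℂ) / 10)) by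
        linear_combination (2 * Real.pi * (((Real.sqrt 5 : ℝ) : ℂ) / 10)) * Complex.I_sq,
      Complex.exp_add, Complex.exp_pi_mul_I]
    ring
  have hr1 : |-r| < 1 := by
    have := norm_qc_lt_one ell5.im_pos
    rwa [show ell5.1 = (ell5 : ℂ) from rfl, hr', Complex.norm_real] at this
  obtain ⟨⟨s, hs, hs'⟩, ⟨t, ht, ht'⟩⟩ := phi_ofReal_pos hr1
  rw [hauptU_eq, hauptV_eq, hr', hs', ht'] at h1
  have hζr : ζ = ((-(s / r / t) : ℝ) : ℂ) := by
    have : (r : ℂ) ≠ 0 := by exact_mod_cast hr.ne'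
    have : (t : ℂ) ≠ 0 := by exact_mod_cast ht.ne'
    push_cast at h1 ⊢
    field_simp at h1 ⊢
    linear_combination -h1
  rw [hζ, hζr]
  rw [hζr] at h24
  have hp : 0 < s / r / t := by positivity
  rcases real_root_of_unity h24 with h | h
  · linarith
  · rw [h]; push_cast; ring

/-- The fixed point of the Fricke involution. -/
def ell10 : ℍ := ⟨Complex.I * (Real.sqrt 10 / 10 : ℝ), by
  have := Real.sqrt_pos.mpr (show (0 : ℝ) < 10 by norm_num)
  simp⟩

theorem hauptU_alW_ten (τ : ℍ) : hauptU (alW 10 • τ) = 4 * (hauptV τ)⁻¹ := by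
  obtain ⟨ζ, h24, hζ⟩ := exists_hauptU_alW_ten
  have hfix : alW 10 • ell10 = ell10 := by
    apply UpperHalfPlane.ext
    have h5 : ((Real.sqrt 10 : ℝ) : ℂ) ^ 2 = 10 := by
      rw [← ofReal_pow, Real.sq_sqrt (by norm_num)]; norm_num
    have hne : ((Real.sqrt 10 : ℝ) : ℂ) ≠ 0 := by intro h; rw [h] at h5; norm_num at h5
    rw [smul_alW_ten, ell10]
    push_cast
    rw [div_eq_iff]
    · linear_combination (-(1 / 10 : ℂ)) * (((Real.sqrt 10 : ℝ) : ℂ) ^ 2) * Complex.I_sq + (1 / 10) * h5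
    · simp
  have h1 := hζ ell10
  rw [hfix] at h1
  obtain ⟨r, hr, hr'⟩ : ∃ r : ℝ, 0 < r ∧ qc ell10 = (r : ℂ) := by
    refine ⟨Real.exp (-(2 * Real.pi * (Real.sqrt 10 / 10))), Real.exp_pos _, ?_⟩
    rw [qc, ell10]
    push_cast
    congr 1
    linear_combination (2 * Real.pi * (((Real.sqrt 10 : ℝ) : ℂ) / 10)) * Complex.I_sq
  have hr1 : |r| < 1 := by
    have := norm_qc_lt_one ell10.im_pos
    rwa [show ell10.1 = (ell10 : ℂ) from rfl, hr', Complex.norm_real] at this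
  obtain ⟨⟨s, hs, hs'⟩, ⟨t, ht, ht'⟩⟩ := phi_ofReal_pos hr1
  rw [hauptU_eq, hauptV_eq, hr', hs', ht'] at h1
  have hζr : ζ = ((s / r * t : ℝ) : ℂ) := by
    have : (r : ℂ) ≠ 0 := by exact_mod_cast hr.ne'
    have : (t : ℂ) ≠ 0 := by exact_mod_cast ht.ne'
    push_cast at h1 ⊢
    field_simp at h1 ⊢
    linear_combination -h1
  have hp : 0 < s / r * t := by positivity
  have h25 : (((s / r * t / 4 : ℝ)) : ℂ) ^ 24 = 1 := by
    rw [hζr] at h24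
    push_cast at h24 ⊢
    rw [div_pow, h24, div_self (by norm_num)]
  rcases real_root_of_unity h25 with h | h
  · rw [hζ, hζr, show s / r * t = 4 by linarith]; push_cast; rfl
  · linarith

lemma alSet_gamma_mul {e : ℤ} (he' : e ∣ 10) {W M : GL (Fin 2) ℝ}
    (hW : W ∈ alSet e) (hM : M ∈ heckeSet 1) : W * M ∈ alSet e := by
  obtain ⟨f, hf⟩ := he'
  have hfR : (10 : ℝ) = e * f := by exact_mod_cast hf
  obtain ⟨x, y, z, w, h, h'⟩ := hW
  obtain ⟨A, B, C, D, k, k'⟩ := hM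
  refine ⟨x * A + f * y * C, e * x * B + y * D, z * A + e * w * C, f * z * B + w * D, ?_, ?_⟩
  · rw [Units.val_mul, h, k]
    push_cast
    ext i j; fin_cases i <;> fin_cases j <;> simp <;> (try rw [hfR]) <;> ring
  · rw [hf] at h' k' ⊢
    linear_combination e * k' + h' * (A * D - e * f * B * C)

/-- Matrices proportional by a positive factor act in the same way. -/
lemma smul_congr_of_smul {M N : GL (Fin 2) ℝ} {g : ℝ} (hg : 0 < g) (hN : 0 < N.det.val)
    (h : M.1 = g • N.1) (τ : ℍ) : M • τ = N • τ := by
  have e1 : N.1 = !![N.1 0 0, N.1 0 1; N.1 1 0, N.1 1 1] := Matrix.eta_fin_two _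
  have e2 : M.1 = !![g * N.1 0 0, g * N.1 0 1; g * N.1 1 0, g * N.1 1 1] := by
    rw [h]; ext i j; fin_cases i <;> fin_cases j <;> simp
  have d1 := hN
  rw [det_of_coe e1] at d1
  apply UpperHalfPlane.ext
  rw [smul_of_coe e1 d1, smul_of_coe e2 (by nlinarith [mul_pos (mul_pos hg hg) d1])]
  push_cast
  rw [← mul_div_mul_left (((N.1 0 0 : ℝ) : ℂ) * τ + (N.1 0 1 : ℝ)) _
    (show (g : ℂ) ≠ 0 by exact_mod_cast hg.ne')]
  congr 1 <;> ring

lemma alSet_mul {g a b k : ℤ} (hg : 0 < g) (h10 : g * a * b * k = 10) {W W' : GL (Fin 2) ℝ}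
    (hW : W ∈ alSet (g * a)) (hW' : W' ∈ alSet (g * b)) :
    ∃ V ∈ alSet (a * b), (W * W').1 = (g : ℝ) • V.1 := by
  have h10R : (10 : ℝ) = g * a * b * k := by exact_mod_cast h10.symm
  have ha : a ≠ 0 := by rintro rfl; simp at h10
  have hb : b ≠ 0 := by rintro rfl; simp at h10
  have hgR : (g : ℝ) ≠ 0 := by exact_mod_cast hg.ne'
  have hdet := congrArg Units.val (Matrix.GeneralLinearGroup.det.map_mul W W')
  have d1 := alSet_det hW
  have d2 := alSet_det hW'
  rw [Units.val_mul, d1, d2] at hdet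
  obtain ⟨x, y, z, w, h, h'⟩ := hW
  obtain ⟨x', y', z', w', l, l'⟩ := hW'
  let N : Matrix (Fin 2) (Fin 2) ℝ := !![((a * b : ℤ) : ℝ) * (g * x * x' + k * y * z' : ℤ),
    (a * x * y' + b * y * w' : ℤ); 10 * ((b * z * x' + a * w * z' : ℤ) : ℝ),
    ((a * b : ℤ) : ℝ) * (k * z * y' + g * w * w' : ℤ)]
  have hN : (W * W').1 = (g : ℝ) • N := by
    rw [Units.val_mul, h, l]
    ext i j; fin_cases i <;> fin_cases j <;> simp [N] <;> (try rw [h10R]) <;> ring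
  have hN' : N.det = ((a * b : ℤ) : ℝ) := by
    have h3 : (W * W').1.det = g ^ 2 * N.det := by rw [hN, Matrix.det_smul]; simp
    rw [Matrix.GeneralLinearGroup.val_det_apply] at hdet
    rw [hdet] at h3
    have : (g : ℝ) ^ 2 * N.det = g ^ 2 * ((a * b : ℤ) : ℝ) := by rw [← h3]; push_cast; ring
    exact mul_left_cancel₀ (pow_ne_zero 2 hgR) this
  refine ⟨Matrix.GeneralLinearGroup.mkOfDetNeZero N (by rw [hN']; exact_mod_cast mul_ne_zero ha hb),
    ⟨_, _, _, _, rfl, ?_⟩, hN⟩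
  rw [Matrix.det_fin_two_of] at hN'
  have : ((a * b * (g * x * x' + k * y * z') * (a * b * (k * z * y' + g * w * w')) -
    10 * (a * x * y' + b * y * w') * (b * z * x' + a * w * z') : ℤ) : ℝ) = ((a * b : ℤ) : ℝ) := by
    rw [← hN']; push_cast; ring
  exact_mod_cast this

/-- The group law on the exact divisors of ten. -/
def edMul (e f : ℤ) : ℤ := e * f / (Int.gcd e f : ℤ) ^ 2

lemma edMul_mem {e f : ℤ} (he : e ∈ ed) (hf : f ∈ ed) : edMul e f ∈ ed := by
  exact (by decide : ∀ e ∈ ed, ∀ f ∈ ed, edMul e f ∈ ed) e he f hf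

lemma alSet_mul_ed {e f : ℤ} (he : e ∈ ed) (hf : f ∈ ed) {W W' : GL (Fin 2) ℝ}
    (hW : W ∈ alSet e) (hW' : W' ∈ alSet f) :
    ∃ g : ℤ, 0 < g ∧ e * f = g ^ 2 * edMul e f ∧
      ∃ V ∈ alSet (edMul e f), (W * W').1 = (g : ℝ) • V.1 := by
  obtain ⟨g, a, b, k, hg, h1, rfl, rfl, h2⟩ : ∃ g a b k : ℤ, 0 < g ∧ g * a * b * k = 10 ∧
      e = g * a ∧ f = g * b ∧ edMul e f = a * b := by
    refine ⟨Int.gcd e f, e / Int.gcd e f, f / Int.gcd e f, 10 * (Int.gcd e f) / (e * f), ?_⟩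
    exact (by decide : ∀ e ∈ ed, ∀ f ∈ ed, (0 : ℤ) < Int.gcd e f ∧
      Int.gcd e f * (e / Int.gcd e f) * (f / Int.gcd e f) * (10 * (Int.gcd e f) / (e * f)) = 10 ∧
      e = Int.gcd e f * (e / Int.gcd e f) ∧ f = Int.gcd e f * (f / Int.gcd e f) ∧
      edMul e f = e / Int.gcd e f * (f / Int.gcd e f)) e he f hf
  refine ⟨g, hg, by rw [h2]; ring, ?_⟩
  rw [h2]
  exact alSet_mul hg h1 hW hW'

lemma alSet_smul_smul {e f : ℤ} (he : e ∈ ed) (hf : f ∈ ed) {W W' : GL (Fin 2) ℝ}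
    (hW : W ∈ alSet e) (hW' : W' ∈ alSet f) :
    ∃ V ∈ alSet (edMul e f), ∀ τ : ℍ, W • W' • τ = V • τ := by
  obtain ⟨g, hg, -, V, hV, h⟩ := alSet_mul_ed he hf hW hW'
  refine ⟨V, hV, fun τ ↦ ?_⟩
  rw [← mul_smul]
  refine smul_congr_of_smul (g := (g : ℝ)) (by exact_mod_cast hg) ?_ h τ
  rw [alSet_det hV]
  exact_mod_cast ed_pos (edMul_mem he hf)

/-- A function on the upper half-plane invariant under `Γ₀(10)`. -/
def GammaInv (f : ℍ → ℂ) : Prop := ∀ γ ∈ heckeSet 1, ∀ τ, f (γ • τ) = f τ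

lemma GammaInv.alSet_congr {f : ℍ → ℂ} (hf : GammaInv f) {e : ℤ} (he : e ∈ ed)
    {W W' : GL (Fin 2) ℝ} (hW : W ∈ alSet e) (hW' : W' ∈ alSet e) (τ : ℍ) :
    f (W • τ) = f (W' • τ) := by
  rw [← hf _ (alSet_mul_inv (ed_pos he) (ed_dvd he) hW' hW) (W' • τ), mul_smul, inv_smul_smul]

lemma GammaInv.comp_alSet {f : ℍ → ℂ} (hf : GammaInv f) {e : ℤ} (he : e ∈ ed)
    {W : GL (Fin 2) ℝ} (hW : W ∈ alSet e) : GammaInv fun τ ↦ f (W • τ) := by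
  intro γ hγ τ
  show f (W • γ • τ) = _
  rw [← mul_smul]
  exact hf.alSet_congr he (alSet_gamma_mul (ed_dvd he) hW hγ) hW τ

lemma GammaInv.alW_alW {f : ℍ → ℂ} (hf : GammaInv f) {e e' : ℤ} (he : e ∈ ed) (he' : e' ∈ ed)
    (τ : ℍ) : f (alW e • alW e' • τ) = f (alW (edMul e e') • τ) := by
  obtain ⟨V, hV, h⟩ := alSet_smul_smul he he' (alW_mem he) (alW_mem he')
  rw [h]
  exact hf.alSet_congr (edMul_mem he he') hV (alW_mem (edMul_mem he he')) τ

lemma gammaInv_hauptU : GammaInv hauptU := fun _ h τ ↦ hauptU_gamma h τ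

lemma one_mem_ed : (1 : ℤ) ∈ ed := by decide
lemma two_mem_ed : (2 : ℤ) ∈ ed := by decide
lemma five_mem_ed : (5 : ℤ) ∈ ed := by decide
lemma ten_mem_ed : (10 : ℤ) ∈ ed := by decide

lemma hauptV_alW_five (τ : ℍ) : hauptV (alW 5 • τ) = -hauptU τ := by
  have h := hauptU_alW_five (alW 5 • τ)
  rw [gammaInv_hauptU.alW_alW five_mem_ed five_mem_ed, show edMul 5 5 = 1 by decide, alW_one,
    one_smul] at h
  rw [h, neg_neg]

lemma hauptU_alW_two (τ : ℍ) : hauptU (alW 2 • τ) = -4 * (hauptU τ)⁻¹ := by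
  have h := hauptU_alW_ten (alW 5 • τ)
  rw [gammaInv_hauptU.alW_alW ten_mem_ed five_mem_ed, show edMul 10 5 = 2 by decide,
    hauptV_alW_five] at h
  rw [h, inv_neg]; ring

lemma tendsto_qc : Tendsto (fun τ : ℍ ↦ qc τ) atImInfty (𝓝[≠] 0) := by
  simp_rw [qc_eq_qParam]
  exact (Function.Periodic.qParam_tendsto one_pos).comp
    (UpperHalfPlane.tendsto_coe_atImInfty)

/-- The Euler product with its first two factors removed. -/
def eulerTail (q : ℂ) : ℂ := eulerProd q / ((1 - q) * (1 - q ^ 2))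

/-- `f = 1 + O(q ^ 3)` near `0`. -/
def OneAddCube (f : ℂ → ℂ) : Prop := (fun q ↦ f q - 1) =O[𝓝 0] fun q ↦ q ^ 3

lemma OneAddCube.tendsto {f : ℂ → ℂ} (hf : OneAddCube f) : Tendsto f (𝓝 0) (𝓝 1) := by
  have h : Tendsto (fun q : ℂ ↦ q ^ 3) (𝓝 0) (𝓝 0) := by
    simpa using (continuous_pow 3 (M := ℂ)).tendsto 0
  simpa using (hf.trans_tendsto h).add_const 1

lemma OneAddCube.mul {f g : ℂ → ℂ} (hf : OneAddCube f) (hg : OneAddCube g) :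
    OneAddCube fun q ↦ f q * g q := by
  have h1 : (fun q ↦ (f q - 1) * g q) =O[𝓝 0] fun q : ℂ ↦ q ^ 3 * (1 : ℂ) :=
    Asymptotics.IsBigO.mul hf (hg.tendsto.isBigO_one ℂ)
  simp only [mul_one] at h1
  refine (h1.add hg).congr_left fun q ↦ ?_
  ring

lemma OneAddCube.inv {f : ℂ → ℂ} (hf : OneAddCube f) : OneAddCube fun q ↦ (f q)⁻¹ := by
  have h1 : (fun q ↦ (f q - 1) * (-(f q)⁻¹)) =O[𝓝 0] fun q : ℂ ↦ q ^ 3 * (1 : ℂ) :=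
    Asymptotics.IsBigO.mul hf ((hf.tendsto.inv₀ one_ne_zero).neg.isBigO_one ℂ)
  simp only [mul_one] at h1
  refine h1.congr' ?_ EventuallyEq.rfl
  filter_upwards [hf.tendsto.eventually_ne one_ne_zero] with q hq
  field_simp
  ring

lemma OneAddCube.pow {f : ℂ → ℂ} (hf : OneAddCube f) (n : ℕ) : OneAddCube fun q ↦ f q ^ n := by
  induction n with
  | zero => simpa [OneAddCube] using Asymptotics.isBigO_zero _ _
  | succ n ih => simpa only [pow_succ] using ih.mul hf

lemma isBigO_pow_pow {m n : ℕ} (h : m ≤ n) : (fun q : ℂ ↦ q ^ n) =O[𝓝 0] fun q ↦ q ^ m := by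
  refine Asymptotics.IsBigO.of_bound 1 ?_
  filter_upwards [Metric.ball_mem_nhds (0 : ℂ) one_pos] with q hq
  rw [norm_pow, norm_pow, one_mul]
  exact pow_le_pow_of_le_one (norm_nonneg _) (by simpa using (mem_ball_zero_iff.mp hq).le) h

lemma OneAddCube.comp_pow {f : ℂ → ℂ} (hf : OneAddCube f) {n : ℕ} (hn : 1 ≤ n) :
    OneAddCube fun q ↦ f (q ^ n) := by
  have h : Tendsto (fun q : ℂ ↦ q ^ n) (𝓝 0) (𝓝 0) := by
    simpa [show n ≠ 0 by omega] using (continuous_pow n (M := ℂ)).tendsto 0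
  refine (Asymptotics.IsBigO.comp_tendsto hf h).trans ?_
  show (fun q : ℂ ↦ (q ^ n) ^ 3) =O[𝓝 0] _
  simp_rw [← pow_mul]
  exact isBigO_pow_pow (by omega)

lemma oneAddCube_eulerTail : OneAddCube eulerTail := by
  refine Asymptotics.IsBigO.of_bound 4 ?_
  filter_upwards [Metric.closedBall_mem_nhds (0 : ℂ) (show (0 : ℝ) < 1 / 2 by norm_num)] with q hq
  have hq : ‖q‖ ≤ 1 / 2 := by simpa using hq
  obtain ⟨R, h, hR⟩ := eulerProd_near_zero hq
  have h1 : 1 - q ≠ 0 := by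
    intro h; rw [← sub_eq_zero.mp h] at hq; norm_num at hq
  have h2 : 1 - q ^ 2 ≠ 0 := by
    intro h
    have h3 : ‖q‖ ^ 2 = 1 := by rw [← norm_pow, ← sub_eq_zero.mp h, norm_one]
    nlinarith [norm_nonneg q]
  rw [eulerTail, h, mul_div_cancel_left₀ _ (mul_ne_zero h1 h2), norm_pow]
  exact hR

lemma oneAddCube_one_sub_pow {n : ℕ} (hn : 3 ≤ n) : OneAddCube fun q ↦ 1 - q ^ n := by
  refine ((isBigO_pow_pow hn).neg_left).congr_left fun q ↦ ?_
  ring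

lemma eventually_one_sub_pow_ne {n : ℕ} (hn : 1 ≤ n) : ∀ᶠ q : ℂ in 𝓝 0, 1 - q ^ n ≠ 0 := by
  have h : Tendsto (fun q : ℂ ↦ 1 - q ^ n) (𝓝 0) (𝓝 1) := by
    simpa [show n ≠ 0 by omega] using (continuous_const.sub (continuous_pow n (M := ℂ))).tendsto (x := 0) (f := fun q : ℂ ↦ 1 - q ^ n)
  exact h.eventually_ne one_ne_zero

lemma eulerProd_eventually_eq :
    ∀ᶠ q in 𝓝 0, eulerProd q = (1 - q) * (1 - q ^ 2) * eulerTail q := by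
  filter_upwards [eventually_one_sub_pow_ne (n := 1) le_rfl,
    eventually_one_sub_pow_ne (n := 2) one_le_two] with q h1 h2
  rw [pow_one] at h1
  rw [eulerTail, mul_div_cancel₀ _ (mul_ne_zero h1 h2)]

lemma eulerProd_pow_eventually_eq {n : ℕ} (hn : 1 ≤ n) :
    ∀ᶠ q in 𝓝 0, eulerProd (q ^ n) = (1 - q ^ n) * (1 - q ^ (2 * n)) * eulerTail (q ^ n) := by
  have h : Tendsto (fun q : ℂ ↦ q ^ n) (𝓝 0) (𝓝 0) := by
    simpa [show n ≠ 0 by omega] using (continuous_pow n (M := ℂ)).tendsto 0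
  filter_upwards [h.eventually eulerProd_eventually_eq] with q hq
  rw [hq, ← pow_mul, mul_comm 2 n]

lemma oneAddCube_eulerProd_pow {n : ℕ} (hn : 3 ≤ n) : OneAddCube fun q ↦ eulerProd (q ^ n) := by
  refine (((oneAddCube_one_sub_pow hn).mul (oneAddCube_one_sub_pow (n := 2 * n) (by omega))).mul
    (oneAddCube_eulerTail.comp_pow (n := n) (by omega))).congr' ?_ EventuallyEq.rfl
  filter_upwards [eulerProd_pow_eventually_eq (n := n) (by omega)] with q hq
  rw [hq]

lemma oneAddCube_phiU : OneAddCube fun q ↦ phiU q * (1 - q) := by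
  refine (((oneAddCube_one_sub_pow (n := 4) (by norm_num)).mul (oneAddCube_eulerTail.comp_pow
    (n := 2) (by norm_num))).mul ((oneAddCube_eulerProd_pow (n := 5) (by norm_num)).pow 5)).mul
    (oneAddCube_eulerTail.mul ((oneAddCube_eulerProd_pow (n := 10) (by norm_num)).pow 5)).inv
    |>.congr' ?_ EventuallyEq.rfl
  filter_upwards [eulerProd_pow_eventually_eq (n := 2) (by norm_num), eulerProd_eventually_eq,
    eventually_one_sub_pow_ne (n := 1) le_rfl, eventually_one_sub_pow_ne (n := 2) one_le_two]
    with q h1 h2 h3 h4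
  rw [pow_one] at h3
  simp only [phiU, h1, h2]
  generalize eulerProd (q ^ 5) = a
  generalize eulerProd (q ^ 10) = b
  generalize eulerTail (q ^ 2) = d
  generalize eulerTail q = f
  norm_num
  rw [show (1 - q) * (1 - q ^ 2) * f * b ^ 5 = ((1 - q) * (1 - q ^ 2)) * (f * b ^ 5) by ring,
    show (1 - q ^ 2) * (1 - q ^ 4) * d * a ^ 5 = (1 - q ^ 2) * ((1 - q ^ 4) * d * a ^ 5) by ring,
    div_eq_mul_inv, mul_inv, mul_inv, mul_inv]
  field_simp

lemma phiV_isBigO : (fun q ↦ phiV q - (1 - 5 * q)) =O[𝓝 0] fun q ↦ q ^ 2 := by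
  have hA : OneAddCube fun q ↦ eulerProd (q ^ 10) * (eulerTail q) ^ 5 *
      (eulerProd (q ^ 5) * ((1 - q ^ 4) * eulerTail (q ^ 2)) ^ 5)⁻¹ :=
    ((oneAddCube_eulerProd_pow (by norm_num)).mul (oneAddCube_eulerTail.pow 5)).mul
      ((oneAddCube_eulerProd_pow (by norm_num)).mul (((oneAddCube_one_sub_pow (by norm_num)).mul
        (oneAddCube_eulerTail.comp_pow one_le_two)).pow 5)).inv
  have h1 : (fun q : ℂ ↦ (1 - q) ^ 5 * (eulerProd (q ^ 10) * (eulerTail q) ^ 5 *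
      (eulerProd (q ^ 5) * ((1 - q ^ 4) * eulerTail (q ^ 2)) ^ 5)⁻¹ - 1)) =O[𝓝 0]
      fun q : ℂ ↦ (1 : ℂ) * q ^ 3 := by
    refine Asymptotics.IsBigO.mul ?_ hA
    have : Tendsto (fun q : ℂ ↦ (1 - q) ^ 5) (𝓝 0) (𝓝 ((1 - 0) ^ 5)) :=
      ((continuous_const.sub continuous_id).pow 5).tendsto 0
    exact this.isBigO_one ℂ
  simp only [one_mul] at h1
  have h2 : (fun q : ℂ ↦ q ^ 2 * (10 - 10 * q + 5 * q ^ 2 - q ^ 3)) =O[𝓝 0]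
      fun q : ℂ ↦ q ^ 2 * (1 : ℂ) := by
    refine Asymptotics.IsBigO.mul (Asymptotics.isBigO_refl _ _) ?_
    have : Tendsto (fun q : ℂ ↦ 10 - 10 * q + 5 * q ^ 2 - q ^ 3) (𝓝 0)
      (𝓝 (10 - 10 * 0 + 5 * 0 ^ 2 - 0 ^ 3)) := Continuous.tendsto (by fun_prop) 0
    exact this.isBigO_one ℂ
  simp only [mul_one] at h2
  refine ((h1.trans (isBigO_pow_pow (by norm_num))).add h2).congr' ?_ EventuallyEq.rfl
  filter_upwards [eulerProd_pow_eventually_eq (n := 2) (by norm_num), eulerProd_eventually_eq,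
    eventually_one_sub_pow_ne (n := 2) one_le_two]
    with q h1 h2 h4
  simp only [phiV, h1, h2]
  generalize eulerProd (q ^ 5) = a
  generalize eulerProd (q ^ 10) = b
  generalize eulerTail (q ^ 2) = d
  generalize eulerTail q = f
  norm_num
  rw [show b * ((1 - q) * (1 - q ^ 2) * f) ^ 5 = (1 - q ^ 2) ^ 5 * ((1 - q) ^ 5 * (b * f ^ 5)) by ring,
    show a * ((1 - q ^ 2) * (1 - q ^ 4) * d) ^ 5 = (1 - q ^ 2) ^ 5 * (a * ((1 - q ^ 4) * d) ^ 5) by ring,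
    mul_div_mul_left _ _ (pow_ne_zero 5 h4), div_eq_mul_inv, mul_inv]
  ring

lemma tendsto_phiU : Tendsto phiU (𝓝 0) (𝓝 1) := by
  have h1 : Tendsto (fun q : ℂ ↦ 1 - q) (𝓝 0) (𝓝 1) := by
    simpa using (continuous_const.sub continuous_id (X := ℂ)).tendsto (x := 0) (f := fun q : ℂ ↦ 1 - q)
  have := (oneAddCube_phiU.tendsto).div h1 one_ne_zero
  rw [div_one] at this
  refine this.congr' ?_
  filter_upwards [eventually_one_sub_pow_ne (n := 1) le_rfl] with q hq
  rw [pow_one] at hq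
  simp [hq]

lemma tendsto_qc_nhds : Tendsto (fun τ : ℍ ↦ qc τ) atImInfty (𝓝 0) :=
  tendsto_qc.mono_right nhdsWithin_le_nhds

lemma tendsto_hauptU_mul : Tendsto (fun τ ↦ hauptU τ * qc τ) atImInfty (𝓝 1) := by
  refine (tendsto_phiU.comp tendsto_qc_nhds).congr fun τ ↦ ?_
  rw [hauptU_eq, div_mul_cancel₀ _ (qc_ne_zero _)]; rfl

lemma tendsto_hauptU_inv : Tendsto (fun τ ↦ (hauptU τ)⁻¹) atImInfty (𝓝 0) := by
  have := tendsto_qc_nhds.div tendsto_hauptU_mul one_ne_zero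
  rw [zero_div] at this
  refine this.congr fun τ ↦ ?_
  have := qc_ne_zero τ
  have := hauptU_ne_zero τ
  simp only [Pi.div_apply]
  field_simp

lemma tendsto_hauptV : Tendsto (fun τ ↦ (1 - hauptV τ) / qc τ) atImInfty (𝓝 5) := by
  have h1 : Tendsto (fun q : ℂ ↦ (phiV q - (1 - 5 * q)) / q) (𝓝[≠] 0) (𝓝 0) := by
    have h2 := phiV_isBigO.mono (nhdsWithin_le_nhds (s := {0}ᶜ))
    have h3 : (fun q : ℂ ↦ (phiV q - (1 - 5 * q)) / q) =O[𝓝[≠] 0] fun q ↦ q ^ 2 / q := by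
      simp only [div_eq_mul_inv]
      exact h2.mul (Asymptotics.isBigO_refl _ _)
    refine h3.trans_tendsto ?_
    have : Tendsto (fun q : ℂ ↦ q) (𝓝[≠] 0) (𝓝 0) := tendsto_id.mono_left nhdsWithin_le_nhds
    refine this.congr' ?_
    filter_upwards [self_mem_nhdsWithin] with q hq
    rw [sq, mul_div_cancel_right₀ _ hq]
  have h2 := (h1.comp tendsto_qc).const_sub 5
  rw [sub_zero] at h2
  refine h2.congr fun τ ↦ ?_
  have := qc_ne_zero τ
  rw [hauptV_eq]
  simp only [Function.comp]
  field_simp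
  ring

lemma tendsto_hauptV_one : Tendsto hauptV atImInfty (𝓝 1) := by
  have := (tendsto_hauptV.mul tendsto_qc_nhds).const_sub 1
  simp only [mul_zero, sub_zero] at this
  refine this.congr fun τ ↦ ?_
  rw [div_mul_cancel₀ _ (qc_ne_zero _)]; ring

lemma isBoundedAtImInfty_of_tendsto {f : ℍ → ℂ} {c : ℂ} (h : Tendsto f atImInfty (𝓝 c)) :
    IsBoundedAtImInfty f := by
  exact h.isBigO_one ℝ

lemma hauptU_hauptV (τ : ℍ) : (1 + hauptU τ) * (1 - hauptV τ) = 5 := by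
  have hU5 : GammaInv fun τ ↦ hauptU (alW 5 • τ) :=
    gammaInv_hauptU.comp_alSet five_mem_ed (alW_mem five_mem_ed)
  have hF : GammaInv fun τ ↦ (1 + hauptU τ) * (1 - hauptV τ) := by
    intro γ hγ τ
    have h : hauptU (alW 5 • γ • τ) = hauptU (alW 5 • τ) := hU5 γ hγ τ
    rw [hauptU_alW_five, hauptU_alW_five, neg_inj] at h
    simp only [gammaInv_hauptU γ hγ τ, h]
  have lim : Tendsto (fun τ ↦ (1 + hauptU τ) * (1 - hauptV τ)) atImInfty (𝓝 5) := by
    have := (tendsto_qc_nhds.add tendsto_hauptU_mul).mul tendsto_hauptV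
    norm_num at this
    refine this.congr fun τ ↦ ?_
    have := qc_ne_zero τ
    field_simp
  have b2 : Tendsto (fun τ ↦ (1 + -4 * (hauptU τ)⁻¹) * (1 + -4 * (hauptV τ)⁻¹ * (-1)))
      atImInfty (𝓝 ((1 + -4 * 0) * (1 + -4 * (1 : ℂ)⁻¹ * (-1)))) :=
    ((tendsto_hauptU_inv.const_mul (-4)).const_add 1).mul
      ((((tendsto_hauptV_one.inv₀ one_ne_zero).const_mul (-4)).mul_const (-1)).const_add 1)
  obtain ⟨c, hc⟩ := eq_const_of_bounded (fun τ ↦ (1 + hauptU τ) * (1 - hauptV τ))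
    (mdiff_mul (mdiff_add (mdiff_const 1) mdiff_hauptU) (mdiff_sub (mdiff_const 1) mdiff_hauptV))
    hF (by
      intro e he
      have hv : ∀ τ, hauptV τ = -hauptU (alW 5 • τ) := fun τ ↦ by rw [hauptU_alW_five, neg_neg]
      have he' := he
      simp only [ed, Finset.mem_insert, Finset.mem_singleton] at he'
      have comm : ∀ τ, hauptV (alW e • τ) = -hauptU (alW (edMul 5 e) • τ) := fun τ ↦ by
        rw [hv, gammaInv_hauptU.alW_alW five_mem_ed he]
      simp only [comm]
      rcases he' with rfl | rfl | rfl | rfl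
      · simp only [show edMul 5 1 = 5 by decide, alW_one, one_smul, hauptU_alW_five]
        simpa using isBoundedAtImInfty_of_tendsto lim
      · simp only [show edMul 5 2 = 10 by decide, hauptU_alW_two, hauptU_alW_ten]
        refine isBoundedAtImInfty_of_tendsto (b2.congr fun τ ↦ ?_)
        ring
      · simp only [show edMul 5 5 = 1 by decide, alW_one, one_smul, hauptU_alW_five]
        refine isBoundedAtImInfty_of_tendsto (lim.congr fun τ ↦ ?_)
        ring
      · simp only [show edMul 5 10 = 2 by decide, hauptU_alW_two, hauptU_alW_ten]
        refine isBoundedAtImInfty_of_tendsto (b2.congr fun τ ↦ ?_)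
        ring)
  simp only [hc] at lim ⊢
  exact tendsto_nhds_unique tendsto_const_nhds lim

/-- The normalized hauptmodul of level ten on the upper half-plane. -/
def hauptG (τ : ℍ) : ℂ := hauptU τ - 1

lemma hauptG_eq_jn (τ : ℍ) : jn 10 τ = hauptG τ := by
  simp [jn, hauptG, hauptU]

lemma mdiff_hauptG : MDiff hauptG := mdiff_sub mdiff_hauptU (mdiff_const 1)

lemma gammaInv_hauptG : GammaInv hauptG := fun γ h τ ↦ by
  simp only [hauptG, gammaInv_hauptU γ h τ]

/-- The value of the hauptmodul at the cusps other than `∞`. -/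
def cuspVal (e : ℤ) : ℂ := if e = 2 then -1 else if e = 5 then -2 else 3

/-- The constants in the Atkin–Lehner transformations of the hauptmodul. -/
def cuspLam (e : ℤ) : ℂ := if e = 2 then -4 else if e = 5 then 5 else 20

/-- The exact divisors of ten other than one. -/
def ed' : Finset ℤ := {2, 5, 10}

lemma ed'_sub {e : ℤ} (h : e ∈ ed') : e ∈ ed := by
  revert h; simp [ed', ed]; omega

lemma cuspLam_ne_zero (e : ℤ) : cuspLam e ≠ 0 := by
  unfold cuspLam; split_ifs <;> norm_num

lemma hauptG_alW {e : ℤ} (he : e ∈ ed') (τ : ℍ) :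
    (hauptG (alW e • τ) - cuspVal e) * (hauptG τ - cuspVal e) = cuspLam e := by
  have h := hauptU_hauptV τ
  have h0 := hauptU_ne_zero τ
  have h1 := hauptV_ne_zero τ
  simp only [ed', Finset.mem_insert, Finset.mem_singleton] at he
  rcases he with rfl | rfl | rfl <;> simp only [hauptG, cuspVal, cuspLam] <;> norm_num
  · rw [hauptU_alW_two]; field_simp
  · rw [hauptU_alW_five]; linear_combination h
  · rw [hauptU_alW_ten]; field_simp; linear_combination 4 * h

lemma hauptG_ne_cuspVal {e : ℤ} (he : e ∈ ed') (τ : ℍ) : hauptG τ ≠ cuspVal e := by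
  intro h
  have := hauptG_alW he τ
  rw [h, sub_self, mul_zero] at this
  exact cuspLam_ne_zero e this.symm

lemma hauptG_alW_eq {e : ℤ} (he : e ∈ ed') (τ : ℍ) :
    hauptG (alW e • τ) = cuspVal e + cuspLam e / (hauptG τ - cuspVal e) := by
  have h := hauptG_alW he τ
  have := sub_ne_zero.mpr (hauptG_ne_cuspVal he τ)
  field_simp
  linear_combination h

/-- The hauptmodul of the Fricke group on the upper half-plane. -/
def hauptJ (τ : ℍ) : ℂ := hauptU τ * hauptV τ + 4 + 16 * (hauptU τ * hauptV τ)⁻¹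

lemma hauptJ_eq_jnStar (τ : ℍ) : jnStar 10 τ = hauptJ τ := by
  obtain ⟨h1, h2, h5, h10⟩ := eta_scaled_ne_zero τ
  simp only [jnStar, hauptJ, hauptU, hauptV]
  norm_num
  generalize dedekindEta τ = a at *
  generalize dedekindEta (2 * τ) = b at *
  generalize dedekindEta (5 * τ) = c at *
  generalize dedekindEta (10 * τ) = d at *
  field_simp

lemma hauptJ_eq (τ : ℍ) : hauptJ τ * ((hauptG τ + 1) * (hauptG τ + 2) * (hauptG τ - 3)) =
    (hauptG τ - 3) ^ 2 * (hauptG τ + 1) ^ 2 + 4 * ((hauptG τ + 1) * (hauptG τ + 2) * (hauptG τ - 3)) +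
      16 * (hauptG τ + 2) ^ 2 := by
  have h := hauptU_hauptV τ
  have h0 := hauptU_ne_zero τ
  have h1 := hauptV_ne_zero τ
  have h2 : 1 + hauptU τ ≠ 0 := fun h' ↦ by rw [h'] at h; simp at h
  have hv : hauptV τ = (hauptU τ - 4) / (hauptU τ + 1) := by
    rw [add_comm] at h2
    field_simp; linear_combination -h
  have h3 : hauptU τ - 4 ≠ 0 := fun h' ↦ by rw [hv, h'] at h1; simp at h1
  simp only [hauptJ, hauptG, hv]
  generalize hauptU τ = u at *
  rw [add_comm] at h2
  field_simp
  ring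

lemma hauptG_add_one_ne (τ : ℍ) : hauptG τ + 1 ≠ 0 := by
  have := sub_ne_zero.mpr (hauptG_ne_cuspVal (e := 2) (by decide) τ)
  simpa [cuspVal] using this

lemma hauptG_add_two_ne (τ : ℍ) : hauptG τ + 2 ≠ 0 := by
  have := sub_ne_zero.mpr (hauptG_ne_cuspVal (e := 5) (by decide) τ)
  simpa [cuspVal] using this

lemma hauptG_sub_three_ne (τ : ℍ) : hauptG τ - 3 ≠ 0 := by
  have := sub_ne_zero.mpr (hauptG_ne_cuspVal (e := 10) (by decide) τ)
  simpa [cuspVal] using this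

lemma hauptG_two (τ : ℍ) : hauptG (alW 2 • τ) = -1 - 4 / (hauptG τ + 1) := by
  rw [hauptG_alW_eq (by decide)]; simp [cuspVal, cuspLam]; ring

lemma hauptG_five (τ : ℍ) : hauptG (alW 5 • τ) = -2 + 5 / (hauptG τ + 2) := by
  rw [hauptG_alW_eq (by decide)]; simp [cuspVal, cuspLam]

lemma hauptG_ten (τ : ℍ) : hauptG (alW 10 • τ) = 3 + 20 / (hauptG τ - 3) := by
  rw [hauptG_alW_eq (by decide)]; simp [cuspVal, cuspLam]

lemma hauptJ_sq (τ : ℍ) : hauptJ τ ^ 2 - 44 = ∑ e ∈ ed, (hauptG (alW e • τ) ^ 2 - 4) := by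
  have h := hauptJ_eq τ
  have h1 := hauptG_add_one_ne τ
  have h2 := hauptG_add_two_ne τ
  have h3 := hauptG_sub_three_ne τ
  simp only [ed]
  rw [Finset.sum_insert (by decide), Finset.sum_insert (by decide), Finset.sum_insert (by decide),
    Finset.sum_singleton, alW_one, one_smul, hauptG_two, hauptG_five, hauptG_ten]
  generalize hauptG τ = g at *
  generalize hauptJ τ = J at *
  rw [← eq_div_iff (by positivity)] at h
  subst h
  field_simp
  ring

lemma phiU_isBigO : (fun q ↦ phiU q - (1 + q + q ^ 2)) =O[𝓝 0] fun q ↦ q ^ 3 := by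
  have h1 : (fun q ↦ (phiU q * (1 - q) - 1 + q ^ 3) * (1 - q)⁻¹) =O[𝓝 0] fun q : ℂ ↦ q ^ 3 * (1 : ℂ) := by
    refine Asymptotics.IsBigO.mul (Asymptotics.IsBigO.add oneAddCube_phiU (Asymptotics.isBigO_refl _ _)) ?_
    have h1 : Tendsto (fun q : ℂ ↦ 1 - q) (𝓝 0) (𝓝 1) := by
      simpa using (continuous_const.sub continuous_id (X := ℂ)).tendsto (x := 0) (f := fun q : ℂ ↦ 1 - q)
    exact (h1.inv₀ one_ne_zero).isBigO_one ℂ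
  simp only [mul_one] at h1
  refine h1.congr' ?_ EventuallyEq.rfl
  filter_upwards [eventually_one_sub_pow_ne (n := 1) le_rfl] with q hq
  rw [pow_one] at hq
  field_simp
  ring

lemma hauptG_isBigO : (fun τ ↦ hauptG τ - (qc τ)⁻¹ - qc τ) =O[atImInfty] fun τ ↦ qc τ ^ 2 := by
  have h1 := phiU_isBigO.comp_tendsto tendsto_qc_nhds
  have h2 := h1.mul (Asymptotics.isBigO_refl (fun τ : ℍ ↦ (qc τ)⁻¹) _)
  refine h2.congr (fun τ ↦ ?_) fun τ ↦ ?_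
  · have := qc_ne_zero τ
    simp only [Function.comp, hauptG, hauptU_eq]
    field_simp
    ring
  · have := qc_ne_zero τ
    simp only [Function.comp]
    field_simp

lemma tendsto_qc_sq : Tendsto (fun τ : ℍ ↦ qc τ ^ 2) atImInfty (𝓝 0) := by
  simpa using tendsto_qc_nhds.pow 2

lemma tendsto_hauptG_sub : Tendsto (fun τ ↦ hauptG τ - (qc τ)⁻¹) atImInfty (𝓝 0) := by
  have := (hauptG_isBigO.trans_tendsto tendsto_qc_sq).add tendsto_qc_nhds
  simpa using this

lemma tendsto_hauptG_mul_add (a : ℂ) : Tendsto (fun τ ↦ (hauptG τ + a) * qc τ) atImInfty (𝓝 1) := by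
  have := ((tendsto_hauptG_sub.add_const a).mul tendsto_qc_nhds).add_const 1
  simp only [mul_zero, zero_add] at this
  refine this.congr fun τ ↦ ?_
  have := qc_ne_zero τ
  field_simp
  ring

lemma tendsto_qc_div_hauptG (a b : ℂ) :
    Tendsto (fun τ ↦ (hauptG τ + a) / (hauptG τ + b)) atImInfty (𝓝 1) := by
  have := (tendsto_hauptG_mul_add a).div (tendsto_hauptG_mul_add b) one_ne_zero
  rw [div_one] at this
  refine this.congr fun τ ↦ ?_
  simp only [Pi.div_apply]
  rw [mul_div_mul_right _ _ (qc_ne_zero _)]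

lemma tendsto_inv_hauptG (b : ℂ) : Tendsto (fun τ ↦ 1 / (hauptG τ + b)) atImInfty (𝓝 0) := by
  have := tendsto_qc_nhds.div (tendsto_hauptG_mul_add b) one_ne_zero
  rw [zero_div] at this
  refine this.congr fun τ ↦ ?_
  simp only [Pi.div_apply]
  rw [← mul_div_mul_right 1 _ (qc_ne_zero τ), one_mul]

lemma tendsto_hauptJ_sub :
    Tendsto (fun τ ↦ (hauptJ τ - hauptG τ) * (hauptG τ + 2)) atImInfty (𝓝 21) := by
  have h := ((tendsto_qc_div_hauptG 2 1).mul (tendsto_qc_div_hauptG 2 (-3))).const_mul 16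
    |>.const_add 5
  norm_num at h
  refine h.congr fun τ ↦ ?_
  have h := hauptJ_eq τ
  have h1 := hauptG_add_one_ne τ
  have h2 := hauptG_add_two_ne τ
  have h3 := hauptG_sub_three_ne τ
  rw [← sub_eq_add_neg]
  generalize hauptG τ = g at *
  generalize hauptJ τ = J at *
  rw [← eq_div_iff (by positivity)] at h
  subst h
  field_simp
  ring

lemma tendsto_hauptG_sub_div : Tendsto (fun τ ↦ (hauptG τ - (qc τ)⁻¹) / qc τ) atImInfty (𝓝 1) := by
  have := (hauptG_isBigO.mul (Asymptotics.isBigO_refl (fun τ : ℍ ↦ (qc τ)⁻¹) _)).trans_tendsto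
    (tendsto_qc_nhds.congr fun τ ↦ ?_)
  · have := this.add_const 1
    rw [zero_add] at this
    refine this.congr fun τ ↦ ?_
    have := qc_ne_zero τ
    field_simp
    ring
  · have := qc_ne_zero τ
    field_simp

lemma tendsto_hauptJ_sq :
    Tendsto (fun τ ↦ hauptJ τ ^ 2 - 44 - (qc τ)⁻¹ ^ 2) atImInfty (𝓝 0) := by
  have h1 : Tendsto (fun τ ↦ hauptG τ ^ 2 - (qc τ)⁻¹ ^ 2) atImInfty (𝓝 2) := by
    have := tendsto_hauptG_sub_div.mul ((tendsto_hauptG_mul_add 0).add_const 1)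
    norm_num at this
    refine this.congr fun τ ↦ ?_
    have := qc_ne_zero τ
    field_simp
    ring
  have h3 := ((tendsto_hauptJ_sub.mul (tendsto_inv_hauptG 2)).mul tendsto_hauptJ_sub).mul
    (tendsto_inv_hauptG 2)
  have h2 := (h1.add ((tendsto_hauptJ_sub.mul (tendsto_qc_div_hauptG 0 2)).const_mul 2)).add h3
  have h4 := h2.add_const (-44)
  norm_num at h4
  refine h4.congr fun τ ↦ ?_
  have h2 := hauptG_add_two_ne τ
  have := qc_ne_zero τ
  generalize hauptG τ = g at *
  generalize hauptJ τ = J at *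
  field_simp
  ring

lemma tendsto_norm_hauptG : Tendsto (fun τ ↦ ‖hauptG τ‖) atImInfty atTop := by
  have h := tendsto_inv_hauptG 0
  simp only [add_zero, one_div] at h
  have h2 : Tendsto (fun τ ↦ (hauptG τ)⁻¹) atImInfty (𝓝[≠] 0) := by
    refine tendsto_nhdsWithin_iff.mpr ⟨h, ?_⟩
    have := tendsto_hauptG_mul_add 0
    filter_upwards [this.eventually_ne one_ne_zero] with τ hτ
    simp only [add_zero] at hτ
    exact inv_ne_zero (left_ne_zero_of_mul hτ)
  have := (tendsto_inv₀_nhdsNE_zero (α := ℂ)).comp h2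
  simpa [Function.comp_def] using tendsto_norm_cobounded_atTop.comp this

lemma tendsto_hauptJ_sub_hauptG : Tendsto (fun τ ↦ hauptJ τ - hauptG τ) atImInfty (𝓝 0) := by
  have := tendsto_hauptJ_sub.mul (tendsto_inv_hauptG 2)
  rw [mul_zero] at this
  refine this.congr fun τ ↦ ?_
  have h2 := hauptG_add_two_ne τ
  field_simp

lemma tendsto_norm_hauptJ : Tendsto (fun τ ↦ ‖hauptJ τ‖) atImInfty atTop := by
  have h1 := tendsto_hauptJ_sub_hauptG.norm
  rw [norm_zero] at h1
  have h2 := tendsto_norm_hauptG.atTop_add (h1.const_mul (-1))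
  refine tendsto_atTop_mono (fun τ ↦ ?_) h2
  have := norm_sub_norm_le (hauptG τ) (hauptJ τ)
  rw [norm_sub_rev] at this
  linarith

/-- Terms of positive exponent of a `q`-expansion vanish at infinity. -/
lemma tendsto_of_hasSum {a : ℕ → ℂ} {f : ℍ → ℂ}
    (h : ∀ τ : ℍ, HasSum (fun m ↦ a m * qc τ ^ m) (f τ)) : Tendsto f atImInfty (𝓝 (a 0)) := by
  have hs : ∀ τ : ℍ, f τ = a 0 + qc τ * ∑' m, a (m + 1) * qc τ ^ m := fun τ ↦ by
    have h1 := (h τ).summable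
    rw [← (h τ).tsum_eq, h1.tsum_eq_zero_add, ← tsum_mul_left]
    simp only [pow_zero, mul_one, add_right_inj]
    exact tsum_congr fun m ↦ by ring
  obtain ⟨τ₀⟩ : Nonempty ℍ := inferInstance
  have hsum : Summable fun m ↦ ‖a (m + 1)‖ * ‖qc τ₀‖ ^ m := by
    have h1 := ((h τ₀).summable.norm.comp_injective (add_left_injective 1)).mul_left (‖qc τ₀‖⁻¹)
    refine h1.congr fun m ↦ ?_
    have := norm_ne_zero_iff.mpr (qc_ne_zero τ₀)
    simp only [Function.comp, norm_mul, norm_pow, pow_succ]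
    field_simp
  have hb : ∀ᶠ τ : ℍ in atImInfty, ‖∑' m, a (m + 1) * qc τ ^ m‖ ≤ ∑' m, ‖a (m + 1)‖ * ‖qc τ₀‖ ^ m := by
    have h0 : Tendsto (fun τ : ℍ ↦ ‖qc τ‖) atImInfty (𝓝 0) := by
      simpa using tendsto_qc_nhds.norm
    filter_upwards [h0.eventually_lt_const (norm_pos_iff.mpr (qc_ne_zero τ₀))] with τ hτ
    refine tsum_of_norm_bounded hsum.hasSum fun m ↦ ?_
    rw [norm_mul, norm_pow]
    gcongr
  have h2 : Tendsto (fun τ : ℍ ↦ qc τ * ∑' m, a (m + 1) * qc τ ^ m) atImInfty (𝓝 0) := by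
    refine tendsto_qc_nhds.zero_mul_isBoundedUnder_le ?_
    exact ⟨_, eventually_map.mpr hb⟩
  have h3 := h2.const_add (a 0)
  rw [add_zero] at h3
  exact h3.congr fun τ ↦ (hs τ).symm

/-- The polynomial giving the Faber polynomial of degree two is `X ^ 2 - 44`. -/
lemma faber_poly_eq {P : Polynomial ℂ} {e : ℤ → ℂ}
    (hP : HasQExp (fun z => Polynomial.eval (jnStar 10 z) P) e (-2))
    (he2 : e (-2) = 1) (he1 : e (-1) = 0) (he0 : e 0 = 0) :
    P = Polynomial.X ^ 2 - Polynomial.C 44 := by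
  have h1 : Tendsto (fun τ : ℍ ↦ P.eval (hauptJ τ) - (qc τ)⁻¹ ^ 2) atImInfty (𝓝 0) := by
    have := tendsto_of_hasSum (a := fun m ↦ e m) (f := fun τ ↦ P.eval (hauptJ τ) - (qc τ)⁻¹ ^ 2)
      (fun τ ↦ ?_)
    · simpa [he0] using this
    · have h := hP.2 τ τ.im_pos
      rw [← hasSum_nat_add_iff' 2] at h
      simp only [Finset.sum_range_succ, Finset.sum_range_zero, hauptJ_eq_jnStar] at h
      norm_num [he2, he1] at h
      rw [inv_pow]
      exact h
  have h2 : Tendsto (fun τ ↦ (P - (Polynomial.X ^ 2 - Polynomial.C 44)).eval (hauptJ τ)) atImInfty (𝓝 0) := by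
    have := h1.sub tendsto_hauptJ_sq
    rw [sub_zero] at this
    refine this.congr fun τ ↦ ?_
    simp
  by_contra hne
  set R := P - (Polynomial.X ^ 2 - Polynomial.C 44) with hR
  have hR0 : R ≠ 0 := sub_ne_zero.mpr hne
  by_cases hd : 0 < R.degree
  · have h3 := Polynomial.tendsto_norm_atTop R hd tendsto_norm_hauptJ
    exact not_tendsto_nhds_of_tendsto_atTop h3 _ h2.norm
  · have := Polynomial.eq_C_of_degree_le_zero (not_lt.mp hd)
    rw [this] at h2
    simp only [Polynomial.eval_C] at h2
    have h4 := tendsto_nhds_unique tendsto_const_nhds h2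
    rw [h4, map_zero] at this
    exact hR0 this

lemma exists_qc_eq {q : ℂ} (h0 : q ≠ 0) (h1 : ‖q‖ < 1) : ∃ τ : ℍ, qc τ = q := by
  have h := Function.Periodic.im_invQParam_pos_of_norm_lt_one one_pos h1 h0
  exact ⟨⟨_, h⟩, by rw [qc_eq_qParam]; exact Function.Periodic.qParam_right_inv one_ne_zero h0⟩

lemma hasSum_coeff {c : ℤ → ℂ} (hc : HasQExp (jn 10) c (-1)) (τ : ℍ) :
    HasSum (fun m : ℕ ↦ c (m - 1) * qc τ ^ m) (hauptG τ * qc τ) := by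
  have h := (hc.2 τ τ.im_pos).mul_right (qc τ)
  rw [hauptG_eq_jn] at h
  refine h.congr_fun fun m ↦ ?_
  rw [mul_assoc, ← zpow_add_one₀ (qc_ne_zero _), neg_add_eq_sub, sub_add_cancel, zpow_natCast]

lemma coeff_neg_one {c : ℤ → ℂ} (hc : HasQExp (jn 10) c (-1)) : c (-1) = 1 := by
  have h1 := tendsto_of_hasSum (hasSum_coeff hc)
  have h2 := tendsto_hauptG_mul_add 0
  simp only [add_zero] at h2
  simpa using tendsto_nhds_unique h1 h2

lemma hasSum_coeff' {c : ℤ → ℂ} (hc : HasQExp (jn 10) c (-1)) (τ : ℍ) :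
    HasSum (fun m : ℕ ↦ c m * qc τ ^ m) (hauptG τ - (qc τ)⁻¹) := by
  have h := ((hasSum_nat_add_iff' 1).mpr (hasSum_coeff hc τ)).mul_left (qc τ)⁻¹
  have hq := qc_ne_zero τ
  simp only [Finset.sum_range_one, Nat.cast_zero, zero_sub, coeff_neg_one hc] at h
  have e1 : (qc τ)⁻¹ * (hauptG τ * qc τ - 1 * qc τ ^ 0) = hauptG τ - (qc τ)⁻¹ := by field_simp
  rw [e1] at h
  refine h.congr_fun fun m ↦ ?_
  push_cast
  rw [add_sub_cancel_right]
  field_simp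
  ring

lemma coeff_zero {c : ℤ → ℂ} (hc : HasQExp (jn 10) c (-1)) : c 0 = 0 := by
  have h1 := tendsto_of_hasSum (hasSum_coeff' hc)
  simpa using tendsto_nhds_unique h1 tendsto_hauptG_sub

lemma glT_mem (k : ℤ) : glT k ∈ heckeSet 1 := ⟨1, k, 0, 1, by simp [glT, gl_coe], by norm_num⟩

lemma exists_sub_isBigO_qc {H : ℍ → ℂ} (hol : MDiff H) (per : ∀ τ, H (glT 1 • τ) = H τ)
    (bdd : IsBoundedAtImInfty H) : ∃ a, (fun τ ↦ H τ - a) =O[atImInfty] fun τ : ℍ ↦ qc τ := by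
  have hper : Function.Periodic (H ∘ ofComplex) ((1 : ℝ) : ℂ) := by
    intro z
    by_cases hz : 0 < z.im
    · have hz' : 0 < (z + ((1 : ℝ) : ℂ)).im := by simpa using hz
      simp only [Function.comp, ofComplex_apply_of_im_pos hz, ofComplex_apply_of_im_pos hz']
      rw [← per ⟨z, hz⟩]
      congr 1
      apply UpperHalfPlane.ext
      rw [glT_smul]
      simp
    · have hz' : (z + ((1 : ℝ) : ℂ)).im ≤ 0 := by simpa using hz
      simp only [Function.comp, ofComplex_apply_of_im_nonpos (not_lt.mp hz),
        ofComplex_apply_of_im_nonpos hz']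
  have hhol : ∀ᶠ z in comap Complex.im atTop, DifferentiableAt ℂ (H ∘ ofComplex) z := by
    filter_upwards [preimage_mem_comap (Ioi_mem_atTop 0)] with z hz
    exact (UpperHalfPlane.mdifferentiable_iff.mp hol).differentiableAt
      (isOpen_upperHalfPlaneSet.mem_nhds hz)
  have h := Function.Periodic.exp_decay_sub_of_bounded_at_inf one_pos hper hhol
    (Asymptotics.IsBigO.comp_tendsto bdd tendsto_comap_im_ofComplex)
  have h2 : (fun τ ↦ H τ - Function.Periodic.cuspFunction 1 (H ∘ ofComplex) 0) =O[atImInfty]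
      ((fun z : ℂ ↦ Real.exp (-2 * Real.pi * z.im / 1)) ∘ UpperHalfPlane.coe) :=
    (h.comp_tendsto tendsto_coe_atImInfty).congr_left fun τ ↦ by simp
  refine ⟨_, h2.trans ?_⟩
  · refine Asymptotics.IsBigO.of_bound 1 (Eventually.of_forall fun τ ↦ ?_)
    simp only [Function.comp, norm_qc, Real.norm_eq_abs, Real.abs_exp, one_mul]
    apply le_of_eq
    congr 1
    ring

lemma tendsto_hauptG_alW {e : ℤ} (he : e ∈ ed') :
    Tendsto (fun τ ↦ hauptG (alW e • τ)) atImInfty (𝓝 (cuspVal e)) := by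
  have := ((tendsto_inv_hauptG (-cuspVal e)).const_mul (cuspLam e)).const_add (cuspVal e)
  rw [mul_zero, add_zero] at this
  refine this.congr fun τ ↦ ?_
  rw [hauptG_alW_eq he, mul_one_div, sub_eq_add_neg]

lemma hauptG_isBigO_inv : hauptG =O[atImInfty] fun τ : ℍ ↦ (qc τ)⁻¹ := by
  have h1 : (fun τ ↦ hauptG τ * qc τ) =O[atImInfty] fun _ ↦ (1 : ℂ) := by
    simpa using (tendsto_hauptG_mul_add 0).isBigO_one ℂ
  refine (h1.mul (Asymptotics.isBigO_refl (fun τ : ℍ ↦ (qc τ)⁻¹) _)).congr (fun τ ↦ ?_) fun τ ↦ ?_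
  · rw [mul_assoc, mul_inv_cancel₀ (qc_ne_zero _), mul_one]
  · rw [one_mul]

lemma mdiff_qc : MDiff fun τ : ℍ ↦ qc τ := by
  rw [UpperHalfPlane.mdifferentiable_iff]
  have h : Differentiable ℂ qc := by unfold qc; fun_prop
  refine h.differentiableOn.congr fun z hz ↦ ?_
  simp [ofComplex_apply_of_im_pos hz]

/-- A modular function of level ten holomorphic away from `∞` is a polynomial in the
hauptmodul. -/
lemma exists_poly_of_bounded (B : ℕ) : ∀ {f : ℍ → ℂ}, MDiff f → GammaInv f →
    (∀ e ∈ ed', IsBoundedAtImInfty fun τ ↦ f (alW e • τ)) →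
    f =O[atImInfty] (fun τ : ℍ ↦ (qc τ)⁻¹ ^ B) → ∃ Q : Polynomial ℂ, ∀ τ, f τ = Q.eval (hauptG τ) := by
  induction B with
  | zero =>
    intro f hf inv bdd hinf
    obtain ⟨c, hc⟩ := eq_const_of_bounded f hf inv (fun e he ↦ by
      by_cases h1 : e = 1
      · subst h1
        simp only [alW_one, one_smul]
        exact hinf.trans (Asymptotics.IsBigO.of_bound 1 (by simp))
      · refine bdd e ?_
        revert he; simp [ed, ed', h1])
    exact ⟨Polynomial.C c, by simpa using hc⟩
  | succ B ih =>
    intro f hf inv bdd hinf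
    have hq : ∀ τ : ℍ, qc τ ≠ 0 := fun τ ↦ qc_ne_zero τ
    obtain ⟨a, ha⟩ := exists_sub_isBigO_qc (H := fun τ ↦ f τ * qc τ ^ (B + 1))
      (mdiff_mul hf (mdiff_pow mdiff_qc _))
      (fun τ ↦ by rw [inv _ (glT_mem 1), qc_glT])
      (by
        have := hinf.mul (Asymptotics.isBigO_refl (fun τ : ℍ ↦ qc τ ^ (B + 1)) _)
        refine (this.trans (Asymptotics.IsBigO.of_bound 1 (Eventually.of_forall fun τ ↦ ?_)))
        rw [← mul_pow, inv_mul_cancel₀ (hq τ)]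
        simp)
    have hb : (fun τ ↦ (hauptG τ * qc τ) ^ (B + 1) - 1) =O[atImInfty] fun τ : ℍ ↦ qc τ := by
      have h1 : (fun τ ↦ hauptG τ * qc τ - 1) =O[atImInfty] fun τ : ℍ ↦ qc τ := by
        have := (tendsto_hauptG_sub.isBigO_one ℂ).mul
          (Asymptotics.isBigO_refl (fun τ : ℍ ↦ qc τ) _)
        refine this.congr (fun τ ↦ ?_) fun τ ↦ by rw [one_mul]
        rw [sub_mul, inv_mul_cancel₀ (hq τ)]
      have h2 : (fun τ ↦ ∑ i ∈ Finset.range (B + 1), (hauptG τ * qc τ) ^ i) =O[atImInfty]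
          fun _ ↦ (1 : ℂ) := by
        have h3 := tendsto_hauptG_mul_add 0
        simp only [add_zero] at h3
        exact (tendsto_finsetSum _ fun i _ ↦ h3.pow i).isBigO_one ℂ
      refine (h2.mul h1).congr (fun τ ↦ ?_) fun τ ↦ by rw [one_mul]
      rw [geom_sum_mul]
    have hd : (fun τ ↦ f τ - a * hauptG τ ^ (B + 1)) =O[atImInfty] fun τ : ℍ ↦ (qc τ)⁻¹ ^ B := by
      have := (ha.sub (hb.const_mul_left a)).mul
        (Asymptotics.isBigO_refl (fun τ : ℍ ↦ (qc τ)⁻¹ ^ (B + 1)) _)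
      refine this.congr (fun τ ↦ ?_) fun τ ↦ ?_
      · have h1 : qc τ ^ (B + 1) * (qc τ)⁻¹ ^ (B + 1) = 1 := by
          rw [← mul_pow, mul_inv_cancel₀ (hq τ), one_pow]
        rw [mul_pow]
        linear_combination (f τ - a * hauptG τ ^ (B + 1)) * h1
      · rw [pow_succ, mul_comm, mul_assoc, inv_mul_cancel₀ (hq τ), mul_one]
    obtain ⟨Q, hQ⟩ := ih (f := fun τ ↦ f τ - a * hauptG τ ^ (B + 1))
      (mdiff_sub hf (mdiff_mul (mdiff_const a) (mdiff_pow mdiff_hauptG _)))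
      (fun γ hγ τ ↦ by simp only [inv γ hγ τ, gammaInv_hauptG γ hγ τ])
      (fun e he ↦ by
        have h1 : (fun τ ↦ a * hauptG (alW e • τ) ^ (B + 1)) =O[atImInfty] (1 : ℍ → ℝ) :=
          (((tendsto_hauptG_alW he).pow (B + 1)).const_mul a).isBigO_one ℝ
        exact Asymptotics.IsBigO.sub (bdd e he) h1) hd
    refine ⟨Q + Polynomial.C a * Polynomial.X ^ (B + 1), fun τ ↦ ?_⟩
    have := hQ τ
    simp only [Polynomial.eval_add, Polynomial.eval_mul, Polynomial.eval_C, Polynomial.eval_pow,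
      Polynomial.eval_X, ← this]
    ring

/-- The polynomial vanishing at the values of the hauptmodul at the cusps. -/
def cuspPoly : Polynomial ℂ :=
  (Polynomial.X + Polynomial.C 1) * (Polynomial.X + Polynomial.C 2) * (Polynomial.X - Polynomial.C 3)

lemma eval_cuspPoly (x : ℂ) : cuspPoly.eval x = (x + 1) * (x + 2) * (x - 3) := by
  simp [cuspPoly]

lemma eval_cuspPoly_hauptG_ne (τ : ℍ) : cuspPoly.eval (hauptG τ) ≠ 0 := by
  rw [eval_cuspPoly]
  exact mul_ne_zero (mul_ne_zero (hauptG_add_one_ne τ) (hauptG_add_two_ne τ)) (hauptG_sub_three_ne τ)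

lemma eval_cuspPoly_cuspVal {e : ℤ} (he : e ∈ ed') : cuspPoly.eval (cuspVal e) = 0 := by
  simp only [ed', Finset.mem_insert, Finset.mem_singleton] at he
  rcases he with rfl | rfl | rfl <;> rw [eval_cuspPoly] <;> norm_num [cuspVal]

lemma mdiff_eval_hauptG (Q : Polynomial ℂ) : MDiff fun τ ↦ Q.eval (hauptG τ) := by
  induction Q using Polynomial.induction_on' with
  | add p q hp hq => simpa using mdiff_add hp hq
  | monomial n a =>
    simpa using mdiff_mul (mdiff_const a) (mdiff_pow mdiff_hauptG n)

lemma hauptG_alW_sub_isBigO {e : ℤ} (he : e ∈ ed') :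
    (fun τ ↦ hauptG (alW e • τ) - cuspVal e) =O[atImInfty] fun τ : ℍ ↦ qc τ := by
  have h1 : (fun τ ↦ cuspLam e * ((hauptG τ + -cuspVal e) * qc τ)⁻¹) =O[atImInfty]
      fun _ ↦ (1 : ℂ) :=
    (((tendsto_hauptG_mul_add (-cuspVal e)).inv₀ one_ne_zero).const_mul _).isBigO_one ℂ
  refine (h1.mul (Asymptotics.isBigO_refl (fun τ : ℍ ↦ qc τ) _)).congr (fun τ ↦ ?_)
    fun τ ↦ one_mul _
  rw [hauptG_alW_eq he, ← sub_eq_add_neg]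
  have := sub_ne_zero.mpr (hauptG_ne_cuspVal he τ)
  have := qc_ne_zero τ
  field_simp
  ring

lemma cuspPoly_alW_isBigO {e : ℤ} (he : e ∈ ed') :
    (fun τ ↦ cuspPoly.eval (hauptG (alW e • τ))) =O[atImInfty] fun τ : ℍ ↦ qc τ := by
  obtain ⟨R, hR⟩ := Polynomial.dvd_iff_isRoot.mpr (eval_cuspPoly_cuspVal he)
  have h1 : (fun τ ↦ R.eval (hauptG (alW e • τ))) =O[atImInfty] fun _ ↦ (1 : ℂ) :=
    ((R.continuous.tendsto _).comp (tendsto_hauptG_alW he)).isBigO_one ℂ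
  refine ((hauptG_alW_sub_isBigO he).mul h1).congr (fun τ ↦ ?_) fun τ ↦ mul_one _
  rw [hR]; simp

lemma qc_inv_pow_isBigO {m n : ℕ} (h : m ≤ n) :
    (fun τ : ℍ ↦ (qc τ)⁻¹ ^ m) =O[atImInfty] fun τ : ℍ ↦ (qc τ)⁻¹ ^ n := by
  refine Asymptotics.IsBigO.of_bound 1 (Eventually.of_forall fun τ ↦ ?_)
  rw [norm_pow, norm_pow, one_mul, norm_inv]
  exact pow_le_pow_right₀ ((one_le_inv₀ (norm_pos_iff.mpr (qc_ne_zero _))).mpr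
    (norm_qc_lt_one τ.im_pos).le) h

lemma eval_hauptG_isBigO (Q : Polynomial ℂ) : ∃ B : ℕ,
    (fun τ ↦ Q.eval (hauptG τ)) =O[atImInfty] fun τ : ℍ ↦ (qc τ)⁻¹ ^ B := by
  refine ⟨Q.natDegree, ?_⟩
  simp only [Polynomial.eval_eq_sum_range]
  refine Asymptotics.IsBigO.fun_sum fun i hi ↦ ?_
  refine ((hauptG_isBigO_inv.pow i).const_mul_left _).trans (qc_inv_pow_isBigO ?_)
  simpa [Nat.lt_succ_iff] using hi

/-- `f` is meromorphic at all the cusps. -/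
def ModerateAtCusps (f : ℍ → ℂ) : Prop := ∀ e ∈ ed, ∃ B : ℕ,
  (fun τ ↦ f (alW e • τ)) =O[atImInfty] fun τ : ℍ ↦ (qc τ)⁻¹ ^ B

/-- A weakly holomorphic modular function of level ten is a rational function of the
hauptmodul with poles at the cusps. -/
theorem exists_poly_of_moderate {f : ℍ → ℂ} (hf : MDiff f) (inv : GammaInv f)
    (hm : ModerateAtCusps f) : ∃ (K : ℕ) (Q : Polynomial ℂ), ∀ τ,
      f τ * cuspPoly.eval (hauptG τ) ^ K = Q.eval (hauptG τ) := by
  choose! B hB using hm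
  let K := B 2 + B 5 + B 10
  obtain ⟨B', hB'⟩ := eval_hauptG_isBigO (cuspPoly ^ K)
  have h1 := hB 1 (by decide)
  simp only [alW_one, one_smul] at h1
  obtain ⟨Q, hQ⟩ := exists_poly_of_bounded (B 1 + B') (f := fun τ ↦ f τ * cuspPoly.eval (hauptG τ) ^ K)
    (mdiff_mul hf (mdiff_pow (mdiff_eval_hauptG _) _))
    (fun γ hγ τ ↦ by simp only [inv γ hγ τ, gammaInv_hauptG γ hγ τ])
    (fun e he ↦ by
      have hBK : B e ≤ K := by
        simp only [ed', Finset.mem_insert, Finset.mem_singleton] at he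
        rcases he with rfl | rfl | rfl <;> simp only [K] <;> omega
      have := ((hB e (ed'_sub he)).trans (qc_inv_pow_isBigO hBK)).mul ((cuspPoly_alW_isBigO he).pow K)
      refine (this.congr_right (g₂ := fun _ ↦ (1 : ℂ)) fun τ ↦ ?_).trans ?_
      · rw [← mul_pow, inv_mul_cancel₀ (qc_ne_zero _), one_pow]
      · exact Asymptotics.isBigO_const_const _ one_ne_zero _)
    (by
      simp only [Polynomial.eval_pow] at hB'
      refine (h1.mul hB').congr_right fun τ ↦ ?_
      rw [pow_add])
  exact ⟨K, Q, hQ⟩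

/-- Every value other than the values at the cusps is taken by the hauptmodul. -/
theorem exists_hauptG_eq {X : ℂ} (hX : ∀ e ∈ ed', X ≠ cuspVal e) : ∃ τ, hauptG τ = X := by
  by_contra! hne
  obtain ⟨c, hc⟩ := eq_const_of_bounded (fun τ ↦ 1 / (hauptG τ - X))
    (mdiff_div (mdiff_const 1) (mdiff_sub mdiff_hauptG (mdiff_const X)) fun τ ↦ sub_ne_zero.mpr (hne τ))
    (fun γ hγ τ ↦ by simp only [gammaInv_hauptG γ hγ τ])
    (fun e he ↦ by
      by_cases h1 : e = 1
      · subst h1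
        simp only [alW_one, one_smul]
        simpa [sub_eq_add_neg] using isBoundedAtImInfty_of_tendsto (tendsto_inv_hauptG (-X))
      · have he' : e ∈ ed' := by revert he; simp [ed, ed', h1]
        have := ((tendsto_hauptG_alW he').sub_const X).inv₀ (sub_ne_zero.mpr (hX e he').symm)
        simpa using isBoundedAtImInfty_of_tendsto this)
  have h0 : c = 0 := by
    have := tendsto_inv_hauptG (-X)
    simp only [← sub_eq_add_neg, hc] at this
    exact tendsto_nhds_unique tendsto_const_nhds this
  obtain ⟨τ⟩ : Nonempty ℍ := inferInstance
  have := hc τ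
  rw [h0] at this
  simp [sub_ne_zero.mpr (hne τ)] at this

open scoped PeriodPair in
lemma weierstrassPExcept_eventuallyEq {L₁ L₂ : PeriodPair} (h2 : L₁.g₂ = L₂.g₂)
    (h3 : L₁.g₃ = L₂.g₃) : L₁.weierstrassPExcept 0 =ᶠ[𝓝 0] L₂.weierstrassPExcept 0 := by
  have ha : ∀ L : PeriodPair, AnalyticAt ℂ (L.weierstrassPExcept 0) 0 := fun L ↦
    L.analyticAt_weierstrassPExcept 0
  have hd : ∀ L : PeriodPair, AnalyticAt ℂ (L.derivWeierstrassPExcept 0) 0 := fun L ↦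
    L.analyticAt_derivWeierstrassPExcept 0
  have hder : ∀ L : PeriodPair, ∀ᶠ z in 𝓝 (0 : ℂ), z ∈ (L.lattice \ {(0 : ℂ)} : Set ℂ)ᶜ ∧
      HasDerivAt (L.weierstrassPExcept 0) (L.derivWeierstrassPExcept 0 z) z := fun L ↦ by
    filter_upwards [(ha L).eventually_analyticAt, L.compl_lattice_sdiff_singleton_mem_nhds 0]
      with z hz hz'
    rw [← L.eqOn_deriv_weierstrassPExcept_derivWeierstrassPExcept 0 hz']
    exact ⟨hz', hz.differentiableAt.hasDerivAt⟩
  by_contra hne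
  have hD : AnalyticAt ℂ (fun z ↦ L₁.weierstrassPExcept 0 z - L₂.weierstrassPExcept 0 z) 0 :=
    (ha L₁).sub (ha L₂)
  obtain ⟨m, u, hu, hu0, hDu⟩ := hD.exists_eventuallyEq_pow_smul_nonzero_iff.mpr fun h ↦ hne (by
    filter_upwards [h] with z hz using sub_eq_zero.mp hz)
  simp only [sub_zero, smul_eq_mul] at hDu
  have key : ∀ᶠ z in 𝓝[≠] (0 : ℂ), (m * u z + z * deriv u z) *
      (z ^ 3 * (L₁.derivWeierstrassPExcept 0 z + L₂.derivWeierstrassPExcept 0 z) - 4) =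
      u z * (4 * ((z ^ 2 * L₁.weierstrassPExcept 0 z + 1) ^ 2 +
        (z ^ 2 * L₁.weierstrassPExcept 0 z + 1) * (z ^ 2 * L₂.weierstrassPExcept 0 z + 1) +
        (z ^ 2 * L₂.weierstrassPExcept 0 z + 1) ^ 2) - L₂.g₂ * z ^ 4) := by
    have hDu' := hDu.eventually_nhds
    filter_upwards [nhdsWithin_le_nhds hDu', nhdsWithin_le_nhds (hder L₁),
      nhdsWithin_le_nhds (hder L₂), nhdsWithin_le_nhds hu.eventually_analyticAt,
      self_mem_nhdsWithin] with z hz h1 h2' huz (hz0 : z ≠ 0)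
    have hl1 : z ∉ L₁.lattice := fun h ↦ h1.1 ⟨h, hz0⟩
    have hl2 : z ∉ L₂.lattice := fun h ↦ h2'.1 ⟨h, hz0⟩
    have e1 := L₁.derivWeierstrassP_sq z hl1
    have e2 := L₂.derivWeierstrassP_sq z hl2
    have p1 := L₁.weierstrassPExcept_add 0 z
    have p2 := L₂.weierstrassPExcept_add 0 z
    have d1 := L₁.derivWeierstrassPExcept_sub 0 z
    have d2 := L₂.derivWeierstrassPExcept_sub 0 z
    simp only [ZeroMemClass.coe_zero, sub_zero] at p1 p2 d1 d2
    rw [← p1, ← d1, h2, h3] at e1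
    rw [← p2, ← d2] at e2
    have hder1 := ((h1.2.sub h2'.2).congr_of_eventuallyEq (f₁ := fun w ↦ w ^ m * u w)
      (by filter_upwards [hz] with w hw using hw.symm)).unique
      ((hasDerivAt_pow m z).mul huz.differentiableAt.hasDerivAt)
    have hval := hz.self_of_nhds
    have hm : (m : ℂ) * z ^ (m - 1) * z = m * z ^ m := by
      cases m with
      | zero => simp
      | succ k => simp only [Nat.add_sub_cancel]; ring
    generalize L₁.weierstrassPExcept 0 z = f at *
    generalize L₂.weierstrassPExcept 0 z = g at *
    generalize L₁.derivWeierstrassPExcept 0 z = f' at *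
    generalize L₂.derivWeierstrassPExcept 0 z = g' at *
    generalize deriv u z = u' at *
    generalize u z = v at *
    have hk : (f' - g') * z = z ^ m * (m * v + z * u') := by
      rw [hder1]; linear_combination v * hm
    apply mul_left_cancel₀ (pow_ne_zero m hz0)
    rw [← mul_assoc, ← hk, ← mul_assoc, ← hval]
    have e3 := congrArg (· * z ^ 6) e1
    have e4 := congrArg (· * z ^ 6) e2
    simp only [ne_eq, OfNat.ofNat_ne_zero, not_false_eq_true, zero_pow, div_zero, sub_zero] at e3 e4
    have i3 : z ^ 3 * (2 / z ^ 3) = 2 := by field_simp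
    have i2 : z ^ 2 * (1 / z ^ 2) = 1 := by field_simp
    have q1 : (z ^ 3 * f' - 2) ^ 2 = 4 * (z ^ 2 * f + 1) ^ 3 - L₂.g₂ * (z ^ 2 * f + 1) * z ^ 4
        - L₂.g₃ * z ^ 6 := by
      rw [← i3, ← i2]; linear_combination e3
    have q2 : (z ^ 3 * g' - 2) ^ 2 = 4 * (z ^ 2 * g + 1) ^ 3 - L₂.g₂ * (z ^ 2 * g + 1) * z ^ 4
        - L₂.g₃ * z ^ 6 := by
      rw [← i3, ← i2]; linear_combination e4
    apply mul_left_cancel₀ (pow_ne_zero 2 hz0)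
    linear_combination q1 - q2
  have hca := (ha L₁).continuousAt
  have hcb := (ha L₂).continuousAt
  have hcc := (hd L₁).continuousAt
  have hcd := (hd L₂).continuousAt
  have hcu := hu.continuousAt
  have hcu' := hu.deriv.continuousAt
  have hl : ContinuousAt (fun z ↦ (m * u z + z * deriv u z) *
      (z ^ 3 * (L₁.derivWeierstrassPExcept 0 z + L₂.derivWeierstrassPExcept 0 z) - 4)) 0 := by
    fun_prop
  have hr : ContinuousAt (fun z ↦ u z * (4 * ((z ^ 2 * L₁.weierstrassPExcept 0 z + 1) ^ 2 +
        (z ^ 2 * L₁.weierstrassPExcept 0 z + 1) * (z ^ 2 * L₂.weierstrassPExcept 0 z + 1) +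
        (z ^ 2 * L₂.weierstrassPExcept 0 z + 1) ^ 2) - L₂.g₂ * z ^ 4)) 0 := by
    fun_prop
  have := tendsto_nhds_unique_of_eventuallyEq (hl.tendsto.mono_left nhdsWithin_le_nhds)
    (hr.tendsto.mono_left nhdsWithin_le_nhds) key
  simp only [zero_mul, add_zero, ne_eq, OfNat.ofNat_ne_zero, not_false_eq_true, zero_pow,
    zero_add, mul_zero, sub_zero, zero_sub, one_pow] at this
  have h4 : (m : ℂ) * 4 + 12 = 0 := mul_left_cancel₀ hu0 (by linear_combination -this)
  have h5 : ((m * 4 + 12 : ℕ) : ℂ) = 0 := by exact_mod_cast h4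
  exact absurd h5 (by norm_cast)

lemma lattice_le_of_eisenstein {L₁ L₂ : PeriodPair} (h2 : L₁.g₂ = L₂.g₂)
    (h3 : L₁.g₃ = L₂.g₃) : L₁.lattice ≤ L₂.lattice := by
  intro l hl
  by_contra hl2
  let S : Set ℂ := ((L₁.lattice : Set ℂ) ∪ L₂.lattice)
  have hcount : ∀ L : PeriodPair, (L.lattice : Set ℂ).Countable := fun L ↦ by
    have : Countable L.lattice := L.latticeEquivProd.toEquiv.countable_iff.mpr inferInstance
    exact Set.countable_coe_iff.mp this
  have hS : S.Countable := (hcount L₁).union (hcount L₂)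
  have hSc : IsClosed S := L₁.isClosed_lattice.union L₂.isClosed_lattice
  have hconn : IsPreconnected Sᶜ :=
    (hS.isConnected_compl_of_one_lt_rank (by simp [Complex.rank_real_complex])).isPreconnected
  have h1 : AnalyticOnNhd ℂ L₁.weierstrassP Sᶜ := L₁.analyticOnNhd_weierstrassP.mono fun z hz h ↦ hz (.inl h)
  have h2' : AnalyticOnNhd ℂ L₂.weierstrassP Sᶜ := L₂.analyticOnNhd_weierstrassP.mono fun z hz h ↦ hz (.inr h)
  have hloc : L₁.weierstrassP =ᶠ[𝓝[≠] 0] L₂.weierstrassP := by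
    filter_upwards [nhdsWithin_le_nhds (weierstrassPExcept_eventuallyEq h2 h3)] with z hz
    have p1 := L₁.weierstrassPExcept_add 0 z
    have p2 := L₂.weierstrassPExcept_add 0 z
    simp only [ZeroMemClass.coe_zero, sub_zero] at p1 p2
    rw [← p1, ← p2, hz]
  obtain ⟨U, hU, hUo, hU0⟩ := mem_nhds_iff.mp (mem_nhdsWithin_iff_exists_mem_nhds_inter.mp hloc).choose_spec.1
  have hUe : ∀ z ∈ U, z ≠ 0 → L₁.weierstrassP z = L₂.weierstrassP z := fun z hz hz0 ↦
    (mem_nhdsWithin_iff_exists_mem_nhds_inter.mp hloc).choose_spec.2 ⟨hU hz, hz0⟩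
  obtain ⟨z₀, hz₀, hz₀'⟩ : (U ∩ Sᶜ).Nonempty :=
    (hS.dense_compl ℝ).inter_open_nonempty U hUo ⟨0, hU0⟩
  have hz00 : z₀ ≠ 0 := fun h ↦ hz₀' (.inl (h ▸ L₁.lattice.zero_mem))
  have heq : Set.EqOn L₁.weierstrassP L₂.weierstrassP Sᶜ := by
    refine h1.eqOn_of_preconnected_of_eventuallyEq h2' hconn hz₀' ?_
    filter_upwards [(hUo.sdiff isClosed_singleton).mem_nhds ⟨hz₀, hz00⟩] with z hz
    exact hUe z hz.1 hz.2
  have hmem : ∀ᶠ z in 𝓝[≠] l, z ∈ Sᶜ := by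
    have e1 := L₁.compl_lattice_sdiff_singleton_mem_nhds l
    have e2 := L₂.isClosed_lattice.isOpen_compl.mem_nhds hl2
    filter_upwards [nhdsWithin_le_nhds e1, nhdsWithin_le_nhds e2, self_mem_nhdsWithin]
      with z hz hz2 hz3
    rintro (h | h)
    · exact hz ⟨h, hz3⟩
    · exact hz2 h
  have hord := L₁.order_weierstrassP l hl
  rw [meromorphicOrderAt_congr (by filter_upwards [hmem] with z hz using heq hz)] at hord
  have := (L₂.analyticOnNhd_weierstrassP l hl2).meromorphicOrderAt_nonneg
  rw [hord] at this
  exact absurd this (by decide)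

lemma lattice_eq_of_eisenstein {L₁ L₂ : PeriodPair} (h2 : L₁.g₂ = L₂.g₂)
    (h3 : L₁.g₃ = L₂.g₃) : L₁.lattice = L₂.lattice :=
  le_antisymm (lattice_le_of_eisenstein h2 h3) (lattice_le_of_eisenstein h2.symm h3.symm)

/-- The lattice spanned by `μτ` and `μ`. -/
def tauPair (μ : ℂ) (hμ : μ ≠ 0) (τ : ℍ) : PeriodPair where
  ω₁ := μ * τ
  ω₂ := μ
  indep := by
    rw [LinearIndependent.pair_iff]
    intro s t h
    have h1 : (s : ℂ) * τ + t = 0 := by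
      apply mul_left_cancel₀ hμ
      simp only [real_smul] at h
      linear_combination h
    have him := congrArg Complex.im h1
    have hre := congrArg Complex.re h1
    simp at him hre
    have hs : s = 0 := by
      rcases him with h | h
      · exact h
      · exact absurd h τ.im_ne_zero
    subst hs
    simpa using hre

lemma tauPair_G (μ : ℂ) (hμ : μ ≠ 0) (τ : ℍ) (k : ℕ) (hk : 3 ≤ k) :
    (tauPair μ hμ τ).G k = (μ ^ k)⁻¹ * (riemannZeta k * (2 * ModularForm.E hk τ)) := by
  have hE : (2 : ℂ) * ModularForm.E hk τ = eisensteinSeries (N := 1) 0 k τ := by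
    have : ModularForm.E hk τ =
      (1 / 2 : ℂ) • EisensteinSeries.eisensteinSeriesSIF (N := 1) 0 k τ := rfl
    rw [this, EisensteinSeries.eisensteinSeriesSIF_apply]
    simp
  rw [hE, ← tsum_eisSummand_eq_riemannZeta_mul_eisensteinSeries hk, PeriodPair.G,
    ← tsum_mul_left, ← (tauPair μ hμ τ).latticeEquivProd.symm.toEquiv.tsum_eq,
    ← (finTwoArrowEquiv ℤ).tsum_eq]
  refine tsum_congr fun v ↦ ?_
  have : (((tauPair μ hμ τ).latticeEquivProd.symm.toEquiv (finTwoArrowEquiv ℤ v) :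
      (tauPair μ hμ τ).lattice) : ℂ) = v 0 * (μ * τ) + v 1 * μ :=
    (tauPair μ hμ τ).latticeEquiv_symm_apply _
  rw [this, EisensteinSeries.eisSummand, _root_.zpow_neg, zpow_natCast, ← mul_inv, ← mul_pow]
  congr 2; ring

lemma exists_scale {a b c a' b' c' : ℂ} (hc : c ≠ 0) (hc' : c' ≠ 0)
    (h : c = (a ^ 3 - b ^ 2) / 1728) (h' : c' = (a' ^ 3 - b' ^ 2) / 1728)
    (hj : a ^ 3 / c = a' ^ 3 / c') : ∃ l : ℂ, l ≠ 0 ∧ a = l ^ 4 * a' ∧ b = l ^ 6 * b' := by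
  obtain ⟨l, hl⟩ := IsAlgClosed.exists_pow_nat_eq (c / c') (show 0 < 12 by norm_num)
  have hl0 : l ≠ 0 := by
    rintro rfl
    exact div_ne_zero hc hc' (by rw [← hl]; norm_num)
  have hlc : l ^ 12 * c' = c := by rw [hl]; field_simp
  rw [div_eq_div_iff hc hc'] at hj
  have h3 : a ^ 3 = l ^ 12 * a' ^ 3 := mul_right_cancel₀ hc' (by
    linear_combination hj - a' ^ 3 * hlc)
  have h2 : b ^ 2 = l ^ 12 * b' ^ 2 := by
    linear_combination 1728 * h + h3 - l ^ 12 * 1728 * h' + 1728 * hlc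
  obtain ⟨w, hw, hw'⟩ : ∃ w : ℂ, w ^ 3 = 1 ∧ a = w * l ^ 4 * a' := by
    by_cases ha : a' = 0
    · refine ⟨1, by norm_num, ?_⟩
      rw [ha] at h3 ⊢
      simpa using h3
    · refine ⟨a / (l ^ 4 * a'), ?_, by field_simp⟩
      rw [div_pow, h3, mul_pow, ← pow_mul, div_self]
      exact mul_ne_zero (pow_ne_zero _ hl0) (pow_ne_zero _ ha)
  have hw0 : w ≠ 0 := by rintro rfl; norm_num at hw
  have h6 : (b - l ^ 6 * b') * (b + l ^ 6 * b') = 0 := by linear_combination h2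
  rcases mul_eq_zero.mp h6 with h6 | h6
  · refine ⟨w * l, mul_ne_zero hw0 hl0, ?_, ?_⟩
    · linear_combination hw' - w * l ^ 4 * a' * hw
    · linear_combination h6 - l ^ 6 * b' * (w ^ 3 + 1) * hw
  · refine ⟨w * (l * Complex.I), mul_ne_zero hw0 (mul_ne_zero hl0 I_ne_zero), ?_, ?_⟩
    · have : Complex.I ^ 4 = 1 := I_pow_four
      linear_combination hw' - w * l ^ 4 * a' * hw - w ^ 4 * l ^ 4 * a' * this
    · have : Complex.I ^ 6 = -1 := by rw [show 6 = 4 + 2 by rfl, pow_add, I_pow_four, I_sq]; ring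
      linear_combination h6 + l ^ 6 * b' * (w ^ 3 + 1) * hw - w ^ 6 * l ^ 6 * b' * this

/-- Klein's `j`-function. -/
def kleinJ (τ : ℍ) : ℂ := ModularForm.E₄ τ ^ 3 / ModularForm.discriminant τ

/-- Real matrices of integral unimodular matrices. -/
def slSet : Set (GL (Fin 2) ℝ) :=
  {M | ∃ A B C D : ℤ, M.1 = !![(A : ℝ), (B : ℝ); (C : ℝ), (D : ℝ)] ∧ A * D - B * C = 1}

lemma eq_zero_of_add_eq_zero {s t : ℝ} {τ : ℍ} (h1 : (s : ℂ) * τ + t = 0) : s = 0 ∧ t = 0 := by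
  have him := congrArg Complex.im h1
  have hre := congrArg Complex.re h1
  simp at him hre
  have hs : s = 0 := him.resolve_right τ.im_ne_zero
  subst hs
  exact ⟨rfl, by simpa using hre⟩

theorem exists_slSet_of_kleinJ {τ τ' : ℍ} (h : kleinJ τ = kleinJ τ') :
    ∃ γ ∈ slSet, γ • τ = τ' := by
  obtain ⟨l, hl, h4, h6⟩ := exists_scale (ModularForm.discriminant_ne_zero τ)
    (ModularForm.discriminant_ne_zero τ') (ModularForm.discriminant_eq_E₄_cube_sub_E₆_sq τ)
    (ModularForm.discriminant_eq_E₄_cube_sub_E₆_sq τ') h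
  have hl' := inv_ne_zero hl
  have hlat : (tauPair 1 one_ne_zero τ).lattice = (tauPair l⁻¹ hl' τ').lattice := by
    apply lattice_eq_of_eisenstein
    · rw [PeriodPair.g₂, PeriodPair.g₂, tauPair_G _ _ _ 4 (by norm_num),
        tauPair_G _ _ _ 4 (by norm_num)]
      change 60 * (_ * (_ * (2 * ModularForm.E₄ τ))) = 60 * (_ * (_ * (2 * ModularForm.E₄ τ')))
      rw [h4]; simp; ring
    · rw [PeriodPair.g₃, PeriodPair.g₃, tauPair_G _ _ _ 6 (by norm_num),
        tauPair_G _ _ _ 6 (by norm_num)]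
      change 140 * (_ * (_ * (2 * ModularForm.E₆ τ))) = 140 * (_ * (_ * (2 * ModularForm.E₆ τ')))
      rw [h6]; simp; ring
  have m1 : l⁻¹ * (τ' : ℂ) ∈ (tauPair 1 one_ne_zero τ).lattice := by
    rw [hlat]; exact (tauPair l⁻¹ hl' τ').ω₁_mem_lattice
  have m2 : l⁻¹ ∈ (tauPair 1 one_ne_zero τ).lattice := by
    rw [hlat]; exact (tauPair l⁻¹ hl' τ').ω₂_mem_lattice
  have m3 : (1 : ℂ) * (τ : ℂ) ∈ (tauPair l⁻¹ hl' τ').lattice := by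
    rw [← hlat]; exact (tauPair 1 one_ne_zero τ).ω₁_mem_lattice
  have m4 : (1 : ℂ) ∈ (tauPair l⁻¹ hl' τ').lattice := by
    rw [← hlat]; exact (tauPair 1 one_ne_zero τ).ω₂_mem_lattice
  obtain ⟨A, B, e1⟩ := PeriodPair.mem_lattice.mp m1
  obtain ⟨C, D, e2⟩ := PeriodPair.mem_lattice.mp m2
  obtain ⟨A', B', e3⟩ := PeriodPair.mem_lattice.mp m3
  obtain ⟨C', D', e4⟩ := PeriodPair.mem_lattice.mp m4
  simp only [tauPair, one_mul, mul_one] at e1 e2 e3 e4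
  have i1 := eq_zero_of_add_eq_zero (s := A' * A + B' * C - 1) (t := A' * B + B' * D) (τ := τ) (by
    push_cast; linear_combination e3 + A' * e1 + B' * e2)
  have i2 := eq_zero_of_add_eq_zero (s := C' * A + D' * C) (t := C' * B + D' * D - 1) (τ := τ) (by
    push_cast; linear_combination e4 + C' * e1 + D' * e2)
  have j1 : A' * A + B' * C - 1 = 0 := by exact_mod_cast i1.1
  have j2 : A' * B + B' * D = 0 := by exact_mod_cast i1.2
  have j3 : C' * A + D' * C = 0 := by exact_mod_cast i2.1
  have j4 : C' * B + D' * D - 1 = 0 := by exact_mod_cast i2.2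
  have hdet : (A * D - B * C) * (A' * D' - B' * C') = 1 := by
    linear_combination (C' * B + D' * D) * j1 + j4 - (C' * A + D' * C) * j2
  have hpos : 0 < A * D - B * C := by
    have hτ' : (τ' : ℂ) = l * (A * τ + B) := by rw [e1]; field_simp
    have hl1 : l * (C * τ + D) = 1 := by rw [e2]; field_simp
    have hz : (C * τ + D : ℂ) ≠ 0 := fun h ↦ by rw [h] at hl1; simp at hl1
    have : (τ' : ℂ) = (A * τ + B) / (C * τ + D) := by
      rw [eq_div_iff hz, hτ']; linear_combination (A * τ + B : ℂ) * hl1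
    have him : (τ' : ℂ).im * Complex.normSq (C * τ + D) = (A * D - B * C) * (τ : ℂ).im := by
      have := congrArg Complex.im this
      rw [Complex.div_im] at this
      have hn : Complex.normSq (C * τ + D) ≠ 0 := by simpa using hz
      rw [this, sub_mul, div_mul_cancel₀ _ hn, div_mul_cancel₀ _ hn]
      simp
      ring
    have h1 : 0 < ((A * D - B * C : ℤ) : ℝ) * (τ : ℂ).im := by
      push_cast
      rw [← him]
      exact mul_pos τ'.im_pos (Complex.normSq_pos.mpr hz)
    exact_mod_cast pos_of_mul_pos_left h1 τ.im_pos.le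
  have hdet1 : A * D - B * C = 1 := by
    rcases Int.eq_one_or_neg_one_of_mul_eq_one hdet with h | h <;> omega
  have hpos' : (0 : ℝ) < A * D - B * C := by exact_mod_cast hpos
  refine ⟨gl A B C D hpos', ⟨A, B, C, D, rfl, hdet1⟩, UpperHalfPlane.ext ?_⟩
  rw [gl_smul]
  push_cast
  rw [e1, e2, mul_comm, mul_div_cancel_right₀ _ hl']

lemma slSet_eq {γ : GL (Fin 2) ℝ} (h : γ ∈ slSet) :
    ∃ g : SL(2, ℤ), γ = Matrix.SpecialLinearGroup.mapGL ℝ g := by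
  obtain ⟨A, B, C, D, h, h'⟩ := h
  obtain ⟨g, hg⟩ : ∃ g : SL(2, ℤ), g.1 = !![A, B; C, D] :=
    ⟨⟨!![A, B; C, D], by rw [Matrix.det_fin_two_of, h']⟩, rfl⟩
  refine ⟨g, gl_ext ?_⟩
  rw [h]
  ext i j; fin_cases i <;> fin_cases j <;> simp [hg]

lemma kleinJ_slSet {γ : GL (Fin 2) ℝ} (h : γ ∈ slSet) (τ : ℍ) : kleinJ (γ • τ) = kleinJ τ := by
  obtain ⟨g, rfl⟩ := slSet_eq h
  have hg : Matrix.SpecialLinearGroup.mapGL ℝ g ∈ 𝒮ℒ := ⟨g, rfl⟩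
  have h4 := SlashInvariantForm.slash_action_eqn'' ModularForm.E₄ hg τ
  have h12 : ModularForm.discriminant (Matrix.SpecialLinearGroup.mapGL ℝ g • τ) = _ :=
    SlashInvariantForm.slash_action_eqn'' CuspForm.discriminant hg τ
  have hd := denom_ne_zero (Matrix.SpecialLinearGroup.mapGL ℝ g) τ
  rw [kleinJ, kleinJ, h4, h12, mul_pow, ← zpow_natCast, ← _root_.zpow_mul]
  exact mul_div_mul_left _ _ (zpow_ne_zero _ hd)

lemma mdiff_kleinJ : MDiff kleinJ :=
  mdiff_div (mdiff_pow ModularForm.E₄.holo' 3) CuspForm.discriminant.holo'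
    ModularForm.discriminant_ne_zero

lemma kleinJ_isBigO : kleinJ =O[atImInfty] fun τ : ℍ ↦ (qc τ)⁻¹ := by
  have h4 : (fun τ ↦ ModularForm.E₄ τ ^ 3) =O[atImInfty] fun _ : ℍ ↦ (1 : ℂ) := by
    have : (fun τ ↦ ModularForm.E₄ τ) =O[atImInfty] fun _ : ℍ ↦ (1 : ℝ) :=
      ModularFormClass.bdd_at_infty ModularForm.E₄
    have h2 := (this.pow 3)
    simp only [one_pow] at h2
    exact h2.trans (Asymptotics.isBigO_const_const _ one_ne_zero _)
  have h5 : (fun τ ↦ (ModularForm.discriminant τ)⁻¹) =O[atImInfty] fun τ : ℍ ↦ (qc τ)⁻¹ := by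
    refine Asymptotics.IsBigO.inv_rev ?_ (.of_forall fun τ h ↦ absurd h (qc_ne_zero _))
    refine (Asymptotics.IsBigO.of_norm_eventuallyLE (.of_forall fun τ ↦ ?_)).trans
      ModularForm.exp_isBigO_discriminant
    simp only [norm_qc, coe_im]
    apply le_of_eq; congr 1; ring
  refine (h4.mul h5).congr (fun τ ↦ (div_eq_mul_inv _ _).symm) fun τ ↦ one_mul _

/-- The matrix of multiplication by `e`. -/
def dg (e : ℕ) (he : 0 < e) : GL (Fin 2) ℝ := gl e 0 0 1 (by simpa using he)

lemma dg_smul (e : ℕ) (he : 0 < e) (τ : ℍ) : ((dg e he • τ : ℍ) : ℂ) = e * τ := by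
  rw [dg, gl_smul]; simp

lemma dg_det (e : ℕ) (he : 0 < e) : 0 < (dg e he).det.val := by
  rw [dg, det_of_coe (gl_coe ..)]; simpa using he

lemma kleinJ_dg_isBigO (e : ℕ) (he : 0 < e) :
    (fun τ ↦ kleinJ (dg e he • τ)) =O[atImInfty] fun τ : ℍ ↦ (qc τ)⁻¹ ^ e := by
  have ht : Tendsto (fun τ : ℍ ↦ dg e he • τ) atImInfty atImInfty := by
    rw [atImInfty, tendsto_comap_iff]
    have h : (UpperHalfPlane.im ∘ fun τ : ℍ ↦ dg e he • τ) = fun τ ↦ (e : ℝ) * τ.im := by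
      ext τ
      have := congrArg Complex.im (dg_smul e he τ)
      simpa using this
    rw [h]
    exact tendsto_comap.const_mul_atTop (by exact_mod_cast he)
  refine (kleinJ_isBigO.comp_tendsto ht).congr_right fun τ ↦ ?_
  simp only [Function.comp_apply, dg_smul, qc_nat_mul, inv_pow]

lemma kleinJ_congr {M N : GL (Fin 2) ℝ} {g : ℝ} (hg : 0 < g) (hN : 0 < N.det.val)
    {A B C D : ℤ} (h' : A * D - B * C = 1)
    (h : M.1 = g • (!![(A : ℝ), (B : ℝ); (C : ℝ), (D : ℝ)] * N.1)) (τ : ℍ) :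
    kleinJ (M • τ) = kleinJ (N • τ) := by
  have hd : (0 : ℝ) < A * D - B * C := by exact_mod_cast h' ▸ one_pos
  have hdet : 0 < (gl A B C D hd * N).det.val := by
    rw [map_mul, Units.val_mul]
    exact mul_pos (by rw [det_of_coe (gl_coe ..)]; exact hd) hN
  rw [smul_congr_of_smul hg hdet (by rw [h, Units.val_mul, gl_coe]), mul_smul]
  exact kleinJ_slSet ⟨A, B, C, D, rfl, h'⟩ _

lemma kleinJ_hauptG {τ τ' : ℍ} (f : ℍ → ℂ) (hf : MDiff f) (inv : GammaInv f)
    (hm : ModerateAtCusps f) (h : hauptG τ = hauptG τ') : f τ = f τ' := by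
  obtain ⟨K, Q, hQ⟩ := exists_poly_of_moderate hf inv hm
  have h1 := hQ τ
  have h2 := hQ τ'
  rw [← h, ← h1] at h2
  exact (mul_right_cancel₀ (pow_ne_zero _ (eval_cuspPoly_hauptG_ne τ)) h2).symm

lemma kleinJ_eq_of_hauptG {τ τ' : ℍ} (h : hauptG τ = hauptG τ') : kleinJ τ = kleinJ τ' := by
  refine kleinJ_hauptG kleinJ mdiff_kleinJ ?_ ?_ h
  · rintro γ ⟨A, B, C, D, h, h'⟩ τ
    exact kleinJ_slSet ⟨A, B, 10 * C, D, by simpa using h, by linarith⟩ τ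
  · intro e he
    have key : ∀ (k : ℕ) (hk : 0 < k) {A B C D : ℤ} (_ : A * D - B * C = 1)
      (_ : (alW e).1 = (1 : ℝ) • (!![(A : ℝ), (B : ℝ); (C : ℝ), (D : ℝ)] * (dg k hk).1)),
      ∃ B : ℕ, (fun τ ↦ kleinJ (alW e • τ)) =O[atImInfty] fun τ : ℍ ↦ (qc τ)⁻¹ ^ B :=
      fun k hk A B C D h1 h2 ↦ ⟨k, (kleinJ_dg_isBigO k hk).congr_left fun τ ↦
        (kleinJ_congr one_pos (dg_det k hk) h1 h2 τ).symm⟩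
    simp only [ed, Finset.mem_insert, Finset.mem_singleton] at he
    rcases he with rfl | rfl | rfl | rfl
    · exact key 1 one_pos (A := 1) (B := 0) (C := 0) (D := 1) (by norm_num)
        (by simp [alW, dg, gl_coe, Matrix.one_fin_two])
    · exact key 2 two_pos (A := 1) (B := 1) (C := 5) (D := 6) (by norm_num)
        (by simp [alW, dg, gl_coe]; norm_num)
    · exact key 5 (by norm_num) (A := 1) (B := 2) (C := 2) (D := 5) (by norm_num)
        (by simp [alW, dg, gl_coe]; norm_num)
    · exact key 10 (by norm_num) (A := 0) (B := -1) (C := 1) (D := 0) (by norm_num)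
        (by simp [alW, dg, gl_coe])

lemma dg_ten_alW_isBigO {e : ℤ} (k : ℕ) (hk : 0 < k) (g : ℝ) (hg : 0 < g) {A B C D : ℤ}
    (h1 : A * D - B * C = 1)
    (h2 : (dg 10 (by norm_num) * alW e).1 =
      g • (!![(A : ℝ), (B : ℝ); (C : ℝ), (D : ℝ)] * (dg k hk).1)) :
    ∃ B : ℕ, (fun τ ↦ kleinJ (dg 10 (by norm_num) • alW e • τ)) =O[atImInfty]
      fun τ : ℍ ↦ (qc τ)⁻¹ ^ B :=
  ⟨k, (kleinJ_dg_isBigO k hk).congr_left fun τ ↦ by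
    rw [← mul_smul, kleinJ_congr hg (dg_det k hk) h1 h2 τ]⟩

lemma kleinJ_ten_eq_of_hauptG {τ τ' : ℍ} (h : hauptG τ = hauptG τ') :
    kleinJ (dg 10 (by norm_num) • τ) = kleinJ (dg 10 (by norm_num) • τ') := by
  have hd := dg_det 10 (by norm_num)
  generalize hM : dg 10 (by norm_num) = M at hd
  refine kleinJ_hauptG (fun τ ↦ kleinJ (M • τ)) (mdiff_smul mdiff_kleinJ hd) ?_ ?_ h <;> subst hM
  · rintro γ ⟨A, B, C, D, h, h'⟩ τ
    simp only
    rw [← mul_smul]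
    refine kleinJ_congr (A := A) (B := 10 * B) (C := C) (D := D) one_pos hd
      (by linarith) ?_ τ
    rw [Units.val_mul, h]
    simp [dg, gl_coe, mul_comm]
  · intro e he
    beta_reduce
    simp only [ed, Finset.mem_insert, Finset.mem_singleton] at he
    rcases he with rfl | rfl | rfl | rfl
    · refine dg_ten_alW_isBigO 10 (by norm_num) 1 one_pos (A := 1) (B := 0) (C := 0) (D := 1)
        (by norm_num) ?_
      simp [alW, dg, gl_coe]
    · refine dg_ten_alW_isBigO 5 (by norm_num) 2 two_pos (A := 2) (B := 5) (C := 1) (D := 3)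
        (by norm_num) ?_
      simp [alW, dg, gl_coe]; norm_num
    · refine dg_ten_alW_isBigO 2 (by norm_num) 5 (by norm_num) (A := 5) (B := 4) (C := 1) (D := 1)
        (by norm_num) ?_
      simp [alW, dg, gl_coe]; norm_num
    · refine dg_ten_alW_isBigO 1 (by norm_num) 10 (by norm_num) (A := 0) (B := -1) (C := 1)
        (D := 0) (by norm_num) ?_
      simp [alW, dg, gl_coe]

/-- The hauptmodul as a function of a complex variable. -/
def hauptGC (z : ℂ) : ℂ := hauptG (ofComplex z)

lemma hauptGC_coe (τ : ℍ) : hauptGC τ = hauptG τ := by rw [hauptGC, ofComplex_apply]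

lemma analyticAt_of_mdiff {f : ℍ → ℂ} (hf : MDiff f) (τ : ℍ) :
    AnalyticAt ℂ (fun z ↦ f (ofComplex z)) τ :=
  (UpperHalfPlane.mdifferentiable_iff.mp hf).analyticAt (isOpen_upperHalfPlaneSet.mem_nhds τ.im_pos)

lemma analyticAt_hauptGC (τ : ℍ) : AnalyticAt ℂ hauptGC τ := analyticAt_of_mdiff mdiff_hauptG τ

lemma hauptGC_not_eventually_const (τ : ℍ) (c : ℂ) : ¬ ∀ᶠ z in 𝓝 (τ : ℂ), hauptGC z = c := by
  intro h
  have ha : AnalyticOnNhd ℂ hauptGC upperHalfPlaneSet := fun z hz ↦ analyticAt_hauptGC ⟨z, hz⟩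
  have hc : IsPreconnected upperHalfPlaneSet := (convex_halfSpace_im_gt 0).isPreconnected
  have heq := ha.eqOn_of_preconnected_of_eventuallyEq (g := fun _ ↦ c)
    analyticOnNhd_const hc τ.im_pos h
  have h1 := tendsto_norm_hauptG.eventually (eventually_gt_atTop ‖c‖)
  obtain ⟨σ, hσ⟩ := h1.exists
  have := heq σ.im_pos
  rw [hauptGC_coe] at this
  rw [this] at hσ
  exact lt_irrefl _ hσ

lemma nhds_le_map_hauptG (τ : ℍ) : 𝓝 (hauptG τ) ≤ map hauptG (𝓝 τ) := by
  rcases (analyticAt_hauptGC τ).eventually_constant_or_nhds_le_map_nhds with h | h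
  · exact absurd h (hauptGC_not_eventually_const τ _)
  · rw [hauptGC_coe] at h
    refine h.trans ?_
    have : Tendsto ofComplex (𝓝 (τ : ℂ)) (𝓝 τ) := by
      have := (contMDiffAt_ofComplex (n := ⊤) τ.im_pos).continuousAt.tendsto
      rwa [ofComplex_apply] at this
    exact (map_map (m := ofComplex) (m' := hauptG)) ▸ map_mono this

lemma exists_gamma_of_frequently {τ τ' : ℍ} {F : Filter (ℍ × ℍ)} (hF : F ≤ 𝓝 (τ, τ'))
    (h : ∃ᶠ p in F, ∃ γ ∈ heckeSet 1, γ • p.1 = p.2) :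
    ∃ γ ∈ heckeSet 1, γ • τ = τ' ∧ ∃ᶠ p in F, γ • p.1 = p.2 := by
  obtain ⟨K, hK, hKτ⟩ := exists_compact_mem_nhds τ
  obtain ⟨K', hK', hKτ'⟩ := exists_compact_mem_nhds τ'
  have hfin : {g : 𝒮ℒ | (((g • ·) '' K) ∩ K').Nonempty}.Finite :=
    ProperlyDiscontinuousSMul.finite_disjoint_inter_image hK hK'
  have hev : ∀ᶠ p in F, p.1 ∈ K ∧ p.2 ∈ K' := hF (prod_mem_nhds hKτ hKτ')
  obtain ⟨γ, hγ, hfr⟩ : ∃ γ ∈ heckeSet 1, ∃ᶠ p in F, γ • p.1 = p.2 := by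
    by_contra hcon
    push Not at hcon
    have := (eventually_all_finite hfin).mpr fun g _ ↦
      (show ∀ᶠ p in F, g.1 ∈ heckeSet 1 → g.1 • p.1 ≠ p.2 by
        by_cases hg : g.1 ∈ heckeSet 1
        · filter_upwards [hcon g.1 hg] with p hp _ using hp
        · exact .of_forall fun p h ↦ absurd h hg)
    refine h ?_
    filter_upwards [this, hev] with p hp hpK
    rintro ⟨γ, hγ, hγp⟩
    have hsl : γ ∈ slSet := by
      obtain ⟨A, B, C, D, h, h'⟩ := hγ
      exact ⟨A, B, 10 * C, D, by simpa using h, by linarith⟩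
    obtain ⟨g, hg⟩ := slSet_eq hsl
    refine hp ⟨γ, ⟨g, hg.symm⟩⟩ ?_ hγ hγp
    exact ⟨p.2, ⟨p.1, hpK.1, hγp⟩, hpK.2⟩
  refine ⟨γ, hγ, ?_, hfr⟩
  have hcl : IsClosed {p : ℍ × ℍ | γ • p.1 = p.2} :=
    isClosed_eq ((continuous_const_smul γ).comp continuous_fst) continuous_snd
  exact hcl.closure_subset (mem_closure_iff_frequently.mpr (hfr.filter_mono hF))

lemma quadratic_eq_zero {z : ℂ} (hz : ¬ IsAlgebraic ℤ z) {p q r : ℤ}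
    (h : (p : ℂ) * z ^ 2 + q * z + r = 0) : p = 0 ∧ q = 0 ∧ r = 0 := by
  have hP : Polynomial.C p * Polynomial.X ^ 2 + Polynomial.C q * Polynomial.X + Polynomial.C r =
      0 := by
    by_contra hP
    exact hz ⟨_, hP, by simpa using h⟩
  have hc : ∀ k, _ := fun k ↦ congrArg (Polynomial.coeff · k) hP
  simp only [Polynomial.coeff_add, Polynomial.coeff_C_mul, Polynomial.coeff_X_pow,
    Polynomial.coeff_X, Polynomial.coeff_C, Polynomial.coeff_zero] at hc
  have h2 := hc 2
  have h1 := hc 1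
  have h0 := hc 0
  norm_num at h0 h1 h2
  exact ⟨h2, h1, h0⟩

lemma exists_gamma_of_hauptG_generic {τ τ' : ℍ} (hτ : ¬ IsAlgebraic ℤ (τ : ℂ))
    (h : hauptG τ = hauptG τ') : ∃ γ ∈ heckeSet 1, γ • τ = τ' := by
  obtain ⟨γ, ⟨A, B, C, D, hγ, hdet⟩, hγτ⟩ := exists_slSet_of_kleinJ (kleinJ_eq_of_hauptG h)
  obtain ⟨δ, ⟨A', B', C', D', hδ, hdet'⟩, hδτ⟩ :=
    exists_slSet_of_kleinJ (kleinJ_ten_eq_of_hauptG h)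
  have e1 := smul_of_coe hγ (by exact_mod_cast hdet ▸ one_pos) τ
  have e2 := smul_of_coe hδ (by exact_mod_cast hdet' ▸ one_pos) (dg 10 (by norm_num) • τ)
  rw [hδτ, dg_smul, dg_smul, ← hγτ, e1] at e2
  push_cast at e2
  have hn1 : (C : ℂ) * τ + D ≠ 0 := by
    intro h0
    have := eq_zero_of_add_eq_zero (s := C) (t := D) (τ := τ) (by exact_mod_cast h0)
    have h1 : C = 0 := by exact_mod_cast this.1
    have h2 : D = 0 := by exact_mod_cast this.2
    simp [h1, h2] at hdet
  have hn2 : (C' : ℂ) * (10 * τ) + D' ≠ 0 := by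
    intro h0
    have := eq_zero_of_add_eq_zero (s := C' * 10) (t := D') (τ := τ)
      (by push_cast; linear_combination h0)
    have h1 : C' = 0 := by exact_mod_cast (mul_eq_zero.mp this.1).resolve_right (by norm_num)
    have h2 : D' = 0 := by exact_mod_cast this.2
    simp [h1, h2] at hdet'
  rw [← mul_div_assoc, div_eq_div_iff hn1 hn2] at e2
  obtain ⟨q1, q2, q3⟩ := quadratic_eq_zero (p := 10 * A * (10 * C') - 10 * A' * C)
    (q := 10 * A * D' + 10 * B * (10 * C') - 10 * A' * D - B' * C)
    (r := 10 * B * D' - B' * D) hτ (by push_cast; linear_combination e2)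
  refine ⟨γ, ⟨A, B, A' * C' * D - C' * (A * D' + 10 * B * C' - A' * D), D, ?_, ?_⟩, hγτ⟩
  all_goals
    have hC : C = 10 * (A' * C' * D - C' * (A * D' + 10 * B * C' - A' * D)) := by
      have hk : C * D' = 10 * C' * D := by
        apply mul_left_cancel₀ (show (10 : ℤ) ≠ 0 by norm_num)
        linear_combination 10 * D' * C * (-hdet) + 100 * C' * D * hdet - D ^ 2 * q1 + C * D * q2 - C ^ 2 * q3
      linear_combination (-C) * hdet' + A' * hk + C' * q2
  · rw [hγ]; congr 1
    have : (C : ℝ) = ((10 * (A' * C' * D - C' * (A * D' + 10 * B * C' - A' * D)) : ℤ) : ℝ) := by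
      exact_mod_cast hC
    rw [this]; push_cast; rfl
  · rw [← hdet]
    linear_combination B * hC

/-- The hauptmodul separates the orbits of the group of level ten. -/
theorem exists_gamma_of_hauptG {τ τ' : ℍ} (h : hauptG τ = hauptG τ') :
    ∃ γ ∈ heckeSet 1, γ • τ = τ' := by
  obtain ⟨γ, hγ, hγτ, -⟩ := exists_gamma_of_frequently (τ := τ) (τ' := τ') le_rfl (by
    rw [frequently_iff]
    intro U hU
    obtain ⟨V, hV, V', hV', hVU⟩ := mem_nhds_prod_iff.mp hU
    have h1 : hauptG '' V' ∈ 𝓝 (hauptG τ) := h ▸ nhds_le_map_hauptG τ' (image_mem_map hV')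
    have h2 : hauptG ⁻¹' (hauptG '' V') ∩ V ∈ 𝓝 τ :=
      inter_mem (mdiff_hauptG.continuous.continuousAt.preimage_mem_nhds h1) hV
    obtain ⟨W, hW, hWo, hWτ⟩ := mem_nhds_iff.mp h2
    have hWo' : IsOpen ((↑) '' W : Set ℂ) := isOpenEmbedding_coe.isOpenMap _ hWo
    obtain ⟨_, ⟨σ, hσ, rfl⟩, hσa⟩ :=
      ((Algebraic.countable ℤ ℂ).dense_compl ℝ).inter_open_nonempty _ hWo' ⟨_, τ, hWτ, rfl⟩
    obtain ⟨⟨σ', hσ', he⟩, hσV⟩ := hW hσ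
    exact ⟨(σ, σ'), hVU ⟨hσV, hσ'⟩, exists_gamma_of_hauptG_generic hσa he.symm⟩)
  exact ⟨γ, hγ, hγτ⟩

/-- Integral multiples of the elements of the group of level ten. -/
def scalarClass : Set (GL (Fin 2) ℝ) :=
  {M | ∃ s : ℤ, ∃ γ ∈ heckeSet 1, M.1 = (s : ℝ) • γ.1}

lemma moebius_sub {A B C D : ℂ} {z w : ℂ} (hz : C * z + D ≠ 0) (hw : C * w + D ≠ 0) :
    (A * z + B) / (C * z + D) - (A * w + B) / (C * w + D) =
      (z - w) * ((A * D - B * C) / ((C * z + D) * (C * w + D))) := by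
  rw [div_sub_div _ _ hz hw, ← mul_div_assoc]
  congr 1; ring

lemma tendsto_ofComplex (τ : ℍ) : Tendsto ofComplex (𝓝 (τ : ℂ)) (𝓝 τ) := by
  have := (contMDiffAt_ofComplex (n := ⊤) τ.im_pos).continuousAt.tendsto
  rwa [ofComplex_apply] at this

lemma lin_int_ne_zero {A B C D n : ℤ} (h : A * D - B * C = n) (hn : 0 < n) (τ : ℍ) :
    (C : ℂ) * τ + D ≠ 0 := by
  intro h0
  have := eq_zero_of_add_eq_zero (s := C) (t := D) (τ := τ) (by exact_mod_cast h0)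
  have h1 : C = 0 := by exact_mod_cast this.1
  have h2 : D = 0 := by exact_mod_cast this.2
  simp [h1, h2] at h
  omega

/-- Every root of unity whose order divides the ramification index of the hauptmodul is the
multiplier of an elliptic element. -/
theorem exists_gamma_multiplier {τ : ℍ} {m : ℕ} {u : ℂ → ℂ} (hm : m ≠ 0) (hu : AnalyticAt ℂ u τ)
    (hu0 : u τ ≠ 0) (h : ∀ᶠ z in 𝓝 (τ : ℂ), hauptGC z - hauptG τ = (z - τ) ^ m * u z)
    {ζ : ℂ} (hζ : ζ ^ m = 1) :
    ∃ γ ∈ heckeSet 1, γ • τ = τ ∧ ∃ A B C D : ℤ,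
      γ.1 = !![(A : ℝ), (B : ℝ); 10 * (C : ℝ), (D : ℝ)] ∧ A * D - 10 * B * C = 1 ∧
      ζ * (10 * C * τ + D) ^ 2 = 1 := by
  obtain ⟨c, hc⟩ := IsAlgClosed.exists_pow_nat_eq (u τ) (Nat.pos_of_ne_zero hm)
  have hc0 : c ≠ 0 := by rintro rfl; rw [zero_pow hm] at hc; exact hu0 hc.symm
  let v : ℂ → ℂ := fun z ↦ c * (u z / u τ) ^ ((m : ℂ)⁻¹)
  have hvm : ∀ z, v z ^ m = u z := fun z ↦ by
    simp only [v]
    rw [mul_pow, Complex.cpow_nat_inv_pow _ hm, hc]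
    field_simp
  have hva : AnalyticAt ℂ v τ := by
    refine analyticAt_const.mul ((hu.div analyticAt_const hu0).cpow analyticAt_const ?_)
    simp [div_self hu0]
  have hv0 : v τ = c := by simp [v, div_self hu0]
  let k : ℂ → ℂ := fun z ↦ (z - τ) * v z
  have hka : AnalyticAt ℂ k τ := (analyticAt_id.sub analyticAt_const).mul hva
  have hk0 : k τ = 0 := by simp [k]
  have hkd : HasStrictDerivAt k c τ := by
    have h1 := hka.hasStrictDerivAt
    have h2 : HasDerivAt k (1 * v τ + ((τ : ℂ) - τ) * deriv v τ) τ :=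
      ((hasDerivAt_id (τ : ℂ)).sub_const (τ : ℂ)).mul hva.differentiableAt.hasDerivAt
    rw [h2.deriv] at h1
    simpa [hv0] using h1
  let K := hkd.localInverse k c τ hc0
  have hKd : HasDerivAt K c⁻¹ 0 := by
    have := (hkd.to_localInverse hc0).hasDerivAt
    rwa [hk0] at this
  have hKr : ∀ᶠ w in 𝓝 (0 : ℂ), k (K w) = w := by
    have := (hkd.hasStrictFDerivAt_equiv hc0).eventually_right_inverse
    rwa [hk0] at this
  have hK0 : K 0 = τ := by
    have := (hkd.hasStrictFDerivAt_equiv hc0).localInverse_apply_image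
    rwa [hk0] at this
  have hKt : Tendsto K (𝓝 0) (𝓝 (τ : ℂ)) := by
    have := hKd.continuousAt.tendsto
    rwa [hK0] at this
  have hζt : Tendsto (fun w : ℂ ↦ ζ * w) (𝓝 0) (𝓝 0) := by
    have : ContinuousAt (fun w : ℂ ↦ ζ * w) 0 := by fun_prop
    simpa using this.tendsto
  have hgK : ∀ᶠ w in 𝓝 (0 : ℂ), hauptGC (K w) - hauptG τ = w ^ m := by
    filter_upwards [hKr, hKt.eventually h] with w h1 h2
    rw [h2, ← hvm, ← mul_pow]
    congr 1
  have him : ∀ᶠ w in 𝓝 (0 : ℂ), 0 < (K w).im :=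
    hKt.eventually (isOpen_upperHalfPlaneSet.mem_nhds τ.im_pos)
  let F : Filter (ℍ × ℍ) := map (fun w ↦ (ofComplex (K w), ofComplex (K (ζ * w)))) (𝓝[≠] 0)
  have hF : F ≤ 𝓝 (τ, τ) := by
    have h1 := (tendsto_ofComplex τ).comp hKt
    exact (h1.prodMk_nhds (h1.comp hζt)).mono_left nhdsWithin_le_nhds
  obtain ⟨γ, hγ, hγτ, hfr⟩ := exists_gamma_of_frequently hF (by
    apply Eventually.frequently
    simp only [F, eventually_map]
    filter_upwards [nhdsWithin_le_nhds hgK, nhdsWithin_le_nhds (hζt.eventually hgK)] with w h1 h2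
    apply exists_gamma_of_hauptG
    change hauptGC _ = hauptGC _
    rw [mul_pow, hζ, one_mul] at h2
    linear_combination h1 - h2)
  refine ⟨γ, hγ, hγτ, ?_⟩
  obtain ⟨A, B, C, D, hco, hdet⟩ := hγ
  refine ⟨A, B, C, D, hco, hdet, ?_⟩
  have hdet' : A * D - B * (10 * C) = 1 := by linarith
  have hdetR : (0 : ℝ) < A * D - B * (10 * C) := by exact_mod_cast hdet' ▸ one_pos
  have hlin : ∀ σ : ℍ, (10 * C : ℂ) * σ + D ≠ 0 := fun σ ↦ by
    have := lin_int_ne_zero hdet' one_pos σ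
    push_cast at this; exact this
  have hfr' : ∃ᶠ w in 𝓝[≠] (0 : ℂ), (K (ζ * w) - τ) / w =
      ((K w - τ) / w) * (1 / ((10 * C * K w + D) * (10 * C * τ + D))) := by
    have h1 : ∃ᶠ w in 𝓝[≠] (0 : ℂ), γ • ofComplex (K w) = ofComplex (K (ζ * w)) := hfr
    refine (h1.and_eventually (nhdsWithin_le_nhds (him.and (hζt.eventually him)))).mono ?_
    rintro w ⟨h1, h2, h3⟩
    have e1 := congrArg ((↑) : ℍ → ℂ) h1
    have e2 := smul_of_coe hco hdetR (ofComplex (K w))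
    have e3 := smul_of_coe hco hdetR τ
    have hl := hlin (ofComplex (K w))
    rw [e1] at e2
    rw [hγτ] at e3
    rw [ofComplex_apply_of_im_pos h2] at e2 hl
    rw [ofComplex_apply_of_im_pos h3] at e2
    simp only at e2 hl
    push_cast at e2 e3
    have hd : (A : ℂ) * D - B * (10 * C) = 1 := by exact_mod_cast hdet'
    have := moebius_sub (A := A) (B := B) hl (hlin τ)
    rw [← e2, ← e3, hd] at this
    rw [this]; ring
  have hl1 : Tendsto (fun w ↦ (K w - τ) / w) (𝓝[≠] 0) (𝓝 c⁻¹) := by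
    have := hKd.tendsto_slope
    refine this.congr fun w ↦ ?_
    simp [slope_def_field, hK0]
  have hl2 : Tendsto (fun w ↦ (K (ζ * w) - τ) / w) (𝓝[≠] 0) (𝓝 (c⁻¹ * ζ)) := by
    have h1 : HasDerivAt (fun w ↦ K (ζ * w)) (c⁻¹ * ζ) 0 := by
      have h2 : HasDerivAt (fun w : ℂ ↦ ζ * w) ζ 0 := by simpa using (hasDerivAt_id (0 : ℂ)).const_mul ζ
      exact HasDerivAt.comp (h₂ := K) 0 (by simpa using hKd) h2
    refine h1.tendsto_slope.congr fun w ↦ ?_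
    simp [slope_def_field, hK0]
  have hl3 : Tendsto (fun w ↦ ((K w - τ) / w) * (1 / ((10 * C * K w + D) * (10 * C * τ + D))))
      (𝓝[≠] 0) (𝓝 (c⁻¹ * (1 / ((10 * C * τ + D) * (10 * C * τ + D))))) := by
    refine hl1.mul ((Tendsto.div tendsto_const_nhds ?_ (mul_ne_zero (hlin τ) (hlin τ))))
    exact ((((hKt.mono_left nhdsWithin_le_nhds).const_mul _).add_const _).mul_const _)
  have := tendsto_nhds_unique_of_frequently_eq hl2 hl3 hfr'
  have h2 := mul_left_cancel₀ (inv_ne_zero hc0) this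
  rw [h2, one_div, ← pow_two]
  exact inv_mul_cancel₀ (pow_ne_zero _ (hlin τ))

/-- Two integral matrices of level ten fixing the same point and with proportional multipliers
are proportional. -/
lemma mem_scalarClass_of_multiplier {τ : ℍ} {n A B C D A' B' C' D' : ℤ} (hn : 0 < n)
    {N γ : GL (Fin 2) ℝ} (hγ : γ ∈ heckeSet 1)
    (hN : N.1 = !![(A : ℝ), (B : ℝ); 10 * (C : ℝ), (D : ℝ)]) (hNd : A * D - 10 * B * C = n)
    (hγc : γ.1 = !![(A' : ℝ), (B' : ℝ); 10 * (C' : ℝ), (D' : ℝ)]) (hγd : A' * D' - 10 * B' * C' = 1)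
    (hNτ : N • τ = τ) (hγτ : γ • τ = τ)
    (h : (n : ℂ) * (10 * C' * τ + D') ^ 2 = (10 * C * τ + D) ^ 2) : N ∈ scalarClass := by
  have hnR : (0 : ℝ) < n := by exact_mod_cast hn
  obtain ⟨r, hr0, hr⟩ : ∃ r : ℝ, r ^ 2 = n ∧ (10 * C * τ + D : ℂ) = r * (10 * C' * τ + D') := by
    have h1 : ((√(n : ℝ) : ℝ) : ℂ) ^ 2 = n := by
      rw [← Complex.ofReal_pow, Real.sq_sqrt hnR.le]; simp
    rw [← h1, ← mul_pow, sq_eq_sq_iff_eq_or_eq_neg] at h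
    rcases h with h | h
    · exact ⟨√n, Real.sq_sqrt hnR.le, h.symm⟩
    · exact ⟨-√n, by rw [neg_sq, Real.sq_sqrt hnR.le], by push_cast; linear_combination h⟩
  have hNd' : (A * D - B * (10 * C) : ℝ) = n := by rw [← hNd]; push_cast; ring
  have hγd' : (A' * D' - B' * (10 * C') : ℝ) = 1 := by
    have : ((A' * D' - 10 * B' * C' : ℤ) : ℝ) = 1 := by rw [hγd]; simp
    push_cast at this; linarith
  have l1 := lin_int_ne_zero (A := A) (B := B) (C := 10 * C) (D := D) (n := n) (by linarith) hn τ
  have l2 := lin_int_ne_zero (A := A') (B := B') (C := 10 * C') (D := D') (n := 1) (by linarith) one_pos τ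
  push_cast at l1 l2
  have e1 := smul_of_coe hN (by rw [hNd']; exact hnR) τ
  have e2 := smul_of_coe hγc (by rw [hγd']; exact one_pos) τ
  rw [hNτ] at e1
  rw [hγτ] at e2
  push_cast at e1 e2
  rw [eq_div_iff l1] at e1
  rw [eq_div_iff l2] at e2
  obtain ⟨c1, c2⟩ := eq_zero_of_add_eq_zero (s := 10 * C - r * (10 * C')) (t := D - r * D') (τ := τ)
    (by push_cast; linear_combination hr)
  obtain ⟨c3, c4⟩ := eq_zero_of_add_eq_zero (s := A - r * A') (t := B - r * B') (τ := τ)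
    (by push_cast; linear_combination r * e2 - e1 + τ * hr)
  refine ⟨A * D' - 10 * B * C', γ, hγ, ?_⟩
  have hs : ((A * D' - 10 * B * C' : ℤ) : ℝ) = r := by
    push_cast
    linear_combination D' * c3 - 10 * C' * c4 + r * hγd'
  rw [hs, hN, hγc]
  ext i j; fin_cases i <;> fin_cases j <;> simp <;> linarith

lemma mem_scalarClass_of_gamma_mul {γ M : GL (Fin 2) ℝ} (hγ : γ ∈ heckeSet 1)
    (h : γ * M ∈ scalarClass) : M ∈ scalarClass := by
  obtain ⟨s, δ, hδ, e⟩ := h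
  refine ⟨s, γ⁻¹ * δ, ?_, ?_⟩
  · have := heckeSet_mul (heckeSet_one_inv hγ) hδ
    rwa [one_mul] at this
  · rw [Units.val_mul, ← Matrix.mul_smul, ← e, ← Units.val_mul, inv_mul_cancel_left]

/-- The vanishing order of `g(z) - g(Mz)` at a zero does not depend on the integral matrix `M`. -/
theorem analyticOrderAt_hauptG_sub (τ : ℍ) : ∃ m : ℕ, m ≠ 0 ∧
    analyticOrderAt (fun z ↦ hauptGC z - hauptG τ) (τ : ℂ) = m ∧
    ∀ n : ℤ, 0 < n → ∀ M ∈ heckeSet n, M ∉ scalarClass → hauptG (M • τ) = hauptG τ →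
      analyticOrderAt (fun z ↦ hauptGC z - hauptG (M • ofComplex z)) (τ : ℂ) = m := by
  have hga : AnalyticAt ℂ (fun z ↦ hauptGC z - hauptG τ) (τ : ℂ) :=
    (analyticAt_hauptGC τ).sub analyticAt_const
  obtain ⟨m, u, hu, hu0, hum⟩ := hga.exists_eventuallyEq_pow_smul_nonzero_iff.2 (by
    intro h
    refine hauptGC_not_eventually_const τ (hauptG τ) ?_
    filter_upwards [h] with z hz
    linear_combination hz)
  simp only [smul_eq_mul] at hum
  have hm : m ≠ 0 := by
    rintro rfl
    have := hum.self_of_nhds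
    simp [hauptGC_coe] at this
    exact hu0 this.symm
  refine ⟨m, hm, hga.analyticOrderAt_eq_natCast.2 ⟨u, hu, hu0, by simpa using hum⟩, ?_⟩
  intro n hn M hM hMs hMτ
  obtain ⟨γ, hγ, hγM⟩ := exists_gamma_of_hauptG hMτ
  obtain ⟨N, hNdef⟩ : ∃ N, N = γ * M := ⟨_, rfl⟩
  have hNτ : N • τ = τ := by rw [hNdef, mul_smul, hγM]
  have hNs : N ∉ scalarClass := fun h ↦ hMs (mem_scalarClass_of_gamma_mul hγ (hNdef ▸ h))
  have hNh : N ∈ heckeSet n := by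
    have := heckeSet_mul hγ hM
    rwa [one_mul, ← hNdef] at this
  have hgN : ∀ σ : ℍ, hauptG (M • σ) = hauptG (N • σ) := fun σ ↦ by
    rw [hNdef, mul_smul, gammaInv_hauptG γ hγ]
  obtain ⟨A, B, C, D, hN, hNd⟩ := hNh
  have hnR : (0 : ℝ) < n := by exact_mod_cast hn
  have hNd' : (A * D - B * (10 * C) : ℝ) = n := by rw [← hNd]; push_cast; ring
  have hNdC : (A * D - B * (10 * C) : ℂ) = n := by rw [← hNd]; push_cast; ring
  have hlin : ∀ σ : ℍ, (10 * C * σ + D : ℂ) ≠ 0 := fun σ ↦ by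
    have := lin_int_ne_zero (A := A) (B := B) (C := 10 * C) (D := D) (n := n) (by linarith) hn σ
    push_cast at this; exact this
  have hsm : ∀ σ : ℍ, ((N • σ : ℍ) : ℂ) = (A * σ + B) / (10 * C * σ + D) := fun σ ↦ by
    rw [smul_of_coe hN (by rw [hNd']; exact hnR) σ]; push_cast; rfl
  let w : ℂ → ℂ := fun z ↦ (A * z + B) / (10 * C * z + D)
  let ρ : ℂ → ℂ := fun z ↦ n / ((10 * C * z + D) * (10 * C * τ + D))
  have hwa : AnalyticAt ℂ w τ := by
    refine AnalyticAt.div ?_ ?_ (hlin τ) <;> fun_prop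
  have hρa : AnalyticAt ℂ ρ τ := by
    refine AnalyticAt.div ?_ ?_ (mul_ne_zero (hlin τ) (hlin τ)) <;> fun_prop
  have hwτ : w τ = τ := (hsm τ).symm.trans (by rw [hNτ])
  have hwt : Tendsto w (𝓝 (τ : ℂ)) (𝓝 (τ : ℂ)) := by
    have := hwa.continuousAt.tendsto; rwa [hwτ] at this
  have huw : AnalyticAt ℂ (fun z ↦ u (w z)) τ := AnalyticAt.fun_comp (by rwa [hwτ]) hwa
  have him : ∀ᶠ z in 𝓝 (τ : ℂ), 0 < z.im := isOpen_upperHalfPlaneSet.mem_nhds τ.im_pos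
  have hev : ∀ᶠ z in 𝓝 (τ : ℂ), hauptGC z - hauptG (M • ofComplex z) =
      (z - τ) ^ m * (u z - ρ z ^ m * u (w z)) := by
    filter_upwards [hum, hwt.eventually hum, him] with z h1 h2 h3
    have e1 : w z = ((N • ofComplex z : ℍ) : ℂ) := by
      rw [hsm, ofComplex_apply_of_im_pos h3]
    have e2 : hauptGC (w z) = hauptG (M • ofComplex z) := by
      rw [hgN, e1, hauptGC_coe]
    have e3 : w z - τ = (z - τ) * ρ z := by
      have hl := hlin (ofComplex z)
      rw [ofComplex_apply_of_im_pos h3] at hl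
      have := moebius_sub (A := A) (B := B) hl (hlin τ)
      rw [hNdC] at this
      rw [← this]
      conv_lhs => rw [← hwτ]
    rw [e2, e3, mul_pow] at h2
    linear_combination h1 - h2
  refine (AnalyticAt.analyticOrderAt_eq_natCast (AnalyticAt.congr ?_ (EventuallyEq.symm hev))).2
    ⟨_, hu.sub ((hρa.pow m).mul huw), ?_, by simpa using hev⟩
  · exact ((analyticAt_id.sub analyticAt_const).pow m).mul (hu.sub ((hρa.pow m).mul huw))
  · intro h0
    simp only [Pi.sub_apply, Pi.mul_apply, Pi.pow_apply, hwτ] at h0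
    have hρ1 : ρ τ ^ m = 1 := by
      have : u τ * (1 - ρ τ ^ m) = 0 := by linear_combination h0
      rcases mul_eq_zero.1 this with h | h
      · exact absurd h hu0
      · linear_combination -h
    obtain ⟨γ', hγ', hγτ', A', B', C', D', hc', hd', hz⟩ :=
      exists_gamma_multiplier hm hu hu0 hum hρ1
    refine hNs (mem_scalarClass_of_multiplier hn hγ' hN hNd hc' hd' hNτ hγτ' ?_)
    have hl := hlin τ
    simp only [ρ] at hz
    generalize (10 * C' * τ + D' : ℂ) = v at hz ⊢
    generalize (10 * C * τ + D : ℂ) = v' at hz hl ⊢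
    rw [div_mul_eq_mul_div, div_eq_one_iff_eq (mul_ne_zero hl hl)] at hz
    rw [hz]; ring

/-! ### Representatives of integral matrices modulo the group of level ten -/

/-- The matrix `[a, b; 0, d]`. -/
def upMat (a b d : ℝ) : GL (Fin 2) ℝ := if h : 0 < a * d - b * 0 then gl a b 0 d h else 1

lemma upMat_coe {a b d : ℝ} (h : 0 < a * d) : (upMat a b d).1 = !![a, b; 0, d] := by
  rw [upMat, dif_pos (by simpa using h), gl_coe]

lemma upMat_smul {a b d : ℝ} (h : 0 < a * d) (τ : ℍ) :
    ((upMat a b d • τ : ℍ) : ℂ) = (a * τ + b) / d := by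
  rw [smul_of_coe (upMat_coe h) (by simpa using h)]; simp

/-- Factorizations `n = a d` with `e ∣ a`. -/
def factorPairs (e : ℤ) (n : ℕ) : Finset (ℕ × ℕ) :=
  n.divisorsAntidiagonal.filter fun p ↦ e ∣ p.1

lemma mem_factorPairs {e : ℤ} {n : ℕ} {p : ℕ × ℕ} :
    p ∈ factorPairs e n ↔ (p.1 * p.2 = n ∧ n ≠ 0) ∧ e ∣ p.1 := by
  simp [factorPairs, Nat.mem_divisorsAntidiagonal]

lemma factorPairs_pos {e : ℤ} {n : ℕ} {p : ℕ × ℕ} (h : p ∈ factorPairs e n) :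
    0 < p.1 ∧ 0 < p.2 := by
  obtain ⟨⟨h1, h2⟩, -⟩ := mem_factorPairs.1 h
  rw [← h1] at h2
  exact ⟨Nat.pos_of_ne_zero (left_ne_zero_of_mul h2), Nat.pos_of_ne_zero (right_ne_zero_of_mul h2)⟩

/-- Indices of the representatives. -/
abbrev RepIndex := Σ _ : ℤ, Σ _ : ℕ × ℕ, ℕ

/-- The index set of the representatives of the integral matrices of determinant `n`. -/
def repSet (n : ℕ) : Finset RepIndex :=
  ed.sigma fun e ↦ (factorPairs e n).sigma fun p ↦ Finset.range (e.toNat * p.2)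

/-- The representative with a given index. -/
def repMat (i : RepIndex) : GL (Fin 2) ℝ :=
  alW i.1 * upMat (i.2.1.1 / i.1) (i.2.2 / i.1) i.2.1.2

lemma mem_repSet {n : ℕ} {i : RepIndex} :
    i ∈ repSet n ↔ i.1 ∈ ed ∧ i.2.1 ∈ factorPairs i.1 n ∧ i.2.2 < i.1.toNat * i.2.1.2 := by
  simp [repSet]

lemma alSet_entries {e f : ℤ} (he : 0 < e) (hf : 10 = e * f) {W : GL (Fin 2) ℝ} (hW : W ∈ alSet e) :
    ∃ x y z w : ℤ, W.1 = !![(e : ℝ) * x, (y : ℝ); 10 * (z : ℝ), (e : ℝ) * w] ∧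
      e * x * w - f * y * z = 1 := by
  obtain ⟨x, y, z, w, h, h'⟩ := hW
  refine ⟨x, y, z, w, h, ?_⟩
  have : e * (e * x * w - f * y * z) = e * 1 := by
    rw [hf] at h'; linear_combination h'
  exact mul_left_cancel₀ he.ne' this

lemma mul_upMat_coe {e f x y z w a d β : ℤ} (he : 0 < e) (ha : 0 < a) (hd : 0 < d)
    (hf : 10 = e * f) {W : GL (Fin 2) ℝ}
    (hW : W.1 = !![(e : ℝ) * x, (y : ℝ); 10 * (z : ℝ), (e : ℝ) * w]) :
    (W * upMat (a / e) (β / e) d).1 =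
      !![(x * a : ℝ), x * β + y * d; f * z * a, f * z * β + e * w * d] := by
  have heR : (0 : ℝ) < e := by exact_mod_cast he
  have haR : (0 : ℝ) < a := by exact_mod_cast ha
  have hdR : (0 : ℝ) < d := by exact_mod_cast hd
  have hfR : (10 : ℝ) = e * f := by exact_mod_cast hf
  rw [Units.val_mul, hW, upMat_coe (by positivity), hfR]
  ext i j; fin_cases i <;> fin_cases j <;> simp <;> field_simp

lemma repMat_mem {n : ℕ} {i : RepIndex} (hi : i ∈ repSet n) : repMat i ∈ heckeSet n := by
  obtain ⟨e, ⟨a, d⟩, β⟩ := i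
  obtain ⟨he, hp, -⟩ := mem_repSet.1 hi
  obtain ⟨⟨hn, -⟩, a', ha'⟩ := mem_factorPairs.1 hp
  obtain ⟨ha, hd⟩ := factorPairs_pos hp
  simp only at he hp hn ha' ha hd
  obtain ⟨f, hf⟩ := ed_dvd he
  obtain ⟨x, y, z, w, hW, h1⟩ := alSet_entries (ed_pos he) hf (alW_mem he)
  have := mul_upMat_coe (a := a) (d := d) (β := β) (ed_pos he) (by exact_mod_cast ha)
    (by exact_mod_cast hd) hf hW
  simp only [Int.cast_natCast] at this
  refine ⟨x * a, x * β + y * d, z * a', f * z * β + e * w * d, ?_, ?_⟩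
  · have ha2 : (a : ℝ) = e * a' := by exact_mod_cast ha'
    have hfR : (10 : ℝ) = e * f := by exact_mod_cast hf
    simp only [repMat]
    rw [this, hfR]
    push_cast
    ext i j; fin_cases i <;> fin_cases j <;> simp
    rw [ha2]; ring
  · have : (n : ℤ) = a * d := by exact_mod_cast hn.symm
    rw [this, hf]
    linear_combination (a * d : ℤ) * h1 + ((x * β + y * d) * f * z : ℤ) * ha'

lemma isCoprime_of_eq {x y a b : ℤ} (h : x * a - y * b = 1) : IsCoprime x y :=
  ⟨a, -b, by linear_combination h⟩

lemma eq_of_mul_column {x z x' z' a a' : ℤ} (h : IsCoprime x z) (h' : IsCoprime x' z') (ha : 0 < a)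
    (ha' : 0 < a') (e1 : x * a = x' * a') (e2 : z * a = z' * a') : a = a' := by
  obtain ⟨u, v, h⟩ := h
  obtain ⟨u', v', h'⟩ := h'
  refine Int.dvd_antisymm ha.le ha'.le ⟨u' * x + v' * z, ?_⟩ ⟨u * x' + v * z', ?_⟩
  · linear_combination -a' * h' - u' * e1 - v' * e2
  · linear_combination -a * h + u * e1 + v * e2

lemma ed_eq_of_coprime {e e' f f' : ℤ} (he : e ∈ ed) (he' : e' ∈ ed) (hf : 10 = e * f)
    (hf' : 10 = e' * f') (h1 : IsCoprime e f') (h2 : IsCoprime e' f) : e = e' := by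
  rw [Int.isCoprime_iff_gcd_eq_one] at h1 h2
  obtain rfl : f = 10 / e := by rw [hf, Int.mul_ediv_cancel_left _ (ed_pos he).ne']
  obtain rfl : f' = 10 / e' := by rw [hf', Int.mul_ediv_cancel_left _ (ed_pos he').ne']
  have key : ∀ e ∈ ed, ∀ e' ∈ ed, e.gcd (10 / e') = 1 → e'.gcd (10 / e) = 1 → e = e' := by decide
  exact key e he e' he' h1 h2

/-- Distinct representatives are inequivalent. -/
lemma repMat_inj {n : ℕ} {i j : RepIndex} (hi : i ∈ repSet n) (hj : j ∈ repSet n)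
    {γ : GL (Fin 2) ℝ} (hγ : γ ∈ heckeSet 1) (h : repMat i = γ * repMat j) : i = j := by
  obtain ⟨e, ⟨a, d⟩, β⟩ := i
  obtain ⟨e', ⟨a', d'⟩, β'⟩ := j
  obtain ⟨he, hp, hβ⟩ := mem_repSet.1 hi
  obtain ⟨he', hp', hβ'⟩ := mem_repSet.1 hj
  obtain ⟨⟨hn, -⟩, -⟩ := mem_factorPairs.1 hp
  obtain ⟨⟨hn', -⟩, -⟩ := mem_factorPairs.1 hp'
  obtain ⟨ha, hd⟩ := factorPairs_pos hp
  obtain ⟨ha', hd'⟩ := factorPairs_pos hp'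
  simp only at he hp hn ha hd hβ he' hp' hn' ha' hd' hβ'
  obtain ⟨f, hf⟩ := ed_dvd he
  obtain ⟨f', hf'⟩ := ed_dvd he'
  obtain ⟨x, y, z, w, hW, h1⟩ := alSet_entries (ed_pos he) hf (alW_mem he)
  obtain ⟨x', y', z', w', hW', h1'⟩ := alSet_entries (ed_pos he') hf'
    (alSet_mul_gamma (ed_dvd he') (alW_mem he') hγ)
  have e1 := mul_upMat_coe (a := a) (d := d) (β := β) (ed_pos he) (by exact_mod_cast ha)
    (by exact_mod_cast hd) hf hW
  have e2 := mul_upMat_coe (a := a') (d := d') (β := β') (ed_pos he') (by exact_mod_cast ha')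
    (by exact_mod_cast hd') hf' hW'
  simp only [Int.cast_natCast] at e1 e2
  have h' := congrArg Units.val h
  simp only [repMat, ← mul_assoc] at h'
  rw [e1, e2] at h'
  have c00 := congrFun (congrFun h' 0) 0
  have c01 := congrFun (congrFun h' 0) 1
  have c10 := congrFun (congrFun h' 1) 0
  have c11 := congrFun (congrFun h' 1) 1
  simp only [Matrix.of_apply, Matrix.cons_val_zero, Matrix.cons_val_one, Matrix.cons_val'] at c00 c01 c10 c11
  norm_cast at c00 c01 c10 c11
  have haa : (a : ℤ) = a' := eq_of_mul_column (x := x) (z := f * z) (x' := x') (z' := f' * z')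
    (isCoprime_of_eq (a := e * w) (b := y) (by linear_combination h1))
    (isCoprime_of_eq (a := e' * w') (b := y') (by linear_combination h1'))
    (by exact_mod_cast ha) (by exact_mod_cast ha') c00 c10
  have ha0 : (a : ℤ) ≠ 0 := by exact_mod_cast ha.ne'
  rw [← haa] at c00 c10
  have hx := mul_right_cancel₀ ha0 c00
  have hz := mul_right_cancel₀ ha0 c10
  have hee : e = e' := by
    refine ed_eq_of_coprime he he' hf hf' ?_ ?_
    · refine isCoprime_of_eq (a := x * w) (b := y * z') ?_
      linear_combination h1 + y * hz
    · refine isCoprime_of_eq (a := x' * w') (b := y' * z) ?_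
      linear_combination h1' - y' * hz
  subst hee
  have haa' : a = a' := by exact_mod_cast haa
  subst haa'
  have hdd : d = d' := Nat.eq_of_mul_eq_mul_left ha (hn.trans hn'.symm)
  subst hdd
  have hff : f = f' := mul_left_cancel₀ (ed_pos he).ne' (hf.symm.trans hf')
  subst hff
  subst hx
  have hdvd : (e * d : ℤ) ∣ β - β' := by
    refine ⟨w * (y' - y) - y * (w' - w), ?_⟩
    linear_combination -(β - β' : ℤ) * h1 + e * w * c01 - y * c11 + y * β' * hz
  have hβ1 : (β : ℤ) < e * d := by
    have : (β : ℤ) < (e.toNat * d : ℕ) := by exact_mod_cast hβ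
    rwa [Nat.cast_mul, Int.toNat_of_nonneg (ed_pos he).le] at this
  have hβ2 : (β' : ℤ) < e * d := by
    have : (β' : ℤ) < (e.toNat * d : ℕ) := by exact_mod_cast hβ'
    rwa [Nat.cast_mul, Int.toNat_of_nonneg (ed_pos he).le] at this
  have : (β : ℤ) - β' = 0 := Int.eq_zero_of_abs_lt_dvd hdvd (by rw [abs_lt]; constructor <;> omega)
  have hb : β = β' := by omega
  rw [hb]

lemma exists_ed_of_dvd {f : ℤ} (hf : 0 < f) (h : f ∣ 10) : ∃ e ∈ ed, 10 = e * f ∧ IsCoprime e f := by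
  have : f ≤ 10 := Int.le_of_dvd (by norm_num) h
  obtain ⟨e, he⟩ := h
  have key : ∀ f ∈ Finset.Icc (1 : ℤ) 10, f ∣ 10 → 10 / f ∈ ed ∧ 10 = 10 / f * f ∧ (10 / f).gcd f = 1 := by
    decide
  obtain ⟨h1, h2, h3⟩ := key f (Finset.mem_Icc.2 ⟨hf, this⟩) ⟨e, he⟩
  exact ⟨_, h1, h2, Int.isCoprime_iff_gcd_eq_one.2 h3⟩

/-- Every integral matrix of level ten is equivalent to a representative. -/
lemma exists_repMat {n : ℕ} (hn : 0 < n) {M : GL (Fin 2) ℝ} (hM : M ∈ heckeSet n) :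
    ∃ i ∈ repSet n, ∃ γ ∈ heckeSet 1, M = γ * repMat i := by
  obtain ⟨A, B, C, D, hMc, hdet⟩ := hM
  have hn' : (0 : ℤ) < n := by exact_mod_cast hn
  have hne : A ≠ 0 ∨ 10 * C ≠ 0 := by
    by_contra! h
    have : A * D - B * (10 * C) = n := by linarith
    rw [h.1, h.2] at this; simp at this; omega
  obtain ⟨g, p, c, hg, hpc, hA, hC⟩ : ∃ g p c : ℤ, 0 < g ∧ IsCoprime p c ∧ A = p * g ∧ 10 * C = c * g := by
    obtain ⟨p, c, h1, h2, h3⟩ := Int.exists_gcd_one (m := A) (n := 10 * C)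
      (Int.gcd_pos_iff.2 hne)
    exact ⟨_, p, c, by exact_mod_cast Int.gcd_pos_iff.2 hne, Int.isCoprime_iff_gcd_eq_one.2 h1, h2, h3⟩
  obtain ⟨f, c', t, hf, hct, hc, ht⟩ : ∃ f c' t : ℤ, 0 < f ∧ IsCoprime c' t ∧ c = c' * f ∧ 10 = t * f := by
    have h0 : 0 < Int.gcd c 10 := Int.gcd_pos_iff.2 (Or.inr (by norm_num))
    obtain ⟨p, c, h1, h2, h3⟩ := Int.exists_gcd_one h0
    exact ⟨_, p, c, by exact_mod_cast h0, Int.isCoprime_iff_gcd_eq_one.2 h1, h2, h3⟩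
  obtain ⟨e, he, hef, hcop⟩ := exists_ed_of_dvd hf ⟨t, by linarith⟩
  obtain rfl : t = e := mul_right_cancel₀ hf.ne' (ht.symm.trans hef)
  have he0 := ed_pos he
  have hCt : t * C = g * c' := by
    refine mul_right_cancel₀ hf.ne' ?_
    linear_combination hC - C * ht + g * hc
  obtain ⟨a', ha'⟩ : t ∣ g := hct.symm.dvd_of_dvd_mul_right ⟨C, hCt.symm⟩
  obtain ⟨w, y, hwy⟩ : ∃ w y : ℤ, t * p * w - f * y * c' = 1 := by
    have h1 : IsCoprime (t * p) (f * c') :=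
      IsCoprime.mul_left (hcop.mul_right hct.symm) (by rw [mul_comm]; rwa [hc] at hpc)
    obtain ⟨u, v, huv⟩ := h1
    exact ⟨u, -v, by linear_combination huv⟩
  obtain ⟨d, hd⟩ : ∃ d, d = p * D - f * c' * B := ⟨_, rfl⟩
  have hgd : g * d = n := by rw [hd, ← hdet]; linear_combination -D * hA + B * g * hc + B * hC
  have hd0 : 0 < d := by
    by_contra! h
    nlinarith [mul_nonneg hg.le (neg_nonneg.2 h)]
  obtain ⟨b, hb⟩ : ∃ b, b = t * w * B - y * D := ⟨_, rfl⟩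
  have heR : (0 : ℝ) < t := by exact_mod_cast he0
  have hgR : (0 : ℝ) < g := by exact_mod_cast hg
  have hdR : (0 : ℝ) < d := by exact_mod_cast hd0
  have htd : 0 < t * d := by positivity
  lift g to ℕ using hg.le
  lift d to ℕ using hd0.le
  obtain ⟨β, hβ⟩ := Int.eq_ofNat_of_zero_le (Int.emod_nonneg b htd.ne')
  have hβlt := Int.emod_lt_of_pos b htd
  have hbk := Int.emod_add_mul_ediv b (t * d)
  rw [hβ] at hβlt hbk
  generalize b / (t * d) = k at hbk
  have hi : (⟨t, ⟨(g, d), β⟩⟩ : RepIndex) ∈ repSet n := by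
    refine mem_repSet.2 ⟨he, mem_factorPairs.2 ⟨⟨by exact_mod_cast hgd, hn.ne'⟩, a', ha'⟩, ?_⟩
    have : (β : ℤ) < (t.toNat * d : ℕ) := by
      rw [Nat.cast_mul, Int.toNat_of_nonneg he0.le]; exact hβlt
    exact_mod_cast this
  have hdetW : (0 : ℝ) < (t * p : ℝ) * (t * w) - y * (10 * c') := by
    have h1 : t * p * (t * w) - y * (10 * c') = t := by linear_combination t * hwy - y * c' * ht
    have h2 : ((t * p * (t * w) - y * (10 * c') : ℤ) : ℝ) = t := by rw [h1]
    push_cast at h2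
    rw [h2]; exact heR
  have hW : gl (t * p) y (10 * c') (t * w) hdetW ∈ alSet t :=
    ⟨p, y, c', w, by rw [gl_coe], by linear_combination t * hwy - y * c' * ht⟩
  have hWT := alSet_gamma_mul (ed_dvd he) hW (glT_mem k)
  refine ⟨_, hi, _, alSet_mul_inv he0 (ed_dvd he) (alW_mem he) hWT, ?_⟩
  simp only [repMat, ← mul_assoc, inv_mul_cancel_right]
  rw [mul_assoc]
  refine gl_ext ?_
  have hup : (glT k * upMat (g / t) (β / t) d).1 = (upMat (g / t) (b / t) d).1 := by
    rw [Units.val_mul, glT, gl_coe, upMat_coe (by simp only [Int.cast_natCast] at hgR hdR; positivity),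
      upMat_coe (by simp only [Int.cast_natCast] at hgR hdR; positivity)]
    have : (b : ℝ) = β + t * d * k := by exact_mod_cast hbk.symm
    rw [this]
    ext i j; fin_cases i <;> fin_cases j <;> simp
    field_simp
  have := mul_upMat_coe (a := g) (d := d) (β := b) he0 hg hd0 ht (W := gl _ _ _ _ hdetW) (gl_coe ..)
  rw [Units.val_mul, hup, ← Units.val_mul]
  simp only [Int.cast_natCast] at this
  rw [this, hMc]
  have hcr : (10 * C : ℝ) = f * c' * g := by
    have : 10 * C = f * c' * g := by linear_combination hC + g * hc
    exact_mod_cast this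
  have hAr : (A : ℝ) = p * g := by exact_mod_cast hA
  have hBr : (B : ℝ) = p * b + y * d := by
    have : B = p * b + y * d := by rw [hb, hd]; linear_combination -B * hwy
    exact_mod_cast this
  have hDr : (D : ℝ) = f * c' * b + t * w * d := by
    have : D = f * c' * b + t * w * d := by rw [hb, hd]; linear_combination -D * hwy
    exact_mod_cast this
  rw [hcr, hAr, hBr, hDr]

lemma det_pos_of_repMat {n : ℕ} (hn : 0 < n) {i : RepIndex} (hi : i ∈ repSet n) :
    0 < (repMat i).det.val :=
  det_pos_of_hecke (by exact_mod_cast hn) (repMat_mem hi)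

lemma scalarClass_gamma_mul {γ M : GL (Fin 2) ℝ} (hγ : γ ∈ heckeSet 1) (h : M ∈ scalarClass) :
    γ * M ∈ scalarClass := by
  refine mem_scalarClass_of_gamma_mul (heckeSet_one_inv hγ) ?_
  rwa [inv_mul_cancel_left]

lemma scalarClass_mul_gamma {γ M : GL (Fin 2) ℝ} (hγ : γ ∈ heckeSet 1) (h : M ∈ scalarClass) :
    M * γ ∈ scalarClass := by
  obtain ⟨s, δ, hδ, e⟩ := h
  refine ⟨s, δ * γ, ?_, ?_⟩
  · have := heckeSet_mul hδ hγ
    rwa [one_mul] at this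
  · rw [Units.val_mul, e, Matrix.smul_mul, Units.val_mul]

lemma alSet_conj' {e : ℤ} (he : e ∈ ed) {W γ : GL (Fin 2) ℝ}
    (hW : W ∈ alSet e) (hγ : γ ∈ heckeSet 1) : W * γ * W⁻¹ ∈ heckeSet 1 :=
  alSet_mul_inv (ed_pos he) (ed_dvd he) hW (alSet_gamma_mul (ed_dvd he) hW hγ)

lemma mem_scalarClass_of_conj {e : ℤ} (he : e ∈ ed) {W M : GL (Fin 2) ℝ}
    (hW : W ∈ alSet e) (h : W⁻¹ * (M * W) ∈ scalarClass) : M ∈ scalarClass := by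
  obtain ⟨s, δ, hδ, e⟩ := h
  refine ⟨s, W * δ * W⁻¹, alSet_conj' he hW hδ, ?_⟩
  rw [Units.val_mul, Units.val_mul, ← Matrix.smul_mul, ← Matrix.mul_smul, ← e, ← Units.val_mul,
    ← Units.val_mul]
  congr 1; group

open Classical in
/-- The indices of the non-scalar representatives. -/
def repSet' (n : ℕ) : Finset RepIndex := (repSet n).filter fun i ↦ repMat i ∉ scalarClass

lemma mem_repSet' {n : ℕ} {i : RepIndex} : i ∈ repSet' n ↔ i ∈ repSet n ∧ repMat i ∉ scalarClass := by
  simp [repSet']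

lemma exists_repMat' {n : ℕ} (hn : 0 < n) {M : GL (Fin 2) ℝ} (hM : M ∈ heckeSet n)
    (hs : M ∉ scalarClass) : ∃ i ∈ repSet' n, ∃ γ ∈ heckeSet 1, M = γ * repMat i := by
  obtain ⟨i, hi, γ, hγ, h⟩ := exists_repMat hn hM
  exact ⟨i, mem_repSet'.2 ⟨hi, fun h' ↦ hs (h ▸ scalarClass_gamma_mul hγ h')⟩, γ, hγ, h⟩

/-- A product over representatives may be reindexed by any map that acts injectively on classes. -/
lemma prod_repMat_reindex {n : ℕ} (hn : 0 < n) (T : GL (Fin 2) ℝ → GL (Fin 2) ℝ)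
    (hT : ∀ M ∈ heckeSet n, M ∉ scalarClass → T M ∈ heckeSet n ∧ T M ∉ scalarClass)
    (hinj : ∀ M M' γ, γ ∈ heckeSet 1 → T M = γ * T M' → ∃ δ ∈ heckeSet 1, M = δ * M')
    (F : GL (Fin 2) ℝ → ℂ) (hF : ∀ γ ∈ heckeSet 1, ∀ M, F (γ * M) = F M) :
    ∏ i ∈ repSet' n, F (T (repMat i)) = ∏ i ∈ repSet' n, F (repMat i) := by
  have h1 : ∀ i : repSet' n, ∃ j : repSet' n, ∃ γ ∈ heckeSet 1, T (repMat i.1) = γ * repMat j.1 := by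
    rintro ⟨i, hi⟩
    obtain ⟨hi1, hi2⟩ := mem_repSet'.1 hi
    obtain ⟨j, hj, γ, hγ, h⟩ := exists_repMat' hn (hT _ (repMat_mem hi1) hi2).1
      (hT _ (repMat_mem hi1) hi2).2
    exact ⟨⟨j, hj⟩, γ, hγ, h⟩
  choose σ γ hγ hσ using h1
  have hσi : Function.Injective σ := by
    intro i j hij
    obtain ⟨δ, hδ, h⟩ := hinj (repMat i.1) (repMat j.1) (γ i * (γ j)⁻¹) (by
      have := heckeSet_mul (hγ i) (heckeSet_one_inv (hγ j))
      rwa [one_mul] at this) (by rw [hσ i, hσ j, hij]; group)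
    exact Subtype.ext (repMat_inj (mem_repSet'.1 i.2).1 (mem_repSet'.1 j.2).1 hδ h)
  rw [← Finset.prod_coe_sort, ← Finset.prod_coe_sort (repSet' n)]
  refine Fintype.prod_bijective σ (Finite.injective_iff_bijective.1 hσi) _ _ fun i ↦ ?_
  rw [hσ i, hF _ (hγ i)]

/-- The modular polynomial of the hauptmodul on the diagonal, without its scalar factor. -/
def diagProd (n : ℕ) (τ : ℍ) : ℂ := ∏ i ∈ repSet' n, (hauptG τ - hauptG (repMat i • τ))

lemma mdiff_prod {ι : Type*} (s : Finset ι) {f : ι → ℍ → ℂ} (h : ∀ i ∈ s, MDiff (f i)) :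
    MDiff (fun τ ↦ ∏ i ∈ s, f i τ) := by
  classical
  induction s using Finset.induction_on with
  | empty => simpa using mdiff_const 1
  | insert a s ha ih =>
    simp only [Finset.prod_insert ha]
    exact mdiff_mul (h a (Finset.mem_insert_self ..)) (ih fun i hi ↦ h i (Finset.mem_insert_of_mem hi))

lemma mdiff_diagProd {n : ℕ} (hn : 0 < n) : MDiff (diagProd n) :=
  mdiff_prod _ fun _ hi ↦ mdiff_sub mdiff_hauptG
    (mdiff_smul mdiff_hauptG (det_pos_of_repMat hn (mem_repSet'.1 hi).1))

lemma gammaInv_diagProd {n : ℕ} (hn : 0 < n) : GammaInv (diagProd n) := by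
  intro γ hγ τ
  have := prod_repMat_reindex hn (fun M ↦ M * γ)
    (fun M hM hs ↦ ⟨by simpa using heckeSet_mul hM hγ, fun h ↦ hs (by
      simpa using scalarClass_mul_gamma (heckeSet_one_inv hγ) h)⟩)
    (fun M M' δ hδ h ↦ ⟨δ, hδ, by
      rw [← mul_assoc] at h; exact mul_right_cancel h⟩)
    (fun M ↦ hauptG τ - hauptG (M • τ))
    (fun δ hδ M ↦ by rw [mul_smul, gammaInv_hauptG δ hδ])
  rw [diagProd, diagProd, ← this]
  refine Finset.prod_congr rfl fun i _ ↦ ?_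
  rw [gammaInv_hauptG γ hγ, mul_smul]

lemma diagProd_alW {n : ℕ} (hn : 0 < n) {e : ℤ} (he : e ∈ ed) (τ : ℍ) :
    diagProd n (alW e • τ) =
      ∏ i ∈ repSet' n, (hauptG (alW e • τ) - hauptG (alW e • repMat i • τ)) := by
  have hn' : (0 : ℤ) < n := by exact_mod_cast hn
  have := prod_repMat_reindex hn (fun M ↦ (alW e)⁻¹ * (M * alW e))
    (fun M hM hs ↦ ⟨alSet_conj hn' (ed_pos he) (ed_dvd he) (alW_mem he) hM,
      fun h ↦ hs (mem_scalarClass_of_conj he (alW_mem he) h)⟩)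
    (fun M M' δ hδ h ↦ ⟨_, alSet_conj' he (alW_mem he) hδ, by
      have h2 : M = alW e * ((alW e)⁻¹ * (M * alW e)) * (alW e)⁻¹ := by group
      rw [h2, h]; group⟩)
    (fun M ↦ hauptG (alW e • τ) - hauptG (alW e • M • τ))
    (fun δ hδ M ↦ by
      rw [mul_smul]
      exact congrArg _ (gammaInv_hauptG.comp_alSet he (alW_mem he) δ hδ (M • τ)))
  rw [diagProd, ← this]
  refine Finset.prod_congr rfl fun i _ ↦ ?_
  simp only [mul_smul, smul_inv_smul]

lemma diagProd_alW_eq {n : ℕ} (hn : 0 < n) {e : ℤ} (he : e ∈ ed') (τ : ℍ) :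
    diagProd n (alW e • τ) *
      ((hauptG τ - cuspVal e) ^ (repSet' n).card * ∏ i ∈ repSet' n, (hauptG (repMat i • τ) - cuspVal e)) =
      (-cuspLam e) ^ (repSet' n).card * diagProd n τ := by
  rw [diagProd_alW hn (ed'_sub he), ← Finset.prod_const, ← Finset.prod_mul_distrib,
    ← Finset.prod_mul_distrib, diagProd, ← Finset.prod_const, ← Finset.prod_mul_distrib]
  refine Finset.prod_congr rfl fun i _ ↦ ?_
  rw [hauptG_alW_eq he, hauptG_alW_eq he]
  have h1 := sub_ne_zero.2 (hauptG_ne_cuspVal he τ)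
  have h2 := sub_ne_zero.2 (hauptG_ne_cuspVal he (repMat i • τ))
  generalize hauptG (repMat i • τ) = u at *
  generalize hauptG τ = v at *
  field_simp
  ring

/-! ### Growth orders at infinity -/

/-- `F` grows like `|q|^{-N}` at infinity. -/
def HasOrd (F : ℍ → ℂ) (N : ℝ) : Prop :=
  ∃ A : ℝ, 0 < A ∧ Tendsto (fun τ : ℍ ↦ ‖F τ‖ * Real.exp (-(2 * Real.pi * N * τ.im))) atImInfty (𝓝 A)

lemma HasOrd.mul {F G : ℍ → ℂ} {N M : ℝ} (hF : HasOrd F N) (hG : HasOrd G M) :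
    HasOrd (fun τ ↦ F τ * G τ) (N + M) := by
  obtain ⟨A, hA, h1⟩ := hF
  obtain ⟨B, hB, h2⟩ := hG
  refine ⟨A * B, mul_pos hA hB, (h1.mul h2).congr fun τ ↦ ?_⟩
  rw [norm_mul, show -(2 * Real.pi * (N + M) * τ.im) =
    -(2 * Real.pi * N * τ.im) + -(2 * Real.pi * M * τ.im) by ring, Real.exp_add]
  ring

lemma HasOrd.inv {F : ℍ → ℂ} {N : ℝ} (hF : HasOrd F N) : HasOrd (fun τ ↦ (F τ)⁻¹) (-N) := by
  obtain ⟨A, hA, h1⟩ := hF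
  refine ⟨A⁻¹, inv_pos.2 hA, (h1.inv₀ hA.ne').congr fun τ ↦ ?_⟩
  rw [mul_inv, ← Real.exp_neg, norm_inv]
  congr 2; ring

lemma hasOrd_of_tendsto {F : ℍ → ℂ} {c : ℂ} (hc : c ≠ 0) (h : Tendsto F atImInfty (𝓝 c)) :
    HasOrd F 0 :=
  ⟨‖c‖, norm_pos_iff.2 hc, by simpa using h.norm⟩

lemma hasOrd_const {c : ℂ} (hc : c ≠ 0) : HasOrd (fun _ ↦ c) 0 :=
  hasOrd_of_tendsto hc tendsto_const_nhds

lemma HasOrd.div {F G : ℍ → ℂ} {N M : ℝ} (hF : HasOrd F N) (hG : HasOrd G M) :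
    HasOrd (fun τ ↦ F τ / G τ) (N - M) := by
  simpa only [div_eq_mul_inv, sub_eq_add_neg] using hF.mul hG.inv

lemma HasOrd.prod {ι : Type*} (s : Finset ι) {F : ι → ℍ → ℂ} {N : ι → ℝ}
    (h : ∀ i ∈ s, HasOrd (F i) (N i)) : HasOrd (fun τ ↦ ∏ i ∈ s, F i τ) (∑ i ∈ s, N i) := by
  classical
  induction s using Finset.induction_on with
  | empty => simpa using hasOrd_const one_ne_zero
  | insert a s ha ih =>
    simp only [Finset.prod_insert ha, Finset.sum_insert ha]
    exact (h a (Finset.mem_insert_self ..)).mul (ih fun i hi ↦ h i (Finset.mem_insert_of_mem hi))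

lemma HasOrd.pow {F : ℍ → ℂ} {N : ℝ} (hF : HasOrd F N) (k : ℕ) :
    HasOrd (fun τ ↦ F τ ^ k) (k * N) := by
  simpa using HasOrd.prod (Finset.range k) fun _ _ ↦ hF

lemma tendsto_im_atImInfty : Tendsto (fun τ : ℍ ↦ τ.im) atImInfty atTop := tendsto_comap

lemma HasOrd.not_lt {F : ℍ → ℂ} {N M : ℝ} (hF : HasOrd F N) (hG : HasOrd F M) : ¬ N < M := by
  intro h
  obtain ⟨A, hA, h1⟩ := hF
  obtain ⟨B, hB, h2⟩ := hG
  have h3 : Tendsto (fun τ : ℍ ↦ Real.exp (-(2 * Real.pi * (M - N) * τ.im))) atImInfty (𝓝 0) := by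
    refine Real.tendsto_exp_neg_atTop_nhds_zero.comp
      (tendsto_im_atImInfty.const_mul_atTop (mul_pos Real.two_pi_pos (sub_pos.2 h)))
  have h4 := h1.mul h3
  rw [mul_zero] at h4
  refine hB.ne' (tendsto_nhds_unique h2 (h4.congr fun τ ↦ ?_))
  rw [mul_assoc, ← Real.exp_add]
  congr 2; ring

lemma HasOrd.unique {F : ℍ → ℂ} {N M : ℝ} (hF : HasOrd F N) (hG : HasOrd F M) : N = M :=
  le_antisymm (_root_.not_lt.1 (hG.not_lt hF)) (_root_.not_lt.1 (hF.not_lt hG))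

lemma upMat_im {a b d : ℝ} (ha : 0 < a) (hd : 0 < d) (τ : ℍ) :
    (upMat a b d • τ : ℍ).im = a / d * τ.im := by
  have := congrArg Complex.im (upMat_smul (a := a) (b := b) (mul_pos ha hd) τ)
  rw [Complex.div_ofReal_im] at this
  simp only [coe_im, Complex.add_im, Complex.mul_im, Complex.ofReal_im, Complex.ofReal_re] at this
  rw [this]; ring

lemma tendsto_upMat {a b d : ℝ} (ha : 0 < a) (hd : 0 < d) :
    Tendsto (fun τ : ℍ ↦ upMat a b d • τ) atImInfty atImInfty := by
  refine tendsto_comap_iff.2 ?_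
  have := tendsto_im_atImInfty.const_mul_atTop (div_pos ha hd)
  exact this.congr fun τ ↦ (upMat_im ha hd τ).symm

lemma HasOrd.comp_upMat {F : ℍ → ℂ} {N : ℝ} (hF : HasOrd F N) {a b d : ℝ} (ha : 0 < a) (hd : 0 < d) :
    HasOrd (fun τ ↦ F (upMat a b d • τ)) (N * (a / d)) := by
  obtain ⟨A, hA, h1⟩ := hF
  refine ⟨A, hA, (h1.comp (tendsto_upMat ha hd (b := b))).congr fun τ ↦ ?_⟩
  simp only [Function.comp_apply, upMat_im ha hd]
  congr 3; ring

lemma hasOrd_of_mul_qc {F : ℍ → ℂ} {A : ℂ} {N : ℤ} (hA : A ≠ 0)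
    (h : Tendsto (fun τ : ℍ ↦ F τ * qc τ ^ N) atImInfty (𝓝 A)) : HasOrd F N := by
  refine ⟨‖A‖, norm_pos_iff.2 hA, h.norm.congr fun τ ↦ ?_⟩
  rw [norm_mul, norm_zpow, norm_qc, ← Real.rpow_intCast, ← Real.exp_mul, coe_im]
  congr 2; ring

lemma hasOrd_hauptG_sub (c : ℂ) : HasOrd (fun τ ↦ hauptG τ - c) 1 := by
  have := hasOrd_of_mul_qc (F := fun τ ↦ hauptG τ - c) (N := 1) one_ne_zero
    (by simpa [sub_eq_add_neg] using tendsto_hauptG_mul_add (-c))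
  simpa using this

lemma HasOrd.isBigO {F : ℍ → ℂ} {N : ℝ} (hF : HasOrd F N) :
    ∃ B : ℕ, F =O[atImInfty] fun τ : ℍ ↦ (qc τ)⁻¹ ^ B := by
  obtain ⟨B, hB⟩ := exists_nat_ge N
  refine ⟨B, ?_⟩
  obtain ⟨A, hA, h⟩ := hF
  refine Asymptotics.IsBigO.of_bound (A + 1) ?_
  filter_upwards [h.eventually (gt_mem_nhds (lt_add_one A))] with τ hτ
  rw [norm_pow, norm_inv, norm_qc, ← Real.exp_neg, ← Real.exp_nat_mul]
  rw [Real.exp_neg, ← div_eq_mul_inv, div_lt_iff₀ (Real.exp_pos _)] at hτ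
  refine hτ.le.trans (mul_le_mul_of_nonneg_left (Real.exp_le_exp.2 ?_) (by positivity))
  simp only [neg_neg, coe_im]
  have := mul_le_mul_of_nonneg_right hB (mul_pos Real.two_pi_pos τ.im_pos).le
  linarith

/-! ### Two-term expansions at infinity -/

/-- `F q^N = A (1 - s₁ q + (s₁² - s₂) / 2 q² + o(q²))`; the numbers `N`, `s₁`, `s₂` add up
under products. -/
def Jet (F : ℍ → ℂ) (N : ℤ) (s₁ s₂ : ℂ) : Prop :=
  ∃ A : ℂ, A ≠ 0 ∧ (fun τ : ℍ ↦ F τ * qc τ ^ N - A * (1 - s₁ * qc τ + (s₁ ^ 2 - s₂) / 2 * qc τ ^ 2))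
    =o[atImInfty] fun τ : ℍ ↦ qc τ ^ 2

lemma qc_isBigO_one (k : ℕ) : (fun τ : ℍ ↦ qc τ ^ k) =O[atImInfty] fun _ ↦ (1 : ℂ) :=
  (tendsto_qc_nhds.pow k).isBigO_one ℂ

lemma quad_isBigO_one (A a b : ℂ) :
    (fun τ : ℍ ↦ A * (1 - a * qc τ + b * qc τ ^ 2)) =O[atImInfty] fun _ ↦ (1 : ℂ) := by
  refine Tendsto.isBigO_one ℂ (c := A * (1 - a * 0 + b * 0 ^ 2)) ?_
  exact ((tendsto_const_nhds.sub (tendsto_qc_nhds.const_mul a)).add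
    ((tendsto_qc_nhds.pow 2).const_mul b)).const_mul A

lemma qc_sq_isLittleO_one : (fun τ : ℍ ↦ qc τ ^ 2) =o[atImInfty] fun _ ↦ (1 : ℂ) := by
  rw [Asymptotics.isLittleO_one_iff]
  simpa using tendsto_qc_nhds.pow 2

lemma qc_pow_isLittleO {k : ℕ} (hk : 2 < k) :
    (fun τ : ℍ ↦ qc τ ^ k) =o[atImInfty] fun τ : ℍ ↦ qc τ ^ 2 := by
  have h : (fun τ : ℍ ↦ qc τ ^ (k - 2)) =o[atImInfty] fun _ ↦ (1 : ℂ) := by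
    rw [Asymptotics.isLittleO_one_iff]
    simpa [zero_pow (by omega : k - 2 ≠ 0)] using tendsto_qc_nhds.pow (k - 2)
  have := h.mul_isBigO (Asymptotics.isBigO_refl (fun τ : ℍ ↦ qc τ ^ 2) _)
  refine this.congr (fun τ ↦ ?_) (fun τ ↦ one_mul _)
  rw [← pow_add]; congr 1; omega

lemma Jet.mul {F G : ℍ → ℂ} {N M : ℤ} {s₁ s₂ t₁ t₂ : ℂ} (hF : Jet F N s₁ s₂) (hG : Jet G M t₁ t₂) :
    Jet (fun τ ↦ F τ * G τ) (N + M) (s₁ + t₁) (s₂ + t₂) := by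
  obtain ⟨A, hA, h1⟩ := hF
  obtain ⟨B, hB, h2⟩ := hG
  refine ⟨A * B, mul_ne_zero hA hB, ?_⟩
  have h1' : (fun τ : ℍ ↦ F τ * qc τ ^ N) =O[atImInfty] fun _ ↦ (1 : ℂ) := by
    have := (h1.trans qc_sq_isLittleO_one).isBigO.add (quad_isBigO_one A s₁ ((s₁ ^ 2 - s₂) / 2))
    exact this.congr_left fun τ ↦ by ring
  have e1 := h1'.mul_isLittleO h2
  have e2 := h1.mul_isBigO (quad_isBigO_one B t₁ ((t₁ ^ 2 - t₂) / 2))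
  simp only [one_mul, mul_one] at e1 e2
  have e3 := (qc_pow_isLittleO (k := 3) (by norm_num)).const_mul_left
    (A * B * (-s₁ * (t₁ ^ 2 - t₂) / 2 - t₁ * (s₁ ^ 2 - s₂) / 2))
  have e4 := (qc_pow_isLittleO (k := 4) (by norm_num)).const_mul_left
    (A * B * ((s₁ ^ 2 - s₂) / 2 * ((t₁ ^ 2 - t₂) / 2)))
  refine (((e1.add e2).add e3).add e4).congr_left fun τ ↦ ?_
  rw [zpow_add₀ (qc_ne_zero _)]
  ring

lemma jet_const {A : ℂ} (hA : A ≠ 0) : Jet (fun _ ↦ A) 0 0 0 :=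
  ⟨A, hA, by simp⟩

lemma Jet.prod {ι : Type*} (s : Finset ι) {F : ι → ℍ → ℂ} {N : ι → ℤ} {s₁ s₂ : ι → ℂ}
    (h : ∀ i ∈ s, Jet (F i) (N i) (s₁ i) (s₂ i)) :
    Jet (fun τ ↦ ∏ i ∈ s, F i τ) (∑ i ∈ s, N i) (∑ i ∈ s, s₁ i) (∑ i ∈ s, s₂ i) := by
  classical
  induction s using Finset.induction_on with
  | empty => simpa using jet_const one_ne_zero
  | insert a s ha ih =>
    simp only [Finset.prod_insert ha, Finset.sum_insert ha]
    exact (h a (Finset.mem_insert_self ..)).mul (ih fun i hi ↦ h i (Finset.mem_insert_of_mem hi))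

lemma Jet.pow {F : ℍ → ℂ} {N : ℤ} {s₁ s₂ : ℂ} (hF : Jet F N s₁ s₂) (k : ℕ) :
    Jet (fun τ ↦ F τ ^ k) (k * N) (k * s₁) (k * s₂) := by
  simpa using Jet.prod (Finset.range k) fun _ _ ↦ hF

lemma Jet.congr {F G : ℍ → ℂ} {N : ℤ} {s₁ s₂ : ℂ} (hF : Jet F N s₁ s₂) (h : ∀ τ, F τ = G τ) :
    Jet G N s₁ s₂ := by
  rwa [← funext h]

lemma Jet.tendsto {F : ℍ → ℂ} {N : ℤ} {s₁ s₂ : ℂ} (hF : Jet F N s₁ s₂) :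
    ∃ A ≠ 0, Tendsto (fun τ : ℍ ↦ F τ * qc τ ^ N) atImInfty (𝓝 A) := by
  obtain ⟨A, hA, h⟩ := hF
  refine ⟨A, hA, ?_⟩
  have h1 := (Asymptotics.isLittleO_one_iff ℂ).1 (h.trans qc_sq_isLittleO_one)
  have h2 : Tendsto (fun τ : ℍ ↦ A * (1 - s₁ * qc τ + (s₁ ^ 2 - s₂) / 2 * qc τ ^ 2)) atImInfty
      (𝓝 (A * (1 - s₁ * 0 + (s₁ ^ 2 - s₂) / 2 * 0 ^ 2))) :=
    ((tendsto_const_nhds.sub (tendsto_qc_nhds.const_mul _)).add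
      ((tendsto_qc_nhds.pow 2).const_mul _)).const_mul A
  have := h1.add h2
  simp only [mul_zero, sub_zero, zero_add, zero_pow two_ne_zero, add_zero, mul_one] at this
  exact this.congr fun τ ↦ by ring

lemma Jet.hasOrd {F : ℍ → ℂ} {N : ℤ} {s₁ s₂ : ℂ} (hF : Jet F N s₁ s₂) : HasOrd F N := by
  obtain ⟨A, hA, h⟩ := hF.tendsto
  exact hasOrd_of_mul_qc hA h

lemma quad_eq_zero {a b c : ℂ}
    (h : (fun τ : ℍ ↦ a + b * qc τ + c * qc τ ^ 2) =o[atImInfty] fun τ : ℍ ↦ qc τ ^ 2) :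
    a = 0 ∧ b = 0 ∧ c = 0 := by
  have h1 : Tendsto (fun τ : ℍ ↦ qc τ) atImInfty (𝓝 0) := tendsto_qc_nhds
  have ha : a = 0 := by
    have h2 := (Asymptotics.isLittleO_one_iff ℂ).1 (h.trans qc_sq_isLittleO_one)
    have h3 : Tendsto (fun τ : ℍ ↦ a + b * qc τ + c * qc τ ^ 2) atImInfty
      (𝓝 (a + b * 0 + c * 0 ^ 2)) :=
      (tendsto_const_nhds.add (h1.const_mul b)).add ((h1.pow 2).const_mul c)
    simpa using tendsto_nhds_unique h3 h2
  subst ha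
  have hq : ∀ τ : ℍ, qc τ ≠ 0 := fun τ ↦ qc_ne_zero _
  have h' := h.tendsto_div_nhds_zero
  have hb : b = 0 := by
    have h2 : Tendsto (fun τ : ℍ ↦ b + c * qc τ) atImInfty (𝓝 0) := by
      have := h'.mul h1
      rw [zero_mul] at this
      refine this.congr fun τ ↦ ?_
      have := hq τ
      generalize qc τ = u at *
      field_simp
      ring
    have h3 : Tendsto (fun τ : ℍ ↦ b + c * qc τ) atImInfty (𝓝 (b + c * 0)) :=
      tendsto_const_nhds.add (h1.const_mul c)
    simpa using tendsto_nhds_unique h3 h2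
  subst hb
  refine ⟨rfl, rfl, ?_⟩
  refine tendsto_nhds_unique (tendsto_const_nhds (x := c) (f := atImInfty)) (h'.congr fun τ ↦ ?_)
  have := hq τ
  generalize qc τ = u at *
  field_simp
  ring

lemma Jet.unique {F : ℍ → ℂ} {N M : ℤ} {s₁ s₂ t₁ t₂ : ℂ} (hF : Jet F N s₁ s₂) (hG : Jet F M t₁ t₂) :
    N = M ∧ s₁ = t₁ ∧ s₂ = t₂ := by
  have hNM : N = M := by exact_mod_cast hF.hasOrd.unique hG.hasOrd
  subst hNM
  refine ⟨rfl, ?_⟩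
  obtain ⟨A, hA, h1⟩ := hF
  obtain ⟨B, hB, h2⟩ := hG
  obtain ⟨e1, e2, e3⟩ := quad_eq_zero (a := B - A) (b := A * s₁ - B * t₁)
    (c := B * ((t₁ ^ 2 - t₂) / 2) - A * ((s₁ ^ 2 - s₂) / 2)) ((h1.sub h2).congr_left fun τ ↦ by ring)
  obtain rfl : B = A := by linear_combination e1
  obtain rfl : s₁ = t₁ := mul_left_cancel₀ hA (by linear_combination e2)
  refine ⟨rfl, ?_⟩
  refine mul_left_cancel₀ hA ?_
  linear_combination 2 * e3

lemma jet_of_sub_isLittleO {F : ℍ → ℂ} {s : ℂ}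
    (h : (fun τ : ℍ ↦ 1 - F τ - s * qc τ ^ 2) =o[atImInfty] fun τ : ℍ ↦ qc τ ^ 2) :
    Jet F 0 0 (2 * s) := by
  refine ⟨1, one_ne_zero, h.neg_left.congr_left fun τ ↦ ?_⟩
  simp; ring

lemma jet_hauptG_sub (X : ℂ) : Jet (fun τ ↦ hauptG τ - X) 1 X (X ^ 2 - 2) := by
  refine ⟨1, one_ne_zero, ?_⟩
  have h := hauptG_isBigO.mul (Asymptotics.isBigO_refl (fun τ : ℍ ↦ qc τ) atImInfty)
  have h2 : (fun τ : ℍ ↦ qc τ ^ 2 * qc τ) =o[atImInfty] fun τ : ℍ ↦ qc τ ^ 2 :=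
    (qc_pow_isLittleO (k := 3) (by norm_num)).congr_left fun τ ↦ by ring
  refine (h.trans_isLittleO h2).congr_left fun τ ↦ ?_
  have := qc_ne_zero (τ : ℂ)
  rw [zpow_one]
  field_simp
  ring

/-! ### Fractional powers of `q` -/

/-- The `D`-th root of `q^a` singled out by `β`. -/
def rt (a D β : ℕ) (τ : ℍ) : ℂ := qc ((a * τ + β) / D)

lemma rt_pow {D : ℕ} (hD : 0 < D) (a β : ℕ) (τ : ℍ) : rt a D β τ ^ D = qc τ ^ a := by
  have hD' : (D : ℂ) ≠ 0 := by exact_mod_cast hD.ne'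
  rw [rt, ← qc_nat_mul, ← qc_nat_mul, mul_div_cancel₀ _ hD', qc_add]
  have := qc_intCast β
  simp only [Int.cast_natCast] at this
  rw [this, mul_one]

lemma rt_eq (a : ℕ) {D : ℕ} (β : ℕ) (τ : ℍ) :
    rt a D β τ = cexp (2 * Real.pi * I / D) ^ β * rt a D 0 τ := by
  simp only [rt, qc]
  rw [← Complex.exp_nat_mul, ← Complex.exp_add]
  congr 1
  push_cast
  ring

lemma sum_rt_pow {D : ℕ} (hD : 0 < D) (a : ℕ) {m : ℕ} (hm : 0 < m) (hm' : m < D) (τ : ℍ) :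
    ∑ β ∈ Finset.range D, rt a D β τ ^ m = 0 := by
  have hp := Complex.isPrimitiveRoot_exp D hD.ne'
  set ζ := cexp (2 * Real.pi * I / D)
  have h1 : (ζ ^ m) ≠ 1 := hp.pow_ne_one_of_pos_of_lt hm.ne' hm'
  have h2 : ∑ β ∈ Finset.range D, (ζ ^ m) ^ β = 0 := by
    have := geom_sum_mul (ζ ^ m) D
    rw [pow_right_comm, hp.pow_eq_one, one_pow, sub_self] at this
    exact (mul_eq_zero.1 this).resolve_right (sub_ne_zero.2 h1)
  calc _ = ∑ β ∈ Finset.range D, (ζ ^ m) ^ β * rt a D 0 τ ^ m := by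
        refine Finset.sum_congr rfl fun β _ ↦ ?_
        rw [rt_eq, mul_pow, ← pow_mul, ← pow_mul, mul_comm β]
    _ = 0 := by rw [← Finset.sum_mul, h2, zero_mul]

lemma tendsto_rt {a D : ℕ} (ha : 0 < a) (hD : 0 < D) (β : ℕ) :
    Tendsto (rt a D β) atImInfty (𝓝 0) := by
  rw [tendsto_zero_iff_norm_tendsto_zero]
  have h : Tendsto (fun τ : ℍ ↦ (a / D : ℝ) * τ.im) atImInfty atTop :=
    tendsto_im_atImInfty.const_mul_atTop (by positivity)
  refine (Real.tendsto_exp_neg_atTop_nhds_zero.comp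
    (h.const_mul_atTop Real.two_pi_pos)).congr fun τ ↦ ?_
  simp only [rt, norm_qc, Complex.div_natCast_im, Function.comp_apply]
  simp [mul_div_right_comm]

lemma rt_pow_succ_isLittleO {a D : ℕ} (ha : 0 < a) (hD : 0 < D) (β : ℕ) :
    (fun τ ↦ rt a D β τ ^ (D + 1)) =o[atImInfty] fun τ : ℍ ↦ qc τ ^ a := by
  have h := ((Asymptotics.isLittleO_one_iff ℂ).2 (tendsto_rt ha hD β)).mul_isBigO
    (Asymptotics.isBigO_refl (fun τ : ℍ ↦ qc τ ^ a) atImInfty)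
  refine h.congr (fun τ ↦ ?_) (fun τ ↦ one_mul _)
  rw [pow_succ, rt_pow hD, mul_comm]

/-- The trace of a power series over the conjugate roots of `q^a`. -/
lemma sum_rt_isLittleO {H : ℂ → ℂ} {P : FormalMultilinearSeries ℂ ℂ ℂ}
    (hH : HasFPowerSeriesAt H P 0) {a D : ℕ} (ha : 0 < a) (hD : 0 < D) :
    (fun τ ↦ ∑ β ∈ Finset.range D, H (rt a D β τ) - D * P.coeff 0 - D * P.coeff D * qc τ ^ a)
      =o[atImInfty] fun τ : ℍ ↦ qc τ ^ a := by
  have h1 := hH.isBigO_sub_partialSum_pow (D + 1)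
  simp only [zero_add] at h1
  have h2 : ∀ β ∈ Finset.range D, (fun τ ↦ H (rt a D β τ) - P.partialSum (D + 1) (rt a D β τ))
      =o[atImInfty] fun τ : ℍ ↦ qc τ ^ a := fun β _ ↦ by
    have h3 := h1.comp_tendsto (tendsto_rt ha hD β)
    refine Asymptotics.IsBigO.trans_isLittleO h3 ?_
    refine Asymptotics.IsLittleO.congr_left (rt_pow_succ_isLittleO ha hD β).norm_left fun τ ↦ ?_
    simp
  refine (Asymptotics.IsLittleO.fun_sum h2).congr_left fun τ ↦ ?_
  rw [Finset.sum_sub_distrib, sub_sub]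
  congr 1
  have h4 : ∀ w, P.partialSum (D + 1) w =
      P.coeff 0 + ∑ m ∈ Finset.Ico 1 D, w ^ m * P.coeff m + w ^ D * P.coeff D := fun w ↦ by
    simp only [FormalMultilinearSeries.partialSum, FormalMultilinearSeries.apply_eq_prod_smul_coeff,
      Finset.prod_const, Finset.card_univ, Fintype.card_fin, smul_eq_mul]
    rw [Finset.sum_range_succ, Finset.range_eq_Ico, Finset.sum_eq_sum_Ico_succ_bot hD]
    simp
  simp only [h4, rt_pow hD, Finset.sum_add_distrib, Finset.sum_const, Finset.card_range, nsmul_eq_mul]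
  rw [Finset.sum_comm, Finset.sum_eq_zero (s := Finset.Ico 1 D)]
  · ring
  · intro m hm
    rw [Finset.mem_Ico] at hm
    rw [← Finset.sum_mul, sum_rt_pow hD a hm.1 hm.2, zero_mul]

lemma prod_sub_rt {D : ℕ} (hD : 0 < D) (a : ℕ) (x : ℂ) (τ : ℍ) :
    ∏ β ∈ Finset.range D, (x - (rt a D β τ)⁻¹) = x ^ D - (qc τ ^ a)⁻¹ := by
  have hp := (Complex.isPrimitiveRoot_exp D hD.ne').inv
  have h1 := hp.pow_sub_pow_eq_prod_sub_mul x (rt a D 0 τ)⁻¹ hD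
  rw [inv_pow, rt_pow hD] at h1
  rw [h1, Polynomial.nthRootsFinset_def, Finset.prod_eq_multiset_prod,
    Finset.prod_eq_multiset_prod, Multiset.toFinset_val, hp.nthRoots_one_nodup.dedup,
    hp.nthRoots_eq (one_pow D), Multiset.map_map, Finset.range_val]
  congr 1
  refine Multiset.map_congr rfl fun β _ ↦ ?_
  simp only [Function.comp_apply, mul_one]
  rw [rt_eq a β τ, mul_inv, inv_pow]

/-! ### The product of factors close to one -/

lemma prod_one_sub_isLittleO {ι : Type*} (s : Finset ι) {x : ι → ℍ → ℂ}
    (h : ∀ i ∈ s, x i =o[atImInfty] fun τ : ℍ ↦ qc τ) :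
    (fun τ ↦ 1 - ∏ i ∈ s, (1 - x i τ) - ∑ i ∈ s, x i τ) =o[atImInfty] fun τ : ℍ ↦ qc τ ^ 2 := by
  classical
  induction s using Finset.induction_on with
  | empty => simp
  | insert j s hj ih =>
    have ih := ih fun i hi ↦ h i (Finset.mem_insert_of_mem hi)
    have hx := h j (Finset.mem_insert_self ..)
    have hs := Asymptotics.IsLittleO.fun_sum fun i hi ↦ h i (Finset.mem_insert_of_mem (s := s) hi)
    have h1 : (fun τ ↦ 1 - x j τ) =O[atImInfty] fun _ ↦ (1 : ℂ) := by
      refine Tendsto.isBigO_one ℂ (c := 1 - 0) (tendsto_const_nhds.sub ?_)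
      exact (Asymptotics.isLittleO_one_iff ℂ).1
        (hx.trans_isBigO (by simpa using qc_isBigO_one 1))
    have h2 := (h1.mul_isLittleO ih).congr_right fun τ ↦ one_mul _
    have h3 := (hx.mul hs).congr_right fun τ ↦ (sq (qc τ)).symm
    refine (h2.sub h3).congr_left fun τ ↦ ?_
    rw [Finset.prod_insert hj, Finset.sum_insert hj]
    ring

/-! ### Expansions of the blocks of the diagonal product -/

lemma exists_series {c : ℤ → ℂ} (hc : HasQExp (jn 10) c (-1)) : ∃ G : ℂ → ℂ,
    HasFPowerSeriesAt G (FormalMultilinearSeries.ofScalars ℂ fun m : ℕ ↦ c m) 0 ∧ G 0 = 0 ∧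
      ∀ τ : ℍ, G (qc τ) = hauptG τ - (qc τ)⁻¹ := by
  have hs : ∀ w : ℂ, ‖w‖ < 1 → Summable fun m : ℕ ↦ c m * w ^ m := fun w hw ↦ by
    by_cases h0 : w = 0
    · exact summable_of_ne_finset_zero (s := {0}) fun m hm ↦ by
        simp only [Finset.mem_singleton] at hm; simp [h0, hm]
    · obtain ⟨τ, hτ⟩ := exists_qc_eq h0 hw
      exact hτ ▸ (hasSum_coeff' hc τ).summable
  refine ⟨fun w ↦ ∑' m : ℕ, c m * w ^ m, ⟨(2⁻¹ : NNReal), ?_, by simp, fun {y} hy ↦ ?_⟩, ?_,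
    fun τ ↦ (hasSum_coeff' hc τ).tsum_eq⟩
  · refine FormalMultilinearSeries.le_radius_of_summable_norm _ ?_
    refine (hs (2⁻¹ : ℂ) (by norm_num)).norm.congr fun m ↦ ?_
    rw [FormalMultilinearSeries.ofScalars_norm]
    simp
  · have hy' : ‖y‖ < 1 := by
      rw [Metric.mem_eball, edist_zero_right, enorm_lt_coe] at hy
      have h3 : ‖y‖ < (2⁻¹ : NNReal) := hy
      push_cast at h3
      linarith
    have := (hs y hy').hasSum
    rw [zero_add]
    refine this.congr_fun fun m ↦ ?_
    rw [FormalMultilinearSeries.apply_eq_prod_smul_coeff, FormalMultilinearSeries.coeff_ofScalars]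
    simp [mul_comm]
  · change ∑' m : ℕ, c m * (0 : ℂ) ^ m = 0
    rw [tsum_eq_single 0 fun m hm ↦ by simp [hm]]
    simpa using coeff_zero hc

/-- The relative deviation of `hauptG τ - hauptG τ'` from the difference of the polar parts. -/
def blockErr (G : ℂ → ℂ) (p q : ℂ) : ℂ :=
  q * G p + q ^ 2 * (p * ((dslope G 0 p - dslope G 0 q) / (p - q)))

lemma hauptG_sub_eq {G : ℂ → ℂ} (h0 : G 0 = 0) (hG : ∀ τ : ℍ, G (qc τ) = hauptG τ - (qc τ)⁻¹)
    (τ τ' : ℍ) : hauptG τ - hauptG τ' =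
      ((qc τ)⁻¹ - (qc τ')⁻¹) * (1 - blockErr G (qc τ') (qc τ)) := by
  have h1 : hauptG τ = (qc τ)⁻¹ + G (qc τ) := by rw [hG]; ring
  have h2 : hauptG τ' = (qc τ')⁻¹ + G (qc τ') := by rw [hG]; ring
  have hq := qc_ne_zero τ
  have hp := qc_ne_zero τ'
  rw [h1, h2, blockErr, dslope_of_ne _ hp, dslope_of_ne _ hq, slope_def_field, slope_def_field, h0]
  generalize qc τ = q at *
  generalize qc τ' = p at *
  by_cases h : p = q
  · simp [h]
  · have h' : p - q ≠ 0 := sub_ne_zero.2 h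
    generalize G p = x
    generalize G q = y
    field_simp
    ring

section
variable {G : ℂ → ℂ} {P : FormalMultilinearSeries ℂ ℂ ℂ}

lemma tendsto_series_rt (hG : HasFPowerSeriesAt G P 0) (h0 : G 0 = 0) {a d : ℕ} (ha : 0 < a)
    (hd : 0 < d) (β : ℕ) : Tendsto (fun τ ↦ G (rt a d β τ)) atImInfty (𝓝 0) := by
  have := hG.continuousAt.tendsto
  rw [h0] at this
  exact this.comp (tendsto_rt ha hd β)

lemma blockErr_sub_isLittleO (hG : HasFPowerSeriesAt G P 0) {a d : ℕ} (ha : 0 < a)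
    (hd : 0 < d) (β : ℕ) :
    (fun τ : ℍ ↦ blockErr G (rt a d β τ) (qc τ) - qc τ * G (rt a d β τ)) =o[atImInfty]
      fun τ : ℍ ↦ qc τ ^ 2 := by
  have hH := hG.has_fpower_series_dslope_fslope.analyticAt.hasStrictDerivAt.hasStrictFDerivAt.isBigO_sub
  have hH' := hH.comp_tendsto ((tendsto_rt ha hd β).prodMk_nhds tendsto_qc_nhds)
  have h1 : (fun τ : ℍ ↦ (dslope G 0 (rt a d β τ) - dslope G 0 (qc τ)) / (rt a d β τ - qc τ))
      =O[atImInfty] fun _ ↦ (1 : ℂ) := by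
    obtain ⟨C, hC⟩ := hH'.bound
    refine Asymptotics.IsBigO.of_bound |C| ?_
    filter_upwards [hC] with τ hτ
    simp only [Function.comp_apply] at hτ
    rw [norm_div, norm_one, mul_one]
    exact div_le_of_le_mul₀ (norm_nonneg _) (abs_nonneg _)
      (hτ.trans (mul_le_mul_of_nonneg_right (le_abs_self C) (norm_nonneg _)))
  have h2 := (Asymptotics.isBigO_refl (fun τ : ℍ ↦ qc τ ^ 2) atImInfty).mul_isLittleO
    (((Asymptotics.isLittleO_one_iff ℂ).2 (tendsto_rt ha hd β)).mul_isBigO h1)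
  refine h2.congr (fun τ ↦ ?_) fun τ ↦ ?_
  · rw [blockErr]; ring
  · ring

lemma blockErr_isLittleO (hG : HasFPowerSeriesAt G P 0) (h0 : G 0 = 0) {a d : ℕ} (ha : 0 < a)
    (hd : 0 < d) (β : ℕ) :
    (fun τ : ℍ ↦ blockErr G (rt a d β τ) (qc τ)) =o[atImInfty] fun τ : ℍ ↦ qc τ := by
  have h1 := (Asymptotics.isBigO_refl (fun τ : ℍ ↦ qc τ) atImInfty).mul_isLittleO
    ((Asymptotics.isLittleO_one_iff ℂ).2 (tendsto_series_rt hG h0 ha hd β))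
  have h2 : (fun τ : ℍ ↦ qc τ ^ 2) =O[atImInfty] fun τ : ℍ ↦ qc τ := by
    have := (Asymptotics.isBigO_refl (fun τ : ℍ ↦ qc τ) atImInfty).mul (qc_isBigO_one 1)
    exact this.congr (fun τ ↦ by ring) fun τ ↦ by ring
  refine (((blockErr_sub_isLittleO hG ha hd β).trans_isBigO h2).add
    (h1.congr_right fun τ ↦ mul_one _)).congr_left fun τ ↦ by ring

lemma jet_prod_blockErr (hG : HasFPowerSeriesAt G P 0) (h0 : G 0 = 0) {a d : ℕ} (ha : 0 < a)
    (hd : 0 < d) (s : Finset ℕ) {κ : ℂ}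
    (h : (fun τ : ℍ ↦ qc τ * ∑ β ∈ s, G (rt a d β τ) - κ * qc τ ^ 2) =o[atImInfty]
      fun τ : ℍ ↦ qc τ ^ 2) :
    Jet (fun τ ↦ ∏ β ∈ s, (1 - blockErr G (rt a d β τ) (qc τ))) 0 0 (2 * κ) := by
  refine jet_of_sub_isLittleO ?_
  have h1 := prod_one_sub_isLittleO s fun β _ ↦ blockErr_isLittleO hG h0 ha hd β
  have h2 := Asymptotics.IsLittleO.fun_sum fun β (_ : β ∈ s) ↦ blockErr_sub_isLittleO hG ha hd β
  refine ((h1.add h2).add h).congr_left fun τ ↦ ?_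
  rw [Finset.sum_sub_distrib, Finset.mul_sum]
  ring

lemma trace_isLittleO (hG : HasFPowerSeriesAt G P 0) (h0 : G 0 = 0) {a d : ℕ} (ha : 0 < a)
    (hd : 0 < d) : (fun τ : ℍ ↦ qc τ * ∑ β ∈ Finset.range d, G (rt a d β τ) -
      (if a = 1 then d * P.coeff d else 0) * qc τ ^ 2) =o[atImInfty] fun τ : ℍ ↦ qc τ ^ 2 := by
  have h1 : P.coeff 0 = 0 := by rw [← h0]; exact hG.coeff_zero _
  have h2 := (Asymptotics.isBigO_refl (fun τ : ℍ ↦ qc τ) atImInfty).mul_isLittleO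
    (sum_rt_isLittleO hG ha hd)
  simp only [h1, mul_zero, sub_zero] at h2
  split_ifs with h
  · subst h
    exact h2.congr (fun τ ↦ by ring) fun τ ↦ by ring
  · have h3 := qc_pow_isLittleO (k := a + 1) (by omega)
    refine ((h2.trans_isBigO (h3.isBigO.congr_left fun τ ↦ by ring)).add
      (h3.const_mul_left (d * P.coeff d))).congr_left fun τ ↦ by ring

end

lemma jet_qc_zpow (N : ℤ) : Jet (fun τ : ℍ ↦ qc τ ^ (-N)) N 0 0 := by
  refine ⟨1, one_ne_zero, ?_⟩
  refine (Asymptotics.isLittleO_zero (E' := ℂ) (F' := ℂ) _ _).congr_left fun τ ↦ ?_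
  rw [← zpow_add₀ (qc_ne_zero τ)]; simp

lemma jet_one_sub_qc {k : ℕ} (hk : 0 < k) :
    Jet (fun τ : ℍ ↦ 1 - qc τ ^ k) 0 (if k = 1 then 1 else 0)
      (if k = 1 then 1 else if k = 2 then 2 else 0) := by
  refine ⟨1, one_ne_zero, ?_⟩
  rcases (by omega : k = 1 ∨ k = 2 ∨ 2 < k) with rfl | rfl | hk2
  · refine (Asymptotics.isLittleO_zero (E' := ℂ) (F' := ℂ) _ _).congr_left fun τ ↦ ?_
    simp
  · refine (Asymptotics.isLittleO_zero (E' := ℂ) (F' := ℂ) _ _).congr_left fun τ ↦ ?_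
    norm_num; ring
  · refine (qc_pow_isLittleO hk2).neg_left.congr_left fun τ ↦ ?_
    rw [if_neg (by omega), if_neg (by omega), if_neg (by omega)]; simp

lemma jet_polar {a d : ℕ} (h : a ≠ d) :
    Jet (fun τ : ℍ ↦ (qc τ)⁻¹ ^ d - (qc τ ^ a)⁻¹) (max a d : ℕ)
      (if a = d + 1 ∨ d = a + 1 then 1 else 0)
      (if a = d + 1 ∨ d = a + 1 then 1 else if a = d + 2 ∨ d = a + 2 then 2 else 0) := by
  rcases lt_or_gt_of_ne h with h | h
  · obtain ⟨k, rfl⟩ := Nat.exists_eq_add_of_lt h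
    have := (jet_qc_zpow (a + k + 1 : ℕ)).mul (jet_one_sub_qc (k := k + 1) (by omega))
    rw [max_eq_right h.le]
    convert this.congr (G := fun τ : ℍ ↦ (qc τ)⁻¹ ^ (a + k + 1) - (qc τ ^ a)⁻¹) fun τ ↦ ?_ using 1
    · simp
    · rw [zero_add]; congr 1; simp; omega
    · rw [zero_add]
      split_ifs <;> first | rfl | omega
    · have := qc_ne_zero τ
      rw [_root_.zpow_neg, zpow_natCast, inv_pow]
      field_simp
      ring
  · obtain ⟨k, rfl⟩ := Nat.exists_eq_add_of_lt h
    have := ((jet_qc_zpow (d + k + 1 : ℕ)).mul (jet_one_sub_qc (k := k + 1) (by omega))).mul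
      (jet_const (A := -1) (by norm_num))
    rw [max_eq_left h.le]
    convert this.congr (G := fun τ : ℍ ↦ (qc τ)⁻¹ ^ d - (qc τ ^ (d + k + 1))⁻¹) fun τ ↦ ?_ using 1
    · simp
    · rw [zero_add, add_zero]; congr 1; simp; omega
    · rw [zero_add, add_zero]
      split_ifs <;> first | rfl | omega
    · have := qc_ne_zero τ
      rw [_root_.zpow_neg, zpow_natCast, inv_pow]
      field_simp
      ring

/-! #### The three kinds of blocks -/

lemma qc_upMat {e : ℤ} (he : 0 < e) {a d : ℕ} (ha : 0 < a) (hd : 0 < d) (β : ℕ) (τ : ℍ) :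
    qc ((upMat (a / e) (β / e) d • τ : ℍ) : ℂ) = rt a (e.toNat * d) β τ := by
  have heR : (0 : ℝ) < e := by exact_mod_cast he
  rw [upMat_smul (by positivity), rt]
  have h1 : ((e.toNat : ℕ) : ℂ) = e := by
    have : ((e.toNat : ℤ) : ℂ) = e := by rw [Int.toNat_of_nonneg he.le]
    exact_mod_cast this
  congr 1
  push_cast
  rw [h1]
  have : (e : ℂ) ≠ 0 := by exact_mod_cast he.ne'
  have : (d : ℂ) ≠ 0 := by exact_mod_cast hd.ne'
  field_simp

lemma repMat_smul {e : ℤ} {a d β : ℕ} (τ : ℍ) :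
    repMat ⟨e, (a, d), β⟩ • τ = alW e • (upMat (a / e) (β / e) d • τ : ℍ) := by
  rw [repMat, mul_smul]

lemma hauptG_sub_repMat_one {G : ℂ → ℂ} (h0 : G 0 = 0)
    (hG : ∀ τ : ℍ, G (qc τ) = hauptG τ - (qc τ)⁻¹) {a d : ℕ} (ha : 0 < a) (hd : 0 < d) (β : ℕ)
    (τ : ℍ) : hauptG τ - hauptG (repMat ⟨1, (a, d), β⟩ • τ) =
      ((qc τ)⁻¹ - (rt a d β τ)⁻¹) * (1 - blockErr G (rt a d β τ) (qc τ)) := by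
  have h := qc_upMat one_pos ha hd β τ
  rw [repMat_smul, alW_one, one_smul, hauptG_sub_eq h0 hG, h]
  simp

lemma jet_block_one {c : ℤ → ℂ} (hc : HasQExp (jn 10) c (-1)) {a d : ℕ} (ha : 0 < a) (hd : 0 < d)
    (h : a ≠ d) : Jet (fun τ ↦ ∏ β ∈ Finset.range d, (hauptG τ - hauptG (repMat ⟨1, (a, d), β⟩ • τ)))
      (max a d : ℕ) (if a = d + 1 ∨ d = a + 1 then 1 else 0)
      ((if a = d + 1 ∨ d = a + 1 then 1 else if a = d + 2 ∨ d = a + 2 then 2 else 0) +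
        2 * (if a = 1 then d * c d else 0)) := by
  obtain ⟨G, hG, h0, hG'⟩ := exists_series hc
  have h1 := jet_prod_blockErr hG h0 ha hd _ (trace_isLittleO hG h0 ha hd)
  have h2 := (jet_polar h).mul h1
  rw [FormalMultilinearSeries.coeff_ofScalars, add_zero, add_zero] at h2
  refine h2.congr fun τ ↦ ?_
  rw [← prod_sub_rt hd, ← Finset.prod_mul_distrib]
  exact Finset.prod_congr rfl fun β _ ↦ (hauptG_sub_repMat_one h0 hG' ha hd β τ).symm

lemma jet_block_diag {c : ℤ → ℂ} (hc : HasQExp (jn 10) c (-1)) {d : ℕ} (hd : 0 < d) :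
    Jet (fun τ ↦ ∏ β ∈ (Finset.range d).erase 0, (hauptG τ - hauptG (repMat ⟨1, (d, d), β⟩ • τ)))
      (d - 1 : ℕ) 0 (2 * ((if d = 1 then d * c d else 0) - 1)) := by
  obtain ⟨G, hG, h0, hG'⟩ := exists_series hc
  have hr : ∀ τ : ℍ, rt d d 0 τ = qc τ := fun τ ↦ by
    have : (d : ℂ) ≠ 0 := by exact_mod_cast hd.ne'
    rw [rt, Nat.cast_zero, add_zero, mul_div_cancel_left₀ _ this]
  have h4 : (fun τ : ℍ ↦ qc τ * G (qc τ) - 1 * qc τ ^ 2) =o[atImInfty] fun τ : ℍ ↦ qc τ ^ 2 := by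
    have h5 := (Asymptotics.isLittleO_one_iff ℂ).2
      (by simpa using tendsto_hauptG_sub_div.sub_const 1 :
        Tendsto (fun τ : ℍ ↦ (hauptG τ - (qc τ)⁻¹) / qc τ - 1) atImInfty (𝓝 0))
    have h6 := (Asymptotics.isBigO_refl (fun τ : ℍ ↦ qc τ ^ 2) atImInfty).mul_isLittleO h5
    refine h6.congr (fun τ ↦ ?_) fun τ ↦ mul_one _
    rw [hG']
    have := qc_ne_zero τ
    field_simp
  have h1 := jet_prod_blockErr (κ := (if d = 1 then d * c d else 0) - 1) hG h0 hd hd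
    ((Finset.range d).erase 0) (by
      have h3 := trace_isLittleO hG h0 hd hd
      rw [FormalMultilinearSeries.coeff_ofScalars] at h3
      refine (h3.sub h4).congr_left fun τ ↦ ?_
      rw [← Finset.add_sum_erase _ _ (Finset.mem_range.2 hd), hr]
      ring)
  set ζ := cexp (2 * Real.pi * I / d)
  have hp : IsPrimitiveRoot ζ d := Complex.isPrimitiveRoot_exp d hd.ne'
  have hA : ∏ β ∈ (Finset.range d).erase 0, (1 - (ζ ^ β)⁻¹) ≠ 0 := by
    refine Finset.prod_ne_zero_iff.2 fun β hβ ↦ ?_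
    rw [Finset.mem_erase, Finset.mem_range] at hβ
    have := hp.pow_ne_one_of_pos_of_lt hβ.1 hβ.2
    rw [sub_ne_zero, ne_comm, Ne, inv_eq_one]
    exact this
  have h2 := ((jet_qc_zpow (d - 1 : ℕ)).mul (jet_const hA)).mul h1
  simp only [add_zero, zero_add] at h2
  refine h2.congr fun τ ↦ ?_
  have h7 : qc τ ^ (-((d - 1 : ℕ) : ℤ)) = ∏ β ∈ (Finset.range d).erase 0, (qc τ)⁻¹ := by
    rw [Finset.prod_const, Finset.card_erase_of_mem (Finset.mem_range.2 hd), Finset.card_range,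
      _root_.zpow_neg, zpow_natCast, inv_pow]
  rw [h7, ← Finset.prod_mul_distrib, ← Finset.prod_mul_distrib]
  refine Finset.prod_congr rfl fun β _ ↦ ?_
  rw [hauptG_sub_repMat_one h0 hG' hd hd β τ]
  congr 1
  rw [rt_eq d β τ, hr, mul_inv]
  ring

lemma jet_block_al {e : ℤ} (he : e ∈ ed') {c : ℤ → ℂ} (hc : HasQExp (jn 10) c (-1)) {a d : ℕ}
    (ha : 2 ≤ a) (hd : 0 < d) :
    Jet (fun τ ↦ ∏ β ∈ Finset.range (e.toNat * d), (hauptG τ - hauptG (repMat ⟨e, (a, d), β⟩ • τ)))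
      (e.toNat * d : ℕ) ((e.toNat * d : ℕ) * cuspVal e)
      ((e.toNat * d : ℕ) * (cuspVal e ^ 2 - 2)) := by
  obtain ⟨G, hG, h0, hG'⟩ := exists_series hc
  have he0 := ed_pos (ed'_sub he)
  have hD : 0 < e.toNat * d := by have : 0 < e.toNat := by omega
                                  positivity
  generalize hDe : e.toNat * d = D at *
  set κ := cuspVal e
  set H : ℂ → ℂ := fun w ↦ w / (1 + w * G w - κ * w) with hHdef
  have hH : AnalyticAt ℂ H 0 := by
    refine analyticAt_id.div ((analyticAt_const.add (analyticAt_id.mul hG.analyticAt)).sub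
      (analyticAt_const.mul analyticAt_id)) (by simp)
  obtain ⟨P, hP⟩ := hH
  have hP0 : P.coeff 0 = 0 := by
    have h0' : H 0 = 0 := by simp [hHdef]
    rw [← h0']; exact hP.coeff_zero _
  have hHτ : ∀ τ : ℍ, H (qc τ) = 1 / (hauptG τ - κ) := fun τ ↦ by
    have h1 := hG' τ
    have h2 := qc_ne_zero τ
    have h3 : (1 + qc τ * G (qc τ) - κ * qc τ) = qc τ * (hauptG τ - κ) := by
      rw [h1]; field_simp; ring
    simp only [hHdef]
    rw [h3, div_mul_eq_div_div, div_self h2]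
  have hfac : ∀ β : ℕ, ∀ τ : ℍ, hauptG τ - hauptG (repMat ⟨e, (a, d), β⟩ • τ) =
      (hauptG τ - κ) * (1 - cuspLam e * (1 / (hauptG τ - κ)) * H (rt a D β τ)) := fun β τ ↦ by
    have h1 := sub_ne_zero.2 (hauptG_ne_cuspVal he τ)
    have h2 := qc_upMat he0 (by omega : 0 < a) hd β τ
    rw [hDe] at h2
    rw [repMat_smul, hauptG_alW_eq he, ← h2, hHτ]
    have h3 := sub_ne_zero.2 (hauptG_ne_cuspVal he (upMat (a / e) (β / e) d • τ))
    change hauptG τ - (κ + _ / (_ - κ)) = _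
    change _ - κ ≠ 0 at h3
    change _ - κ ≠ 0 at h1
    field_simp
    ring
  have hinv : (fun τ ↦ cuspLam e * (1 / (hauptG τ - κ))) =O[atImInfty] fun τ : ℍ ↦ qc τ := by
    have h1 := tendsto_hauptG_mul_add (-κ)
    have h2 : Tendsto (fun τ ↦ cuspLam e * ((hauptG τ + -κ) * qc τ)⁻¹) atImInfty
      (𝓝 (cuspLam e * 1⁻¹)) := (h1.inv₀ one_ne_zero).const_mul _
    have h3 := (h2.isBigO_one ℂ).mul (Asymptotics.isBigO_refl (fun τ : ℍ ↦ qc τ) atImInfty)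
    refine h3.congr (fun τ ↦ ?_) fun τ ↦ one_mul _
    have := qc_ne_zero τ
    rw [mul_inv, ← sub_eq_add_neg]
    field_simp
  have hsmall : ∀ β : ℕ, (fun τ : ℍ ↦ cuspLam e * (1 / (hauptG τ - κ)) * H (rt a D β τ))
      =o[atImInfty] fun τ : ℍ ↦ qc τ := fun β ↦ by
    have h1 := tendsto_series_rt hP (by simp [hHdef]) (by omega : 0 < a) hD β
    exact (hinv.mul_isLittleO ((Asymptotics.isLittleO_one_iff ℂ).2 h1)).congr_right
      fun τ ↦ mul_one _
  have hjet : Jet (fun τ ↦ ∏ β ∈ Finset.range D,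
      (1 - cuspLam e * (1 / (hauptG τ - κ)) * H (rt a D β τ))) 0 0 (2 * 0) := by
    refine jet_of_sub_isLittleO ?_
    have h1 := prod_one_sub_isLittleO (Finset.range D) fun β _ ↦ hsmall β
    have h2 := sum_rt_isLittleO hP (by omega : 0 < a) hD
    simp only [hP0, mul_zero, sub_zero] at h2
    have h3 : (fun τ ↦ ∑ β ∈ Finset.range D, H (rt a D β τ)) =O[atImInfty] fun τ : ℍ ↦ qc τ ^ a :=
      (h2.isBigO.add (((Asymptotics.isBigO_refl (fun τ : ℍ ↦ qc τ ^ a) atImInfty)).const_mul_left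
        (D * P.coeff D))).congr_left fun τ ↦ by ring
    have h4 := hinv.mul h3
    have h5 := h4.trans_isLittleO ((qc_pow_isLittleO (k := a + 1) (by omega)).congr_left
      fun τ ↦ pow_succ' _ _)
    refine (h1.add h5).congr_left fun τ ↦ ?_
    rw [Finset.mul_sum]
    ring
  have h := ((jet_hauptG_sub κ).pow D).mul hjet
  simp only [mul_one, mul_zero, add_zero] at h
  refine h.congr fun τ ↦ ?_
  rw [← Finset.card_range D, ← Finset.prod_const, Finset.card_range, ← Finset.prod_mul_distrib]
  exact Finset.prod_congr rfl fun β _ ↦ (hfac β τ).symm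

/-! ### The divisor of the diagonal product at the cusps -/

/-- The translations occurring in a block of non-scalar representatives. -/
def betaSet (e : ℤ) (p : ℕ × ℕ) : Finset ℕ :=
  if e = 1 ∧ p.1 = p.2 then (Finset.range p.2).erase 0 else Finset.range (e.toNat * p.2)

lemma repMat_one_coe {s : ℕ} (hs : 0 < s) : (repMat ⟨1, (s, s), 0⟩).1 = (s : ℝ) • (1 : Matrix _ _ ℝ) := by
  have : (0 : ℝ) < s := by exact_mod_cast hs
  simp only [repMat, alW_one, one_mul]
  rw [upMat_coe (by simp only [Int.cast_one, div_one]; positivity)]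
  ext i j; fin_cases i <;> fin_cases j <;> simp

lemma neg_mem_heckeSet {γ : GL (Fin 2) ℝ} {n : ℤ} (h : γ ∈ heckeSet n) : -γ ∈ heckeSet n := by
  obtain ⟨A, B, C, D, h, h'⟩ := h
  refine ⟨-A, -B, -C, -D, ?_, by linear_combination h'⟩
  rw [Units.val_neg, h]
  ext i j; fin_cases i <;> fin_cases j <;> simp

lemma exists_of_mem_scalarClass {M : GL (Fin 2) ℝ} {n : ℕ} (hn : 0 < n) (hM : M ∈ heckeSet n)
    (h : M ∈ scalarClass) : ∃ s : ℕ, 0 < s ∧ s * s = n ∧ ∃ γ ∈ heckeSet 1, M.1 = (s : ℝ) • γ.1 := by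
  obtain ⟨s, γ, hγ, e⟩ := h
  have h1 : (s : ℝ) ^ 2 = n := by
    have h2 := congrArg Matrix.det e
    rw [Matrix.det_smul] at h2
    have h3 := heckeSet_det hM
    have h4 := heckeSet_det hγ
    simp only [GeneralLinearGroup.val_det_apply] at h3 h4
    rw [h3, h4] at h2
    simpa using h2.symm
  have h1' : s * s = n := by rw [← sq]; exact_mod_cast h1
  have hs0 : s ≠ 0 := by
    rintro rfl
    rw [zero_mul] at h1'
    omega
  refine ⟨s.natAbs, Int.natAbs_pos.2 hs0, ?_, ?_⟩
  · have := congrArg Int.natAbs h1'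
    simpa [Int.natAbs_mul] using this
  · rcases le_total 0 s with h | h
    · refine ⟨γ, hγ, ?_⟩
      have : ((s.natAbs : ℤ) : ℝ) = s := by rw [Int.natAbs_of_nonneg h]
      rw [e, ← this, Int.cast_natCast]
    · refine ⟨-γ, neg_mem_heckeSet hγ, ?_⟩
      have : ((s.natAbs : ℤ) : ℝ) = -s := by rw [Int.ofNat_natAbs_of_nonpos h]; simp
      rw [Int.cast_natCast] at this
      rw [e, this, Units.val_neg]
      simp

lemma repMat_mem_scalarClass {n : ℕ} (hn : 0 < n) {i : RepIndex} (hi : i ∈ repSet n) :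
    repMat i ∈ scalarClass ↔ i.1 = 1 ∧ i.2.1.1 = i.2.1.2 ∧ i.2.2 = 0 := by
  constructor
  · intro h
    obtain ⟨s, hs, hsn, γ, hγ, e⟩ := exists_of_mem_scalarClass hn (repMat_mem hi) h
    have hj : (⟨1, (s, s), 0⟩ : RepIndex) ∈ repSet n := by
      rw [mem_repSet]
      refine ⟨one_mem_ed, mem_factorPairs.2 ⟨⟨hsn, hn.ne'⟩, one_dvd _⟩, by simpa using hs⟩
    have : repMat i = γ * repMat ⟨1, (s, s), 0⟩ := by
      apply gl_ext
      rw [e, Units.val_mul, repMat_one_coe hs]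
      simp
    rw [repMat_inj hi hj hγ this]
    simp
  · obtain ⟨e, ⟨a, d⟩, β⟩ := i
    rintro ⟨h1, h2, h3⟩
    simp only at h1 h2 h3
    subst h1 h2 h3
    obtain ⟨-, hp, -⟩ := mem_repSet.1 hi
    refine ⟨a, 1, one_mem_heckeSet, ?_⟩
    rw [repMat_one_coe (factorPairs_pos hp).1]
    simp

lemma repSet'_eq {n : ℕ} (hn : 0 < n) :
    repSet' n = ed.sigma fun e ↦ (factorPairs e n).sigma fun p ↦ betaSet e p := by
  ext ⟨e, ⟨a, d⟩, β⟩
  have key : (⟨e, (a, d), β⟩ : RepIndex) ∈ repSet' n ↔ (⟨e, (a, d), β⟩ : RepIndex) ∈ repSet n ∧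
      ¬ (e = 1 ∧ a = d ∧ β = 0) := by
    rw [mem_repSet']
    exact and_congr_right fun h ↦ not_congr (repMat_mem_scalarClass hn h)
  rw [key, mem_repSet, Finset.mem_sigma, Finset.mem_sigma, betaSet]
  simp only
  split_ifs with h
  · obtain ⟨rfl, rfl⟩ := h
    simp; tauto
  · simp only [Finset.mem_range]; tauto

lemma prod_repSet' {n : ℕ} (hn : 0 < n) {R : Type*} [CommMonoid R] (F : RepIndex → R) :
    ∏ i ∈ repSet' n, F i = ∏ e ∈ ed, ∏ p ∈ factorPairs e n, ∏ β ∈ betaSet e p, F ⟨e, p, β⟩ := by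
  rw [repSet'_eq hn, Finset.prod_sigma]
  exact Finset.prod_congr rfl fun e _ ↦ Finset.prod_sigma _ _ _

lemma sum_repSet' {n : ℕ} (hn : 0 < n) {R : Type*} [AddCommMonoid R] (F : RepIndex → R) :
    ∑ i ∈ repSet' n, F i = ∑ e ∈ ed, ∑ p ∈ factorPairs e n, ∑ β ∈ betaSet e p, F ⟨e, p, β⟩ := by
  rw [repSet'_eq hn, Finset.sum_sigma]
  exact Finset.sum_congr rfl fun e _ ↦ Finset.sum_sigma _ _ _

lemma sum_ed {R : Type*} [AddCommMonoid R] (F : ℤ → R) : ∑ e ∈ ed, F e = F 1 + ∑ e ∈ ed', F e := by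
  rw [show ed = insert 1 ed' by decide, Finset.sum_insert (by decide)]

lemma mem_ed_iff {e : ℤ} : e ∈ ed ↔ e = 1 ∨ e ∈ ed' := by
  rw [show ed = insert 1 ed' by decide, Finset.mem_insert]

lemma one_notMem_ed' : (1 : ℤ) ∉ ed' := by decide

/-- The pole order of a block at infinity. -/
def blkN (e : ℤ) (p : ℕ × ℕ) : ℕ :=
  if e = 1 then if p.1 = p.2 then p.2 - 1 else max p.1 p.2 else e.toNat * p.2

/-- The second power sum of a block. -/
def blkS (c : ℤ → ℂ) (e : ℤ) (p : ℕ × ℕ) : ℂ :=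
  if e = 1 then
    if p.1 = p.2 then 2 * ((if p.1 = 1 then p.2 * c p.2 else 0) - 1)
    else (if p.1 = p.2 + 1 ∨ p.2 = p.1 + 1 then 1 else if p.1 = p.2 + 2 ∨ p.2 = p.1 + 2 then 2 else 0) +
      2 * (if p.1 = 1 then p.2 * c p.2 else 0)
  else (e.toNat * p.2 : ℕ) * (cuspVal e ^ 2 - 2)

lemma jet_block {c : ℤ → ℂ} (hc : HasQExp (jn 10) c (-1)) {n : ℕ} {e : ℤ} (he : e ∈ ed)
    {p : ℕ × ℕ} (hp : p ∈ factorPairs e n) : ∃ s, Jet (fun τ ↦ ∏ β ∈ betaSet e p,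
      (hauptG τ - hauptG (repMat ⟨e, p, β⟩ • τ))) (blkN e p) s (blkS c e p) := by
  obtain ⟨a, d⟩ := p
  obtain ⟨ha, hd⟩ := factorPairs_pos hp
  rcases mem_ed_iff.1 he with rfl | he'
  · by_cases h : a = d
    · subst h
      simp only [blkN, blkS, betaSet, and_self, if_true]
      exact ⟨_, jet_block_diag hc ha⟩
    · simp only [blkN, blkS, betaSet, h, and_false, if_true, if_false]
      have := jet_block_one hc ha hd h
      exact ⟨_, by simpa using this⟩
  · have h1 : e ≠ 1 := fun h ↦ one_notMem_ed' (h ▸ he')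
    have h2 : 2 ≤ a := by
      obtain ⟨-, k, hk⟩ := mem_factorPairs.1 hp
      have : (0 : ℤ) < a := by exact_mod_cast ha
      have he0 := ed_pos he
      by_contra h
      have h4 : (a : ℤ) = 1 := by simp only at ha; omega
      simp only [h4] at hk
      exact h1 (Int.eq_one_of_mul_eq_one_right he0.le hk.symm)
    simp only [blkN, blkS, betaSet, h1, false_and, if_false]
    exact ⟨_, jet_block_al he' hc h2 hd⟩

lemma jet_diagProd {c : ℤ → ℂ} (hc : HasQExp (jn 10) c (-1)) {n : ℕ} (hn : 0 < n) :
    ∃ s, Jet (diagProd n) (∑ e ∈ ed, ∑ p ∈ factorPairs e n, (blkN e p : ℤ)) s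
      (∑ e ∈ ed, ∑ p ∈ factorPairs e n, blkS c e p) := by
  have h : ∀ e ∈ ed, ∀ p ∈ factorPairs e n, ∃ s, Jet (fun τ ↦ ∏ β ∈ betaSet e p,
      (hauptG τ - hauptG (repMat ⟨e, p, β⟩ • τ))) (blkN e p) s (blkS c e p) :=
    fun e he p hp ↦ jet_block hc he hp
  choose! s hs using h
  refine ⟨∑ e ∈ ed, ∑ p ∈ factorPairs e n, s e p, ?_⟩
  refine (Jet.prod _ fun e he ↦ Jet.prod _ fun p hp ↦ hs e he p hp).congr fun τ ↦ ?_
  rw [diagProd, prod_repSet' hn]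

lemma cuspVal_inj {e f : ℤ} (he : e ∈ ed') (hf : f ∈ ed') (h : cuspVal e = cuspVal f) : e = f := by
  simp only [ed', Finset.mem_insert, Finset.mem_singleton] at he hf
  rcases he with rfl | rfl | rfl <;> rcases hf with rfl | rfl | rfl <;>
    first | rfl | (norm_num [cuspVal] at h)

lemma hasOrd_hauptG_alW_sub {e : ℤ} (he : e ∈ ed') (x : ℂ) :
    HasOrd (fun τ ↦ hauptG (alW e • τ) - x) (if x = cuspVal e then -1 else 0) := by
  split_ifs with h
  · have h1 := (hasOrd_const (cuspLam_ne_zero e)).div (hasOrd_hauptG_sub (cuspVal e))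
    rw [zero_sub] at h1
    refine (congrArg (HasOrd · (-1)) (funext fun τ ↦ ?_)).mp h1
    rw [hauptG_alW_eq he, h]; ring
  · exact hasOrd_of_tendsto (sub_ne_zero.2 (Ne.symm h)) ((tendsto_hauptG_alW he).sub_const x)

lemma hasOrd_repMat_sub {e : ℤ} (he : e ∈ ed') {f : ℤ} (hf : f ∈ ed) {a d : ℕ} (ha : 0 < a)
    (hd : 0 < d) (β : ℕ) : HasOrd (fun τ ↦ hauptG (repMat ⟨f, (a, d), β⟩ • τ) - cuspVal e)
      (if f = 1 then (a / d : ℝ) else if f = e then -(a / (f * d)) else 0) := by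
  have hf0 := ed_pos hf
  have hfR : (0 : ℝ) < f := by exact_mod_cast hf0
  have haR : (0 : ℝ) < a := by exact_mod_cast ha
  have hdR : (0 : ℝ) < d := by exact_mod_cast hd
  simp only [repMat_smul]
  rcases mem_ed_iff.1 hf with rfl | hf'
  · have := (hasOrd_hauptG_sub (cuspVal e)).comp_upMat (a := a / (1 : ℤ)) (b := β / (1 : ℤ)) (by positivity) hdR
    simpa [alW_one] using this
  · have := (hasOrd_hauptG_alW_sub hf' (cuspVal e)).comp_upMat (a := a / f) (b := β / f) (d := d)
      (by positivity) hdR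
    rw [if_neg (fun h : f = 1 ↦ one_notMem_ed' (h ▸ hf'))]
    convert this using 1
    by_cases h : f = e
    · subst h; simp; field_simp
    · rw [if_neg h, if_neg (fun h' ↦ h (cuspVal_inj he hf' h').symm)]; simp

lemma card_betaSet {n : ℕ} {e : ℤ} {p : ℕ × ℕ} (hp : p ∈ factorPairs e n) :
    (betaSet e p).card = if e = 1 ∧ p.1 = p.2 then p.2 - 1 else e.toNat * p.2 := by
  rw [betaSet]
  split_ifs
  · rw [Finset.card_erase_of_mem (Finset.mem_range.2 (factorPairs_pos hp).2), Finset.card_range]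
  · rw [Finset.card_range]

/-- The order of the diagonal product at the cusp of index `e`. -/
def cuspOrd (e : ℤ) (n : ℕ) : ℝ :=
  ∑ p ∈ factorPairs 1 n, ((if p.1 = p.2 then (1 : ℝ) else 0) - min (p.1 : ℝ) p.2) +
    ∑ p ∈ factorPairs e n, (p.1 : ℝ)

lemma hasOrd_diagProd_alW {c : ℤ → ℂ} (hc : HasQExp (jn 10) c (-1)) {n : ℕ} (hn : 0 < n) {e : ℤ}
    (he : e ∈ ed') : HasOrd (fun τ ↦ diagProd n (alW e • τ)) (cuspOrd e n) := by
  obtain ⟨s, hs⟩ := jet_diagProd hc hn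
  have h1 := hs.hasOrd
  have h2 := (hasOrd_hauptG_sub (cuspVal e)).pow (repSet' n).card
  have h3 := HasOrd.prod (repSet' n) (F := fun i τ ↦ hauptG (repMat i • τ) - cuspVal e)
    (N := fun i ↦ if i.1 = 1 then (i.2.1.1 / i.2.1.2 : ℝ) else if i.1 = e then
      -(i.2.1.1 / (i.1 * i.2.1.2)) else 0) fun i hi ↦ by
    obtain ⟨f, ⟨a, d⟩, β⟩ := i
    obtain ⟨hf, hp, -⟩ := mem_repSet.1 (mem_repSet'.1 hi).1
    exact hasOrd_repMat_sub he hf (factorPairs_pos hp).1 (factorPairs_pos hp).2 β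
  have h4 := ((hasOrd_const (pow_ne_zero (repSet' n).card (neg_ne_zero.2 (cuspLam_ne_zero e)))).mul h1).div
    (h2.mul h3)
  have h5 : (fun τ ↦ diagProd n (alW e • τ)) = fun τ ↦ (-cuspLam e) ^ (repSet' n).card * diagProd n τ /
      ((hauptG τ - cuspVal e) ^ (repSet' n).card * ∏ i ∈ repSet' n, (hauptG (repMat i • τ) - cuspVal e)) :=
    funext fun τ ↦ by
      rw [← diagProd_alW_eq hn he τ, mul_div_cancel_right₀]
      exact mul_ne_zero (pow_ne_zero _ (sub_ne_zero.2 (hauptG_ne_cuspVal he τ)))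
        (Finset.prod_ne_zero_iff.2 fun i _ ↦ sub_ne_zero.2 (hauptG_ne_cuspVal he _))
  rw [h5]
  convert h4 using 1
  rw [Finset.card_eq_sum_ones, sum_repSet' hn, sum_repSet' hn]
  push_cast
  simp only [Finset.sum_const, nsmul_eq_mul, mul_one, zero_add]
  rw [← sub_sub, ← Finset.sum_sub_distrib, ← Finset.sum_sub_distrib, sum_ed, cuspOrd]
  congr 1
  · rw [← Finset.sum_sub_distrib, ← Finset.sum_sub_distrib]
    refine Finset.sum_congr rfl fun p hp ↦ ?_
    obtain ⟨ha, hd⟩ := factorPairs_pos hp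
    rw [card_betaSet hp]
    have hdR : (p.2 : ℝ) ≠ 0 := by exact_mod_cast hd.ne'
    by_cases h : p.1 = p.2
    · simp only [h, and_self, if_true, blkN]
      rw [Nat.cast_sub (by omega)]
      push_cast
      rw [min_self]
      field_simp
      ring
    · simp only [h, and_false, if_true, if_false, blkN]
      push_cast
      have := min_add_max (p.1 : ℝ) p.2
      simp only [one_mul]
      field_simp
      linarith
  · rw [Finset.sum_eq_single_of_mem e he]
    · rw [← Finset.sum_sub_distrib, ← Finset.sum_sub_distrib]
      refine Finset.sum_congr rfl fun p hp ↦ ?_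
      have h1 : e ≠ 1 := fun h ↦ one_notMem_ed' (h ▸ he)
      rw [card_betaSet hp]
      simp only [h1, false_and, if_false, if_true, blkN]
      have h2 : ((e.toNat : ℕ) : ℝ) = e := by
        have : ((e.toNat : ℤ) : ℝ) = e := by rw [Int.toNat_of_nonneg (ed_pos (ed'_sub he)).le]
        exact_mod_cast this
      push_cast
      rw [h2]
      have hdR : (p.2 : ℝ) ≠ 0 := by exact_mod_cast (factorPairs_pos hp).2.ne'
      have heR : (e : ℝ) ≠ 0 := by exact_mod_cast (ed_pos (ed'_sub he)).ne'
      field_simp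
      ring
    · intro f hf hfe
      rw [← Finset.sum_sub_distrib, ← Finset.sum_sub_distrib]
      refine Finset.sum_eq_zero fun p hp ↦ ?_
      have h1 : f ≠ 1 := fun h ↦ one_notMem_ed' (h ▸ hf)
      rw [card_betaSet hp]
      simp [h1, hfe, blkN]

/-! ### The diagonal product as a polynomial in the hauptmodul -/

lemma moderate_diagProd {c : ℤ → ℂ} (hc : HasQExp (jn 10) c (-1)) {n : ℕ} (hn : 0 < n) :
    ModerateAtCusps (diagProd n) := by
  intro e he
  rcases mem_ed_iff.1 he with rfl | he'
  · obtain ⟨s, hs⟩ := jet_diagProd hc hn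
    simpa [alW_one] using hs.hasOrd.isBigO
  · exact (hasOrd_diagProd_alW hc hn he').isBigO

lemma eval_eq_prod_rootMultiplicity (Q : Polynomial ℂ) (x : ℂ) :
    Q.eval x = Q.leadingCoeff * ∏ r ∈ Q.roots.toFinset, (x - r) ^ Q.rootMultiplicity r := by
  conv_lhs => rw [(IsAlgClosed.splits Q).eq_prod_roots]
  rw [Polynomial.eval_mul, Polynomial.eval_C, Finset.prod_multiset_map_count, Polynomial.eval_prod]
  simp only [Polynomial.eval_pow, Polynomial.eval_sub, Polynomial.eval_X, Polynomial.eval_C,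
    Polynomial.count_roots]

lemma jet_eval_hauptG {Q : Polynomial ℂ} (hQ : Q ≠ 0) : ∃ s, Jet (fun τ ↦ Q.eval (hauptG τ))
    (∑ r ∈ Q.roots.toFinset, (Q.rootMultiplicity r : ℤ)) s
    (∑ r ∈ Q.roots.toFinset, Q.rootMultiplicity r * (r ^ 2 - 2)) := by
  have h := (jet_const (Polynomial.leadingCoeff_ne_zero.2 hQ)).mul
    (Jet.prod Q.roots.toFinset fun r _ ↦ (jet_hauptG_sub r).pow (Q.rootMultiplicity r))
  simp only [zero_add, mul_one] at h
  exact ⟨_, h.congr fun τ ↦ (eval_eq_prod_rootMultiplicity Q _).symm⟩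

lemma hasOrd_eval_alW {Q : Polynomial ℂ} (hQ : Q ≠ 0) {e : ℤ} (he : e ∈ ed') :
    HasOrd (fun τ ↦ Q.eval (hauptG (alW e • τ))) (-(Q.rootMultiplicity (cuspVal e) : ℝ)) := by
  have h := (hasOrd_const (Polynomial.leadingCoeff_ne_zero.2 hQ)).mul
    (HasOrd.prod Q.roots.toFinset fun r _ ↦ (hasOrd_hauptG_alW_sub he r).pow (Q.rootMultiplicity r))
  simp only [← eval_eq_prod_rootMultiplicity] at h
  convert h using 1
  by_cases h0 : cuspVal e ∈ Q.roots.toFinset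
  · rw [Finset.sum_eq_single_of_mem _ h0]
    · simp
    · intro r _ hr; simp [hr]
  · rw [Finset.sum_eq_zero]
    · rw [Multiset.mem_toFinset, Polynomial.mem_roots hQ] at h0
      simp [Polynomial.rootMultiplicity_eq_zero h0]
    · intro r hr
      rw [if_neg (fun h : r = cuspVal e ↦ h0 (h ▸ hr))]; simp

lemma cuspPoly_eq : cuspPoly = ∏ e ∈ ed', (Polynomial.X - Polynomial.C (cuspVal e)) := by
  simp only [ed', cuspPoly]
  rw [Finset.prod_insert (by decide), Finset.prod_insert (by decide), Finset.prod_singleton]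
  norm_num [cuspVal, sub_neg_eq_add, mul_assoc]

lemma eval_cuspPoly_eq (x : ℂ) : cuspPoly.eval x = ∏ e ∈ ed', (x - cuspVal e) := by
  simp [cuspPoly_eq, Polynomial.eval_prod]

lemma hasOrd_cuspPoly_alW {e : ℤ} (he : e ∈ ed') :
    HasOrd (fun τ ↦ cuspPoly.eval (hauptG (alW e • τ))) (-1) := by
  have := HasOrd.prod ed' fun f _ ↦ hasOrd_hauptG_alW_sub he (cuspVal f)
  simp only [← eval_cuspPoly_eq] at this
  convert this using 1
  rw [Finset.sum_eq_single_of_mem e he]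
  · simp
  · intro f hf hfe
    rw [if_neg fun h ↦ hfe (cuspVal_inj hf he h)]

/-- The roots of a polynomial that are not values at cusps. -/
def innerRoots (Q : Polynomial ℂ) : Finset ℂ :=
  Q.roots.toFinset.filter fun x ↦ x ∉ ed'.image cuspVal

lemma sum_innerRoots (Q : Polynomial ℂ) (F : ℂ → ℂ) :
    ∑ r ∈ Q.roots.toFinset, Q.rootMultiplicity r * F r = ∑ r ∈ innerRoots Q, Q.rootMultiplicity r * F r +
      ∑ e ∈ ed', Q.rootMultiplicity (cuspVal e) * F (cuspVal e) := by
  rw [innerRoots, ← Finset.sum_filter_not_add_sum_filter _ (fun x ↦ x ∈ ed'.image cuspVal)]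
  congr 1
  have h : ∑ e ∈ ed', Q.rootMultiplicity (cuspVal e) * F (cuspVal e) =
      ∑ x ∈ ed'.image cuspVal, Q.rootMultiplicity x * F x := by
    rw [Finset.sum_image fun x hx y hy h ↦ cuspVal_inj hx hy h]
  rw [h]
  refine Finset.sum_subset (fun x hx ↦ (Finset.mem_filter.1 hx).2) fun x hx hx' ↦ ?_
  rw [Finset.mem_filter, not_and'] at hx'
  have := hx' hx
  rw [Multiset.mem_toFinset, ← Multiset.count_pos, Polynomial.count_roots, _root_.not_lt,
    Nat.le_zero] at this
  rw [this]; simp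

lemma exists_diagPoly {c : ℤ → ℂ} (hc : HasQExp (jn 10) c (-1)) {n : ℕ} (hn : 0 < n) :
    ∃ (K : ℕ) (Q : Polynomial ℂ), Q ≠ 0 ∧
      (∀ τ, diagProd n τ * cuspPoly.eval (hauptG τ) ^ K = Q.eval (hauptG τ)) ∧
      ∑ r ∈ innerRoots Q, Q.rootMultiplicity r * (r ^ 2 - 4) =
        ∑ e ∈ ed, ∑ p ∈ factorPairs e n, (blkS c e p - 2 * blkN e p) +
          ∑ e ∈ ed', cuspOrd e n * (cuspVal e ^ 2 - 4) := by
  obtain ⟨K, Q, hQ⟩ := exists_poly_of_moderate (mdiff_diagProd hn) (gammaInv_diagProd hn)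
    (moderate_diagProd hc hn)
  obtain ⟨s, hs⟩ := jet_diagProd hc hn
  have hC : Jet (fun τ ↦ cuspPoly.eval (hauptG τ)) 3 (∑ e ∈ ed', cuspVal e)
      (∑ e ∈ ed', (cuspVal e ^ 2 - 2)) := by
    have := Jet.prod ed' fun e _ ↦ jet_hauptG_sub (cuspVal e)
    simp only [← eval_cuspPoly_eq] at this
    exact this
  have h1 := (hs.mul (hC.pow K)).congr hQ
  have hQ0 : Q ≠ 0 := by
    rintro rfl
    obtain ⟨A, hA, h⟩ := h1.tendsto
    simp only [Polynomial.eval_zero, zero_mul] at h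
    exact hA (tendsto_nhds_unique h tendsto_const_nhds)
  obtain ⟨t, ht⟩ := jet_eval_hauptG hQ0
  obtain ⟨hN, -, hS⟩ := ht.unique h1
  refine ⟨K, Q, hQ0, hQ, ?_⟩
  have hm : ∀ e ∈ ed', (Q.rootMultiplicity (cuspVal e) : ℂ) = K - cuspOrd e n := fun e he ↦ by
    have h2 := (hasOrd_diagProd_alW hc hn he).mul ((hasOrd_cuspPoly_alW he).pow K)
    simp only [hQ] at h2
    have h3 := (hasOrd_eval_alW hQ0 he).unique h2
    have h4 : (Q.rootMultiplicity (cuspVal e) : ℝ) = K - cuspOrd e n := by linarith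
    exact_mod_cast congrArg (fun x : ℝ ↦ (x : ℂ)) h4
  have hN' : ∑ r ∈ Q.roots.toFinset, (Q.rootMultiplicity r : ℂ) * 1 =
      ∑ e ∈ ed, ∑ p ∈ factorPairs e n, (blkN e p : ℂ) + K * 3 := by
    have := congrArg (fun x : ℤ ↦ (x : ℂ)) hN
    push_cast at this
    simpa using this
  rw [sum_innerRoots Q (fun r ↦ r ^ 2 - 2)] at hS
  rw [sum_innerRoots Q (fun _ ↦ 1)] at hN'
  have e1 : ∑ e ∈ ed', (Q.rootMultiplicity (cuspVal e) : ℂ) * (cuspVal e ^ 2 - 2) =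
    ∑ e ∈ ed', (K - cuspOrd e n) * (cuspVal e ^ 2 - 2) :=
      Finset.sum_congr rfl fun e he ↦ by rw [hm e he]
  have e2 : ∑ e ∈ ed', (Q.rootMultiplicity (cuspVal e) : ℂ) * 1 = ∑ e ∈ ed', (K - cuspOrd e n : ℂ) * 1 :=
      Finset.sum_congr rfl fun e he ↦ by rw [hm e he]
  rw [e1] at hS
  rw [e2] at hN'
  simp only [Finset.sum_sub_distrib, ← Finset.mul_sum, mul_sub, sub_mul, ← Finset.sum_mul,
    Finset.sum_const, mul_one] at hS hN' ⊢
  have h3 : (ed'.card : ℂ) = 3 := by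
    rw [show ed'.card = 3 by decide]; norm_num
  simp only [nsmul_eq_mul, h3] at hS hN'
  linear_combination -2 * hN' + hS

/-! ### Evaluation of the divisor sums -/

lemma sum_factorPairs_swap {e : ℤ} (he : 0 < e) (n : ℕ) :
    ∑ p ∈ factorPairs e n, (e.toNat * p.2 : ℕ) = ∑ p ∈ factorPairs e n, p.1 := by
  obtain ⟨k, rfl⟩ := Int.eq_ofNat_of_zero_le he.le
  have hk : 0 < k := by exact_mod_cast he
  refine Finset.sum_bij' (fun p _ ↦ (k * p.2, p.1 / k)) (fun p _ ↦ (k * p.2, p.1 / k)) ?_ ?_ ?_ ?_ ?_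
  · rintro ⟨a, d⟩ h
    obtain ⟨⟨h1, h2⟩, h3⟩ := mem_factorPairs.1 h
    obtain ⟨b, rfl⟩ := Int.natCast_dvd_natCast.1 h3
    refine mem_factorPairs.2 ⟨⟨?_, h2⟩, by simp⟩
    simp only at h1 ⊢
    rw [Nat.mul_div_cancel_left _ hk, ← h1]; ring
  · rintro ⟨a, d⟩ h
    obtain ⟨⟨h1, h2⟩, h3⟩ := mem_factorPairs.1 h
    obtain ⟨b, rfl⟩ := Int.natCast_dvd_natCast.1 h3
    refine mem_factorPairs.2 ⟨⟨?_, h2⟩, by simp⟩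
    simp only at h1 ⊢
    rw [Nat.mul_div_cancel_left _ hk, ← h1]; ring
  · rintro ⟨a, d⟩ h
    obtain ⟨-, h3⟩ := mem_factorPairs.1 h
    obtain ⟨b, rfl⟩ := Int.natCast_dvd_natCast.1 h3
    simp [Nat.mul_div_cancel_left _ hk]
  · rintro ⟨a, d⟩ h
    obtain ⟨-, h3⟩ := mem_factorPairs.1 h
    obtain ⟨b, rfl⟩ := Int.natCast_dvd_natCast.1 h3
    simp [Nat.mul_div_cancel_left _ hk]
  · rintro ⟨a, d⟩ _
    simp

lemma sum_fst_factorPairs {k : ℕ} (hk : 0 < k) (n : ℕ) :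
    ∑ p ∈ factorPairs k n, p.1 = if k ∣ n then k * ∑ d ∈ (n / k).divisors, d else 0 := by
  rw [← sum_factorPairs_swap (by exact_mod_cast hk), Int.toNat_natCast, ← Finset.mul_sum]
  split_ifs with h
  · obtain ⟨m, rfl⟩ := h
    rw [Nat.mul_div_cancel_left _ hk]
    congr 1
    refine Finset.sum_bij' (fun p _ ↦ p.2) (fun d _ ↦ (k * (m / d), d)) ?_ ?_ ?_ ?_ ?_
    · rintro ⟨a, d⟩ h
      obtain ⟨⟨h1, h2⟩, h3⟩ := mem_factorPairs.1 h
      obtain ⟨b, rfl⟩ := Int.natCast_dvd_natCast.1 h3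
      simp only [mul_assoc] at h1
      have := Nat.eq_of_mul_eq_mul_left hk h1
      exact Nat.mem_divisors.2 ⟨⟨b, by rw [← this, mul_comm]⟩, right_ne_zero_of_mul h2⟩
    · intro d hd
      obtain ⟨h1, h2⟩ := Nat.mem_divisors.1 hd
      refine mem_factorPairs.2 ⟨⟨?_, mul_ne_zero hk.ne' h2⟩, by simp⟩
      simp only [mul_assoc, Nat.div_mul_cancel h1]
    · rintro ⟨a, d⟩ h
      obtain ⟨⟨h1, h2⟩, h3⟩ := mem_factorPairs.1 h
      obtain ⟨b, rfl⟩ := Int.natCast_dvd_natCast.1 h3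
      simp only [mul_assoc] at h1
      have := Nat.eq_of_mul_eq_mul_left hk h1
      simp only [← this]
      rw [Nat.mul_div_cancel _ (factorPairs_pos h).2]
    · simp
    · simp
  · rw [Finset.sum_eq_zero, mul_zero]
    intro p hp
    obtain ⟨⟨h1, h2⟩, h3⟩ := mem_factorPairs.1 hp
    exact absurd ((Int.natCast_dvd_natCast.1 h3).trans ⟨_, h1.symm⟩) h

/-- The contribution of a factorization `n = a d` with `|a - d| ≤ 2`. -/
def nearDiag (p : ℕ × ℕ) : ℂ :=
  if p.1 = p.2 then 2 else if p.1 = p.2 + 1 ∨ p.2 = p.1 + 1 then 1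
    else if p.1 = p.2 + 2 ∨ p.2 = p.1 + 2 then 2 else 0

lemma divisor_sum_eq {c : ℤ → ℂ} {n : ℕ} (hn : 0 < n) :
    ∑ e ∈ ed, ∑ p ∈ factorPairs e n, (blkS c e p - 2 * blkN e p) +
          ∑ e ∈ ed', cuspOrd e n * (cuspVal e ^ 2 - 4) =
      2 * n * c n + ∑ p ∈ factorPairs 1 n, nearDiag p - 4 * ∑ p ∈ factorPairs 1 n, (p.1 : ℂ) -
        6 * ∑ p ∈ factorPairs 2 n, (p.1 : ℂ) + 10 * ∑ p ∈ factorPairs 10 n, (p.1 : ℂ) := by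
  have hs : ∀ e ∈ ed, ∑ p ∈ factorPairs e n, ((e.toNat * p.2 : ℕ) : ℂ) =
      ∑ p ∈ factorPairs e n, (p.1 : ℂ) := fun e he ↦ by
    exact_mod_cast congrArg (fun x : ℕ ↦ (x : ℂ)) (sum_factorPairs_swap (ed_pos he) n)
  have h1 : ∑ p ∈ factorPairs 1 n, (blkS c 1 p - 2 * blkN 1 p) + 2 *
      ∑ p ∈ factorPairs 1 n, ((if p.1 = p.2 then (1 : ℂ) else 0) - (min (p.1 : ℝ) p.2 : ℝ)) =
      2 * n * c n + ∑ p ∈ factorPairs 1 n, nearDiag p - 4 * ∑ p ∈ factorPairs 1 n, (p.1 : ℂ) := by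
    have h2 : 2 * n * c n = ∑ p ∈ factorPairs 1 n, 2 * (if p.1 = 1 then p.2 * c p.2 else 0 : ℂ) := by
      rw [Finset.sum_eq_single_of_mem (1, n)]
      · simp; ring
      · exact mem_factorPairs.2 ⟨⟨by simp, hn.ne'⟩, one_dvd _⟩
      · rintro ⟨a, d⟩ hp hne
        obtain ⟨⟨h1, -⟩, -⟩ := mem_factorPairs.1 hp
        simp only at h1 ⊢
        rw [if_neg, mul_zero]
        rintro rfl
        exact hne (by rw [← h1, one_mul])
    have h3 : 4 * ∑ p ∈ factorPairs 1 n, (p.1 : ℂ) = ∑ p ∈ factorPairs 1 n, 2 * (p.1 + p.2 : ℂ) := by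
      have := hs 1 one_mem_ed
      rw [← Finset.mul_sum, Finset.sum_add_distrib]
      simp only [Int.toNat_one, one_mul] at this
      rw [this]; ring
    rw [h2, h3, Finset.mul_sum, ← Finset.sum_add_distrib, ← Finset.sum_add_distrib,
      ← Finset.sum_sub_distrib]
    refine Finset.sum_congr rfl fun p hp ↦ ?_
    obtain ⟨ha, hd⟩ := factorPairs_pos hp
    by_cases h : p.1 = p.2
    · simp only [blkS, blkN, nearDiag, h, if_true]
      rw [min_self, Nat.cast_sub (by omega)]
      push_cast
      ring
    · simp only [blkS, blkN, nearDiag, h, if_true, if_false]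
      have : ((max p.1 p.2 : ℕ) : ℂ) = p.1 + p.2 - (min (p.1 : ℝ) p.2 : ℝ) := by
        have := min_add_max (p.1 : ℝ) p.2
        have h4 : ((max p.1 p.2 : ℕ) : ℝ) = p.1 + p.2 - min (p.1 : ℝ) p.2 := by push_cast; linarith
        have h5 := congrArg (fun x : ℝ ↦ (x : ℂ)) h4
        simpa only [Complex.ofReal_sub, Complex.ofReal_add, Complex.ofReal_natCast] using h5
      rw [this]
      ring
  have h2 : ∀ e ∈ ed', ∑ p ∈ factorPairs e n, (blkS c e p - 2 * blkN e p) =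
      (cuspVal e ^ 2 - 4) * ∑ p ∈ factorPairs e n, (p.1 : ℂ) := fun e he ↦ by
    rw [← hs e (ed'_sub he), Finset.mul_sum]
    refine Finset.sum_congr rfl fun p _ ↦ ?_
    have h1 : e ≠ 1 := fun h ↦ one_notMem_ed' (h ▸ he)
    simp only [blkS, blkN, h1, if_false]
    ring
  rw [sum_ed, Finset.sum_congr rfl h2]
  simp only [cuspOrd, Complex.ofReal_add, Complex.ofReal_sum, Complex.ofReal_sub, apply_ite,
    Complex.ofReal_one, Complex.ofReal_zero, Complex.ofReal_natCast]
  simp only [ed']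
  rw [Finset.sum_insert (by decide), Finset.sum_insert (by decide), Finset.sum_singleton,
    Finset.sum_insert (by decide), Finset.sum_insert (by decide), Finset.sum_singleton]
  rw [show cuspVal 2 = -1 by norm_num [cuspVal], show cuspVal 5 = -2 by norm_num [cuspVal],
    show cuspVal 10 = 3 by norm_num [cuspVal]]
  linear_combination h1

/-- The roots in the upper half-plane of positive definite forms `[10 a, b, c]` of
discriminant `-d`. -/
def cmSet (d : ℤ) : Set ℍ :=
  {τ | ∃ a b c : ℤ, 0 < a ∧ b ^ 2 - 40 * a * c = -d ∧ (10 * a * τ ^ 2 + b * τ + c : ℂ) = 0}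

lemma quadratic_root {a b c : ℝ} {τ : ℍ} (h : (a * τ ^ 2 + b * τ + c : ℂ) = 0) :
    b = -2 * a * τ.re ∧ c = a * (τ.re ^ 2 + τ.im ^ 2) := by
  have hz : (τ : ℂ) = (τ.re : ℂ) + τ.im * I := by
    rw [← UpperHalfPlane.coe_re, ← UpperHalfPlane.coe_im, Complex.re_add_im]
  rw [hz] at h
  have h1 := congrArg Complex.im h
  have h2 := congrArg Complex.re h
  simp [pow_two] at h1 h2
  have hb : b = -2 * a * τ.re := by
    have : τ.im * (b + 2 * a * τ.re) = 0 := by linear_combination h1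
    rcases mul_eq_zero.1 this with h3 | h3
    · exact absurd h3 τ.im_pos.ne'
    · linarith
  refine ⟨hb, ?_⟩
  rw [hb] at h2
  linear_combination h2

lemma quadratic_disc {a b c : ℝ} {τ : ℍ} (h : (a * τ ^ 2 + b * τ + c : ℂ) = 0) :
    b ^ 2 - 4 * a * c = -(2 * a * τ.im) ^ 2 := by
  obtain ⟨h1, h2⟩ := quadratic_root h
  rw [h1, h2]; ring

/-- The elements of `heckeSet n` fixing `τ`. -/
def fixSet (n : ℤ) (τ : ℍ) : Set (GL (Fin 2) ℝ) := {M | M ∈ heckeSet n ∧ M • τ = τ}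

lemma smul_eq_self_iff {n A B C D : ℤ} {M : GL (Fin 2) ℝ}
    (hM : M.1 = !![(A : ℝ), B; 10 * C, D]) (hd : A * D - 10 * B * C = n) (hn : 0 < n) (τ : ℍ) :
    M • τ = τ ↔ (10 * C * τ ^ 2 + (D - A) * τ - B : ℂ) = 0 := by
  have hdet : 0 < M.det.val := det_pos_of_hecke hn ⟨A, B, C, D, hM, hd⟩
  have hl : ((10 * C : ℤ) : ℂ) * τ + D ≠ 0 :=
    lin_int_ne_zero (A := A) (B := B) (n := n) (by linear_combination hd) hn τ
  have hs := smul_of_coe hM (by rwa [det_of_coe hM] at hdet) τ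
  rw [UpperHalfPlane.ext_iff, hs]
  push_cast at hl ⊢
  rw [div_eq_iff hl]
  constructor <;> intro h <;> linear_combination -h

/-- The trace of a matrix fixing a point, together with its lower left entry. -/
lemma fix_data {n A B C D : ℤ} {τ : ℍ}
    (hd : A * D - 10 * B * C = n)
    (h : (10 * C * τ ^ 2 + (D - A) * τ - B : ℂ) = 0) :
    ((D : ℝ) - A = -20 * C * τ.re ∧ (-B : ℝ) = 10 * C * (τ.re ^ 2 + τ.im ^ 2)) ∧
      (4 * n - (A + D) ^ 2 : ℝ) = (20 * C * τ.im) ^ 2 := by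
  have h' : (((10 * C : ℝ) : ℂ) * τ ^ 2 + ((D - A : ℝ) : ℂ) * τ + ((-B : ℝ) : ℂ)) = 0 := by
    push_cast; linear_combination h
  obtain ⟨h1, h2⟩ := quadratic_root h'
  have h3 := quadratic_disc h'
  refine ⟨⟨by linarith, h2⟩, ?_⟩
  have : (A * D - 10 * B * C : ℝ) = n := by exact_mod_cast hd
  linear_combination -h3 - 4 * this

lemma mem_cmSet_of_fix {n A B C D : ℤ} {τ : ℍ} (hd : A * D - 10 * B * C = n) (hC : C ≠ 0)
    (h : (10 * C * τ ^ 2 + (D - A) * τ - B : ℂ) = 0) : τ ∈ cmSet (4 * n - (A + D) ^ 2) := by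
  rcases lt_or_gt_of_ne hC with hC | hC
  · refine ⟨-C, A - D, B, by omega, by rw [← hd]; ring, ?_⟩
    push_cast; linear_combination -h
  · refine ⟨C, D - A, -B, by omega, by rw [← hd]; ring, ?_⟩
    push_cast; linear_combination h

/-- The traces `r` for which `τ` is a CM point of discriminant `r² - 4n`. -/
def trSet (n : ℕ) (τ : ℍ) : Set ℤ := {r | r ^ 2 < 4 * n ∧ τ ∈ cmSet (4 * n - r ^ 2)}

lemma finite_sq_lt (n : ℕ) : {r : ℤ | r ^ 2 < 4 * n}.Finite :=
  (Set.finite_Icc (-(4 * n : ℤ)) (4 * n)).subset fun r hr ↦ by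
    simp only [Set.mem_ofPred_eq] at hr
    constructor <;> nlinarith

lemma finite_trSet (n : ℕ) (τ : ℍ) : (trSet n τ).Finite :=
  (finite_sq_lt n).subset fun _ h ↦ h.1

lemma bijOn_fixSet_pos {n : ℕ} (hn : 0 < n) (τ : ℍ) :
    Set.BijOn (fun M : GL (Fin 2) ℝ ↦ ⌊M.1 0 0 + M.1 1 1⌋) {M ∈ fixSet n τ | 0 < M.1 1 0}
      (trSet n τ) := by
  have hn' : (0 : ℤ) < n := by exact_mod_cast hn
  have ht : ∀ {A B C D : ℤ} {M : GL (Fin 2) ℝ}, M.1 = !![(A : ℝ), B; 10 * C, D] →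
      ⌊M.1 0 0 + M.1 1 1⌋ = A + D := fun {A B C D M} h ↦ by
    rw [h]; simp only [Matrix.of_apply, Matrix.cons_val', Matrix.cons_val_zero, Matrix.cons_val_one,
      Matrix.cons_val_fin_one]
    exact_mod_cast Int.floor_intCast (R := ℝ) (A + D)
  refine ⟨?_, ?_, ?_⟩
  · rintro M ⟨⟨⟨A, B, C, D, hM, hd⟩, hf⟩, hp⟩
    have hC : 0 < C := by simpa [hM] using hp
    rw [smul_eq_self_iff hM hd hn'] at hf
    simp only [ht hM]
    refine ⟨?_, mem_cmSet_of_fix hd hC.ne' hf⟩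
    have h := (fix_data hd hf).2
    have : (0 : ℝ) < (20 * C * τ.im) ^ 2 := by
      have := τ.im_pos
      have hC' : (0 : ℝ) < C := by exact_mod_cast hC
      positivity
    rw [← h] at this
    have : ((A + D : ℤ) : ℝ) ^ 2 < 4 * (n : ℤ) := by push_cast at this ⊢; linarith
    exact_mod_cast this
  · rintro M ⟨⟨⟨A, B, C, D, hM, hd⟩, hf⟩, hp⟩ M' ⟨⟨⟨A', B', C', D', hM', hd'⟩, hf'⟩, hp'⟩ he
    have hC : (0 : ℝ) < C := by have : 0 < C := by simpa [hM] using hp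
                                exact_mod_cast this
    have hC' : (0 : ℝ) < C' := by have : 0 < C' := by simpa [hM'] using hp'
                                  exact_mod_cast this
    rw [smul_eq_self_iff hM hd hn'] at hf
    rw [smul_eq_self_iff hM' hd' hn'] at hf'
    simp only [ht hM, ht hM'] at he
    have he : (A + D : ℝ) = A' + D' := by exact_mod_cast he
    obtain ⟨⟨h1, h2⟩, h3⟩ := fix_data hd hf
    obtain ⟨⟨h1', h2'⟩, h3'⟩ := fix_data hd' hf'
    have hy := τ.im_pos
    have hc : (C : ℝ) = C' := by
      have : (20 * C * τ.im) ^ 2 = (20 * C' * τ.im) ^ 2 := by rw [← h3, ← h3', he]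
      have := (pow_left_inj₀ (by positivity) (by positivity) two_ne_zero).1 this
      have := mul_right_cancel₀ hy.ne' this
      linarith
    rw [hc] at h1 h2
    apply gl_ext
    rw [hM, hM', hc, show (A : ℝ) = A' by linarith, show (B : ℝ) = B' by linarith,
      show (D : ℝ) = D' by linarith]
  · rintro r ⟨hr, a, b, c, ha, hd, hf⟩
    obtain ⟨k, hk⟩ : Even (r + b) := by
      have : Even (r ^ 2 - b ^ 2) := ⟨2 * n - 20 * a * c, by linear_combination -hd⟩
      rw [show r ^ 2 - b ^ 2 = (r + b) * (r - b) by ring, Int.even_mul] at this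
      rcases this with h | h
      · exact h
      · rw [show r + b = (r - b) + 2 * b by ring]; exact h.add (even_two_mul b)
    have hdet : (k - b) * k - 10 * (-c) * a = (n : ℤ) := by
      have : r = 2 * k - b := by omega
      rw [this] at hd
      linarith
    have hreal : 0 < (((k - b : ℤ) : ℝ)) * k - ((-c : ℤ) : ℝ) * (10 * a) := by
      have : (((k - b) * k - 10 * (-c) * a : ℤ) : ℝ) = n := by exact_mod_cast hdet
      have hn2 : (0 : ℝ) < n := by exact_mod_cast hn
      push_cast at this ⊢
      linarith
    have hM := gl_coe ((k - b : ℤ) : ℝ) ((-c : ℤ) : ℝ) (10 * (a : ℝ)) (k : ℝ) hreal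
    refine ⟨gl _ _ _ _ hreal, ⟨⟨⟨k - b, -c, a, k, hM, hdet⟩, ?_⟩, ?_⟩, ?_⟩
    · rw [smul_eq_self_iff hM hdet hn']
      push_cast; linear_combination hf
    · rw [hM]; simpa using ha
    · simp only [ht hM]; omega

lemma neg_smul_gl (M : GL (Fin 2) ℝ) (τ : ℍ) : (-M) • τ = M • τ :=
  smul_congr_of_neg (by simp) τ

lemma neg_mem_fixSet {n : ℤ} {τ : ℍ} {M : GL (Fin 2) ℝ} (h : M ∈ fixSet n τ) : -M ∈ fixSet n τ :=
  ⟨neg_mem_heckeSet h.1, by rw [neg_smul_gl]; exact h.2⟩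

lemma ncard_fixSet_zero {n : ℕ} (hn : 0 < n) (τ : ℍ) :
    {M ∈ fixSet n τ | M.1 1 0 = 0}.Finite ∧
      {M ∈ fixSet n τ | M.1 1 0 = 0}.ncard = if IsSquare n then 2 else 0 := by
  have hn' : (0 : ℤ) < n := by exact_mod_cast hn
  have key : ∀ M ∈ {M ∈ fixSet n τ | M.1 1 0 = 0}, ∃ s : ℤ, s * s = n ∧ M.1 = (s : ℝ) • 1 := by
    rintro M ⟨⟨⟨A, B, C, D, hM, hd⟩, hf⟩, h0⟩
    have hC : C = 0 := by simpa [hM] using h0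
    rw [smul_eq_self_iff hM hd hn'] at hf
    obtain ⟨⟨h1, h2⟩, -⟩ := fix_data hd hf
    simp only [hC, Int.cast_zero, mul_zero, zero_mul] at h1 h2
    have hB : B = 0 := by exact_mod_cast neg_eq_zero.1 h2
    have hA : D = A := by exact_mod_cast sub_eq_zero.1 h1
    subst hC hB hA
    refine ⟨D, by linarith, ?_⟩
    rw [hM]; ext i j; fin_cases i <;> fin_cases j <;> simp
  by_cases hs : IsSquare n
  · obtain ⟨s, hs⟩ := hs
    have hs0 : 0 < s := Nat.pos_of_ne_zero fun h ↦ by simp [h] at hs; omega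
    have hsr : (0 : ℝ) < s := by exact_mod_cast hs0
    obtain ⟨M, hM⟩ : ∃ M : GL (Fin 2) ℝ, M.1 = (s : ℝ) • 1 :=
      ⟨gl s 0 0 s (by simpa using mul_pos hsr hsr), by
        rw [gl_coe]; ext i j; fin_cases i <;> fin_cases j <;> simp⟩
    have hM' : M.1 = !![((s : ℤ) : ℝ), ((0 : ℤ) : ℝ); 10 * ((0 : ℤ) : ℝ), ((s : ℤ) : ℝ)] := by
      rw [hM]; ext i j; fin_cases i <;> fin_cases j <;> simp
    have hd : (s : ℤ) * s - 10 * 0 * 0 = n := by rw [hs]; push_cast; ring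
    have hmem : M ∈ fixSet n τ :=
      ⟨⟨s, 0, 0, s, hM', hd⟩, by rw [smul_eq_self_iff hM' hd hn']; simp⟩
    have heq : {M ∈ fixSet n τ | M.1 1 0 = 0} = {M, -M} := by
      ext N
      constructor
      · intro hN
        obtain ⟨t, ht, hNt⟩ := key N hN
        rw [hs] at ht; push_cast at ht
        rcases mul_self_eq_mul_self_iff.1 ht with h | h
        · left; apply gl_ext; rw [hNt, hM, h]; simp
        · right; apply gl_ext; rw [hNt, Units.val_neg, hM, h]; simp
      · rintro (rfl | rfl)
        · exact ⟨hmem, by simp [hM]⟩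
        · exact ⟨neg_mem_fixSet hmem, by simp [hM]⟩
    rw [heq, if_pos ⟨s, hs⟩, Set.ncard_pair]
    · exact ⟨Set.toFinite _, rfl⟩
    · intro h
      have h1 := congrArg (fun N : GL (Fin 2) ℝ ↦ N.1 0 0) h
      rw [Units.val_neg, hM] at h1
      simp at h1
      linarith
  · have heq : {M ∈ fixSet n τ | M.1 1 0 = 0} = ∅ := by
      rw [Set.eq_empty_iff_forall_notMem]
      intro M hM
      obtain ⟨t, ht, -⟩ := key M hM
      exact hs ⟨t.natAbs, by zify; rw [← ht, abs_mul_abs_self]⟩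
    rw [heq, if_neg hs]; simp

lemma ncard_fixSet {n : ℕ} (hn : 0 < n) (τ : ℍ) :
    (fixSet n τ).Finite ∧
      (fixSet n τ).ncard = 2 * (trSet n τ).ncard + if IsSquare n then 2 else 0 := by
  have hb := bijOn_fixSet_pos hn τ
  obtain ⟨hz, hzc⟩ := ncard_fixSet_zero hn τ
  have hp : {M ∈ fixSet n τ | 0 < M.1 1 0}.Finite := hb.finite_iff_finite.2 (finite_trSet n τ)
  have hpc : {M ∈ fixSet n τ | 0 < M.1 1 0}.ncard = (trSet n τ).ncard := by
    rw [← hb.image_eq, hb.injOn.ncard_image]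
  have hneg : {M ∈ fixSet n τ | M.1 1 0 < 0} = (fun M ↦ -M) '' {M ∈ fixSet n τ | 0 < M.1 1 0} := by
    ext M
    constructor
    · rintro ⟨h1, h2⟩
      exact ⟨-M, ⟨neg_mem_fixSet h1, by simpa using h2⟩, neg_neg M⟩
    · rintro ⟨N, ⟨h1, h2⟩, rfl⟩
      exact ⟨neg_mem_fixSet h1, by simpa using h2⟩
  have hu : fixSet n τ = ({M ∈ fixSet n τ | 0 < M.1 1 0} ∪ {M ∈ fixSet n τ | M.1 1 0 < 0}) ∪
      {M ∈ fixSet n τ | M.1 1 0 = 0} := by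
    ext M
    constructor
    · intro h
      rcases lt_trichotomy (M.1 1 0) 0 with h0 | h0 | h0
      · exact Or.inl (Or.inr ⟨h, h0⟩)
      · exact Or.inr ⟨h, h0⟩
      · exact Or.inl (Or.inl ⟨h, h0⟩)
    · rintro ((h | h) | h) <;> exact h.1
  have hnf : {M ∈ fixSet n τ | M.1 1 0 < 0}.Finite := hneg ▸ hp.image _
  have hf : (fixSet n τ).Finite := hu ▸ (hp.union hnf).union hz
  refine ⟨hf, ?_⟩
  rw [hu, Set.ncard_union_eq _ (hp.union hnf) hz, Set.ncard_union_eq _ hp hnf, hzc, hneg,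
    Set.ncard_image_of_injective _ neg_injective, hpc]
  · ring
  · exact Set.disjoint_left.2 fun M h h' ↦ lt_asymm h.2 h'.2
  · refine Set.disjoint_left.2 fun M h h' ↦ ?_
    rcases h with h | h
    · exact h.2.ne' h'.2
    · exact h.2.ne h'.2

lemma fixSet_one_finite (τ : ℍ) : (fixSet 1 τ).Finite := (ncard_fixSet one_pos τ).1

open Classical in
lemma ncard_fixSet_one (τ : ℍ) : (fixSet 1 τ).ncard = if τ ∈ cmSet 4 then 4 else 2 := by
  have h := (ncard_fixSet one_pos τ).2
  rw [if_pos ⟨1, rfl⟩] at h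
  have ht : trSet 1 τ = if τ ∈ cmSet 4 then {0} else ∅ := by
    ext r
    have h3 : r ∈ trSet 1 τ → r = 0 := by
      rintro ⟨h1, a, b, c, -, h2, -⟩
      rw [Nat.cast_one] at h1 h2
      have h4 : -1 ≤ r ∧ r ≤ 1 := by constructor <;> nlinarith
      by_contra h0
      have h5 : r ^ 2 = 1 := by
        have : r = 1 ∨ r = -1 := by omega
        rcases this with rfl | rfl <;> norm_num
      rw [h5] at h2
      have h6 : (b ^ 2 - 40 * a * c) % 5 = 2 := by rw [h2]; norm_num
      rw [show b ^ 2 - 40 * a * c = b ^ 2 + 5 * (-8 * a * c) by ring, Int.add_mul_emod_self_left] at h6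
      rcases (by omega : b % 5 = 0 ∨ b % 5 = 1 ∨ b % 5 = 2 ∨ b % 5 = 3 ∨ b % 5 = 4) with
        h | h | h | h | h <;> simp [pow_two, Int.mul_emod, h] at h6
    split_ifs with h4
    · refine ⟨h3, ?_⟩
      rintro rfl
      exact ⟨by norm_num, by simpa using h4⟩
    · refine ⟨fun h5 ↦ h4 ?_, fun h ↦ h.elim⟩
      have := h5.2
      rw [h3 h5] at this
      simpa using this
  rw [ht] at h
  push_cast at h
  split_ifs at h ⊢ with h4 <;> simpa using h

lemma mem_alSet_two_of_fix {τ : ℍ} (h : τ ∈ cmSet 4) : ∃ V ∈ alSet 2, V • τ = τ := by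
  obtain ⟨a, b, c, ha, hd, hf⟩ := h
  obtain ⟨k, hk⟩ : Even b := by
    have : Even (b ^ 2) := ⟨20 * a * c - 2, by linear_combination hd⟩
    exact (Int.even_pow.1 this).1
  obtain ⟨m, hm⟩ : Odd k := by
    have h1 : k ^ 2 = 10 * a * c - 1 := by rw [hk] at hd; linarith
    have : Odd (k ^ 2) := ⟨5 * a * c - 1, by linear_combination h1⟩
    exact (Int.odd_pow.1 this).resolve_right two_ne_zero
  have hdet : (-(2 * m)) * (2 * (m + 1)) - 10 * (-c) * a = 2 := by
    rw [hk, hm] at hd; linarith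
  have hreal : 0 < ((-(2 * m) : ℤ) : ℝ) * ((2 * (m + 1) : ℤ) : ℝ) - ((-c : ℤ) : ℝ) * (10 * a) := by
    have h2 := congrArg (fun x : ℤ ↦ (x : ℝ)) hdet
    push_cast at h2 ⊢
    linarith
  have hM := gl_coe ((-(2 * m) : ℤ) : ℝ) ((-c : ℤ) : ℝ) (10 * (a : ℝ)) ((2 * (m + 1) : ℤ) : ℝ) hreal
  refine ⟨gl _ _ _ _ hreal, ⟨-m, -c, a, m + 1, ?_, by linarith⟩, ?_⟩
  · rw [hM]; push_cast; congr 3; ring_nf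
  · rw [smul_eq_self_iff hM hdet two_pos]
    rw [hk, hm] at hf
    push_cast at hf ⊢; linear_combination hf

lemma mem_cmSet_four_of_alSet {τ : ℍ} {V : GL (Fin 2) ℝ} (hV : V ∈ alSet 2) (h : V • τ = τ) :
    τ ∈ cmSet 4 := by
  obtain ⟨x, y, z, w, hM, hd⟩ := hV
  have hM' : V.1 = !![((2 * x : ℤ) : ℝ), y; 10 * z, ((2 * w : ℤ) : ℝ)] := by
    rw [hM]; push_cast; rfl
  have hd' : (2 * x) * (2 * w) - 10 * y * z = 2 := hd
  rw [smul_eq_self_iff hM' hd' two_pos] at h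
  obtain ⟨⟨h1, h2⟩, h3⟩ := fix_data hd' h
  have hz : z ≠ 0 := by
    rintro rfl
    have : 4 * (x * w) = 2 := by linarith
    omega
  have h4 : (x + w) ^ 2 ≤ 2 := by
    have : (0 : ℝ) ≤ 4 * (2 : ℤ) - (((2 * x : ℤ) : ℝ) + ((2 * w : ℤ) : ℝ)) ^ 2 := h3 ▸ sq_nonneg _
    have : (0 : ℤ) ≤ 4 * 2 - (2 * x + 2 * w) ^ 2 := by exact_mod_cast this
    nlinarith
  have h5 : -1 ≤ x + w ∧ x + w ≤ 1 := by constructor <;> nlinarith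
  have h6 : x + w ≠ 0 := by
    intro h0
    have hw : w = -x := by omega
    rw [hw] at hd
    have h8 : 2 * (x * x) = -1 - 5 * (y * z) := by linarith
    have h9 : (2 * (x * x)) % 5 = 4 := by rw [h8]; omega
    rcases (by omega : x % 5 = 0 ∨ x % 5 = 1 ∨ x % 5 = 2 ∨ x % 5 = 3 ∨ x % 5 = 4) with
      h | h | h | h | h <;> simp [Int.mul_emod, h] at h9
  have := mem_cmSet_of_fix hd' hz h
  have h7 : (2 * x + 2 * w) ^ 2 = 4 := by
    have : x + w = 1 ∨ x + w = -1 := by omega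
    rcases this with h | h
    · rw [← mul_add, h]; norm_num
    · rw [← mul_add, h]; norm_num
  rw [h7] at this
  exact this

lemma mem_cmSet_four_iff (τ : ℍ) : τ ∈ cmSet 4 ↔ (hauptG τ + 1) ^ 2 = -4 := by
  have h2 : (2 : ℤ) ∈ ed' := by decide
  have hk : cuspVal 2 = -1 := by norm_num [cuspVal]
  have hl : cuspLam 2 = -4 := by norm_num [cuspLam]
  have hg := hauptG_alW h2 τ
  rw [hk, hl] at hg
  have hne : hauptG τ + 1 ≠ 0 := by
    have := hauptG_ne_cuspVal h2 τ
    rw [hk] at this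
    intro h; exact this (by linear_combination h)
  constructor
  · intro h
    obtain ⟨V, hV, hf⟩ := mem_alSet_two_of_fix h
    have := gammaInv_hauptG.alSet_congr two_mem_ed (alW_mem two_mem_ed) hV τ
    rw [this, hf] at hg
    linear_combination hg
  · intro h
    have : hauptG (alW 2 • τ) = hauptG τ := by
      have : (hauptG (alW 2 • τ) - hauptG τ) * (hauptG τ + 1) = 0 := by linear_combination hg - h
      exact sub_eq_zero.1 ((mul_eq_zero.1 this).resolve_right hne)
    obtain ⟨γ, hγ, he⟩ := exists_gamma_of_hauptG this
    rw [← mul_smul] at he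
    exact mem_cmSet_four_of_alSet (alSet_mul_gamma (by norm_num) (alW_mem two_mem_ed) hγ) he

lemma heckeSet_gamma_mul {n : ℤ} {γ M : GL (Fin 2) ℝ} (hγ : γ ∈ heckeSet 1) (hM : M ∈ heckeSet n) :
    γ * M ∈ heckeSet n := by
  have := heckeSet_mul hγ hM
  rwa [one_mul] at this

/-- Fixed points of the scalar classes correspond to fixed points of the group. -/
lemma ncard_fixSet_scalar {n : ℕ} (hn : 0 < n) (τ : ℍ) :
    (fixSet n τ ∩ scalarClass).ncard = if IsSquare n then (fixSet 1 τ).ncard else 0 := by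
  by_cases hs : IsSquare n
  · obtain ⟨s, hs⟩ := hs
    have hs0 : 0 < s := Nat.pos_of_ne_zero fun h ↦ by simp [h] at hs; omega
    have hsr : (0 : ℝ) < s := by exact_mod_cast hs0
    obtain ⟨S, hS⟩ : ∃ S : GL (Fin 2) ℝ, S.1 = (s : ℝ) • 1 :=
      ⟨gl s 0 0 s (by simpa using mul_pos hsr hsr), by
        rw [gl_coe]; ext i j; fin_cases i <;> fin_cases j <;> simp⟩
    have hSM : ∀ M : GL (Fin 2) ℝ, (S * M).1 = (s : ℝ) • M.1 := fun M ↦ by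
      rw [Units.val_mul, hS, Matrix.smul_mul, one_mul]
    rw [if_pos ⟨s, hs⟩, ← Set.ncard_image_of_injective (fixSet 1 τ) (mul_right_injective S)]
    congr 1
    ext M
    constructor
    · rintro ⟨⟨hM, hf⟩, hsc⟩
      obtain ⟨t, ht, htn, γ, hγ, h⟩ := exists_of_mem_scalarClass hn hM hsc
      have hts : t = s := Nat.mul_self_inj.1 (htn.trans hs)
      subst hts
      refine ⟨γ, ⟨hγ, ?_⟩, gl_ext (by rw [h]; exact hSM γ)⟩
      rw [← smul_congr_of_smul hsr (det_pos_of_hecke one_pos hγ) h τ, hf]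
    · rintro ⟨γ, ⟨hγ, hf⟩, rfl⟩
      refine ⟨⟨?_, ?_⟩, ⟨s, γ, hγ, by exact_mod_cast hSM γ⟩⟩
      · obtain ⟨A, B, C, D, h, hd⟩ := hγ
        refine ⟨s * A, s * B, s * C, s * D, ?_, ?_⟩
        · rw [hSM, h]; ext i j; fin_cases i <;> fin_cases j <;> simp; ring
        · rw [hs]; push_cast; linear_combination (s : ℤ) ^ 2 * hd
      · rw [smul_congr_of_smul hsr (det_pos_of_hecke one_pos hγ) (hSM γ) τ, hf]
  · rw [if_neg hs]
    have : fixSet n τ ∩ scalarClass = ∅ := by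
      rw [Set.eq_empty_iff_forall_notMem]
      rintro M ⟨⟨hM, -⟩, hsc⟩
      obtain ⟨t, -, htn, -⟩ := exists_of_mem_scalarClass hn hM hsc
      exact hs ⟨t, htn.symm⟩
    simp [this]

/-- The non-scalar representatives that fix the class of `τ`. -/
def fixReps (n : ℕ) (τ : ℍ) : Finset RepIndex :=
  (repSet' n).filter fun i ↦ hauptG (repMat i • τ) = hauptG τ

lemma mem_fixReps {n : ℕ} {τ : ℍ} {i : RepIndex} :
    i ∈ fixReps n τ ↔ i ∈ repSet' n ∧ hauptG (repMat i • τ) = hauptG τ := by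
  simp [fixReps]

lemma card_fixReps {n : ℕ} (hn : 0 < n) (τ : ℍ) :
    (fixReps n τ).card * (fixSet 1 τ).ncard = (fixSet n τ \ scalarClass).ncard := by
  have h : ∀ i : RepIndex, ∃ γ : GL (Fin 2) ℝ, i ∈ fixReps n τ → γ ∈ heckeSet 1 ∧ γ • repMat i • τ = τ := by
    intro i
    by_cases hi : i ∈ fixReps n τ
    · obtain ⟨γ, hγ, h⟩ := exists_gamma_of_hauptG (mem_fixReps.1 hi).2
      exact ⟨γ, fun _ ↦ ⟨hγ, h⟩⟩
    · exact ⟨1, fun h ↦ absurd h hi⟩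
  choose γ hγ using h
  have hmul : ∀ i ∈ fixReps n τ, ∀ δ ∈ fixSet 1 τ, δ * γ i ∈ heckeSet 1 := fun i hi δ hδ ↦
    heckeSet_gamma_mul hδ.1 (hγ i hi).1
  have himg : fixSet n τ \ scalarClass =
      (fun p : RepIndex × GL (Fin 2) ℝ ↦ p.2 * γ p.1 * repMat p.1) ''
        ((fixReps n τ : Set RepIndex) ×ˢ fixSet 1 τ) := by
    ext M
    constructor
    · rintro ⟨⟨hM, hf⟩, hs⟩
      obtain ⟨i, hi, δ, hδ, h⟩ := exists_repMat' hn hM hs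
      have hfi : i ∈ fixReps n τ := by
        refine mem_fixReps.2 ⟨hi, ?_⟩
        rw [← gammaInv_hauptG δ hδ, ← mul_smul, ← h, hf]
      refine ⟨(i, δ * (γ i)⁻¹), ⟨hfi, heckeSet_gamma_mul hδ (heckeSet_one_inv (hγ i hfi).1), ?_⟩, ?_⟩
      · nth_rewrite 1 [← (hγ i hfi).2]
        rw [mul_smul, inv_smul_smul, ← mul_smul, ← h, hf]
      · simp only [inv_mul_cancel_right]
        exact h.symm
    · rintro ⟨⟨i, δ⟩, ⟨hi, hδ⟩, rfl⟩
      have hi' : i ∈ fixReps n τ := hi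
      obtain ⟨h1, h2⟩ := mem_fixReps.1 hi'
      obtain ⟨h3, h4⟩ := mem_repSet'.1 h1
      refine ⟨⟨heckeSet_gamma_mul (hmul i hi δ hδ) (repMat_mem h3), ?_⟩,
        fun h ↦ h4 (mem_scalarClass_of_gamma_mul (hmul i hi δ hδ) h)⟩
      change (δ * γ i * repMat i) • τ = τ
      rw [mul_smul, mul_smul, (hγ i hi).2, hδ.2]
  rw [himg, Set.InjOn.ncard_image, Set.ncard_prod, Set.ncard_coe_finset]
  rintro ⟨i, δ⟩ ⟨hi, hδ⟩ ⟨j, δ'⟩ ⟨hj, hδ'⟩ h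
  have hi' : i ∈ fixReps n τ := hi
  have hj' : j ∈ fixReps n τ := hj
  simp only at h hδ hδ'
  have hij : i = j := by
    refine repMat_inj (mem_repSet'.1 (mem_fixReps.1 hi').1).1 (mem_repSet'.1 (mem_fixReps.1 hj').1).1
      (heckeSet_gamma_mul (heckeSet_one_inv (hmul i hi' δ hδ)) (hmul j hj' δ' hδ')) ?_
    rw [mul_assoc, ← h, inv_mul_cancel_left]
  subst hij
  rw [mul_left_inj, mul_left_inj] at h
  rw [h]

lemma card_fixReps_mul {n : ℕ} (hn : 0 < n) (τ : ℍ) :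
    (fixReps n τ).card * (fixSet 1 τ).ncard + (if IsSquare n then (fixSet 1 τ).ncard else 0) =
      2 * (trSet n τ).ncard + if IsSquare n then 2 else 0 := by
  obtain ⟨hf, hc⟩ := ncard_fixSet hn τ
  rw [card_fixReps hn, ← ncard_fixSet_scalar hn, ← hc, add_comm]
  exact Set.ncard_inter_add_ncard_sdiff_eq_ncard _ _ hf

lemma analyticOrderAt_finset_prod {ι : Type*} (s : Finset ι) {f : ι → ℂ → ℂ} {z : ℂ}
    (h : ∀ i ∈ s, AnalyticAt ℂ (f i) z) :
    analyticOrderAt (fun w ↦ ∏ i ∈ s, f i w) z = ∑ i ∈ s, analyticOrderAt (f i) z := by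
  classical
  induction s using Finset.induction_on with
  | empty =>
    simp only [Finset.prod_empty, Finset.sum_empty]
    exact analyticAt_const.analyticOrderAt_eq_zero.2 one_ne_zero
  | insert i s hi ih =>
    simp only [Finset.prod_insert hi, Finset.sum_insert hi]
    rw [← ih fun j hj ↦ h j (Finset.mem_insert_of_mem hj)]
    exact analyticOrderAt_mul (h i (Finset.mem_insert_self i s))
      (Finset.analyticAt_fun_prod _ fun j hj ↦ h j (Finset.mem_insert_of_mem hj))

lemma rootMultiplicity_eq_card_fixReps {n K : ℕ} (hn : 0 < n) {Q : Polynomial ℂ} (hQ0 : Q ≠ 0)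
    (hQ : ∀ τ, diagProd n τ * cuspPoly.eval (hauptG τ) ^ K = Q.eval (hauptG τ)) (τ : ℍ) :
    Q.rootMultiplicity (hauptG τ) = (fixReps n τ).card := by
  have hn' : (0 : ℤ) < n := by exact_mod_cast hn
  obtain ⟨m, hm0, hm, hM⟩ := analyticOrderAt_hauptG_sub τ
  obtain ⟨R, hR, hRd⟩ := Q.exists_eq_pow_rootMultiplicity_mul_and_not_dvd hQ0 (hauptG τ)
  set k := Q.rootMultiplicity (hauptG τ)
  have hev : ∀ S : Polynomial ℂ, AnalyticAt ℂ (fun z ↦ S.eval (hauptGC z)) τ := fun S ↦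
    analyticAt_of_mdiff (mdiff_eval_hauptG S) τ
  have h1 : analyticOrderAt (fun z ↦ Q.eval (hauptGC z)) (τ : ℂ) = ((k * m : ℕ) : ℕ∞) := by
    have e1 : (fun z ↦ Q.eval (hauptGC z)) =
        (fun z ↦ hauptGC z - hauptG τ) ^ k * fun z ↦ R.eval (hauptGC z) := by
      ext z; rw [hR]; simp
    have hA : AnalyticAt ℂ (fun z ↦ hauptGC z - hauptG τ) τ :=
      (analyticAt_hauptGC τ).sub analyticAt_const
    rw [e1, analyticOrderAt_mul (hA.pow k) (hev R), analyticOrderAt_pow hA, hm,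
      (hev R).analyticOrderAt_eq_zero.2]
    · simp
    · rw [hauptGC_coe]
      exact fun h ↦ hRd (Polynomial.dvd_iff_isRoot.2 h)
  have hfa : ∀ i ∈ repSet' n, AnalyticAt ℂ (fun z ↦ hauptGC z - hauptG (repMat i • ofComplex z)) τ :=
    fun i hi ↦ (analyticAt_hauptGC τ).sub (analyticAt_of_mdiff
      (mdiff_smul mdiff_hauptG (det_pos_of_repMat hn (mem_repSet'.1 hi).1)) τ)
  have h2 : analyticOrderAt (fun z ↦ Q.eval (hauptGC z)) (τ : ℂ) =
      (((fixReps n τ).card * m : ℕ) : ℕ∞) := by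
    have e1 : (fun z ↦ Q.eval (hauptGC z)) =
        (fun z ↦ ∏ i ∈ repSet' n, (hauptGC z - hauptG (repMat i • ofComplex z))) *
          fun z ↦ (cuspPoly ^ K).eval (hauptGC z) := by
      ext z
      simp only [hauptGC, Pi.mul_apply, Polynomial.eval_pow]
      rw [← hQ]; rfl
    rw [e1, analyticOrderAt_mul (Finset.analyticAt_fun_prod _ hfa) (hev _),
      (hev (cuspPoly ^ K)).analyticOrderAt_eq_zero.2, add_zero, analyticOrderAt_finset_prod _ hfa,
      fixReps, Finset.card_filter, Finset.sum_mul, Nat.cast_sum]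
    · refine Finset.sum_congr rfl fun i hi ↦ ?_
      obtain ⟨hi1, hi2⟩ := mem_repSet'.1 hi
      split_ifs with h
      · rw [hM n hn' _ (repMat_mem hi1) hi2 h, one_mul]
      · rw [(hfa i hi).analyticOrderAt_eq_zero.2]
        · simp
        · rw [hauptGC_coe, ofComplex_apply]
          exact fun h' ↦ h (sub_eq_zero.1 h').symm
    · rw [hauptGC_coe, Polynomial.eval_pow]
      exact pow_ne_zero _ (eval_cuspPoly_hauptG_ne τ)
  rw [h1] at h2
  exact Nat.eq_of_mul_eq_mul_right (Nat.pos_of_ne_zero hm0) (by exact_mod_cast h2)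

/-- The weight `2 / |Γ_τ|` as a function of `X = hauptG τ`. -/
def ellWt (X : ℂ) : ℂ := if (X + 1) ^ 2 = -4 then 1 / 2 else 1

lemma ellWt_mul_ncard (τ : ℍ) : ellWt (hauptG τ) * (fixSet 1 τ).ncard = 2 := by
  classical
  rw [ellWt, ncard_fixSet_one]
  simp only [mem_cmSet_four_iff]
  split_ifs <;> norm_num

lemma ellWt_mul_trSet {n K : ℕ} (hn : 0 < n) {Q : Polynomial ℂ} (hQ0 : Q ≠ 0)
    (hQ : ∀ τ, diagProd n τ * cuspPoly.eval (hauptG τ) ^ K = Q.eval (hauptG τ)) (τ : ℍ) :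
    ellWt (hauptG τ) * (trSet n τ).ncard = Q.rootMultiplicity (hauptG τ) +
      if IsSquare n then 1 - ellWt (hauptG τ) else 0 := by
  have h := congrArg (fun x : ℕ ↦ (x : ℂ)) (card_fixReps_mul hn τ)
  rw [← rootMultiplicity_eq_card_fixReps hn hQ0 hQ] at h
  have h2 := ellWt_mul_ncard τ
  generalize ellWt (hauptG τ) = w at *
  split_ifs at h ⊢ <;> push_cast at h
  · linear_combination -(w / 2) * h + ((Q.rootMultiplicity (hauptG τ) : ℂ) + 1) / 2 * h2
  · linear_combination -(w / 2) * h + (Q.rootMultiplicity (hauptG τ) : ℂ) / 2 * h2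

lemma alSet_smul_mem_cmSet {d e : ℤ} (hd : 0 < d) (he : e ∈ ed) {W : GL (Fin 2) ℝ} (hW : W ∈ alSet e)
    {τ : ℍ} (hτ : τ ∈ cmSet d) : W • τ ∈ cmSet d := by
  obtain ⟨x, y, z, w, hM, hdet⟩ := hW
  obtain ⟨a, b, c, ha, hdisc, hf⟩ := hτ
  obtain ⟨f, hef⟩ := ed_dvd he
  have he0 := ed_pos he
  have hf0 : 0 < f := by nlinarith
  have hpos : 0 < ((e : ℝ) * x) * (e * w) - y * (10 * z) := by
    have := congrArg (fun k : ℤ ↦ (k : ℝ)) hdet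
    have h2 : (0 : ℝ) < e := by exact_mod_cast he0
    push_cast at this; linarith
  have hs := smul_of_coe hM hpos τ
  have hv : ((10 * z : ℤ) : ℂ) * τ + ((e * w : ℤ) : ℂ) ≠ 0 :=
    lin_int_ne_zero (A := e * x) (B := y) (n := e) (by linear_combination hdet) he0 τ
  refine ⟨a * e * w ^ 2 - b * w * z + f * c * z ^ 2,
    -20 * a * w * y + b * (e * w * x + f * y * z) - 20 * c * x * z,
    f * a * y ^ 2 - b * x * y + c * e * x ^ 2, ?_, ?_, ?_⟩
  · have h1 : 4 * a * e * (a * e * w ^ 2 - b * w * z + f * c * z ^ 2) =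
        (2 * a * e * w - b * z) ^ 2 + d * z ^ 2 := by
      linear_combination -(4 * a * c * z ^ 2) * hef - z ^ 2 * hdisc
    have h2 : 0 < (2 * a * e * w - b * z) ^ 2 + d * z ^ 2 := by
      by_cases hz : z = 0
      · subst hz
        have hw : w ≠ 0 := by rintro rfl; simp at hdet; omega
        have : 2 * a * e * w - b * 0 ≠ 0 := by
          rw [mul_zero, sub_zero]
          exact mul_ne_zero (mul_ne_zero (mul_ne_zero two_ne_zero ha.ne') he0.ne') hw
        positivity
      · positivity
    rw [← h1] at h2
    exact (mul_pos_iff_of_pos_left (by positivity)).1 h2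
  · have h1 : e * w * x - f * y * z = 1 := by
      have : e * (e * w * x - f * y * z) = e * 1 := by linear_combination hdet + y * z * hef
      exact mul_left_cancel₀ he0.ne' this
    have key : ∀ t : ℤ, t = e * f →
        (-(2 * t) * a * w * y + b * (e * w * x + f * y * z) - 2 * t * c * x * z) ^ 2 -
          4 * t * (a * e * w ^ 2 - b * w * z + f * c * z ^ 2) *
            (f * a * y ^ 2 - b * x * y + c * e * x ^ 2) =
        (b ^ 2 - 4 * t * a * c) * (e * w * x - f * y * z) ^ 2 := by
      rintro _ rfl; ring
    have h2 := key 10 hef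
    rw [h1] at h2
    linear_combination h2 + hdisc
  · rw [hs]
    push_cast at hv ⊢
    set u : ℂ := e * x * τ + y with hu
    set v : ℂ := 10 * z * τ + e * w with hv'
    have hefC : (10 : ℂ) = e * f := by exact_mod_cast hef
    have hdC : (e * x * (e * w) - 10 * y * z : ℂ) = e := by exact_mod_cast hdet
    have heC : (e : ℂ) ≠ 0 := by exact_mod_cast he0.ne'
    have k1 : (e : ℂ) * w * u - y * v = e * τ := by rw [hu, hv']; linear_combination τ * hdC
    have k2 : (-10 : ℂ) * z * u + e * x * v = e := by rw [hu, hv']; linear_combination hdC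
    have key : (10 * (a * e * w ^ 2 - b * w * z + f * c * z ^ 2) * u ^ 2 +
        (-20 * a * w * y + b * (e * w * x + f * y * z) - 20 * c * x * z) * (u * v) +
        (f * a * y ^ 2 - b * x * y + c * e * x ^ 2) * v ^ 2 : ℂ) = 0 := by
      have : (e : ℂ) * (10 * (a * e * w ^ 2 - b * w * z + f * c * z ^ 2) * u ^ 2 +
        (-20 * a * w * y + b * (e * w * x + f * y * z) - 20 * c * x * z) * (u * v) +
        (f * a * y ^ 2 - b * x * y + c * e * x ^ 2) * v ^ 2) =
        10 * a * (e * w * u - y * v) ^ 2 + b * (e * w * u - y * v) * (-10 * z * u + e * x * v) +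
          c * (-10 * z * u + e * x * v) ^ 2 := by
        linear_combination (-10 * c * z ^ 2 * u ^ 2 - b * y * z * u * v - a * y ^ 2 * v ^ 2) * hefC
      rw [k1, k2] at this
      refine (mul_eq_zero.1 (this.trans ?_)).resolve_left heC
      linear_combination (e : ℂ) ^ 2 * hf
    have : ∀ p q r : ℂ, p * u ^ 2 + q * (u * v) + r * v ^ 2 = 0 → p * (u / v) ^ 2 + q * (u / v) + r = 0 := by
      intro p q r h
      field_simp
      linear_combination h
    exact this _ _ _ key

lemma mem_cmSet_alSet_iff {d e : ℤ} (hd : 0 < d) (he : e ∈ ed) {W : GL (Fin 2) ℝ} (hW : W ∈ alSet e)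
    (τ : ℍ) : W • τ ∈ cmSet d ↔ τ ∈ cmSet d := by
  refine ⟨fun h ↦ ?_, alSet_smul_mem_cmSet hd he hW⟩
  obtain ⟨V, hV, h1⟩ := alSet_smul_smul he he hW hW
  have h2 : edMul e e = 1 := by
    exact (by decide : ∀ e ∈ ed, edMul e e = 1) e he
  rw [h2] at hV
  have h3 := alSet_smul_mem_cmSet hd he hW h
  rw [h1] at h3
  rw [← heckeSet_one_eq] at hV
  have h4 := heckeSet_one_inv hV
  rw [heckeSet_one_eq] at h4
  simpa using alSet_smul_mem_cmSet hd one_mem_ed h4 h3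

lemma mem_cmSet_of_hauptG_eq {d : ℤ} (hd : 0 < d) {τ τ' : ℍ} (h : hauptG τ = hauptG τ')
    (hτ : τ ∈ cmSet d) : τ' ∈ cmSet d := by
  obtain ⟨γ, hγ, rfl⟩ := exists_gamma_of_hauptG h
  rw [heckeSet_one_eq] at hγ
  exact alSet_smul_mem_cmSet hd one_mem_ed hγ hτ

/-- The symmetric matrix of determinant one attached to a point of the upper half-plane. -/
def pointMat (τ : ℍ) : Matrix (Fin 2) (Fin 2) ℝ :=
  τ.im⁻¹ • !![1, -τ.re; -τ.re, τ.re ^ 2 + τ.im ^ 2]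

lemma pointMat_injective : Function.Injective pointMat := by
  intro τ τ' h
  have h0 := congrFun (congrFun h 0) 0
  have h1 := congrFun (congrFun h 0) 1
  simp only [pointMat, Matrix.smul_apply, smul_eq_mul, Matrix.of_apply, Matrix.cons_val',
    Matrix.cons_val_zero, Matrix.cons_val_one, Matrix.cons_val_fin_one, mul_one] at h0 h1
  have him := inv_injective h0
  rw [h0] at h1
  have hre := neg_injective (mul_left_cancel₀ (inv_ne_zero τ'.im_pos.ne') h1)
  apply UpperHalfPlane.ext
  apply Complex.ext
  · exact hre
  · exact him

lemma eq_smul_pointMat {M : Matrix (Fin 2) (Fin 2) ℝ} {D : ℝ} (hD : 0 < D) {τ : ℍ}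
    (hs : M 1 0 = M 0 1) (h0 : 0 < M 0 0) (hd : M.det = D ^ 2)
    (h : (M 0 0 * τ ^ 2 + (2 * M 0 1 : ℝ) * τ + M 1 1 : ℂ) = 0) : M = D • pointMat τ := by
  obtain ⟨h1, h2⟩ := quadratic_root h
  have hb : M 0 1 = -M 0 0 * τ.re := by linarith
  have hy := τ.im_pos
  have h3 : M 0 0 * τ.im = D := by
    rw [Matrix.det_fin_two, hs, h2, hb] at hd
    refine (pow_left_inj₀ (by positivity) hD.le two_ne_zero).1 ?_
    linear_combination hd
  have h4 : M 0 0 = D * τ.im⁻¹ := by rw [← h3]; field_simp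
  have hb' : M 0 1 = D * (τ.im⁻¹ * -τ.re) := by rw [hb, h4]; ring
  ext i j
  fin_cases i <;> fin_cases j
  · simp [pointMat, h4]
  · simpa [pointMat] using hb'
  · simpa [pointMat] using hs.trans hb'
  · simp [pointMat, h2, h4, mul_assoc]

lemma pointMat_smul {V : GL (Fin 2) ℝ} (hV : 0 < V.det.val) (τ : ℍ) :
    V.1ᵀ * pointMat (V • τ) * V.1 = V.det.val • pointMat τ := by
  obtain ⟨A, B, C, D, hM⟩ : ∃ A B C D, V.1 = !![A, B; C, D] := ⟨_, _, _, _, Matrix.eta_fin_two _⟩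
  rw [det_of_coe hM] at hV ⊢
  have hs := smul_of_coe hM hV τ
  set τ' := V • τ
  have hy' := τ'.im_pos
  have hne : (C * τ + D : ℂ) ≠ 0 := by
    intro h
    obtain ⟨h1, h2⟩ := eq_zero_of_add_eq_zero h
    rw [h1, h2] at hV; simp at hV
  have hdet : (pointMat τ').det = 1 := by
    rw [pointMat, Matrix.det_smul, Matrix.det_fin_two_of]
    simp; field_simp; ring
  apply eq_smul_pointMat hV
  · rw [hM]; simp [pointMat, Matrix.mul_apply, Fin.sum_univ_two]; ring
  · have : (V.1ᵀ * pointMat τ' * V.1) 0 0 = τ'.im⁻¹ * ((A - C * τ'.re) ^ 2 + C ^ 2 * τ'.im ^ 2) := by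
      rw [hM]; simp [pointMat, Matrix.mul_apply, Fin.sum_univ_two]; ring
    rw [this]
    refine mul_pos (inv_pos.2 hy') ?_
    by_cases hC : C = 0
    · have hA : A ≠ 0 := by rintro rfl; simp [hC] at hV
      rw [hC]; simp; positivity
    · positivity
  · rw [Matrix.det_mul, Matrix.det_mul, Matrix.det_transpose, hdet, hM, Matrix.det_fin_two_of]; ring
  · have h1 : ((τ' : ℂ) * (C * τ + D)) = A * τ + B := by rw [hs, div_mul_cancel₀ _ hne]
    have h2 : (pointMat τ' 0 0 * τ' ^ 2 + 2 * pointMat τ' 0 1 * τ' + pointMat τ' 1 1 : ℂ) = 0 := by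
      have hz : (τ' : ℂ) = (τ'.re : ℂ) + τ'.im * I := by
        rw [← UpperHalfPlane.coe_re, ← UpperHalfPlane.coe_im, Complex.re_add_im]
      rw [hz]; simp [pointMat]
      ring_nf; rw [I_sq]; ring
    have hsym : pointMat τ' 1 0 = pointMat τ' 0 1 := by simp [pointMat]
    rw [hM]
    simp [Matrix.mul_apply, Fin.sum_univ_two, hsym]
    generalize pointMat τ' 0 0 = p at *
    generalize pointMat τ' 0 1 = q at *
    generalize pointMat τ' 1 1 = s at *
    have h3 : (C * τ + D : ℂ) ^ 2 * (p * τ' ^ 2 + 2 * q * τ' + s) =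
      p * (A * τ + B) ^ 2 + 2 * q * (A * τ + B) * (C * τ + D) + s * (C * τ + D) ^ 2 := by
      rw [← h1]; ring
    rw [h2] at h3
    linear_combination -h3

lemma exists_point_of_form {d : ℤ} (hd : 0 < d) {M : Matrix (Fin 2) (Fin 2) ℝ} (hM : M ∈ QdN d 10) :
    ∃ τ : ℍ, τ ∈ cmSet d ∧ (τ : ℂ) = cmPointC M ∧ M = (√d / 2) • pointMat τ := by
  obtain ⟨a, b, c, rfl, ha, hdisc, k, rfl⟩ := hM
  have hdR : (0 : ℝ) < d := by exact_mod_cast hd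
  have haR : (0 : ℝ) < (10 * k : ℤ) := by exact_mod_cast ha
  have hdiscR : (b : ℝ) ^ 2 - 4 * (10 * k : ℤ) * c = -d := by exact_mod_cast hdisc
  have hdet : (formMat (10 * k : ℤ) b c).det = (√d / 2) ^ 2 := by
    rw [formMat, Matrix.det_fin_two_of, div_pow, Real.sq_sqrt hdR.le]; linarith
  have hsq : Real.sqrt (formMat (10 * k : ℤ) b c).det = √d / 2 := by
    rw [hdet, Real.sqrt_sq (by positivity)]
  have hpt : cmPointC (formMat (10 * k : ℤ) b c) =
      ((-(b / 2) : ℝ) + I * (√d / 2 : ℝ)) / ((10 * k : ℤ) : ℝ) := by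
    rw [cmPointC, hsq]; simp [formMat]
  have him : 0 < (cmPointC (formMat (10 * k : ℤ) b c)).im := by
    rw [hpt, Complex.div_ofReal_im]
    simp only [add_im, ofReal_im, mul_im, Complex.I_re, Complex.I_im, ofReal_re, zero_mul, one_mul, zero_add]
    positivity
  have hroot : (((10 * k : ℤ) : ℝ) * (cmPointC (formMat (10 * k : ℤ) b c)) ^ 2 +
      (b : ℝ) * cmPointC (formMat (10 * k : ℤ) b c) + (c : ℝ) : ℂ) = 0 := by
    rw [hpt]
    have h1 : (((10 * k : ℤ) : ℝ) : ℂ) ≠ 0 := by exact_mod_cast haR.ne'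
    have h2 : ((√d : ℝ) : ℂ) ^ 2 = d := by rw [← ofReal_pow, Real.sq_sqrt hdR.le]; simp
    have h3 : ((b : ℝ) : ℂ) ^ 2 - 4 * (((10 * k : ℤ) : ℝ) : ℂ) * ((c : ℝ) : ℂ) = -d := by
      exact_mod_cast hdiscR
    push_cast only [ofReal_neg, ofReal_div, ofReal_ofNat]
    generalize (((10 * k : ℤ) : ℝ) : ℂ) = A at *
    generalize ((√d : ℝ) : ℂ) = D at *
    field_simp
    ring_nf
    rw [I_sq, h2]
    linear_combination -h3
  refine ⟨⟨_, him⟩, ⟨k, b, c, by omega, by linear_combination hdisc, ?_⟩, rfl, ?_⟩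
  · simpa using hroot
  · refine eq_smul_pointMat (by positivity) ?_ ?_ hdet ?_
    · simp [formMat]
    · simpa [formMat] using haR
    · simp [formMat] at hroot ⊢; linear_combination hroot

lemma exists_form_of_point {d : ℤ} (hd : 0 < d) {τ : ℍ} (hτ : τ ∈ cmSet d) :
    ∃ M ∈ QdN d 10, M = (√d / 2) • pointMat τ := by
  obtain ⟨a, b, c, ha, hdisc, hroot⟩ := hτ
  have hdR : (0 : ℝ) < d := by exact_mod_cast hd
  have haR : (0 : ℝ) < a := by exact_mod_cast ha
  refine ⟨formMat (10 * a) b c, ⟨10 * a, b, c, rfl, by omega, by linear_combination hdisc, ⟨a, rfl⟩⟩, ?_⟩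
  have hdiscR : (b : ℝ) ^ 2 - 40 * a * c = -d := by exact_mod_cast hdisc
  refine eq_smul_pointMat (by positivity) ?_ ?_ ?_ ?_
  · simp [formMat]
  · simpa [formMat] using haR
  · rw [formMat, Matrix.det_fin_two_of, div_pow, Real.sq_sqrt hdR.le]; push_cast; linarith
  · simp [formMat]; linear_combination hroot

/-- The CM point of a form as a point of the upper half-plane. -/
def formPt {d : ℤ} (hd : 0 < d) (Q : QdN d 10) : ℍ := (exists_point_of_form hd Q.2).choose

lemma formPt_spec {d : ℤ} (hd : 0 < d) (Q : QdN d 10) :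
    formPt hd Q ∈ cmSet d ∧ (formPt hd Q : ℂ) = cmPointC Q.1 ∧
      Q.1 = (√d / 2) • pointMat (formPt hd Q) :=
  (exists_point_of_form hd Q.2).choose_spec

lemma formPt_surj {d : ℤ} (hd : 0 < d) {τ : ℍ} (hτ : τ ∈ cmSet d) : ∃ Q, formPt hd Q = τ := by
  obtain ⟨M, hM, h⟩ := exists_form_of_point hd hτ
  have hdR : (0 : ℝ) < d := by exact_mod_cast hd
  refine ⟨⟨M, hM⟩, pointMat_injective ?_⟩
  have h2 := (formPt_spec hd ⟨M, hM⟩).2.2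
  have h3 : (√d / 2 : ℝ) ≠ 0 := by positivity
  exact smul_right_injective _ h3 (h2.symm.trans h)

/-- Elements of the Fricke group are normalised Atkin–Lehner matrices. -/
def alLift (w : SL2R) (e : ℤ) (V : GL (Fin 2) ℝ) : Prop := V ∈ alSet e ∧ V.1 = √(e : ℝ) • w.1

lemma exists_alLift_iff (w : SL2R) : w ∈ FrickeGroup 10 ↔ ∃ e ∈ ed, ∃ V, alLift w e V := by
  constructor
  · intro hw
    induction hw using Subgroup.closure_induction with
    | mem w hw =>
      rcases hw with hw | hw
      · obtain ⟨γ, hγ, rfl⟩ := hw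
        have h0 : (10 : ℤ) ∣ γ.1 1 0 := (ZMod.intCast_zmod_eq_zero_iff_dvd _ 10).1
          (CongruenceSubgroup.Gamma0_mem.1 hγ)
        obtain ⟨k, hk⟩ := h0
        have hdet : γ.1 0 0 * γ.1 1 1 - 10 * γ.1 0 1 * k = 1 := by
          have := γ.2; rw [Matrix.det_fin_two, hk] at this; linarith
        have hpos : (0 : ℝ) < γ.1 0 0 * γ.1 1 1 - γ.1 0 1 * (10 * k) := by
          have := congrArg (fun x : ℤ ↦ (x : ℝ)) hdet
          push_cast at this; linarith
        refine ⟨1, one_mem_ed, gl _ _ _ _ hpos, ⟨γ.1 0 0, γ.1 0 1, k, γ.1 1 1, ?_, ?_⟩, ?_⟩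
        · rw [gl_coe]; simp
        · linarith
        · rw [gl_coe]
          have hkR : ((γ.1 1 0 : ℤ) : ℝ) = 10 * k := by rw [hk]; push_cast; ring
          ext i j; fin_cases i <;> fin_cases j <;> simp [hkR]
      · simp only [Set.mem_iUnion] at hw
        obtain ⟨e, ⟨he, hco⟩, x, y, z, w', h⟩ := hw
        have hed : (e : ℤ) ∈ ed := by
          have : e ≤ 10 := Nat.le_of_dvd (by norm_num) he
          interval_cases e <;> revert he <;> decide
        have he0 : (0 : ℝ) < e := by exact_mod_cast ed_pos hed
        have hs0 : (√(e : ℝ)) ≠ 0 := by positivity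
        have hw : √(e : ℝ) • w.1 = !![(x : ℝ) * e, (y : ℝ); (z : ℝ) * (10 : ℕ), (w' : ℝ) * e] := by
          rw [h, smul_smul, mul_inv_cancel₀ hs0, one_smul]
        have hd : (x : ℝ) * e * (w' * e) - y * (z * 10) = e := by
          have := congrArg Matrix.det hw
          rw [Matrix.det_smul, w.2, Matrix.det_fin_two_of, Fintype.card_fin, Real.sq_sqrt he0.le] at this
          push_cast at this; linarith
        have hpos : (0 : ℝ) < (e * x) * (e * w') - y * (10 * z) := by linarith
        refine ⟨e, hed, gl _ _ _ _ hpos, ⟨x, y, z, w', ?_, ?_⟩, ?_⟩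
        · rw [gl_coe]; simp
        · have : ((e * x * (e * w') - 10 * y * z : ℤ) : ℝ) = (e : ℤ) := by push_cast; linarith
          exact_mod_cast this
        · rw [gl_coe, Int.cast_natCast, hw]; push_cast; simp only [mul_comm]
    | one =>
      refine ⟨1, one_mem_ed, 1, ?_, by simp⟩
      rw [← heckeSet_one_eq]; exact one_mem_heckeSet
    | mul w w' _ _ h h' =>
      obtain ⟨e, he, V, hV, hw⟩ := h
      obtain ⟨f, hf, V', hV', hw'⟩ := h'
      obtain ⟨g, hg, hgef, U, hU, h⟩ := alSet_mul_ed he hf hV hV'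
      refine ⟨_, edMul_mem he hf, U, hU, ?_⟩
      have hgR : (0 : ℝ) < g := by exact_mod_cast hg
      have he0 : (0 : ℝ) < e := by exact_mod_cast ed_pos he
      have hsq : √(e : ℝ) * √(f : ℝ) = g * √(edMul e f : ℤ) := by
        have : (e : ℝ) * f = g ^ 2 * (edMul e f : ℤ) := by exact_mod_cast hgef
        rw [← Real.sqrt_mul he0.le, this, Real.sqrt_mul (by positivity), Real.sqrt_sq hgR.le]
      rw [Units.val_mul, hw, hw', Matrix.smul_mul, Matrix.mul_smul, smul_smul, hsq, ← smul_smul] at h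
      exact (smul_right_injective _ hgR.ne' h).symm
    | inv w _ h =>
      obtain ⟨e, he, V, ⟨x, y, z, w', hV, hd⟩, hw⟩ := h
      have hpos : (0 : ℝ) < (e * w') * (e * x) - (-y) * (-(10 * z)) := by
        have := congrArg (fun x : ℤ ↦ (x : ℝ)) hd
        have he0 : (0 : ℝ) < e := by exact_mod_cast ed_pos he
        push_cast at this; linarith
      refine ⟨e, he, gl _ _ _ _ hpos, ⟨w', -y, -z, x, ?_, by linear_combination hd⟩, ?_⟩
      · rw [gl_coe]; push_cast; congr 3; ring_nf
      · rw [hV] at hw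
        have h00 := congrFun (congrFun hw 0) 0
        have h01 := congrFun (congrFun hw 0) 1
        have h10 := congrFun (congrFun hw 1) 0
        have h11 := congrFun (congrFun hw 1) 1
        simp at h00 h01 h10 h11
        rw [gl_coe, Matrix.SpecialLinearGroup.coe_inv, Matrix.adjugate_fin_two]
        ext i j; fin_cases i <;> fin_cases j <;> simp <;> linarith
  · rintro ⟨e, he, V, ⟨x, y, z, w', hV, hd⟩, hw⟩
    apply Subgroup.subset_closure
    right
    have he0 : (0 : ℝ) < e := by exact_mod_cast ed_pos he
    have hs0 : (√(e : ℝ)) ≠ 0 := by positivity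
    obtain ⟨m, rfl⟩ := Int.eq_ofNat_of_zero_le (ed_pos he).le
    simp only [Set.mem_iUnion]
    refine ⟨m, ?_, x, y, z, w', ?_⟩
    · have : m = 1 ∨ m = 2 ∨ m = 5 ∨ m = 10 := by
        simp only [ed, Finset.mem_insert, Finset.mem_singleton] at he; omega
      rcases this with rfl | rfl | rfl | rfl <;> exact ⟨by decide, by decide⟩
    · rw [hV] at hw
      simp only [Int.cast_natCast] at hw hs0
      rw [← smul_right_injective _ hs0 |>.eq_iff, ← hw, smul_smul, mul_inv_cancel₀ hs0, one_smul]
      push_cast; simp only [mul_comm]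

lemma hauptG_alW_congr {e : ℤ} (he : e ∈ ed) {τ τ' : ℍ} (h : hauptG τ = hauptG τ') :
    hauptG (alW e • τ) = hauptG (alW e • τ') := by
  obtain ⟨γ, hγ, rfl⟩ := exists_gamma_of_hauptG h
  exact (gammaInv_hauptG.comp_alSet he (alW_mem he) γ hγ τ).symm

lemma edMul_self {e : ℤ} (he : e ∈ ed) : edMul e e = 1 :=
  (by decide : ∀ e ∈ ed, edMul e e = 1) e he

lemma edMul_edMul {e f : ℤ} (he : e ∈ ed) (hf : f ∈ ed) : edMul e (edMul e f) = f :=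
  (by decide : ∀ e ∈ ed, ∀ f ∈ ed, edMul e (edMul e f) = f) e he f hf

lemma hauptG_alW_eq_iff {e f : ℤ} (he : e ∈ ed) (hf : f ∈ ed) (τ τ' : ℍ) :
    hauptG (alW e • τ) = hauptG (alW f • τ') ↔ hauptG τ = hauptG (alW (edMul e f) • τ') := by
  constructor <;> intro h
  · have := hauptG_alW_congr he h
    rwa [gammaInv_hauptG.alW_alW he he, gammaInv_hauptG.alW_alW he hf, edMul_self he, alW_one,
      one_smul] at this
  · have := hauptG_alW_congr he h
    rwa [gammaInv_hauptG.alW_alW he (edMul_mem he hf), edMul_edMul he hf] at this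

lemma exists_alSet_smul_iff {e : ℤ} (he : e ∈ ed) (τ τ' : ℍ) :
    (∃ V ∈ alSet e, V • τ' = τ) ↔ hauptG τ = hauptG (alW e • τ') := by
  constructor
  · rintro ⟨V, hV, rfl⟩
    exact gammaInv_hauptG.alSet_congr he hV (alW_mem he) τ'
  · intro h
    obtain ⟨γ, hγ, h⟩ := exists_gamma_of_hauptG h.symm
    exact ⟨γ * alW e, alSet_mul_gamma (ed_dvd he) (alW_mem he) hγ, by rw [mul_smul, h]⟩

lemma exists_alLift_of_alSet {e : ℤ} (he : e ∈ ed) {V : GL (Fin 2) ℝ} (hV : V ∈ alSet e) :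
    ∃ w, alLift w e V := by
  have he0 : (0 : ℝ) < e := by exact_mod_cast ed_pos he
  have hs0 : (√(e : ℝ)) ≠ 0 := by positivity
  have hdet := alSet_det hV
  rw [Matrix.GeneralLinearGroup.val_det_apply] at hdet
  refine ⟨⟨(√(e : ℝ))⁻¹ • V.1, ?_⟩, hV, ?_⟩
  · rw [Matrix.det_smul, hdet, Fintype.card_fin, inv_pow, Real.sq_sqrt he0.le, inv_mul_cancel₀ he0.ne']
  · rw [smul_smul, mul_inv_cancel₀ hs0, one_smul]

lemma alLift.form_iff {w : SL2R} {e : ℤ} (he : e ∈ ed) {V : GL (Fin 2) ℝ} (h : alLift w e V) (σ τ : ℍ) :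
    w.1ᵀ * pointMat σ * w.1 = pointMat τ ↔ V • τ = σ := by
  have he0 : (0 : ℝ) < e := by exact_mod_cast ed_pos he
  have key : w.1ᵀ * pointMat (V • τ) * w.1 = pointMat τ := by
    have := pointMat_smul (V := V) (by rw [alSet_det h.1]; exact he0) τ
    rw [alSet_det h.1, h.2, Matrix.transpose_smul, Matrix.mul_smul, Matrix.smul_mul, Matrix.smul_mul,
      smul_smul, Real.mul_self_sqrt he0.le] at this
    exact smul_right_injective _ he0.ne' this
  constructor
  · intro h'
    have hu : IsUnit w.1 := (Matrix.isUnit_iff_isUnit_det _).2 (by rw [w.2]; exact isUnit_one)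
    have hu' : IsUnit w.1ᵀ := (Matrix.isUnit_iff_isUnit_det _).2 (by
      rw [Matrix.det_transpose, w.2]; exact isUnit_one)
    exact pointMat_injective (hu'.mul_left_cancel (hu.mul_right_cancel (key.trans h'.symm)))
  · rintro rfl; exact key

lemma conj_form_iff {d : ℤ} (hd : 0 < d) (Q Q' : QdN d 10) (w : Matrix (Fin 2) (Fin 2) ℝ) :
    wᵀ * Q.1 * w = Q'.1 ↔ wᵀ * pointMat (formPt hd Q) * w = pointMat (formPt hd Q') := by
  have hdR : (0 : ℝ) < d := by exact_mod_cast hd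
  have h3 : (√d / 2 : ℝ) ≠ 0 := by positivity
  rw [(formPt_spec hd Q).2.2, (formPt_spec hd Q').2.2, Matrix.mul_smul, Matrix.smul_mul]
  exact (smul_right_injective _ h3).eq_iff

lemma formRel_iff {d : ℤ} (hd : 0 < d) (Q Q' : QdN d 10) :
    formRel (FrickeGroup 10) (QdN d 10) Q Q' ↔
      ∃ e ∈ ed, hauptG (formPt hd Q) = hauptG (alW e • formPt hd Q') := by
  constructor
  · rintro ⟨w, hw, h⟩
    obtain ⟨e, he, V, hV⟩ := (exists_alLift_iff w).1 hw
    rw [eq_comm, conj_form_iff hd, hV.form_iff he] at h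
    exact ⟨e, he, (exists_alSet_smul_iff he _ _).1 ⟨V, hV.1, h⟩⟩
  · rintro ⟨e, he, h⟩
    obtain ⟨V, hV, h⟩ := (exists_alSet_smul_iff he _ _).2 h
    obtain ⟨w, hw⟩ := exists_alLift_of_alSet he hV
    refine ⟨w, (exists_alLift_iff w).2 ⟨e, he, V, hw⟩, ?_⟩
    rw [eq_comm, conj_form_iff hd, hw.form_iff he, h]

/-- The Atkin–Lehner indices whose involution fixes the image of `τ` on the modular curve. -/
def alFix (τ : ℍ) : Finset ℤ := {e ∈ ed | hauptG (alW e • τ) = hauptG τ}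

lemma one_mem_alFix (τ : ℍ) : 1 ∈ alFix τ := by
  simp [alFix, one_mem_ed, alW_one]

lemma ncard_alSet_fix {e : ℤ} {τ : ℍ} (he : e ∈ alFix τ) :
    {V | V ∈ alSet e ∧ V • τ = τ}.Finite ∧
      {V | V ∈ alSet e ∧ V • τ = τ}.ncard = (fixSet 1 τ).ncard := by
  obtain ⟨he, h⟩ := Finset.mem_filter.1 he
  obtain ⟨V, hV, hVτ⟩ := (exists_alSet_smul_iff he τ τ).2 h.symm
  have heq : {V | V ∈ alSet e ∧ V • τ = τ} = (fun M ↦ V * M) '' fixSet 1 τ := by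
    ext U
    constructor
    · rintro ⟨hU, hUτ⟩
      refine ⟨V⁻¹ * U, ⟨alSet_inv_mul (ed_pos he) (ed_dvd he) hV hU, ?_⟩, by simp⟩
      rw [mul_smul, hUτ, inv_smul_eq_iff, hVτ]
    · rintro ⟨M, ⟨hM, hMτ⟩, rfl⟩
      exact ⟨alSet_gamma_mul (ed_dvd he) hV hM, by simp only [mul_smul, hMτ, hVτ]⟩
  rw [heq]
  exact ⟨(fixSet_one_finite τ).image _, Set.ncard_image_of_injective _ (mul_right_injective V)⟩

lemma alLift_unique {w : SL2R} {e f : ℤ} (he : e ∈ ed) (hf : f ∈ ed) {V U : GL (Fin 2) ℝ}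
    (hV : alLift w e V) (hU : alLift w f U) : e = f := by
  obtain ⟨⟨x, y, z, t, hVc, hdV⟩, hVw⟩ := hV
  obtain ⟨⟨x', y', z', t', hUc, hdU⟩, hUw⟩ := hU
  have he0 : (0 : ℝ) < e := by exact_mod_cast ed_pos he
  have hf0 : (0 : ℝ) < f := by exact_mod_cast ed_pos hf
  have hfe : ∀ i j, (f : ℝ) * V.1 i j ^ 2 = e * U.1 i j ^ 2 := by
    intro i j
    rw [hVw, hUw]
    simp only [Matrix.smul_apply, smul_eq_mul, mul_pow, Real.sq_sqrt he0.le, Real.sq_sqrt hf0.le]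
    ring
  have h00 := hfe 0 0
  have h01 := hfe 0 1
  simp only [hVc, hUc] at h00 h01
  have h0 : f * (e * x) ^ 2 = e * (f * x') ^ 2 := by
    simp at h00; exact_mod_cast h00
  have h1 : f * y ^ 2 = e * y' ^ 2 := by
    simp at h01; exact_mod_cast h01
  have hsq : ∃ a b : ℤ, b ≠ 0 ∧ f * a ^ 2 = e * b ^ 2 := by
    by_cases hx : x' = 0
    · refine ⟨y, y', ?_, h1⟩
      rintro rfl
      subst hx
      have := ed_pos hf
      simp at hdU; omega
    · exact ⟨e * x, f * x', mul_ne_zero (ed_pos hf).ne' hx, h0⟩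
  obtain ⟨a, b, hb, hab⟩ := hsq
  have hsq : IsSquare (e * f) := by
    have h2 : (f * a) ^ 2 = (e * f) * b ^ 2 := by linear_combination f * hab
    have h3 : b ∣ f * a := (Int.pow_dvd_pow_iff two_ne_zero).1 ⟨e * f, by rw [h2]; ring⟩
    obtain ⟨k, hk⟩ := h3
    refine ⟨k, ?_⟩
    rw [hk] at h2
    have : b ^ 2 * (e * f) = b ^ 2 * (k * k) := by linear_combination -h2
    exact mul_left_cancel₀ (pow_ne_zero 2 hb) this
  obtain ⟨k, hk⟩ := hsq
  have hle : e * f ≤ 100 := (by decide : ∀ e ∈ ed, ∀ f ∈ ed, e * f ≤ 100) e he f hf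
  exact (by decide : ∀ e ∈ ed, ∀ f ∈ ed, ∀ k ∈ Finset.Icc (-10 : ℤ) 10, e * f = k * k → e = f) e he f hf
    k (Finset.mem_Icc.2 ⟨by nlinarith, by nlinarith⟩) hk

lemma card_stab {d : ℤ} (hd : 0 < d) (Q : QdN d 10) :
    Nat.card {w : SL2R // w ∈ FrickeGroup 10 ∧ w.1ᵀ * Q.1 * w.1 = Q.1} =
      (alFix (formPt hd Q)).card * (fixSet 1 (formPt hd Q)).ncard := by
  set τ := formPt hd Q with hτ
  let S : ℤ → Set SL2R := fun e ↦ {w | ∃ V, alLift w e V ∧ V • τ = τ}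
  have hS : ∀ e ∈ alFix τ, (S e).Finite ∧ (S e).ncard = (fixSet 1 τ).ncard := by
    intro e he
    have he' := (Finset.mem_filter.1 he).1
    obtain ⟨hfin, hcard⟩ := ncard_alSet_fix he
    have he0 : (0 : ℝ) < e := by exact_mod_cast ed_pos he'
    have hs0 : (√(e : ℝ)) ≠ 0 := by positivity
    choose! f hf using fun V (hV : V ∈ {V | V ∈ alSet e ∧ V • τ = τ}) ↦ exists_alLift_of_alSet he' hV.1
    have hbij : Set.BijOn f {V | V ∈ alSet e ∧ V • τ = τ} (S e) := by
      refine ⟨fun V hV ↦ ⟨V, hf V hV, hV.2⟩, fun V hV U hU h ↦ ?_, ?_⟩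
      · apply gl_ext; rw [(hf V hV).2, (hf U hU).2, h]
      · rintro w ⟨V, hV, hVτ⟩
        refine ⟨V, ⟨hV.1, hVτ⟩, Subtype.ext ?_⟩
        have h1 := (hf V ⟨hV.1, hVτ⟩).2
        exact smul_right_injective _ hs0 (h1.symm.trans hV.2)
    refine ⟨hbij.finite_iff_finite.1 hfin, ?_⟩
    rw [← hcard, ← hbij.image_eq, hbij.injOn.ncard_image]
  have hmem : {w : SL2R | w ∈ FrickeGroup 10 ∧ w.1ᵀ * Q.1 * w.1 = Q.1} = ⋃ e ∈ alFix τ, S e := by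
    ext w
    simp only [Set.mem_iUnion, exists_prop]
    constructor
    · rintro ⟨hw, h⟩
      obtain ⟨e, he, V, hV⟩ := (exists_alLift_iff w).1 hw
      rw [conj_form_iff hd, hV.form_iff he] at h
      refine ⟨e, Finset.mem_filter.2 ⟨he, ?_⟩, V, hV, h⟩
      exact ((exists_alSet_smul_iff he _ _).1 ⟨V, hV.1, h⟩).symm
    · rintro ⟨e, he, V, hV, h⟩
      have he' := (Finset.mem_filter.1 he).1
      exact ⟨(exists_alLift_iff w).2 ⟨e, he', V, hV⟩, by rw [conj_form_iff hd, hV.form_iff he', h]⟩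
  have hdisj : ((alFix τ : Finset ℤ) : Set ℤ).PairwiseDisjoint S := by
    intro e he f hf hef
    rw [Function.onFun, Set.disjoint_left]
    rintro w ⟨V, hV, -⟩ ⟨U, hU, -⟩
    exact hef (alLift_unique (Finset.mem_filter.1 he).1 (Finset.mem_filter.1 hf).1 hV hU)
  have hcard : Nat.card {w : SL2R // w ∈ FrickeGroup 10 ∧ w.1ᵀ * Q.1 * w.1 = Q.1} =
      {w : SL2R | w ∈ FrickeGroup 10 ∧ w.1ᵀ * Q.1 * w.1 = Q.1}.ncard := Nat.card_coe_set_eq _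
  have hU := (alFix τ).finite_toSet.ncard_biUnion (s := S) (fun e he ↦ (hS e he).1) hdisj
  simp only [Finset.mem_coe] at hU
  rw [hcard, hmem, hU, finsum_mem_finset_eq_sum, Finset.sum_congr rfl fun e he ↦ (hS e he).2,
    Finset.sum_const, smul_eq_mul]

/-- Images on the modular curve of the Atkin–Lehner orbit of `τ`. -/
def alOrbit (τ : ℍ) : Finset ℂ := ed.image fun e ↦ hauptG (alW e • τ)

lemma ellWt_alW {e : ℤ} (he : e ∈ ed) (τ : ℍ) : ellWt (hauptG (alW e • τ)) = ellWt (hauptG τ) := by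
  have h : (hauptG (alW e • τ) + 1) ^ 2 = -4 ↔ (hauptG τ + 1) ^ 2 = -4 := by
    rw [← mem_cmSet_four_iff, ← mem_cmSet_four_iff,
      mem_cmSet_alSet_iff (by norm_num : (0 : ℤ) < 4) he (alW_mem he)]
  simp only [ellWt, h]

lemma card_fibre {e : ℤ} (he : e ∈ ed) (τ : ℍ) :
    {f ∈ ed | hauptG (alW f • τ) = hauptG (alW e • τ)}.card = (alFix τ).card := by
  refine Finset.card_bij' (fun f _ ↦ edMul e f) (fun f _ ↦ edMul e f) ?_ ?_ ?_ ?_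
  · intro f hf
    obtain ⟨hf, h⟩ := Finset.mem_filter.1 hf
    refine Finset.mem_filter.2 ⟨edMul_mem he hf, ?_⟩
    exact ((hauptG_alW_eq_iff he hf τ τ).1 h.symm).symm
  · intro f hf
    obtain ⟨hf, h⟩ := Finset.mem_filter.1 hf
    refine Finset.mem_filter.2 ⟨edMul_mem he hf, ?_⟩
    rw [eq_comm, hauptG_alW_eq_iff he (edMul_mem he hf), edMul_edMul he hf, h]
  · exact fun f hf ↦ edMul_edMul he (Finset.mem_filter.1 hf).1
  · exact fun f hf ↦ edMul_edMul he (Finset.mem_filter.1 hf).1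

lemma hauptJ_div_stabOrder {d : ℤ} (hd : 0 < d) (Q : QdN d 10) :
    (hauptJ (formPt hd Q) ^ 2 - 44) / (stabOrder (FrickeGroup 10) Q.1 : ℂ) =
      ∑ X ∈ alOrbit (formPt hd Q), (X ^ 2 - 4) * ellWt X := by
  rw [stabOrder, card_stab hd]
  set τ := formPt hd Q
  have hk : ((alFix τ).card : ℂ) ≠ 0 := by
    exact_mod_cast (Finset.card_pos.2 ⟨1, one_mem_alFix τ⟩).ne'
  have hst : (((alFix τ).card * (fixSet 1 τ).ncard / 2 : ℕ) : ℂ) * ellWt (hauptG τ) = (alFix τ).card := by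
    have h1 := ellWt_mul_ncard τ
    have h2 : 2 ∣ (fixSet 1 τ).ncard := by
      rw [ncard_fixSet_one]; split_ifs <;> decide
    obtain ⟨m, hm⟩ := h2
    rw [hm] at h1 ⊢
    rw [show (alFix τ).card * (2 * m) / 2 = (alFix τ).card * m by
      rw [show (alFix τ).card * (2 * m) = 2 * ((alFix τ).card * m) by ring]; simp]
    push_cast at h1 ⊢
    linear_combination ((alFix τ).card : ℂ) / 2 * h1
  have hs0 : (((alFix τ).card * (fixSet 1 τ).ncard / 2 : ℕ) : ℂ) ≠ 0 := by
    intro h; rw [h, zero_mul] at hst; exact hk hst.symm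
  have hsum : hauptJ τ ^ 2 - 44 = ∑ X ∈ alOrbit τ, ((alFix τ).card : ℂ) * (X ^ 2 - 4) := by
    rw [hauptJ_sq, Finset.sum_comp (fun X ↦ X ^ 2 - 4) (fun e ↦ hauptG (alW e • τ))]
    refine Finset.sum_congr rfl fun X hX ↦ ?_
    obtain ⟨e, he, rfl⟩ := Finset.mem_image.1 hX
    rw [card_fibre he, nsmul_eq_mul]
  have hw : ∀ X ∈ alOrbit τ, ellWt X = ellWt (hauptG τ) := by
    intro X hX
    obtain ⟨e, he, rfl⟩ := Finset.mem_image.1 hX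
    exact ellWt_alW he τ
  rw [Finset.sum_congr rfl fun X hX ↦ by rw [hw X hX], hsum, div_eq_iff hs0, ← Finset.mul_sum,
    ← Finset.sum_mul]
  linear_combination (-∑ X ∈ alOrbit τ, (X ^ 2 - 4)) * hst

lemma alOrbit_eq_of_mem {τ τ' : ℍ} {e : ℤ} (he : e ∈ ed) (h : hauptG τ = hauptG (alW e • τ')) :
    alOrbit τ = alOrbit τ' := by
  have hsub : ∀ {σ σ' : ℍ}, hauptG σ = hauptG (alW e • σ') → alOrbit σ ⊆ alOrbit σ' := by
    intro σ σ' h X hX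
    obtain ⟨f, hf, rfl⟩ := Finset.mem_image.1 hX
    refine Finset.mem_image.2 ⟨edMul f e, edMul_mem hf he, ?_⟩
    rw [hauptG_alW_congr hf h, gammaInv_hauptG.alW_alW hf he]
  refine (hsub h).antisymm (hsub ?_)
  have := hauptG_alW_congr he h
  rw [gammaInv_hauptG.alW_alW he he, edMul_self he, alW_one, one_smul] at this
  exact this.symm

lemma formRel_of_alOrbit {d : ℤ} (hd : 0 < d) {Q Q' : QdN d 10} {X : ℂ}
    (h : X ∈ alOrbit (formPt hd Q)) (h' : X ∈ alOrbit (formPt hd Q')) :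
    formRel (FrickeGroup 10) (QdN d 10) Q Q' := by
  obtain ⟨e, he, rfl⟩ := Finset.mem_image.1 h
  obtain ⟨f, hf, h'⟩ := Finset.mem_image.1 h'
  exact (formRel_iff hd Q Q').2 ⟨_, edMul_mem he hf, (hauptG_alW_eq_iff he hf _ _).1 h'.symm⟩

lemma alOrbit_out {d : ℤ} (hd : 0 < d) (Q : QdN d 10) :
    alOrbit (formPt hd (Quot.mk (formRel (FrickeGroup 10) (QdN d 10)) Q).out) = alOrbit (formPt hd Q) := by
  let F : Quot (formRel (FrickeGroup 10) (QdN d 10)) → Finset ℂ :=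
    Quot.lift (fun Q ↦ alOrbit (formPt hd Q)) fun Q Q' h ↦ by
      obtain ⟨e, he, h⟩ := (formRel_iff hd Q Q').1 h
      exact alOrbit_eq_of_mem he h
  exact congrArg F (Quot.out_eq (Quot.mk (formRel (FrickeGroup 10) (QdN d 10)) Q))

lemma self_mem_alOrbit (τ : ℍ) : hauptG τ ∈ alOrbit τ :=
  Finset.mem_image.2 ⟨1, one_mem_ed, by rw [alW_one, one_smul]⟩

/-- The trace of `j² - 44` over CM classes as a weighted sum over CM values of the `Γ₀(10)`
hauptmodul. -/
lemma t2Star_eq {d : ℤ} (hd : 0 < d) (hE : (hauptG '' cmSet d).Finite) :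
    t2Star 10 (Polynomial.X ^ 2 - Polynomial.C 44) d =
      ∑ X ∈ hE.toFinset, (X ^ 2 - 4) * ellWt X := by
  classical
  rw [t2Star, if_pos hd, classTrace]
  let F : Quot (formRel (FrickeGroup 10) (QdN d 10)) → Finset ℂ := fun O ↦ alOrbit (formPt hd O.out)
  have hterm : ∀ O : Quot (formRel (FrickeGroup 10) (QdN d 10)),
      Polynomial.eval (jnStar 10 (cmPointC O.out.1)) (Polynomial.X ^ 2 - Polynomial.C 44) /
        (stabOrder (FrickeGroup 10) O.out.1 : ℂ) = ∑ X ∈ F O, (X ^ 2 - 4) * ellWt X := by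
    intro O
    rw [← hauptJ_div_stabOrder hd, ← (formPt_spec hd O.out).2.1, hauptJ_eq_jnStar]
    simp
  have hsub : ∀ O, F O ⊆ hE.toFinset := by
    intro O X hX
    obtain ⟨e, he, rfl⟩ := Finset.mem_image.1 hX
    rw [Set.Finite.mem_toFinset]
    exact ⟨_, (mem_cmSet_alSet_iff hd he (alW_mem he) _).2 (formPt_spec hd O.out).1, rfl⟩
  have hdisj : ∀ O O' X, X ∈ F O → X ∈ F O' → O = O' := by
    intro O O' X h h'
    rw [← Quot.out_eq O, ← Quot.out_eq O']
    exact Quot.sound (formRel_of_alOrbit hd h h')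
  have hinj : Function.Injective F := fun O O' h ↦
    hdisj O O' _ (self_mem_alOrbit _) (h ▸ self_mem_alOrbit (formPt hd O.out) : _ ∈ F O')
  have hfin : Finite (Quot (formRel (FrickeGroup 10) (QdN d 10))) := by
    refine Finite.of_injective (fun O ↦ (⟨F O, Finset.mem_powerset.2 (hsub O)⟩ : hE.toFinset.powerset)) ?_
    intro O O' h
    exact hinj (congrArg Subtype.val h)
  have := Fintype.ofFinite (Quot (formRel (FrickeGroup 10) (QdN d 10)))
  rw [finsum_eq_sum_of_fintype, Finset.sum_congr rfl fun O _ ↦ hterm O, ← Finset.sum_biUnion]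
  · refine Finset.sum_congr ?_ fun _ _ ↦ rfl
    ext X
    constructor
    · intro h
      obtain ⟨O, -, h⟩ := Finset.mem_biUnion.1 h
      exact hsub O h
    · intro h
      rw [Set.Finite.mem_toFinset] at h
      obtain ⟨τ, hτ, rfl⟩ := h
      obtain ⟨Q, rfl⟩ := formPt_surj hd hτ
      refine Finset.mem_biUnion.2 ⟨Quot.mk _ Q, Finset.mem_univ _, ?_⟩
      change _ ∈ alOrbit _
      rw [alOrbit_out]
      exact self_mem_alOrbit _
  · intro O _ O' _ hne
    rw [Function.onFun, Finset.disjoint_left]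
    exact fun X hX hXO ↦ hne (hdisj O O' X hX hXO)

/-- The values of the hauptmodul at the two elliptic points of `Γ₀(10)`. -/
def ellPts : Finset ℂ := {-1 + 2 * I, -1 - 2 * I}

lemma mem_ellPts_iff {X : ℂ} : X ∈ ellPts ↔ (X + 1) ^ 2 = -4 := by
  have h : (X + 1) ^ 2 - -4 = (X - (-1 + 2 * I)) * (X - (-1 - 2 * I)) := by
    linear_combination 4 * I_sq
  rw [ellPts, Finset.mem_insert, Finset.mem_singleton, ← sub_eq_zero (a := (X + 1) ^ 2), h, mul_eq_zero,
    sub_eq_zero, sub_eq_zero]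

lemma ellPts_ne_cuspVal {X : ℂ} (hX : X ∈ ellPts) {e : ℤ} (he : e ∈ ed') : X ≠ cuspVal e := by
  rintro rfl
  rw [mem_ellPts_iff] at hX
  simp only [ed', Finset.mem_insert, Finset.mem_singleton] at he
  rcases he with rfl | rfl | rfl <;> norm_num [cuspVal] at hX

lemma sum_ellPts : ∑ X ∈ ellPts, (X ^ 2 - 4) * (1 - ellWt X) = -7 := by
  have h : ∀ X ∈ ellPts, (X ^ 2 - 4) * (1 - ellWt X) = (X ^ 2 - 4) / 2 := by
    intro X hX
    rw [ellWt, if_pos (mem_ellPts_iff.1 hX)]; ring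
  have hne : (-1 + 2 * I : ℂ) ≠ -1 - 2 * I := by
    intro h
    have := congrArg Complex.im h
    norm_num at this
  rw [Finset.sum_congr rfl h, ellPts, Finset.sum_pair hne]
  linear_combination 4 * I_sq

/-- Sum of the traces of positive discriminant index in terms of the intersection polynomial. -/
lemma sum_t2Star_pos {n K : ℕ} (hn : 0 < n) {Q : Polynomial ℂ} (hQ0 : Q ≠ 0)
    (hQ : ∀ τ : ℍ, diagProd n τ * Polynomial.eval (hauptG τ) cuspPoly ^ K = Polynomial.eval (hauptG τ) Q) :
    ∑ r ∈ (finite_sq_lt n).toFinset, t2Star 10 (Polynomial.X ^ 2 - Polynomial.C 44) (4 * n - r ^ 2) =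
      ∑ X ∈ innerRoots Q, (Q.rootMultiplicity X : ℂ) * (X ^ 2 - 4) + if IsSquare n then -7 else 0 := by
  classical
  set F : Finset ℂ := innerRoots Q ∪ ellPts with hF
  have key := ellWt_mul_trSet hn hQ0 hQ
  have hmult : ∀ τ : ℍ, Q.rootMultiplicity (hauptG τ) ≠ 0 → hauptG τ ∈ innerRoots Q := by
    intro τ h
    rw [innerRoots, Finset.mem_filter, Multiset.mem_toFinset, Finset.mem_image]
    refine ⟨?_, fun ⟨e, he, h⟩ ↦ hauptG_ne_cuspVal he τ h.symm⟩
    rw [← Multiset.count_ne_zero, Polynomial.count_roots]; exact h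
  have hFpt : ∀ X ∈ F, ∃ τ, hauptG τ = X := by
    intro X hX
    refine exists_hauptG_eq fun e he ↦ ?_
    rcases Finset.mem_union.1 hX with hX | hX
    · rintro rfl
      exact (Finset.mem_filter.1 hX).2 (Finset.mem_image_of_mem _ he)
    · exact ellPts_ne_cuspVal hX he
  have hmemF : ∀ (r : ℤ) (τ : ℍ), r ∈ trSet n τ → hauptG τ ∈ F := by
    intro r τ hr
    by_contra hcon
    rw [hF, Finset.mem_union, not_or] at hcon
    have h0 : Q.rootMultiplicity (hauptG τ) = 0 := by
      by_contra h; exact hcon.1 (hmult τ h)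
    have h1 : ellWt (hauptG τ) = 1 := by
      rw [ellWt, if_neg]; exact fun h ↦ hcon.2 (mem_ellPts_iff.2 h)
    have h2 := key τ
    rw [h0, h1] at h2
    simp only [one_mul, Nat.cast_zero, sub_self, ite_self, add_zero, Nat.cast_eq_zero,
      Set.ncard_eq_zero (finite_trSet n τ)] at h2
    rw [h2] at hr; exact hr
  have ht : ∀ r ∈ (finite_sq_lt n).toFinset,
      t2Star 10 (Polynomial.X ^ 2 - Polynomial.C 44) (4 * n - r ^ 2) =
        ∑ X ∈ F, if X ∈ hauptG '' cmSet (4 * n - r ^ 2) then (X ^ 2 - 4) * ellWt X else 0 := by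
    intro r hr
    have hr' : r ^ 2 < 4 * (n : ℤ) := by simpa using hr
    have hsub : hauptG '' cmSet (4 * n - r ^ 2) ⊆ F := by
      rintro _ ⟨τ, hτ, rfl⟩
      exact hmemF r τ ⟨hr', hτ⟩
    rw [t2Star_eq (by omega) (F.finite_toSet.subset hsub), ← Finset.sum_filter]
    refine Finset.sum_congr ?_ fun _ _ ↦ rfl
    ext X
    simp only [Set.Finite.mem_toFinset, Finset.mem_filter]
    exact ⟨fun h ↦ ⟨hsub h, h⟩, fun h ↦ h.2⟩
  rw [Finset.sum_congr rfl ht, Finset.sum_comm]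
  have hX : ∀ X ∈ F, (∑ r ∈ (finite_sq_lt n).toFinset,
      if X ∈ hauptG '' cmSet (4 * n - r ^ 2) then (X ^ 2 - 4) * ellWt X else 0) =
        (Q.rootMultiplicity X : ℂ) * (X ^ 2 - 4) +
          if IsSquare n then (X ^ 2 - 4) * (1 - ellWt X) else 0 := by
    intro X hX
    obtain ⟨τ, rfl⟩ := hFpt X hX
    rw [← Finset.sum_filter, Finset.sum_const, nsmul_eq_mul]
    have hcard : (Finset.filter (fun r : ℤ ↦ hauptG τ ∈ hauptG '' cmSet (4 * n - r ^ 2))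
        (finite_sq_lt n).toFinset).card = (trSet n τ).ncard := by
      rw [← Set.ncard_coe_finset]
      congr 1
      ext r
      simp only [Finset.coe_filter, Set.Finite.mem_toFinset]
      constructor
      · rintro ⟨hr, τ', hτ', h⟩
        have hr' : r ^ 2 < 4 * (n : ℤ) := hr
        exact ⟨hr', mem_cmSet_of_hauptG_eq (by omega) h hτ'⟩
      · rintro ⟨hr, h⟩
        exact ⟨hr, τ, h, rfl⟩
    rw [hcard]
    have := key τ
    split_ifs at this ⊢ <;> linear_combination (hauptG τ ^ 2 - 4) * this
  rw [Finset.sum_congr rfl hX, Finset.sum_add_distrib]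
  congr 1
  · refine (Finset.sum_subset Finset.subset_union_left fun X hX hX' ↦ ?_).symm
    obtain ⟨τ, rfl⟩ := hFpt X hX
    have h0 : Q.rootMultiplicity (hauptG τ) = 0 := by
      by_contra h; exact hX' (hmult τ h)
    rw [h0]; simp
  · split_ifs with hsq
    · rw [← sum_ellPts]
      refine (Finset.sum_subset Finset.subset_union_right fun X hX hX' ↦ ?_).symm
      rw [ellWt, if_neg fun h ↦ hX' (mem_ellPts_iff.2 h)]; ring
    · simp

/-- Factorisations of `n` whose factors differ by one or two. -/
def offPairs (n : ℕ) : Finset (ℕ × ℕ) :=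
  {p ∈ factorPairs 1 n | (p.1 = p.2 + 1 ∨ p.2 = p.1 + 1) ∨ p.1 = p.2 + 2 ∨ p.2 = p.1 + 2}

/-- The signed sum of the factors. -/
def signedSum (p : ℕ × ℕ) : ℤ := if p.2 < p.1 then p.1 + p.2 else -(p.1 + p.2)

lemma signedSum_sq (p : ℕ × ℕ) : signedSum p ^ 2 = (p.1 + p.2) ^ 2 := by
  rw [signedSum]; split_ifs <;> ring

lemma sum_nearDiag {n : ℕ} (hn : 0 < n) :
    ∑ p ∈ factorPairs 1 n, nearDiag p =
      (if IsSquare n then 2 else 0) + ∑ p ∈ offPairs n, nearDiag p := by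
  have hdiag : ∑ p ∈ factorPairs 1 n with p.1 = p.2, nearDiag p = if IsSquare n then 2 else 0 := by
    split_ifs with h
    · obtain ⟨k, rfl⟩ := h
      rw [Finset.sum_eq_single_of_mem (k, k)]
      · simp [nearDiag]
      · simp [mem_factorPairs]; rintro rfl; simp at hn
      · rintro ⟨a, b⟩ hp hne
        obtain ⟨hp, rfl : a = b⟩ := Finset.mem_filter.1 hp
        have : a * a = k * k := (mem_factorPairs.1 hp).1.1
        exact absurd (by rw [Nat.mul_self_inj.1 this]) hne
    · refine Finset.sum_eq_zero ?_
      rintro ⟨a, b⟩ hp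
      obtain ⟨hp, rfl : a = b⟩ := Finset.mem_filter.1 hp
      exact absurd ⟨a, ((mem_factorPairs.1 hp).1.1).symm⟩ h
  rw [← hdiag, ← Finset.sum_filter_add_sum_filter_not _ (fun p : ℕ × ℕ ↦ p.1 = p.2)]
  congr 1
  symm
  refine Finset.sum_subset ?_ ?_
  · intro p hp
    obtain ⟨hp, h⟩ := Finset.mem_filter.1 hp
    exact Finset.mem_filter.2 ⟨hp, by omega⟩
  · intro p hp hp'
    obtain ⟨hp, h⟩ := Finset.mem_filter.1 hp
    have h2 : ¬((p.1 = p.2 + 1 ∨ p.2 = p.1 + 1) ∨ p.1 = p.2 + 2 ∨ p.2 = p.1 + 2) :=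
      fun h ↦ hp' (Finset.mem_filter.2 ⟨hp, h⟩)
    rw [not_or] at h2
    rw [nearDiag, if_neg h, if_neg h2.1, if_neg h2.2]

lemma signedSum_injOn (n : ℕ) : Set.InjOn signedSum (offPairs n : Set (ℕ × ℕ)) := by
  rintro ⟨a, b⟩ hp ⟨a', b'⟩ hp' h
  obtain ⟨hp, h1⟩ := Finset.mem_filter.1 (Finset.mem_coe.1 hp)
  obtain ⟨hp', h1'⟩ := Finset.mem_filter.1 (Finset.mem_coe.1 hp')
  obtain ⟨ha, hb⟩ := factorPairs_pos hp
  obtain ⟨ha', hb'⟩ := factorPairs_pos hp'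
  have e1 := (mem_factorPairs.1 hp).1.1
  have e2 := (mem_factorPairs.1 hp').1.1
  simp only [signedSum] at *
  have hs : a + b = a' + b' := by split_ifs at h <;> omega
  have hprod : ((a : ℤ) - a') * (a - b') = 0 := by
    have : (a : ℤ) * b = a' * b' := by exact_mod_cast e1.trans e2.symm
    have hs' : (a : ℤ) + b = a' + b' := by exact_mod_cast hs
    linear_combination (a : ℤ) * hs' - this
  rcases mul_eq_zero.1 hprod with h0 | h0
  · rw [Prod.mk.injEq]; omega
  · split_ifs at h <;> omega

lemma four_mul_sub_signedSum_sq {n : ℕ} {p : ℕ × ℕ} (hp : p ∈ offPairs n) :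
    4 * (n : ℤ) - signedSum p ^ 2 = if p.1 = p.2 + 1 ∨ p.2 = p.1 + 1 then -1 else -4 := by
  obtain ⟨hp, h⟩ := Finset.mem_filter.1 hp
  obtain ⟨a, b⟩ := p
  have e1 : a * b = n := (mem_factorPairs.1 hp).1.1
  rw [signedSum_sq, ← e1]
  push_cast
  dsimp only at h ⊢
  rcases h with h | h
  · rw [if_pos h]
    rcases h with rfl | rfl <;> push_cast <;> ring
  · rw [if_neg (by omega)]
    rcases h with rfl | rfl <;> push_cast <;> ring

lemma exists_offPairs {n : ℕ} (hn : 0 < n) {r : ℤ} (k : ℕ) (hk : k = 1 ∨ k = 2)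
    (h : r ^ 2 = 4 * n + k ^ 2) : ∃ p ∈ offPairs n, signedSum p = r := by
  have hnZ : (0 : ℤ) < n := by exact_mod_cast hn
  obtain ⟨b, hb, hb0⟩ : ∃ b : ℕ, r.natAbs = 2 * b + k ∧ 0 < b := by
    have h1 : (r.natAbs : ℤ) ^ 2 = 4 * n + k ^ 2 := by rw [Int.natCast_natAbs, sq_abs, h]
    have h2 : k < r.natAbs := by
      have : (k : ℤ) < r.natAbs := by nlinarith
      exact_mod_cast this
    have h3 : r.natAbs % 2 = k % 2 := by
      have h4 : r.natAbs ^ 2 = 4 * n + k ^ 2 := by exact_mod_cast h1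
      have h5 : r.natAbs ^ 2 % 2 = k ^ 2 % 2 := by omega
      rcases hk with rfl | rfl <;> rcases Nat.mod_two_eq_zero_or_one r.natAbs with h6 | h6 <;>
        simp [Nat.pow_mod, h6] at h5 ⊢
    exact ⟨(r.natAbs - k) / 2, by omega, by omega⟩
  have hprod : (b + k) * b = n := by
    have h1 : (r.natAbs : ℤ) ^ 2 = 4 * n + k ^ 2 := by rw [Int.natCast_natAbs, sq_abs, h]
    rw [hb] at h1
    have : (((b + k) * b : ℕ) : ℤ) = n := by push_cast at h1 ⊢; linarith
    exact_mod_cast this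
  rcases lt_or_ge r 0 with hr | hr
  · refine ⟨(b, b + k), Finset.mem_filter.2 ⟨mem_factorPairs.2 ⟨⟨by dsimp only; linarith, hn.ne'⟩,
      one_dvd _⟩, by dsimp only; omega⟩, ?_⟩
    rw [signedSum, if_neg (by dsimp only; omega)]; push_cast; omega
  · refine ⟨(b + k, b), Finset.mem_filter.2 ⟨mem_factorPairs.2 ⟨⟨hprod, hn.ne'⟩,
      one_dvd _⟩, by dsimp only; omega⟩, ?_⟩
    rw [signedSum, if_pos (by dsimp only; omega)]; push_cast; omega

lemma t2Star_zero (P : Polynomial ℂ) : t2Star 10 P 0 = 5 / 2 := by simp [t2Star]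

lemma t2Star_neg_one (P : Polynomial ℂ) : t2Star 10 P (-1) = -1 := by simp [t2Star]

lemma t2Star_neg_four (P : Polynomial ℂ) : t2Star 10 P (-4) = -2 := by simp [t2Star]

lemma t2Star_of_neg (P : Polynomial ℂ) {d : ℤ} (hd : d < 0) (h1 : d ≠ -1) (h4 : d ≠ -4) :
    t2Star 10 P d = 0 := by
  rw [t2Star, if_neg hd.not_gt, if_neg hd.ne, if_neg h1, if_neg h4]

/-- The sum over all `r` splits into the CM part and the boundary part. -/
lemma finsum_t2Star {n : ℕ} (hn : 0 < n) (P : Polynomial ℂ) :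
    ∑ᶠ r : ℤ, t2Star 10 P (4 * n - r ^ 2) =
      ∑ r ∈ (finite_sq_lt n).toFinset, t2Star 10 P (4 * n - r ^ 2) +
        (if IsSquare n then 5 else 0) - ∑ p ∈ offPairs n, nearDiag p := by
  classical
  let D : Finset ℤ := if IsSquare n then {2 * (Nat.sqrt n : ℤ), -(2 * (Nat.sqrt n : ℤ))} else ∅
  have hD : ∀ r, r ∈ D ↔ r ^ 2 = 4 * (n : ℤ) := by
    intro r
    by_cases hsq : IsSquare n
    · obtain ⟨k, rfl⟩ := hsq
      have hD' : D = {2 * (k : ℤ), -(2 * (k : ℤ))} := by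
        rw [show D = _ from if_pos ⟨k, rfl⟩, Nat.sqrt_eq]
      rw [hD', Finset.mem_insert, Finset.mem_singleton, ← sq_eq_sq_iff_eq_or_eq_neg]
      push_cast
      rw [show (2 * (k : ℤ)) ^ 2 = 4 * (k * k) by ring]
    · simp only [D, if_neg hsq, Finset.notMem_empty, false_iff]
      intro h
      apply hsq
      obtain ⟨m, hm⟩ : (2 : ℤ) ∣ r := Int.prime_two.dvd_of_dvd_pow (n := 2) ⟨2 * n, by rw [h]; ring⟩
      refine ⟨m.natAbs, ?_⟩
      have : (n : ℤ) = m * m := by rw [hm] at h; linarith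
      rw [← Int.natAbs_mul, ← this, Int.natAbs_natCast]
  have hDsum : ∑ r ∈ D, t2Star 10 P (4 * n - r ^ 2) = if IsSquare n then 5 else 0 := by
    have : ∀ r ∈ D, t2Star 10 P (4 * n - r ^ 2) = 5 / 2 := by
      intro r hr; rw [(hD r).1 hr, sub_self, t2Star_zero]
    rw [Finset.sum_congr rfl this, Finset.sum_const]
    by_cases hsq : IsSquare n
    · have hs : 0 < Nat.sqrt n := Nat.sqrt_pos.2 hn
      simp only [D, if_pos hsq]
      rw [Finset.card_pair (by omega)]; norm_num
    · simp [D, hsq]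
  have hoff : ∑ r ∈ (offPairs n).image signedSum, t2Star 10 P (4 * n - r ^ 2) =
      -∑ p ∈ offPairs n, nearDiag p := by
    rw [Finset.sum_image (signedSum_injOn n), ← Finset.sum_neg_distrib]
    refine Finset.sum_congr rfl fun p hp ↦ ?_
    rw [four_mul_sub_signedSum_sq hp]
    have h := (Finset.mem_filter.1 hp).2
    have h0 : p.1 ≠ p.2 := by omega
    rw [nearDiag, if_neg h0]
    by_cases h1 : p.1 = p.2 + 1 ∨ p.2 = p.1 + 1
    · rw [if_pos h1, if_pos h1, t2Star_neg_one]
    · rw [if_neg h1, if_neg h1, if_pos (h.resolve_left h1), t2Star_neg_four]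
  have hsub : (Function.support fun r : ℤ ↦ t2Star 10 P (4 * n - r ^ 2)) ⊆
      ((((finite_sq_lt n).toFinset ∪ D) ∪ (offPairs n).image signedSum : Finset ℤ) : Set ℤ) := by
    intro r hr
    rw [Function.mem_support] at hr
    rw [Finset.mem_coe, Finset.mem_union, Finset.mem_union, hD, Set.Finite.mem_toFinset,
      Set.mem_ofPred_eq, Finset.mem_image]
    rcases lt_trichotomy (r ^ 2) (4 * (n : ℤ)) with h | h | h
    · exact .inl (.inl h)
    · exact .inl (.inr h)
    · refine .inr ?_
      by_cases h1 : 4 * (n : ℤ) - r ^ 2 = -1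
      · exact exists_offPairs hn 1 (.inl rfl) (by push_cast; linarith)
      by_cases h4 : 4 * (n : ℤ) - r ^ 2 = -4
      · exact exists_offPairs hn 2 (.inr rfl) (by push_cast; linarith)
      exact absurd (t2Star_of_neg P (by omega) h1 h4) hr
  rw [finsum_eq_sum_of_support_subset _ hsub, Finset.sum_union, Finset.sum_union, hDsum, hoff, sub_eq_add_neg]
  · rw [Finset.disjoint_left]
    intro r h1 h2
    rw [Set.Finite.mem_toFinset, Set.mem_ofPred_eq] at h1
    rw [hD] at h2
    omega
  · rw [Finset.disjoint_left]
    intro r h1 h2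
    obtain ⟨p, hp, rfl⟩ := Finset.mem_image.1 h2
    have h3 := four_mul_sub_signedSum_sq hp
    rw [Finset.mem_union, hD, Set.Finite.mem_toFinset, Set.mem_ofPred_eq] at h1
    split_ifs at h3 <;> omega

lemma sigmaN_natCast {N m : ℕ} (hm : 0 < m) :
    sigmaN N (m : ℚ) = ∑ p ∈ factorPairs 1 m, (p.1 : ℂ) - ∑ p ∈ factorPairs N m, (p.1 : ℂ) := by
  have hm' : (m : ℚ) ≠ 0 := by exact_mod_cast hm.ne'
  have hdiv : ∀ k : ℕ, ∑ p ∈ factorPairs k m, (p.1 : ℂ) = ∑ d ∈ m.divisors with k ∣ d, (d : ℂ) := by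
    intro k
    rw [factorPairs, Finset.sum_filter, Finset.sum_filter]
    simp only [Int.natCast_dvd_natCast]
    exact Nat.sum_divisorsAntidiagonal fun d _ ↦ if k ∣ d then (d : ℂ) else 0
  rw [sigmaN, if_neg hm', if_pos ⟨by exact_mod_cast hm, Rat.den_natCast m⟩, hdiv, ← Nat.cast_one,
    hdiv, Rat.num_natCast, Int.toNat_natCast, eq_sub_iff_add_eq, add_comm,
    Finset.sum_filter_add_sum_filter_not]
  simp

lemma sigmaN_five_half {n : ℕ} (hn : 0 < n) :
    12 * sigmaN 5 ((n : ℚ) / 2) =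
      6 * ∑ p ∈ factorPairs 2 n, (p.1 : ℂ) - 6 * ∑ p ∈ factorPairs 10 n, (p.1 : ℂ) := by
  have hs : ∀ k m : ℕ, 0 < k → ∑ p ∈ factorPairs k m, (p.1 : ℂ) =
      if k ∣ m then (k : ℂ) * ∑ d ∈ (m / k).divisors, (d : ℂ) else 0 := by
    intro k m hk
    have := congrArg (fun x : ℕ ↦ (x : ℂ)) (sum_fst_factorPairs hk m)
    push_cast at this
    rw [this]
  have h2 := hs 2 n two_pos
  have h10 := hs 10 n (by norm_num)
  push_cast at h2 h10
  rw [h2, h10]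
  by_cases h : 2 ∣ n
  · obtain ⟨m, rfl⟩ := h
    have hm : 0 < m := by omega
    have h1 := hs 1 m one_pos
    have h5 := hs 5 m (by norm_num)
    push_cast at h1 h5
    rw [show ((2 * m : ℕ) : ℚ) / 2 = (m : ℕ) by push_cast; ring, sigmaN_natCast hm, h1]
    push_cast
    rw [h5, if_pos (one_dvd _), if_pos (Dvd.intro _ rfl), Nat.div_one, Nat.mul_div_cancel_left _ two_pos,
      show 2 * m / 10 = m / 5 by omega]
    by_cases h : 5 ∣ m
    · rw [if_pos h, if_pos (by omega)]; ring
    · rw [if_neg h, if_neg (by omega)]; ring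
  · have hden : ¬((n : ℚ) / 2).den = 1 := by
      intro hd
      apply h
      have := Rat.den_eq_one_iff _ |>.1 hd
      have h3 : ((n : ℤ) : ℚ) = ((2 * ((n : ℚ) / 2).num : ℤ) : ℚ) := by
        push_cast; rw [this]; ring
      have h4 : (n : ℤ) = 2 * ((n : ℚ) / 2).num := by exact_mod_cast h3
      omega
    rw [sigmaN, if_neg (by positivity), if_neg (fun h ↦ hden h.2), if_neg h, if_neg (by omega)]
    ring

lemma trace_formula_pos {c : ℤ → ℂ} (hc : HasQExp (jn 10) c (-1)) {n : ℕ} (hn : 0 < n) :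
    2 * (n : ℂ) * c n =
      (∑ᶠ r : ℤ, t2Star 10 (Polynomial.X ^ 2 - Polynomial.C 44) (4 * n - r ^ 2)) +
        4 * sigmaN 10 (n : ℚ) + 12 * sigmaN 5 ((n : ℚ) / 2) := by
  obtain ⟨K, Q, hQ0, hQ, hS⟩ := exists_diagPoly hc hn
  rw [divisor_sum_eq hn, sum_nearDiag hn] at hS
  rw [finsum_t2Star hn, sum_t2Star_pos hn hQ0 hQ, hS, sigmaN_five_half hn, sigmaN_natCast hn]
  push_cast
  split_ifs <;> ring

lemma trace_formula_zero (P : Polynomial ℂ) :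
    (∑ᶠ r : ℤ, t2Star 10 P (4 * 0 - r ^ 2)) + 4 * sigmaN 10 0 + 12 * sigmaN 5 (0 / 2) = 0 := by
  have hsub : (Function.support fun r : ℤ ↦ t2Star 10 P (4 * 0 - r ^ 2)) ⊆
      (({0, 1, -1, 2, -2} : Finset ℤ) : Set ℤ) := by
    intro r hr
    by_contra hcon
    simp only [Finset.coe_insert, Finset.coe_singleton, Set.mem_insert_iff, Set.mem_singleton_iff,
      not_or] at hcon
    have h3 : 3 ≤ |r| := by rw [le_abs]; omega
    have h9 : 9 ≤ r ^ 2 := by rw [← sq_abs]; nlinarith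
    exact hr (t2Star_of_neg P (by omega) (by omega) (by omega))
  rw [finsum_eq_sum_of_support_subset _ hsub]
  simp [t2Star, sigmaN]
  norm_num

lemma trace_formula_neg_one (P : Polynomial ℂ) :
    (∑ᶠ r : ℤ, t2Star 10 P (4 * (-1) - r ^ 2)) + 4 * sigmaN 10 (-1) + 12 * sigmaN 5 (-1 / 2) = -2 := by
  have h : ∀ r : ℤ, r ≠ 0 → t2Star 10 P (4 * (-1) - r ^ 2) = 0 := by
    intro r hr
    have : 0 < r ^ 2 := by positivity
    exact t2Star_of_neg P (by omega) (by omega) (by omega)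
  rw [finsum_eq_single _ 0 h, show (4 * (-1) - 0 ^ 2 : ℤ) = -4 by norm_num, t2Star_neg_four, sigmaN, sigmaN,
    if_neg (by norm_num), if_neg (by norm_num), if_neg (by norm_num), if_neg (by norm_num)]
  ring

end

/-- **Theorem 1.1, level 10, part 1.**
For any `n ≥ -1`,
`2n c_n^{(10)} = Σ_{r ∈ ℤ} t₂^{(10*)}(4n - r²) + 4σ₁^{(10)}(n) + 12σ₁^{(5)}(n/2)`. -/
theorem trace_formula_jn_ten
    (c : ℤ → ℂ) (hc : HasQExp (jn 10) c (-1))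
    (P : Polynomial ℂ) (e : ℤ → ℂ)
    (hP : HasQExp (fun z => Polynomial.eval (jnStar 10 z) P) e (-2))
    (he2 : e (-2) = 1) (he1 : e (-1) = 0) (he0 : e 0 = 0)
    (n : ℤ) (hn : -1 ≤ n) :
    2 * (n : ℂ) * c n =
      (∑ᶠ r : ℤ, t2Star 10 P (4 * n - r ^ 2)) +
        4 * sigmaN 10 (n : ℚ) + 12 * sigmaN 5 ((n : ℚ) / 2) := by
  rcases lt_trichotomy n 0 with h | rfl | h
  · obtain rfl : n = -1 := by omega
    have := trace_formula_neg_one P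
    rw [Int.cast_neg, Int.cast_neg, Int.cast_one, Int.cast_one, this, coeff_neg_one hc]; norm_num
  · have := trace_formula_zero P
    rw [Int.cast_zero, Int.cast_zero, this]; ring
  · rw [faber_poly_eq hP he2 he1 he0]
    lift n to ℕ using h.le
    have := trace_formula_pos hc (n := n) (by exact_mod_cast h)
    push_cast
    exact this
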